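/- Let k ≥ 3, 1 ≤ ℓ < k/2 and 1 ≤ d ≤ k−1 with 0.82(k−ℓ) ≤ k−d < k−ℓ. Then h_d^ℓ(k) = t(k,d,ℓ). -/

import Mathlib

/-- `H` is a `k`-uniform hypergraph (a `k`-graph) on the vertex set `Fin n`. -/
def IsKGraph (n k : ℕ) (H : Finset (Finset (Fin n))) : Prop :=
  ∀ e ∈ H, e.card = k

/-- The degree `deg_H(S)` of a vertex set `S` in the `k`-graph `H`: the number of
`(k - |S|)`-sets `T` disjoint from `S` with `S ∪ T ∈ H`. -/
noncomputable def hDeg (n k : ℕ) (H : Finset (Finset (Fin n))) (S : Finset (Fin n)) : ℕ :=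
  Nat.card {T : Finset (Fin n) // T.card = k - S.card ∧ Disjoint S T ∧ S ∪ T ∈ H}

/-- The minimum `d`-degree `δ_d(H)` of a `k`-graph `H` on `Fin n`. -/
noncomputable def minDeg (n k d : ℕ) (H : Finset (Finset (Fin n))) : ℕ :=
  sInf { m : ℕ | ∃ S : Finset (Fin n), S.card = d ∧ hDeg n k H S = m }

/-- `H` contains a Hamilton `ℓ`-cycle: there is a cyclic ordering of all the vertices such
that the `n / (k - ℓ)` segments of `k` consecutive vertices starting at the positions
divisible by `k - ℓ` are all edges of `H` (hence every two consecutive edges share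
exactly `ℓ` vertices). -/
def HasHamiltonCycle (n k l : ℕ) (H : Finset (Finset (Fin n))) : Prop :=
  ∃ f : ZMod n → Fin n, Function.Bijective f ∧
    ∀ j < n / (k - l),
      ((Finset.range k).image (fun i => f ((j * (k - l) + i : ℕ) : ZMod n))) ∈ H

/-- `f` enumerates (the vertices, in order, of) an `ℓ`-path with `t` edges in `H`:
the `j`-th edge consists of the `k` consecutive vertices starting at position `j * (k - ℓ)`,
so every two consecutive edges share exactly `ℓ` vertices. -/
def IsLPath (n k l t : ℕ) (H : Finset (Finset (Fin n))) (f : ℕ → Fin n) : Prop :=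
  Set.InjOn f (Set.Iio (t * (k - l) + l)) ∧
  ∀ j < t, ((Finset.range k).image (fun i => f (j * (k - l) + i))) ∈ H

/-- The vertex set of the `ℓ`-path with `t` edges enumerated by `f`. -/
def pathVerts (n k l t : ℕ) (f : ℕ → Fin n) : Finset (Fin n) :=
  (Finset.range (t * (k - l) + l)).image f

/-- The first `ℓ` vertices (as an ordered `ℓ`-set) of the path enumerated by `f`. -/
def pathBeg (n l : ℕ) (f : ℕ → Fin n) : Fin l → Fin n := fun i => f (i : ℕ)

/-- The last `ℓ` vertices (as an ordered `ℓ`-set) of an `ℓ`-path with `t` edges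
enumerated by `f`. -/
def pathEnd (n k l t : ℕ) (f : ℕ → Fin n) : Fin l → Fin n := fun i => f (t * (k - l) + (i : ℕ))

/-- `T` is a reachable set for the pair `{u, v}` (with parameter `i`): there are
vertex-disjoint `ℓ`-paths `P₁, …, Pᵢ` of length two covering exactly `T ∪ {u}` and
vertex-disjoint `ℓ`-paths `P₁', …, Pᵢ'` of length two covering exactly `T ∪ {v}`,
where `P_j` and `P_j'` have the same (ordered) ends for all `j`. -/
def ReachSet (n k l i : ℕ) (H : Finset (Finset (Fin n))) (u v : Fin n)
    (T : Finset (Fin n)) : Prop :=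
  ∃ P P' : Fin i → ℕ → Fin n,
    (∀ j, IsLPath n k l 2 H (P j)) ∧ (∀ j, IsLPath n k l 2 H (P' j)) ∧
    (∀ j j', j ≠ j' → Disjoint (pathVerts n k l 2 (P j)) (pathVerts n k l 2 (P j'))) ∧
    (∀ j j', j ≠ j' → Disjoint (pathVerts n k l 2 (P' j)) (pathVerts n k l 2 (P' j'))) ∧
    (Finset.univ.biUnion (fun j => pathVerts n k l 2 (P j)) = insert u T) ∧
    (Finset.univ.biUnion (fun j => pathVerts n k l 2 (P' j)) = insert v T) ∧
    (∀ j, pathBeg n l (P j) = pathBeg n l (P' j) ∧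
      pathEnd n k l 2 (P j) = pathEnd n k l 2 (P' j))

/-- `u` and `v` are `(β, i)`-reachable in the `k`-graph `H` on `n` vertices: there are at
least `β * n ^ ((2k - ℓ) i - 1)` sets `T` of size `(2k - ℓ) i - 1` that are reachable sets
for `{u, v}`. -/
def Reachable (n k l : ℕ) (H : Finset (Finset (Fin n))) (β : ℝ) (i : ℕ) (u v : Fin n) : Prop :=
  β * (n : ℝ) ^ ((2 * k - l) * i - 1) ≤
    (Nat.card {T : Finset (Fin n) // T.card = (2 * k - l) * i - 1 ∧
      ReachSet n k l i H u v T} : ℝ)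

/-- `H` contains a `Y_{k,2ℓ}`-tiling (vertex-disjoint copies of the `k`-graph consisting of
two edges intersecting in exactly `2ℓ` vertices) covering all but at most `u` vertices. -/
def HasYTilingCover (n l : ℕ) (H : Finset (Finset (Fin n))) (u : ℝ) : Prop :=
  ∃ (m : ℕ) (e₁ e₂ : Fin m → Finset (Fin n)),
    (∀ j, e₁ j ∈ H ∧ e₂ j ∈ H ∧ ((e₁ j) ∩ (e₂ j)).card = 2 * l) ∧
    (∀ j j', j ≠ j' → Disjoint ((e₁ j) ∪ (e₂ j)) ((e₁ j') ∪ (e₂ j'))) ∧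
    (n : ℝ) - ((Finset.univ.biUnion fun j => (e₁ j) ∪ (e₂ j)).card : ℝ) ≤ u

/-- The tiling threshold `t_d^ℓ(k, n, ε)`: the minimum `t` such that every `k`-graph `H`
on `n` vertices with `δ_d(H) ≥ t` contains a `Y_{k,2ℓ}`-tiling covering all but at most
`ε n` vertices. -/
noncomputable def tThreshold (k d l n : ℕ) (ε : ℝ) : ℕ :=
  sInf { t : ℕ | ∀ H : Finset (Finset (Fin n)), IsKGraph n k H →
    t ≤ minDeg n k d H → HasYTilingCover n l H (ε * n) }

/-- `t(k,d,ℓ) := limsup_{ε → 0⁺} limsup_{n → ∞} t_d^ℓ(k,n,ε) / C(n, k-d)`. -/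
noncomputable def tVal (k d l : ℕ) : ℝ :=
  Filter.limsup
    (fun ε : ℝ => Filter.limsup
      (fun n : ℕ => (tThreshold k d l n ε : ℝ) / (n.choose (k - d) : ℝ)) Filter.atTop)
    (nhdsWithin (0 : ℝ) (Set.Ioi (0 : ℝ)))

/-- The Dirac threshold `h_d^ℓ(k, n)`: the smallest `h` such that every `k`-graph `H` on
`n` vertices with `δ_d(H) ≥ h` contains a Hamilton `ℓ`-cycle. -/
noncomputable def hThreshold (k d l n : ℕ) : ℕ :=
  sInf { h : ℕ | ∀ H : Finset (Finset (Fin n)), IsKGraph n k H →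
    h ≤ minDeg n k d H → HasHamiltonCycle n k l H }

/-- `h_d^ℓ(k) := limsup_{n → ∞, (k-ℓ) ∣ n} h_d^ℓ(k,n) / C(n, k-d)`. -/
noncomputable def hVal (k d l : ℕ) : ℝ :=
  Filter.limsup (fun n : ℕ => (hThreshold k d l n : ℝ) / (n.choose (k - d) : ℝ))
    (Filter.atTop ⊓ Filter.principal { m : ℕ | (k - l) ∣ m })

/-- The generalized binomial coefficient `C(x, r)` for a real `x`. -/
noncomputable def genChoose (x : ℝ) (r : ℕ) : ℝ :=
  (∏ i ∈ Finset.range r, (x - (i : ℝ))) / (r.factorial : ℝ)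

/-- The number of sets in the `ε`-robust `r`-shadow `∂_ε^r(G)` of the `K`-graph `G` on
`Fin n`: the number of `(K - r)`-sets lying in more than `ε * n ^ r` edges of `G`. -/
noncomputable def shadowCard (n K r : ℕ) (G : Finset (Finset (Fin n))) (ε : ℝ) : ℕ :=
  Nat.card {F : Finset (Fin n) // F.card = K - r ∧ ε * (n : ℝ) ^ r < (hDeg n K G F : ℝ)}

/-- `g` is an `S`-absorber, given as a `b`-tuple of distinct vertices avoiding `S`: the
tuple spans a family of `2k - 2ℓ + 1` vertex-disjoint `ℓ`-paths, and there is another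
family of `2k - 2ℓ + 1` vertex-disjoint `ℓ`-paths, with the same ordered ends, spanning
the tuple together with `S`. -/
def IsAbsorberTuple (n k l b : ℕ) (H : Finset (Finset (Fin n))) (S : Finset (Fin n))
    (g : Fin b → Fin n) : Prop :=
  Function.Injective g ∧ (∀ i, g i ∉ S) ∧
  ∃ (t t' : Fin (2 * k - 2 * l + 1) → ℕ) (Q Q' : Fin (2 * k - 2 * l + 1) → ℕ → Fin n),
    (∀ j, IsLPath n k l (t j) H (Q j)) ∧ (∀ j, IsLPath n k l (t' j) H (Q' j)) ∧
    (∀ j j', j ≠ j' → Disjoint (pathVerts n k l (t j) (Q j)) (pathVerts n k l (t j') (Q j'))) ∧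
    (∀ j j', j ≠ j' →
      Disjoint (pathVerts n k l (t' j) (Q' j)) (pathVerts n k l (t' j') (Q' j'))) ∧
    (∀ j, pathBeg n l (Q j) = pathBeg n l (Q' j) ∧
      pathEnd n k l (t j) (Q j) = pathEnd n k l (t' j) (Q' j)) ∧
    Finset.univ.biUnion (fun j => pathVerts n k l (t' j) (Q' j)) = Finset.image g Finset.univ ∧
    Finset.univ.biUnion (fun j => pathVerts n k l (t j) (Q j)) = Finset.image g Finset.univ ∪ S

set_option linter.unusedSectionVars false

/-- Derandomised selection of pairwise disjoint candidates: if every test `f i` has expectation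
at most `p i` under `μ` and few candidates meet a given small set, then `J` pairwise disjoint
candidates can be chosen on which every test has average not much larger than `p i`. -/
theorem exists_disjoint_sequence {V G ι : Type} [DecidableEq V] [Fintype G] [Fintype ι]
    (μ : G → ℝ) (hμ0 : ∀ g, 0 ≤ μ g) (hμ1 : ∑ g, μ g = 1) (supp : G → Finset V) (r J : ℕ)
    (hr : ∀ g, (supp g).card ≤ r) (κ t : ℝ) (hκ0 : 0 ≤ κ) (hκ : κ ≤ 1 / 2) (ht : 0 < t)
    (ht1 : t ≤ 1)
    (hconf : ∀ F : Finset V, F.card ≤ J * r → ∑ g with ¬ Disjoint (supp g) F, μ g ≤ κ)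
    (f : ι → G → ℝ) (hf0 : ∀ i g, 0 ≤ f i g) (hf1 : ∀ i g, f i g ≤ 1) (p : ι → ℝ)
    (hp : ∀ i, ∑ g, μ g * f i g ≤ p i) (hp1 : ∀ i, p i ≤ 1) :
    ∃ g : Fin J → G, (∀ i j, i ≠ j → Disjoint (supp (g i)) (supp (g j))) ∧
      (∀ j, 0 < μ (g j)) ∧
      ∀ i, ∑ j, f i (g j) ≤ J * (p i + t + 4 * κ) + Real.log (Fintype.card ι) / t := by
  classical
  have key : ∀ j ≤ J, ∃ g : Fin j → G, (∀ a b, a ≠ b → Disjoint (supp (g a)) (supp (g b))) ∧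
      (∀ a, 0 < μ (g a)) ∧
      ∑ i, Real.exp (t * ∑ a, f i (g a) - j * (t * (p i + t + 4 * κ))) ≤ Fintype.card ι := by
    intro j
    induction j with
    | zero => intro _; exact ⟨Fin.elim0, fun a => a.elim0, fun a => a.elim0, by simp⟩
    | succ j ih =>
      intro hj
      obtain ⟨g, hg1, hg2, hg3⟩ := ih (by omega)
      set F : Finset V := Finset.univ.biUnion fun a => supp (g a) with hF
      have hFc : F.card ≤ J * r := by
        refine le_trans (Finset.card_biUnion_le_card_mul _ _ r fun a _ => hr _) ?_
        simp only [Finset.card_univ, Fintype.card_fin]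
        exact Nat.mul_le_mul_right _ (by omega)
      set w : ι → ℝ := fun i => Real.exp (t * ∑ a, f i (g a) - j * (t * (p i + t + 4 * κ)))
      have hw : ∀ i, 0 ≤ w i := fun i => (Real.exp_pos _).le
      set P : ℝ := ∑ g with Disjoint (supp g) F, μ g with hP
      have hPs : P + ∑ g with ¬ Disjoint (supp g) F, μ g = 1 := by
        rw [hP, Finset.sum_filter_add_sum_filter_not, hμ1]
      have hPκ : 1 - κ ≤ P := by have := hconf F hFc; linarith
      have hPpos : 0 < P := by linarith
      set v : ι → ℝ := fun i => w i * Real.exp (-(t * (p i + t + 4 * κ))) with hvdef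
      have hv : ∀ i, 0 ≤ v i := fun i => mul_nonneg (hw i) (Real.exp_pos _).le
      have hex : ∃ x, 0 < μ x ∧ Disjoint (supp x) F ∧
          ∑ i, v i * Real.exp (t * f i x) ≤ ∑ i, v i * Real.exp (t * (p i + t + 4 * κ)) := by
        by_contra hcon
        push Not at hcon
        have h1 : P * ∑ i, v i * Real.exp (t * (p i + t + 4 * κ)) <
            ∑ g with Disjoint (supp g) F, μ g * ∑ i, v i * Real.exp (t * f i g) := by
          rw [hP, Finset.sum_mul]
          apply Finset.sum_lt_sum
          · intro x hx
            rcases (hμ0 x).lt_or_eq with h | h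
            · exact mul_le_mul_of_nonneg_left (hcon x h (Finset.mem_filter.1 hx).2).le h.le
            · rw [← h]; simp
          · by_contra hno
            push Not at hno
            have : P ≤ 0 := Finset.sum_nonpos fun x hx => by
              by_contra hx0
              push Not at hx0
              have := hno x hx
              have h2 := hcon x hx0 (Finset.mem_filter.1 hx).2
              exact absurd (mul_lt_mul_of_pos_left h2 hx0) (not_lt.2 this)
            linarith
        have h2 : ∑ g with Disjoint (supp g) F, μ g * ∑ i, v i * Real.exp (t * f i g) =
            ∑ i, v i * ∑ g with Disjoint (supp g) F, μ g * Real.exp (t * f i g) := by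
          simp_rw [Finset.mul_sum]
          rw [Finset.sum_comm]
          refine Finset.sum_congr rfl fun i _ => Finset.sum_congr rfl fun x _ => by ring
        have h3 : ∀ i, ∑ g with Disjoint (supp g) F, μ g * Real.exp (t * f i g) ≤
            P * Real.exp (t * (p i + t + 4 * κ)) := by
          intro i
          have e1 : ∀ x, μ x * Real.exp (t * f i x) ≤ μ x + (t * (μ x * f i x) + t ^ 2 * μ x) := by
            intro x
            have hx : |t * f i x| ≤ 1 := by
              rw [abs_of_nonneg (mul_nonneg ht.le (hf0 i x))]
              exact mul_le_one₀ ht1 (hf0 i x) (hf1 i x)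
            have hb := abs_le.1 (Real.abs_exp_sub_one_sub_id_le hx)
            have : (t * f i x) ^ 2 ≤ t ^ 2 := by
              rw [mul_pow]
              exact mul_le_of_le_one_right (sq_nonneg t) (pow_le_one₀ (hf0 i x) (hf1 i x))
            have : Real.exp (t * f i x) ≤ 1 + t * f i x + t ^ 2 := by linarith [hb.2]
            calc _ ≤ μ x * (1 + t * f i x + t ^ 2) := mul_le_mul_of_nonneg_left this (hμ0 x)
              _ = _ := by ring
          have e2 : ∑ g with Disjoint (supp g) F, μ g * Real.exp (t * f i g) ≤
              P + (t * p i + t ^ 2) := by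
            calc _ ≤ ∑ g with Disjoint (supp g) F, (μ g + (t * (μ g * f i g) + t ^ 2 * μ g)) :=
                  Finset.sum_le_sum fun x _ => e1 x
              _ = P + ∑ g with Disjoint (supp g) F, (t * (μ g * f i g) + t ^ 2 * μ g) := by
                  rw [Finset.sum_add_distrib]
              _ ≤ P + ∑ g, (t * (μ g * f i g) + t ^ 2 * μ g) := by
                  refine add_le_add le_rfl ?_
                  refine Finset.sum_le_sum_of_subset_of_nonneg (Finset.filter_subset _ _) ?_
                  intro x _ _
                  have := hμ0 x
                  have := hf0 i x
                  positivity
              _ ≤ _ := by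
                  rw [Finset.sum_add_distrib, ← Finset.mul_sum, ← Finset.mul_sum, hμ1, mul_one]
                  have := mul_le_mul_of_nonneg_left (hp i) ht.le
                  linarith
          refine e2.trans ?_
          have hp0 : 0 ≤ p i := le_trans
            (Finset.sum_nonneg fun x _ => mul_nonneg (hμ0 x) (hf0 i x)) (hp i)
          have e3 : 1 + t * (p i + t + 4 * κ) ≤ Real.exp (t * (p i + t + 4 * κ)) := by
            have := Real.add_one_le_exp (t * (p i + t + 4 * κ)); linarith
          refine le_trans ?_ (mul_le_mul_of_nonneg_left e3 hPpos.le)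
          have e4 : (1 - κ) * (t * (p i + t + 4 * κ)) ≤ P * (t * (p i + t + 4 * κ)) := by
            gcongr
          have e5 : 0 ≤ (t * κ) * (4 - 4 * κ - p i - t) :=
            mul_nonneg (by positivity) (by linarith [hp1 i])
          nlinarith
        have h4 : ∑ i, v i * ∑ g with Disjoint (supp g) F, μ g * Real.exp (t * f i g) ≤
            P * ∑ i, v i * Real.exp (t * (p i + t + 4 * κ)) := by
          rw [Finset.mul_sum]
          refine Finset.sum_le_sum fun i _ => ?_
          have := mul_le_mul_of_nonneg_left (h3 i) (hv i)
          linarith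
        linarith
      obtain ⟨x, hx0, hxF, hx⟩ := hex
      have hxd : ∀ a, Disjoint (supp x) (supp (g a)) := fun a =>
        hxF.mono_right (Finset.subset_biUnion_of_mem (fun a => supp (g a)) (Finset.mem_univ a))
      refine ⟨Fin.snoc (α := fun _ => G) g x, ?_, ?_, ?_⟩
      · intro a b
        refine Fin.lastCases ?_ (fun a => ?_) a <;> refine Fin.lastCases ?_ (fun b => ?_) b
        · simp
        · intro _; simpa using hxd b
        · intro _; simpa using (hxd a).symm
        · intro hab; simpa using hg1 a b (fun h => hab (by rw [h]))
      · intro a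
        refine Fin.lastCases ?_ (fun a => ?_) a
        · simpa using hx0
        · simpa using hg2 a
      · refine le_trans (b := ∑ i, v i * Real.exp (t * f i x)) (le_of_eq ?_) (le_trans ?_ hg3)
        · refine Finset.sum_congr rfl fun i _ => ?_
          rw [Fin.sum_univ_castSucc]
          simp only [Fin.snoc_castSucc, Fin.snoc_last, hvdef, w]
          rw [← Real.exp_add, ← Real.exp_add]
          congr 1
          push_cast
          ring
        · refine hx.trans (le_of_eq (Finset.sum_congr rfl fun i _ => ?_))
          simp only [hvdef]
          rw [mul_assoc, ← Real.exp_add]; simp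
  obtain ⟨g, h1, h2, h3⟩ := key J le_rfl
  refine ⟨g, h1, h2, fun i => ?_⟩
  have h4 : Real.exp (t * ∑ a, f i (g a) - J * (t * (p i + t + 4 * κ))) ≤ Fintype.card ι :=
    le_trans (Finset.single_le_sum (f := fun i =>
      Real.exp (t * ∑ a, f i (g a) - J * (t * (p i + t + 4 * κ))))
      (fun i _ => (Real.exp_pos _).le) (Finset.mem_univ i)) h3
  have h5 := (Real.le_log_iff_exp_le (lt_of_lt_of_le (Real.exp_pos _) h4)).2 h4
  rw [← sub_le_iff_le_add', le_div_iff₀ ht]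
  linarith

open Classical in
/-- The real-valued indicator of a proposition. -/
noncomputable def ind (p : Prop) : ℝ := if p then 1 else 0

theorem ind_of {p : Prop} (h : p) : ind p = 1 := if_pos h
theorem ind_of_not {p : Prop} (h : ¬ p) : ind p = 0 := if_neg h
theorem ind_nonneg (p : Prop) : 0 ≤ ind p := by unfold ind; split_ifs <;> norm_num
theorem ind_le_one (p : Prop) : ind p ≤ 1 := by unfold ind; split_ifs <;> norm_num
theorem ind_mono {p q : Prop} (h : p → q) : ind p ≤ ind q := by
  by_cases hp : p
  · rw [ind_of hp, ind_of (h hp)]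
  · rw [ind_of_not hp]; exact ind_nonneg q
theorem ind_congr {p q : Prop} (h : p ↔ q) : ind p = ind q := by rw [propext h]
theorem ind_and (p q : Prop) : ind (p ∧ q) = ind p * ind q := by
  by_cases hp : p <;> by_cases hq : q <;> simp [ind, hp, hq]
theorem ind_not (p : Prop) : ind (¬ p) = 1 - ind p := by
  by_cases hp : p <;> simp [ind, hp]
theorem ind_or_le (p q : Prop) : ind (p ∨ q) ≤ ind p + ind q := by
  by_cases hp : p <;> by_cases hq : q <;> simp [ind, hp, hq]

/-- The probability of `P` under the uniform distribution on a finite type. -/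
noncomputable def pr {α : Type} [Fintype α] (P : α → Prop) : ℝ :=
  (∑ x, ind (P x)) / Fintype.card α

section pr
variable {α β : Type} [Fintype α] [Fintype β]

theorem pr_nonneg (P : α → Prop) : 0 ≤ pr P :=
  div_nonneg (Finset.sum_nonneg fun _ _ => ind_nonneg _) (Nat.cast_nonneg _)

theorem sum_ind_eq_card (P : α → Prop) [DecidablePred P] :
    ∑ x, ind (P x) = (Finset.univ.filter P).card := by
  rw [Finset.card_filter]; push_cast
  refine Finset.sum_congr rfl fun x _ => ?_
  by_cases h : P x <;> simp [ind, h]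

theorem pr_mono {P Q : α → Prop} (h : ∀ x, P x → Q x) : pr P ≤ pr Q :=
  div_le_div_of_nonneg_right (Finset.sum_le_sum fun x _ => ind_mono (h x)) (Nat.cast_nonneg _)

theorem pr_congr {P Q : α → Prop} (h : ∀ x, P x ↔ Q x) : pr P = pr Q :=
  le_antisymm (pr_mono fun x => (h x).1) (pr_mono fun x => (h x).2)

theorem pr_le_one (P : α → Prop) : pr P ≤ 1 := by
  refine div_le_one_of_le₀ ?_ (Nat.cast_nonneg _)
  calc ∑ x, ind (P x) ≤ ∑ _x : α, (1 : ℝ) := Finset.sum_le_sum fun x _ => ind_le_one _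
    _ = _ := by simp

theorem pr_of_forall [Nonempty α] {P : α → Prop} (h : ∀ x, P x) : pr P = 1 := by
  have : (Fintype.card α : ℝ) ≠ 0 := by simp
  rw [pr, Finset.sum_congr rfl fun x _ => ind_of (h x)]
  simp [this]

theorem pr_of_forall_not {P : α → Prop} (h : ∀ x, ¬ P x) : pr P = 0 := by
  rw [pr, Finset.sum_congr rfl fun x _ => ind_of_not (h x)]; simp

theorem exists_of_pr_pos {P : α → Prop} (h : 0 < pr P) : ∃ x, P x := by
  by_contra hc
  push Not at hc
  rw [pr_of_forall_not hc] at h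
  exact lt_irrefl _ h

theorem nonempty_of_pr_pos {P : α → Prop} (h : 0 < pr P) : Nonempty α :=
  (exists_of_pr_pos h).nonempty

theorem pr_or_le (P Q : α → Prop) : pr (fun x => P x ∨ Q x) ≤ pr P + pr Q := by
  rw [pr, pr, pr, ← add_div, ← Finset.sum_add_distrib]
  exact div_le_div_of_nonneg_right (Finset.sum_le_sum fun x _ => ind_or_le _ _) (Nat.cast_nonneg _)

theorem pr_not [Nonempty α] (P : α → Prop) : pr (fun x => ¬ P x) = 1 - pr P := by
  have : (Fintype.card α : ℝ) ≠ 0 := by simp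
  rw [pr, pr, Finset.sum_congr rfl fun x _ => ind_not (P x), Finset.sum_sub_distrib, sub_div]
  simp [this]

/-- Discarding an unlikely event. -/
theorem pr_and_ge (P Q : α → Prop) : pr P - pr (fun x => ¬ Q x) ≤ pr (fun x => P x ∧ Q x) := by
  have h : pr P ≤ pr (fun x => (P x ∧ Q x) ∨ ¬ Q x) := pr_mono fun x hx => by
    by_cases hq : Q x
    · exact Or.inl ⟨hx, hq⟩
    · exact Or.inr hq
  have := h.trans (pr_or_le _ _)
  linarith

theorem pr_exists_le {ι : Type} (s : Finset ι) (P : ι → α → Prop) :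
    pr (fun x => ∃ i ∈ s, P i x) ≤ ∑ i ∈ s, pr (P i) := by
  classical
  induction s using Finset.induction_on with
  | empty => rw [pr_of_forall_not]; simp; simp
  | insert a s ha ih =>
    rw [Finset.sum_insert ha]
    refine le_trans (le_trans (pr_mono ?_) (pr_or_le (P a) (fun x => ∃ i ∈ s, P i x))) ?_
    · rintro x ⟨i, hi, h⟩
      rcases Finset.mem_insert.1 hi with rfl | hi
      · exact Or.inl h
      · exact Or.inr ⟨i, hi, h⟩
    · linarith

/-- Pigeonhole: one of finitely many events covering an event has a proportional share. -/
theorem exists_pr_ge {ι : Type} [Fintype ι] (P : α → Prop) (Q : ι → α → Prop)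
    (h : ∀ x, P x → ∃ i, Q i x) {b : ℝ} (hb : b ≤ pr P) (hb0 : 0 < b) :
    ∃ i, b / Fintype.card ι ≤ pr (Q i) := by
  by_contra hc
  push Not at hc
  have h1 : pr P ≤ ∑ i, pr (Q i) := le_trans (pr_mono fun x hx => by
    obtain ⟨i, hi⟩ := h x hx; exact ⟨i, Finset.mem_univ i, hi⟩) (pr_exists_le Finset.univ Q)
  obtain ⟨x, hx⟩ := exists_of_pr_pos (lt_of_lt_of_le hb0 hb)
  obtain ⟨i0, _⟩ := h x hx
  have : Nonempty ι := ⟨i0⟩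
  have h2 : ∑ i, pr (Q i) < ∑ _i : ι, b / Fintype.card ι :=
    Finset.sum_lt_sum_of_nonempty Finset.univ_nonempty fun i _ => hc i
  have : (Fintype.card ι : ℝ) ≠ 0 := by simp
  rw [Finset.sum_const, Finset.card_univ, nsmul_eq_mul, mul_div_cancel₀ _ this] at h2
  linarith

theorem pr_equiv (e : α ≃ β) (P : β → Prop) : pr (fun x => P (e x)) = pr P := by
  rw [pr, pr, Fintype.card_congr e, Equiv.sum_comp e fun y => ind (P y)]

theorem pr_prod (P : α → β → Prop) :
    pr (fun x : α × β => P x.1 x.2) = (∑ a, pr (P a)) / Fintype.card α := by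
  simp only [pr, Fintype.sum_prod_type, Fintype.card_prod, Nat.cast_mul, ← Finset.sum_div]
  rw [div_div, mul_comm]

theorem pr_swap (P : α → β → Prop) :
    pr (fun x : α × β => P x.1 x.2) = pr (fun x : β × α => P x.2 x.1) :=
  (pr_equiv (Equiv.prodComm β α) fun x : α × β => P x.1 x.2).symm

theorem pr_bind {P : α → Prop} {Q : α → β → Prop} {b c : ℝ} (hb : b ≤ pr P) (hc0 : 0 ≤ c)
    (hQ : ∀ a, P a → c ≤ pr (Q a)) : b * c ≤ pr (fun x : α × β => P x.1 ∧ Q x.1 x.2) := by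
  rw [pr_prod (fun a y => P a ∧ Q a y)]
  refine (mul_le_mul_of_nonneg_right hb hc0).trans ?_
  rw [pr, div_mul_eq_mul_div, Finset.sum_mul]
  refine div_le_div_of_nonneg_right (Finset.sum_le_sum fun a _ => ?_) (Nat.cast_nonneg _)
  by_cases h : P a
  · rw [ind_of h, one_mul]
    exact (hQ a h).trans (pr_mono fun y hy => ⟨h, hy⟩)
  · rw [ind_of_not h, zero_mul]; exact pr_nonneg _

theorem pr_prod_le_of_forall {P : α → β → Prop} {c : ℝ} (hc : 0 ≤ c) (h : ∀ a, pr (P a) ≤ c) :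
    pr (fun x : α × β => P x.1 x.2) ≤ c := by
  rw [pr_prod]
  refine div_le_of_le_mul₀ (Nat.cast_nonneg _) hc ?_
  calc ∑ a, pr (P a) ≤ ∑ _a : α, c := Finset.sum_le_sum fun a _ => h a
    _ = _ := by simp [mul_comm]

/-- Markov: fibres that are not large contribute little. -/
theorem pr_le_fiber (P : α → β → Prop) (c : ℝ) (hc : 0 ≤ c) :
    pr (fun x : α × β => P x.1 x.2) ≤ pr (fun a => c ≤ pr (P a)) + c := by
  rw [pr_prod]
  rcases isEmpty_or_nonempty α with h | h
  · simp [pr, hc]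
  have hc1 : (0 : ℝ) < Fintype.card α := by simp [Fintype.card_pos]
  rw [pr, div_add' _ _ _ hc1.ne']
  refine div_le_div_of_nonneg_right ?_ hc1.le
  calc ∑ a, pr (P a) ≤ ∑ a, (ind (c ≤ pr (P a)) + c) := Finset.sum_le_sum fun a _ => ?_
    _ = _ := by rw [Finset.sum_add_distrib]; simp [mul_comm]
  by_cases h : c ≤ pr (P a)
  · rw [ind_of h]; linarith [pr_le_one (P a)]
  · rw [ind_of_not h]; linarith

theorem pr_fiber {P : α → β → Prop} {b : ℝ} (hb0 : 0 ≤ b)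
    (hb : b ≤ pr (fun x : α × β => P x.1 x.2)) : b / 2 ≤ pr (fun a => b / 2 ≤ pr (P a)) := by
  have := pr_le_fiber P (b / 2) (by linarith)
  linarith

theorem pr_markov {P : α → β → Prop} {b c : ℝ} (hc : 0 < c)
    (hb : pr (fun x : α × β => P x.1 x.2) ≤ b) : pr (fun a => c ≤ pr (P a)) ≤ b / c := by
  rw [le_div_iff₀ hc]
  refine le_trans ?_ hb
  have := pr_bind (P := fun a => c ≤ pr (P a)) (Q := P) (le_refl _) hc.le fun a h => h
  exact this.trans (pr_mono fun x hx => hx.2)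

theorem pr_fst [Nonempty β] (P : α → Prop) : pr (fun x : α × β => P x.1) = pr P := by
  rw [pr_prod (fun a _ => P a), pr]
  congr 1
  refine Finset.sum_congr rfl fun a _ => ?_
  by_cases h : P a
  · rw [ind_of h]; exact pr_of_forall fun _ => h
  · rw [ind_of_not h]; exact pr_of_forall_not fun _ => h

theorem pr_pow (P : β → Prop) (t : ℕ) : pr (fun y : Fin t → β => ∀ j, P (y j)) = pr P ^ t := by
  classical
  rw [pr, pr, div_pow, Fintype.sum_pow]
  congr 1
  · refine Finset.sum_congr rfl fun y _ => ?_
    by_cases h : ∀ j, P (y j)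
    · rw [ind_of h, Finset.prod_eq_one fun j _ => ind_of (h j)]
    · rw [ind_of_not h]
      push Not at h
      obtain ⟨j, hj⟩ := h
      rw [Finset.prod_eq_zero (Finset.mem_univ j) (ind_of_not hj)]
  · simp

/-- Jensen's inequality for independent copies of the second coordinate. -/
theorem pr_copies {P : α → β → Prop} {b : ℝ} (hb0 : 0 < b)
    (hb : b ≤ pr (fun x : α × β => P x.1 x.2)) (t : ℕ) :
    b ^ t ≤ pr (fun x : α × (Fin t → β) => ∀ j, P x.1 (x.2 j)) := by
  have h : Nonempty α := (nonempty_of_pr_pos (lt_of_lt_of_le hb0 hb)).map Prod.fst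
  rw [pr_prod (fun a (y : Fin t → β) => ∀ j, P a (y j))]
  simp_rw [pr_pow]
  refine (pow_le_pow_left₀ hb0.le hb t).trans ?_
  rw [pr_prod, Finset.sum_div, Finset.sum_div]
  have hc1 : (0 : ℝ) < Fintype.card α := by simp [Fintype.card_pos]
  have := Real.pow_arith_mean_le_arith_mean_pow Finset.univ (fun _ : α => 1 / (Fintype.card α : ℝ))
    (fun a => pr (P a)) (fun _ _ => by positivity) (by simp) (fun a _ => pr_nonneg _) t
  simpa only [one_div, inv_mul_eq_div] using this

end pr

theorem pr_blowup_fin {V : Type} [Fintype V] (t : ℕ) : ∀ (k : ℕ) {α : Type} [Fintype α]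
    (P : α → (Fin k → V) → Prop) {b : ℝ}, 0 < b → b ≤ pr (fun x : α × (Fin k → V) => P x.1 x.2) →
    b ^ t ^ k ≤ pr (fun x : α × (Fin k → Fin t → V) => ∀ c : Fin k → Fin t,
      P x.1 fun i => x.2 i (c i)) := by
  intro k
  induction k with
  | zero =>
    intro α _ P b hb0 hb
    rw [pow_zero, pow_one]
    refine hb.trans (le_of_eq ?_)
    rw [← pr_equiv (Equiv.prodCongr (Equiv.refl α) (Equiv.ofUnique (Fin 0 → V) (Fin 0 → Fin t → V)))]
    refine pr_congr fun x => ⟨fun h c => ?_, fun h => ?_⟩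
    · exact (congrArg (P x.1) (Subsingleton.elim _ _)).mp h
    · exact (congrArg (P x.1) (Subsingleton.elim _ _)).mp (h Fin.elim0)
  | succ k ih =>
    intro α _ P b hb0 hb
    have h1 : b ≤ pr (fun x : (α × (Fin k → V)) × V => P x.1.1 (Fin.cons x.2 x.1.2)) := by
      refine hb.trans (le_of_eq ?_)
      rw [← pr_equiv (((Equiv.prodAssoc α (Fin k → V) V).trans
        (Equiv.prodCongr (Equiv.refl α) (Equiv.prodComm _ _))).trans
        (Equiv.prodCongr (Equiv.refl α) (Fin.consEquiv fun _ => V)))]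
      rfl
    have h2 := pr_copies (P := fun (x : α × (Fin k → V)) (v : V) => P x.1 (Fin.cons v x.2)) hb0 h1 t
    have h3 : b ^ t ≤ pr (fun x : (α × (Fin t → V)) × (Fin k → V) =>
        ∀ j, P x.1.1 (Fin.cons (x.1.2 j) x.2)) := by
      refine h2.trans (le_of_eq ?_)
      rw [← pr_equiv (((Equiv.prodAssoc α (Fin t → V) (Fin k → V)).trans
        (Equiv.prodCongr (Equiv.refl α) (Equiv.prodComm _ _))).trans
        (Equiv.prodAssoc α (Fin k → V) (Fin t → V)).symm)]
      rfl
    have h4 := ih (fun (x : α × (Fin t → V)) g => ∀ j, P x.1 (Fin.cons (x.2 j) g))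
      (pow_pos hb0 t) h3
    rw [← pow_mul, ← pow_succ'] at h4
    refine h4.trans (le_of_eq_of_le ?_ (le_refl _))
    rw [← pr_equiv ((Equiv.prodAssoc α (Fin t → V) (Fin k → Fin t → V)).trans
        (Equiv.prodCongr (Equiv.refl α) (Fin.consEquiv fun _ => Fin t → V)))]
    refine pr_congr fun x => ⟨fun h c => ?_, fun h c j => ?_⟩
    · refine (congrArg (P x.1.1) ?_).mp (h (fun i => c i.succ) (c 0))
      funext i
      refine Fin.cases ?_ (fun i => ?_) i <;> simp
    · refine (congrArg (P x.1.1) ?_).mp (h (Fin.cons j c))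
      funext i
      refine Fin.cases ?_ (fun i => ?_) i <;> simp

section tuples
variable {V : Type} [Fintype V] {ι κ : Type} [Fintype ι] [Fintype κ] [DecidableEq ι] [DecidableEq κ]

theorem pr_reindex (e : ι ≃ κ) (P : (ι → V) → Prop) : pr (fun g : κ → V => P (g ∘ e)) = pr P :=
  pr_equiv (Equiv.arrowCongr e.symm (Equiv.refl V)) P

/-- The blow-up lemma: a dense `κ`-partite configuration contains densely many complete ones. -/
theorem pr_blowup (t : ℕ) (P : (κ → V) → Prop) {b : ℝ} (hb0 : 0 < b) (hb : b ≤ pr P) :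
    b ^ t ^ Fintype.card κ ≤ pr (fun y : κ × Fin t → V => ∀ c : κ → Fin t,
      P fun i => y (i, c i)) := by
  have e := Fintype.equivFin κ
  have h1 : b ≤ pr (fun x : Unit × (Fin (Fintype.card κ) → V) => P (x.2 ∘ e)) := by
    refine hb.trans (le_of_eq ?_)
    rw [← pr_reindex e, ← pr_equiv (Equiv.punitProd.{0, 0} (Fin (Fintype.card κ) → V))]
    rfl
  have h2 := pr_blowup_fin t _ (fun (_ : Unit) g => P (g ∘ e)) hb0 h1
  refine h2.trans (le_of_eq ?_)
  rw [← pr_equiv ((Equiv.punitProd.{0, 0} (Fin (Fintype.card κ) → Fin t → V)).trans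
    ((Equiv.arrowCongr e.symm (Equiv.refl (Fin t → V))).trans (Equiv.curry κ (Fin t) V).symm))]
  refine pr_congr fun x => ⟨fun h c => ?_, fun h c => ?_⟩
  · have := h (c ∘ e.symm)
    convert this using 1
    funext i
    simp [Equiv.arrowCongr, Function.uncurry]
  · refine (congrArg P ?_).mp (h (c ∘ e))
    funext i
    simp [Equiv.arrowCongr, Function.uncurry]

/-- Splitting a tuple along an injection of index sets. -/
noncomputable def splitEquiv (V : Type) (e : ι → κ) (he : Function.Injective e) :
    (κ → V) ≃ (ι → V) × ({j // ¬ ∃ i, e i = j} → V) :=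
  open Classical in
  (Equiv.piEquivPiSubtypeProd (fun j => ∃ i, e i = j) fun _ => V).trans
    (Equiv.prodCongr (Equiv.arrowCongr (Equiv.ofInjective e he).symm (Equiv.refl V)) (Equiv.refl _))

theorem pr_split (e : ι → κ) (he : Function.Injective e)
    [Fintype {j // ¬ ∃ i, e i = j}] (P : (ι → V) → ({j // ¬ ∃ i, e i = j} → V) → Prop) :
    pr (fun g : κ → V => P (g ∘ e) fun j => g j.1) =
      pr (fun x : (ι → V) × ({j // ¬ ∃ i, e i = j} → V) => P x.1 x.2) := by
  classical
  rw [← pr_equiv (splitEquiv V e he)]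
  rfl

theorem pr_proj [Nonempty V] (e : ι → κ) (he : Function.Injective e) (P : (ι → V) → Prop) :
    pr (fun g : κ → V => P (g ∘ e)) = pr P := by
  classical
  rw [pr_split e he fun x _ => P x, pr_fst]

theorem pr_eval [Nonempty V] (i : κ) (P : V → Prop) : pr (fun g : κ → V => P (g i)) = pr P := by
  have := pr_proj (V := V) (fun _ : Unit => i) (fun _ _ _ => rfl) (fun x => P (x ()))
  rw [← pr_equiv (Equiv.funUnique Unit V).symm] at this
  exact this

theorem pr_sum_arrow (P : (ι → V) → (κ → V) → Prop) :
    pr (fun g : ι ⊕ κ → V => P (g ∘ Sum.inl) (g ∘ Sum.inr)) =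
      pr (fun x : (ι → V) × (κ → V) => P x.1 x.2) := by
  rw [← pr_equiv (Equiv.sumArrowEquivProdArrow ι κ V)]
  rfl

theorem pr_mem [DecidableEq V] (F : Finset V) :
    pr (fun v : V => v ∈ F) = (F.card : ℝ) / Fintype.card V := by
  rw [pr, sum_ind_eq_card, Finset.filter_mem_eq_inter, Finset.univ_inter]

theorem pr_collision [DecidableEq V] (F : Finset V) :
    pr (fun g : ι → V => ¬ (Function.Injective g ∧ Disjoint (Finset.univ.image g) F)) ≤
      (Fintype.card ι : ℝ) * (Fintype.card ι + F.card) / Fintype.card V := by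
  rcases isEmpty_or_nonempty V with hV | hV
  · rcases isEmpty_or_nonempty ι with hι | hι
    · rw [pr_of_forall_not]
      · positivity
      · intro g hg
        exact hg ⟨Function.injective_of_subsingleton g, by simp⟩
    · have : IsEmpty (ι → V) := by rw [isEmpty_pi]; exact ⟨hι.some, hV⟩
      simp [pr]
  have h0 : (0 : ℝ) < Fintype.card V := by simp [Fintype.card_pos]
  have h1 : ∀ i j : ι, i ≠ j → pr (fun g : ι → V => g i = g j) ≤ 1 / Fintype.card V := by
    intro i j hij
    have hinj : Function.Injective (fun b : Bool => if b then i else j) := by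
      intro a b; cases a <;> cases b <;> simp [hij, hij.symm]
    have h2 := pr_proj (V := V) (fun b : Bool => if b then i else j) hinj
      (fun x => x true = x false)
    simp only [Function.comp] at h2
    simp only [if_true, Bool.false_eq_true, if_false] at h2
    rw [h2, ← pr_equiv (Equiv.boolArrowEquivProd V).symm]
    refine le_trans (le_of_eq (pr_congr fun x => ?_)) (pr_prod_le_of_forall
      (P := fun a b : V => b ∈ ({a} : Finset V)) (by positivity) fun a => ?_)
    · simp [Equiv.boolArrowEquivProd, eq_comm]
    · rw [pr_mem]; simp
  have h2 : pr (fun g : ι → V => ¬ (Function.Injective g ∧ Disjoint (Finset.univ.image g) F)) ≤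
      pr (fun g : ι → V => (∃ p ∈ (Finset.univ : Finset (ι × ι)).filter (fun p => p.1 ≠ p.2),
        g p.1 = g p.2) ∨ ∃ i ∈ (Finset.univ : Finset ι), g i ∈ F) := by
    refine pr_mono fun g hg => ?_
    by_contra hc
    push Not at hc
    refine hg ⟨fun i j hij => ?_, ?_⟩
    · by_contra hne
      exact hc.1 (i, j) (by simp [hne]) hij
    · rw [Finset.disjoint_left]
      intro x hx
      obtain ⟨i, _, rfl⟩ := Finset.mem_image.1 hx
      exact hc.2 i (Finset.mem_univ i)
  refine h2.trans ((pr_or_le _ _).trans ?_)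
  have h3 := pr_exists_le ((Finset.univ : Finset (ι × ι)).filter (fun p => p.1 ≠ p.2))
    (fun p (g : ι → V) => g p.1 = g p.2)
  have h4 := pr_exists_le (Finset.univ : Finset ι) (fun i (g : ι → V) => g i ∈ F)
  have h5 : ∑ p ∈ (Finset.univ : Finset (ι × ι)).filter (fun p => p.1 ≠ p.2),
      pr (fun g : ι → V => g p.1 = g p.2) ≤ (Fintype.card ι * Fintype.card ι : ℕ) * (1 / Fintype.card V) := by
    refine (Finset.sum_le_sum fun p hp => h1 _ _ (Finset.mem_filter.1 hp).2).trans ?_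
    rw [Finset.sum_const, nsmul_eq_mul]
    refine mul_le_mul_of_nonneg_right ?_ (by positivity)
    rw [← Fintype.card_prod]
    exact_mod_cast Finset.card_filter_le _ _
  have h6 : ∑ i ∈ (Finset.univ : Finset ι), pr (fun g : ι → V => g i ∈ F) =
      Fintype.card ι * (F.card / Fintype.card V) := by
    simp_rw [pr_eval (V := V) _ (fun v => v ∈ F), pr_mem]
    simp
  push_cast at h5
  calc _ ≤ _ := add_le_add (h3.trans h5) (h4.trans h6.le)
    _ = _ := by ring

end tuples

/-- The set of entries of a tuple. -/
def im {ι V : Type} [Fintype ι] [DecidableEq V] (g : ι → V) : Finset V := Finset.univ.image g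

section rich
variable {V : Type} [DecidableEq V] {ι κ : Type} [Fintype ι] [Fintype κ]

theorem mem_im {g : ι → V} {x : V} : x ∈ im g ↔ ∃ i, g i = x := by simp [im]

theorem mem_im_self (g : ι → V) (i : ι) : g i ∈ im g := mem_im.2 ⟨i, rfl⟩

theorem im_comp_subset (g : κ → V) (e : ι → κ) : im (g ∘ e) ⊆ im g := by
  intro x hx
  obtain ⟨i, rfl⟩ := mem_im.1 hx
  exact mem_im_self g _

theorem im_comp_equiv (g : κ → V) (e : ι ≃ κ) : im (g ∘ e) = im g := by
  refine Finset.Subset.antisymm (im_comp_subset g e) fun x hx => ?_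
  obtain ⟨i, rfl⟩ := mem_im.1 hx
  exact mem_im.2 ⟨e.symm i, by simp⟩

theorem card_im_le (g : ι → V) : (im g).card ≤ Fintype.card ι :=
  Finset.card_image_le.trans (by simp)

theorem card_im (g : ι → V) (hg : Function.Injective g) : (im g).card = Fintype.card ι := by
  rw [im, Finset.card_image_of_injective _ hg, Finset.card_univ]

theorem injective_of_card_im {g : ι → V} (h : (im g).card = Fintype.card ι) :
    Function.Injective g := by
  rw [im, ← Finset.card_univ] at h
  exact Set.injOn_univ.1 (by simpa using Finset.card_image_iff.1 h)

theorem im_sum (g : ι ⊕ κ → V) : im g = im (g ∘ Sum.inl) ∪ im (g ∘ Sum.inr) := by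
  ext x; simp [mem_im, Sum.exists]

variable [Fintype V]

/-- A random `Q`-tuple satisfies `P` (as a set) with probability at least `1 / Q`. -/
def Rich (Q : ℕ) (P : Finset V → Prop) : Prop :=
  0 < Q ∧ 1 / (Q : ℝ) ≤ pr (fun g : Fin Q → V => P (im g))

/-- Set predicates inherited by supersets. -/
def UpSet (P : Finset V → Prop) : Prop := ∀ X Y, X ⊆ Y → P X → P Y

theorem Rich.imp {Q : ℕ} {P P' : Finset V → Prop} (h : Rich Q P) (hP : ∀ X, P X → P' X) :
    Rich Q P' := ⟨h.1, h.2.trans (pr_mono fun _ => hP _)⟩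

theorem Rich.pos {Q : ℕ} {P : Finset V → Prop} (h : Rich Q P) :
    0 < pr (fun g : Fin Q → V => P (im g)) :=
  lt_of_lt_of_le (one_div_pos.2 (Nat.cast_pos.2 h.1)) h.2

theorem Rich.nonempty {Q : ℕ} {P : Finset V → Prop} (h : Rich Q P) : Nonempty V :=
  (nonempty_of_pr_pos h.pos).map fun g => g ⟨0, h.1⟩

theorem rich_of_tuple [DecidableEq ι] {P : Finset V → Prop} (hP : UpSet P) {b : ℝ} (hb : 0 < b)
    (h : b ≤ pr (fun g : ι → V => P (im g))) {Q : ℕ} [Nonempty V] (hQ : Fintype.card ι ≤ Q)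
    (hbQ : 1 / b ≤ Q) : Rich Q P := by
  classical
  have hQ0 : (0 : ℝ) < Q := lt_of_lt_of_le (one_div_pos.2 hb) hbQ
  refine ⟨by exact_mod_cast hQ0, ?_⟩
  have h1 : 1 / (Q : ℝ) ≤ b := by rw [div_le_comm₀ hQ0 hb]; exact hbQ
  refine h1.trans (h.trans ?_)
  obtain ⟨e⟩ : Nonempty (ι ↪ Fin Q) := Function.Embedding.nonempty_of_card_le (by simpa using hQ)
  rw [← pr_proj (e : ι → Fin Q) e.injective]
  exact pr_mono fun g hg => hP _ _ (im_comp_subset g e) hg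

theorem Rich.mono {Q Q' : ℕ} {P : Finset V → Prop} (h : Rich Q P) (hP : UpSet P) (hQ : Q ≤ Q') :
    Rich Q' P := by
  have := h.nonempty
  have h0 : (0 : ℝ) < Q := Nat.cast_pos.2 h.1
  exact rich_of_tuple (ι := Fin Q) hP (one_div_pos.2 h0) h.2 (by simpa using hQ)
    (by simpa using hQ)

/-- Rich predicates hold in general position with respect to a small set. -/
theorem Rich.avoid {Q : ℕ} {P : Finset V → Prop} (h : Rich Q P) (F : Finset V)
    (hn : 2 * Q ^ 2 * (Q + F.card) ≤ Fintype.card V) :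
    1 / (2 * Q : ℝ) ≤ pr (fun g : Fin Q → V => P (im g) ∧
      (Function.Injective g ∧ Disjoint (im g) F)) := by
  have h0 : (0 : ℝ) < Q := Nat.cast_pos.2 h.1
  have h1 := pr_and_ge (fun g : Fin Q → V => P (im g))
    (fun g => Function.Injective g ∧ Disjoint (im g) F)
  have h2 := pr_collision (ι := Fin Q) F
  have := h.nonempty
  have hV : (0 : ℝ) < Fintype.card V := by simp [Fintype.card_pos]
  have hn' : (2 * Q ^ 2 * (Q + F.card) : ℝ) ≤ Fintype.card V := by exact_mod_cast hn
  have h3 : (Fintype.card (Fin Q) : ℝ) * (Fintype.card (Fin Q) + F.card) / Fintype.card V ≤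
      1 / (2 * Q) := by
    rw [div_le_div_iff₀ hV (by positivity), Fintype.card_fin]
    nlinarith
  have h4 : 1 / (Q : ℝ) = 1 / (2 * Q) + 1 / (2 * Q) := by field_simp; norm_num
  have h5 := h.2
  unfold im at *
  linarith

theorem Rich.exists_avoid {Q : ℕ} {P : Finset V → Prop} (h : Rich Q P) (F : Finset V)
    (hn : 2 * Q ^ 2 * (Q + F.card) ≤ Fintype.card V) :
    ∃ X, P X ∧ X.card ≤ Q ∧ Disjoint X F := by
  have h0 : (0 : ℝ) < Q := Nat.cast_pos.2 h.1
  obtain ⟨g, hg, _, hF⟩ := exists_of_pr_pos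
    (lt_of_lt_of_le (by positivity : 0 < 1 / (2 * Q : ℝ)) (h.avoid F hn))
  exact ⟨im g, hg, by simpa using card_im_le g, hF⟩

/-- Successive choices in general position. -/
theorem Rich.bind {Q Q' : ℕ} {P : Finset V → Prop} {R : Finset V → Finset V → Prop}
    (h : Rich Q P) (F : Finset V) (hR : ∀ X, P X → X.card ≤ Q → Disjoint X F → Rich Q' (R X))
    {f Q'' : ℕ} (hf : F.card ≤ f) (hQ : 8 * (Q + Q' + f + 1) ^ 3 ≤ Q'')
    (hn : Q'' ≤ Fintype.card V) :
    Rich Q'' (fun Z => ∃ X Y, X ∪ Y ⊆ Z ∧ Disjoint X Y ∧ Disjoint X F ∧ Disjoint Y F ∧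
      X.card ≤ Q ∧ Y.card ≤ Q' ∧ P X ∧ R X Y) := by
  have hVne := h.nonempty
  have h0 : (0 : ℝ) < Q := Nat.cast_pos.2 h.1
  have b1 : 2 * Q ^ 2 * (Q + F.card) ≤ 8 * (Q + Q' + f + 1) ^ 3 := by
    calc 2 * Q ^ 2 * (Q + F.card) ≤ 8 * (Q + Q' + f + 1) ^ 2 * (Q + Q' + f + 1) := by
          refine Nat.mul_le_mul (Nat.mul_le_mul (by norm_num) (Nat.pow_le_pow_left ?_ 2)) ?_ <;> omega
      _ = _ := by ring
  have hA := h.avoid F (b1.trans (hQ.trans hn))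
  have hQ'0 : 0 < Q' := by
    obtain ⟨g, hg, _, hF⟩ := exists_of_pr_pos
      (lt_of_lt_of_le (by positivity : 0 < 1 / (2 * Q : ℝ)) hA)
    exact (hR _ hg (by simpa using card_im_le g) hF).1
  have hQ'0' : (0 : ℝ) < Q' := Nat.cast_pos.2 hQ'0
  have hB := pr_bind (β := Fin Q' → V) (Q := fun g y => R (im g) (im y) ∧
      (Function.Injective y ∧ Disjoint (im y) (im g ∪ F))) (c := 1 / (2 * Q' : ℝ)) hA
      (by positivity) (by
    intro g hg
    refine (hR _ hg.1 (by simpa using card_im_le g) hg.2.2).avoid _ (le_trans ?_ (hQ.trans hn))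
    have : (im g ∪ F).card ≤ Q + f := (Finset.card_union_le _ _).trans
      (add_le_add (by simpa using card_im_le g) hf)
    calc 2 * Q' ^ 2 * (Q' + (im g ∪ F).card) ≤ 8 * (Q + Q' + f + 1) ^ 2 * (Q + Q' + f + 1) := by
          refine Nat.mul_le_mul (Nat.mul_le_mul (by norm_num) (Nat.pow_le_pow_left ?_ 2)) ?_ <;> omega
      _ = _ := by ring)
  rw [← pr_sum_arrow fun (g : Fin Q → V) (y : Fin Q' → V) => (P (im g) ∧
    (Function.Injective g ∧ Disjoint (im g) F)) ∧ (R (im g) (im y) ∧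
      (Function.Injective y ∧ Disjoint (im y) (im g ∪ F)))] at hB
  refine rich_of_tuple (ι := Fin Q ⊕ Fin Q') ?_ (b := 1 / (2 * Q) * (1 / (2 * Q'))) (by positivity)
    (hB.trans (pr_mono fun g hg => ?_)) ?_ ?_
  · rintro Z Z' hZ ⟨X, Y, hXY, h⟩
    exact ⟨X, Y, hXY.trans hZ, h⟩
  · obtain ⟨⟨h1, h2, h3⟩, h4, h5, h6⟩ := hg
    rw [Finset.disjoint_union_right] at h6
    exact ⟨_, _, (im_sum g).ge, h6.1.symm, h3, h6.2, by simpa using card_im_le (g ∘ Sum.inl),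
      by simpa using card_im_le (g ∘ Sum.inr), h1, h4⟩
  · simp only [Fintype.card_sum, Fintype.card_fin]
    refine le_trans ?_ hQ
    nlinarith [Nat.zero_le (Q + Q' + f), Nat.zero_le ((Q + Q' + f) ^ 2),
      Nat.zero_le ((Q + Q' + f) ^ 3)]
  · have h7 : 4 * Q * Q' ≤ 8 * (Q + Q' + f + 1) ^ 3 := by
      calc 4 * Q * Q' = 4 * Q * Q' * 1 := (mul_one _).symm
        _ ≤ 8 * (Q + Q' + f + 1) * (Q + Q' + f + 1) * (Q + Q' + f + 1) := by
            refine Nat.mul_le_mul (Nat.mul_le_mul (Nat.mul_le_mul ?_ ?_) ?_) ?_ <;> omega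
        _ = _ := by ring
    have h8 : (4 * Q * Q' : ℝ) ≤ Q'' := by exact_mod_cast h7.trans hQ
    refine le_trans (le_of_eq ?_) h8
    field_simp
    norm_num

/-- A dense family of tuples has many projections with rich fibres. -/
theorem rich_fiber [DecidableEq ι] [DecidableEq κ] (e : ι → κ) (he : Function.Injective e)
    (R : (κ → V) → Prop) {b : ℝ} (hb : 0 < b) (hR : b ≤ pr R) [Nonempty V] {Q : ℕ}
    (hQ : Fintype.card κ ≤ Q) (hbQ : 2 / b ≤ Q) :
    b / 2 ≤ pr (fun a : ι → V => Rich Q (fun X => ∃ g, R g ∧ g ∘ e = a ∧ im g ⊆ im a ∪ X)) := by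
  classical
  have h1 := pr_split (V := V) e he (fun a y => R ((splitEquiv V e he).symm (a, y)))
  have h2 : pr (fun g : κ → V => R ((splitEquiv V e he).symm (g ∘ e, fun j => g j.1))) = pr R := by
    refine pr_congr fun g => ?_
    rw [show (g ∘ e, fun j : {j // ¬ ∃ i, e i = j} => g j.1) = splitEquiv V e he g from rfl,
      Equiv.symm_apply_apply]
  rw [h2] at h1
  rw [h1] at hR
  refine (pr_fiber (P := fun a y => R ((splitEquiv V e he).symm (a, y))) hb.le hR).trans
    (pr_mono fun a ha => ?_)
  refine rich_of_tuple ?_ (half_pos hb) (ha.trans (pr_mono fun y hy => ?_))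
    ((Fintype.card_subtype_le _).trans hQ) ?_
  · rintro X Y hXY ⟨g, h1, h2, h3⟩
    exact ⟨g, h1, h2, h3.trans (Finset.union_subset_union_right hXY)⟩
  · set g := (splitEquiv V e he).symm (a, y) with hg
    have hge : (g ∘ e, fun j : {j // ¬ ∃ i, e i = j} => g j.1) = (a, y) := by
      rw [show (g ∘ e, fun j : {j // ¬ ∃ i, e i = j} => g j.1) = splitEquiv V e he g from rfl, hg,
        Equiv.apply_symm_apply]
    have hg1 : g ∘ e = a := congrArg Prod.fst hge
    have hg2 : (fun j : {j // ¬ ∃ i, e i = j} => g j.1) = y := congrArg Prod.snd hge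
    refine ⟨g, hy, hg1, fun x hx => ?_⟩
    obtain ⟨j, rfl⟩ := mem_im.1 hx
    rw [Finset.mem_union]
    by_cases hj : ∃ i, e i = j
    · obtain ⟨i, rfl⟩ := hj
      left; rw [← hg1]; exact mem_im_self (g ∘ e) i
    · right; rw [← hg2]; exact mem_im_self (fun j : {j // ¬ ∃ i, e i = j} => g j.1) ⟨j, hj⟩
  · refine le_trans (le_of_eq ?_) hbQ
    field_simp

end rich

section growth
variable {ι : Type} [Fintype ι] [DecidableEq ι]

theorem growth_step (Q0 Q1 f : ℕ) {c0 : ℝ} (hc0 : 0 < c0) : ∃ Q2, Q1 ≤ Q2 ∧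
    ∀ (V : Type) [Fintype V] [DecidableEq V] (C : (ι → V) → Finset V → Prop)
      (L : (ι → V) → (ι → V) → Finset V → Prop) (F : Finset V), Q2 ≤ Fintype.card V →
      F.card ≤ f → (∀ a, UpSet (C a)) →
      (∀ a b X Y, C a X → L a b Y → Disjoint (im a) X → Disjoint (im a) Y → Disjoint X Y →
        Disjoint (im a ∪ X ∪ Y) (F ∪ im b) → Disjoint (im b) F → C b (im a ∪ X ∪ Y)) →
      c0 ≤ pr (fun x : (ι → V) × (ι → V) => Rich Q1 (C x.1) ∧ ¬ Rich Q1 (C x.2) ∧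
        Rich Q0 (L x.1 x.2)) →
      pr (fun a => Rich Q1 (C a)) + c0 / 4 ≤ pr (fun a => Rich Q2 (C a)) := by
  set r := Fintype.card ι
  obtain ⟨q1, hq1⟩ := exists_nat_ge (max (r : ℝ) (2 / c0))
  obtain ⟨N1, hN1⟩ := exists_nat_ge (4 * (r * (r + f)) / c0)
  have hq1r : r ≤ q1 := by exact_mod_cast (le_max_left _ _).trans hq1
  have hq1c : 2 / c0 ≤ q1 := (le_max_right _ _).trans hq1
  set f' := f + r
  set Q1' := 8 * (q1 + Q1 + f' + 1) ^ 3 with hQ1'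
  set Q2 := 8 * (Q1' + Q0 + f' + 1) ^ 3 with hQ2
  have hle : ∀ a b : ℕ, a ≤ b → a ≤ 8 * (b + 1) ^ 3 := by
    intro a b hab
    have : b + 1 ≤ (b + 1) ^ 3 := Nat.le_self_pow (by norm_num) _
    omega
  refine ⟨Q2 + N1, ?_, ?_⟩
  · have h1 : Q1 ≤ Q1' := hle _ _ (by omega)
    have h2 : Q1' ≤ Q2 := hle _ _ (by omega)
    omega
  intro V _ _ C L F hn hF hC hcomp hpr
  have hpr2 : c0 ≤ pr (fun x : (ι → V) × (ι → V) => Rich Q1 (C x.2) ∧ ¬ Rich Q1 (C x.1) ∧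
        Rich Q0 (L x.2 x.1)) := by
    rw [← pr_swap (fun a b : ι → V => Rich Q1 (C a) ∧ ¬ Rich Q1 (C b) ∧ Rich Q0 (L a b))]
    exact hpr
  have hne : Nonempty (ι → V) :=
    (nonempty_of_pr_pos (lt_of_lt_of_le hc0 hpr)).map Prod.fst
  obtain ⟨⟨a0, b0⟩, _, _, hab0⟩ := exists_of_pr_pos (lt_of_lt_of_le hc0 hpr)
  have hVne : Nonempty V := hab0.nonempty
  have hV : (0 : ℝ) < Fintype.card V := by simp [Fintype.card_pos]
  have h1 := pr_fiber (P := fun b a : ι → V => Rich Q1 (C a) ∧ ¬ Rich Q1 (C b) ∧ Rich Q0 (L a b))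
    hc0.le hpr2
  have h2 := pr_and_ge (fun b : ι → V => c0 / 2 ≤ pr fun a : ι → V =>
    Rich Q1 (C a) ∧ ¬ Rich Q1 (C b) ∧ Rich Q0 (L a b))
    (fun b => Function.Injective b ∧ Disjoint (Finset.univ.image b) F)
  have h3 := pr_collision (ι := ι) F
  have h4 : (r : ℝ) * (r + F.card) / Fintype.card V ≤ c0 / 4 := by
    rw [div_le_iff₀ hV]
    rw [div_le_iff₀ hc0] at hN1
    have h5 : (N1 : ℝ) ≤ Fintype.card V := by exact_mod_cast (le_trans (by omega) hn : N1 ≤ _)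
    have h6 : (F.card : ℝ) ≤ f := by exact_mod_cast hF
    have h7 : (r : ℝ) * (r + F.card) ≤ r * (r + f) := by gcongr
    have h8 : (N1 : ℝ) * c0 ≤ Fintype.card V * c0 := by gcongr
    nlinarith
  set B : (ι → V) → Prop := fun b => (c0 / 2 ≤ pr fun a : ι → V =>
    Rich Q1 (C a) ∧ ¬ Rich Q1 (C b) ∧ Rich Q0 (L a b)) ∧
    (Function.Injective b ∧ Disjoint (Finset.univ.image b) F) with hB
  have h5 : c0 / 4 ≤ pr B := by linarith
  have hBrich : ∀ b, B b → Rich (Q2 + N1) (C b) := by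
    intro b hb
    have hFb : (F ∪ im b).card ≤ f' :=
      (Finset.card_union_le _ _).trans (add_le_add hF (card_im_le b))
    have r1 : Rich q1 (fun Z => ∃ a, im a ⊆ Z ∧ Rich Q1 (C a) ∧ Rich Q0 (L a b)) := by
      refine rich_of_tuple (ι := ι) ?_ (half_pos hc0) (hb.1.trans (pr_mono fun a ha =>
        ⟨a, Finset.Subset.refl _, ha.1, ha.2.2⟩)) hq1r (by rwa [one_div_div])
      rintro Z Z' hZ ⟨a, ha, h⟩
      exact ⟨a, ha.trans hZ, h⟩
    have r2 := r1.bind (R := fun Z X => ∃ a, im a ⊆ Z ∧ C a X ∧ Rich Q0 (L a b)) (F ∪ im b)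
      (Q' := Q1) (fun Z hZ _ _ => by
        obtain ⟨a, ha, h, h'⟩ := hZ
        exact h.imp fun X hX => ⟨a, ha, hX, h'⟩) hFb hQ1'.ge (by
          have : Q1' ≤ Q2 := hle _ _ (by omega)
          omega)
    have r3 := r2.bind (R := fun Z Y => ∃ a X, im a ∪ X ⊆ Z ∧ Disjoint (im a) X ∧ C a X ∧ L a b Y)
      (F ∪ im b) (Q' := Q0) (fun Z hZ _ _ => by
        obtain ⟨W, X, hWX, hd, _, _, _, _, _, a, ha, hX, hL⟩ := hZ
        exact hL.imp fun Y hY => ⟨a, X, (Finset.union_subset_union_left ha).trans hWX,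
          hd.mono_left ha, hX, hY⟩) hFb hQ2.ge (by omega)
    refine Rich.mono (r3.imp ?_) (hC b) (by omega)
    rintro Z ⟨W, Y, hWY, hd, hWF, hYF, _, _, _, a, X, haX, hdX, hX, hY⟩
    refine hC b _ _ ((Finset.union_subset_union_left haX).trans hWY) (hcomp a b X Y hX hY hdX
      (hd.mono_left (Finset.subset_union_left.trans haX))
      (hd.mono_left (Finset.subset_union_right.trans haX)) ?_ hb.2.2)
    rw [Finset.disjoint_union_left]
    exact ⟨hWF.mono_left haX, hYF⟩
  have hdisj : pr (fun a => Rich Q1 (C a)) + pr B ≤ pr (fun a => Rich Q1 (C a) ∨ B a) := by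
    rw [pr, pr, pr, ← add_div, ← Finset.sum_add_distrib]
    refine div_le_div_of_nonneg_right (Finset.sum_le_sum fun x _ => ?_) (Nat.cast_nonneg _)
    by_cases hB1 : B x
    · have : ¬ Rich Q1 (C x) := by
        obtain ⟨a, ha⟩ := exists_of_pr_pos (lt_of_lt_of_le (half_pos hc0) hB1.1)
        exact ha.2.1
      rw [ind_of_not this, ind_of hB1, ind_of (Or.inr hB1)]; norm_num
    · rw [ind_of_not hB1, add_zero]; exact ind_mono Or.inl
  have hlast : pr (fun a => Rich Q1 (C a) ∨ B a) ≤ pr (fun a => Rich (Q2 + N1) (C a)) := by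
    refine pr_mono fun a ha => ha.elim (fun h => h.mono (hC a) ?_) (hBrich a)
    have h1 : Q1 ≤ Q1' := hle _ _ (by omega)
    have h2 : Q1' ≤ Q2 := hle _ _ (by omega)
    omega
  linarith

/-- A rich relation that expands every set of intermediate density spreads to almost all tuples. -/
theorem growth (ι : Type) [Fintype ι] [DecidableEq ι] (Q0 f : ℕ) {c c0 : ℝ} (hc0 : 0 < c0) : ∃ Q,
    ∀ (V : Type) [Fintype V] [DecidableEq V] (C : (ι → V) → Finset V → Prop)
      (L : (ι → V) → (ι → V) → Finset V → Prop) (F : Finset V), Q ≤ Fintype.card V →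
      F.card ≤ f → (∀ a, UpSet (C a)) →
      (∀ a b X Y, C a X → L a b Y → Disjoint (im a) X → Disjoint (im a) Y → Disjoint X Y →
        Disjoint (im a ∪ X ∪ Y) (F ∪ im b) → Disjoint (im b) F → C b (im a ∪ X ∪ Y)) →
      c ≤ pr (fun a => Rich Q0 (C a)) →
      (∀ A : (ι → V) → Prop, c ≤ pr A → c ≤ pr (fun a => ¬ A a) →
        c0 ≤ pr (fun x : (ι → V) × (ι → V) => A x.1 ∧ ¬ A x.2 ∧ Rich Q0 (L x.1 x.2))) →
      pr (fun a => ¬ Rich Q (C a)) ≤ c := by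
  have main : ∀ R : ℕ, ∃ Q, Q0 ≤ Q ∧
    ∀ (V : Type) [Fintype V] [DecidableEq V] (C : (ι → V) → Finset V → Prop)
      (L : (ι → V) → (ι → V) → Finset V → Prop) (F : Finset V), Q ≤ Fintype.card V →
      F.card ≤ f → (∀ a, UpSet (C a)) →
      (∀ a b X Y, C a X → L a b Y → Disjoint (im a) X → Disjoint (im a) Y → Disjoint X Y →
        Disjoint (im a ∪ X ∪ Y) (F ∪ im b) → Disjoint (im b) F → C b (im a ∪ X ∪ Y)) →
      c ≤ pr (fun a => Rich Q0 (C a)) →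
      (∀ A : (ι → V) → Prop, c ≤ pr A → c ≤ pr (fun a => ¬ A a) →
        c0 ≤ pr (fun x : (ι → V) × (ι → V) => A x.1 ∧ ¬ A x.2 ∧ Rich Q0 (L x.1 x.2))) →
      pr (fun a => ¬ Rich Q (C a)) ≤ c ∨ R * (c0 / 4) ≤ pr (fun a => Rich Q (C a)) := by
    intro R
    induction R with
    | zero =>
      refine ⟨Q0, le_rfl, fun V _ _ C L F _ _ _ _ _ _ => Or.inr ?_⟩
      simpa using pr_nonneg _
    | succ R ih =>
      obtain ⟨Q1, hQ01, hQ1⟩ := ih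
      obtain ⟨Q2, hQ12, hQ2⟩ := growth_step (ι := ι) Q0 Q1 f hc0
      refine ⟨Q2, hQ01.trans hQ12, fun V _ _ C L F hn hF hC hcomp hstart hexp => ?_⟩
      have hmono : ∀ a, Rich Q1 (C a) → Rich Q2 (C a) := fun a h => h.mono (hC a) hQ12
      rcases hQ1 V C L F (hQ12.trans hn) hF hC hcomp hstart hexp with h | h
      · exact Or.inl ((pr_mono fun a ha h' => ha (hmono a h')).trans h)
      · by_cases h' : c ≤ pr (fun a => ¬ Rich Q1 (C a))
        · right
          have h3 := hQ2 V C L F hn hF hC hcomp (hexp (fun a => Rich Q1 (C a))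
            (hstart.trans (pr_mono fun a ha => ha.mono (hC a) hQ01)) h')
          push_cast
          linarith
        · left
          exact (pr_mono fun a ha h' => ha (hmono a h')).trans (not_le.1 h').le
  obtain ⟨R, hR⟩ := exists_nat_gt (4 / c0)
  obtain ⟨Q, _, hQ⟩ := main R
  refine ⟨Q, fun V _ _ C L F hn hF hC hcomp hstart hexp => ?_⟩
  rcases hQ V C L F hn hF hC hcomp hstart hexp with h | h
  · exact h
  · have h1 := pr_le_one (fun a => Rich Q (C a))
    rw [div_lt_iff₀ hc0] at hR
    linarith

end growth

section paths
variable {V : Type} [DecidableEq V] {l o : ℕ}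

/-- `LPath H S S' A`: some `ℓ`-path of `H` (possibly without edges) with ordered ends `S`, `S'`
has vertex set `A`. -/
inductive LPath (H : Finset (Finset V)) : (Fin l → V) → (Fin l → V) → Finset V → Prop
  | single (S : Fin l → V) : Function.Injective S → LPath H S S (im S)
  | step (S S' S'' : Fin l → V) (O A : Finset V) : LPath H S S' A → im S' ∪ O ∪ im S'' ∈ H →
      Function.Injective S'' → Disjoint O (im S'') → Disjoint A (O ∪ im S'') →
      LPath H S S'' (A ∪ (O ∪ im S''))

variable {H : Finset (Finset V)} {S S' S'' a b : Fin l → V} {A B I J O X : Finset V}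

theorem LPath.beg_subset (h : LPath H S S' A) : im S ⊆ A := by
  induction h with
  | single => exact Finset.Subset.refl _
  | step S' S'' O A _ _ _ _ _ ih => exact ih.trans Finset.subset_union_left

theorem LPath.end_subset (h : LPath H S S' A) : im S' ⊆ A := by
  cases h with
  | single => exact Finset.Subset.refl _
  | step O A => exact Finset.subset_union_right.trans Finset.subset_union_right

theorem LPath.beg_injective (h : LPath H S S' A) : Function.Injective S := by
  induction h with
  | single h => exact h
  | step _ _ _ _ _ _ _ _ _ ih => exact ih

theorem LPath.end_injective (h : LPath H S S' A) : Function.Injective S' := by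
  cases h with
  | single h => exact h
  | step _ _ _ _ _ _ h => exact h

theorem LPath.concat (h : LPath H S S' A) (h' : LPath H S' S'' B)
    (hd : Disjoint A (B \ im S')) : LPath H S S'' (A ∪ B) := by
  induction h' with
  | single _ => rwa [Finset.union_eq_left.2 h.end_subset]
  | step T' T'' O B hB hO hinj hOd hBd ih =>
    rw [← Finset.union_assoc]
    have hT : Disjoint (O ∪ im T'') (im S') := (hBd.mono_left hB.beg_subset).symm
    rw [Finset.union_sdiff_distrib, Finset.disjoint_union_right, sdiff_eq_left.2 hT] at hd
    exact LPath.step _ _ _ _ _ (ih hd.1) hO hinj hOd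
      (Finset.disjoint_union_left.2 ⟨hd.2, hBd⟩)

theorem LPath.card (hH : ∀ e ∈ H, e.card = 2 * l + o) (h : LPath H S S' A) :
    ∃ s, A.card = s * (l + o) + l := by
  induction h with
  | single hS => exact ⟨0, by rw [card_im S hS]; simp⟩
  | step S' S'' O A hA hO hinj hOd hAd ih =>
    obtain ⟨s, hs⟩ := ih
    refine ⟨s + 1, ?_⟩
    have h1 := hH _ hO
    rw [Finset.union_assoc, Finset.card_union_of_disjoint (hAd.mono_left hA.end_subset),
      card_im _ hA.end_injective, Fintype.card_fin] at h1
    rw [Finset.card_union_of_disjoint hAd, hs]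
    linarith

/-- `I` is the inner vertex set of an `ℓ`-path from `S` to `S'`. -/
def Conn (H : Finset (Finset V)) (S S' : Fin l → V) (I : Finset V) : Prop :=
  Disjoint (im S) (im S') ∧ Disjoint I (im S ∪ im S') ∧ LPath H S S' (im S ∪ I ∪ im S')

theorem Conn.of_edge (hS : Function.Injective S) (hS' : Function.Injective S')
    (hd : Disjoint (im S) (im S')) (hI : Disjoint I (im S ∪ im S')) (he : im S ∪ I ∪ im S' ∈ H) :
    Conn H S S' I := by
  refine ⟨hd, hI, ?_⟩
  rw [Finset.disjoint_union_right] at hI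
  rw [Finset.union_assoc]
  exact LPath.step _ _ _ _ _ (LPath.single S hS) he hS' hI.2
    (Finset.disjoint_union_right.2 ⟨hI.1.symm, hd⟩)

/-- Two paths joined by a connecting path. -/
theorem LPath.join {b e b' e' : Fin l → V} (h : LPath H b e A) (hc : Conn H e b' I)
    (h' : LPath H b' e' B) (hAB : Disjoint A B) (hI : Disjoint I (A ∪ B)) :
    LPath H b e' (A ∪ I ∪ B) := by
  rw [Finset.disjoint_union_right] at hI
  have h1 : LPath H b b' (A ∪ (im e ∪ I ∪ im b')) := by
    refine h.concat hc.2.2 ?_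
    rw [Finset.disjoint_left]
    intro x hx hx'
    simp only [Finset.mem_sdiff, Finset.mem_union] at hx'
    rcases hx' with ⟨(h1 | h1) | h1, h2⟩
    · exact h2 h1
    · exact Finset.disjoint_left.1 hI.1 h1 hx
    · exact Finset.disjoint_left.1 hAB hx (h'.beg_subset h1)
  have h2 := h1.concat h' (by
    rw [Finset.disjoint_left]
    intro x hx hx'
    simp only [Finset.mem_sdiff, Finset.mem_union] at hx' hx
    rcases hx with h1 | (h1 | h1) | h1
    · exact Finset.disjoint_left.1 hAB h1 hx'.1
    · exact Finset.disjoint_left.1 hAB (h.end_subset h1) hx'.1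
    · exact Finset.disjoint_left.1 hI.2 h1 hx'.1
    · exact hx'.2 h1)
  convert h2 using 1
  ext x
  have := @LPath.end_subset _ _ _ _ _ _ _ h x
  have := @LPath.beg_subset _ _ _ _ _ _ _ h' x
  simp only [Finset.mem_union]
  tauto

theorem Conn.trans (h : Conn H S a I) (h' : Conn H a S' J)
    (hd : Disjoint (im S ∪ I) (J ∪ im S')) : Conn H S S' (I ∪ im a ∪ J) := by
  obtain ⟨h1, h2, h3⟩ := h
  obtain ⟨h4, h5, h6⟩ := h'
  simp only [Finset.disjoint_union_left, Finset.disjoint_union_right] at *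
  refine ⟨hd.2.1, ?_, ?_⟩
  · simp only [Finset.disjoint_union_left, Finset.disjoint_union_right]
    exact ⟨⟨⟨h2.1, h1.symm⟩, hd.1.1.symm⟩, ⟨hd.2.2, h4⟩, h5.2⟩
  have := h3.concat h6 (by
    rw [Finset.disjoint_left]
    intro x hx hx'
    simp only [Finset.mem_sdiff, Finset.mem_union] at hx' hx
    rcases hx' with ⟨(h | h) | h, hn⟩
    · exact hn h
    · rcases hx with (hx | hx) | hx
      · exact Finset.disjoint_left.1 hd.1.1 hx h
      · exact Finset.disjoint_left.1 hd.1.2 hx h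
      · exact hn hx
    · rcases hx with (hx | hx) | hx
      · exact Finset.disjoint_left.1 hd.2.1 hx h
      · exact Finset.disjoint_left.1 hd.2.2 hx h
      · exact hn hx)
  convert this using 1
  ext x
  simp only [Finset.mem_union]
  tauto

/-- `Cov H A E`: `A` is partitioned into vertex sets of paths with the listed pairs of ends. -/
def Cov (H : Finset (Finset V)) : Finset V → List ((Fin l → V) × (Fin l → V)) → Prop
  | A, [] => A = ∅
  | A, p :: E => ∃ B C, LPath H p.1 p.2 B ∧ Cov H C E ∧ Disjoint B C ∧ A = B ∪ C

theorem Cov.append {E E' : List ((Fin l → V) × (Fin l → V))} :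
    ∀ {A B : Finset V}, Cov H A E → Cov H B E' → Disjoint A B → Cov H (A ∪ B) (E ++ E') := by
  induction E with
  | nil =>
    intro A B h h' _
    have : A = ∅ := h
    subst this
    simpa using h'
  | cons p E ih =>
    rintro A B ⟨C, D, h1, h2, h3, rfl⟩ h' hd
    rw [Finset.disjoint_union_left] at hd
    refine ⟨C, D ∪ B, h1, ih h2 h' hd.2, Finset.disjoint_union_right.2 ⟨h3, hd.1⟩, ?_⟩
    rw [Finset.union_assoc]

theorem LPath.cov (h : LPath H S S' A) : Cov H A [(S, S')] :=
  ⟨A, ∅, h, rfl, Finset.disjoint_empty_right _, by simp⟩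

theorem Cov.card_mod (hH : ∀ e ∈ H, e.card = 2 * l + o) {E : List ((Fin l → V) × (Fin l → V))} :
    ∀ {A}, Cov H A E → A.card ≡ E.length * l [MOD (l + o)] := by
  induction E with
  | nil => intro A h; have : A = ∅ := h; subst this; simp [Nat.ModEq.refl]
  | cons p E ih =>
    rintro A ⟨B, C, h1, h2, h3, rfl⟩
    obtain ⟨s, hs⟩ := h1.card hH
    rw [Finset.card_union_of_disjoint h3, hs, List.length_cons, Nat.add_mul, one_mul,
      add_comm (s * (l + o) + l)]
    refine Nat.ModEq.add (ih h2) ?_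
    simp [Nat.ModEq, Nat.add_mod]

/-- Two vertex sets are interchangeable if they are covered by disjoint paths with the same
ends. -/
def Sim (l : ℕ) (H : Finset (Finset V)) (A B : Finset V) : Prop :=
  ∃ E : List ((Fin l → V) × (Fin l → V)), Cov H A E ∧ Cov H B E

theorem Sim.symm (h : Sim l H A B) : Sim l H B A := by
  obtain ⟨E, h1, h2⟩ := h; exact ⟨E, h2, h1⟩

theorem Sim.empty : Sim l H ∅ ∅ := ⟨[], rfl, rfl⟩

theorem Sim.union {A' B' : Finset V} (h : Sim l H A B) (h' : Sim l H A' B') (hA : Disjoint A A')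
    (hB : Disjoint B B') : Sim l H (A ∪ A') (B ∪ B') := by
  obtain ⟨E, h1, h2⟩ := h
  obtain ⟨E', h3, h4⟩ := h'
  exact ⟨E ++ E', h1.append h3 hA, h2.append h4 hB⟩

theorem Sim.card_mod (hH : ∀ e ∈ H, e.card = 2 * l + o) (h : Sim l H A B) :
    A.card ≡ B.card [MOD (l + o)] := by
  obtain ⟨E, h1, h2⟩ := h
  exact (h1.card_mod hH).trans (h2.card_mod hH).symm

theorem LPath.sim (h : LPath H S S' A) (h' : LPath H S S' B) : Sim l H A B :=
  ⟨_, h.cov, h'.cov⟩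

theorem LPath.map {W : Type} [DecidableEq W] {H' : Finset (Finset W)} (φ : V → W)
    (hφ : Function.Injective φ) (hH : ∀ e ∈ H, e.image φ ∈ H') (h : LPath H S S' A) :
    LPath H' (φ ∘ S) (φ ∘ S') (A.image φ) := by
  have him : ∀ T : Fin l → V, (im T).image φ = im (φ ∘ T) := fun T => by
    rw [im, im, Finset.image_image]
  induction h with
  | single hS => rw [him]; exact LPath.single _ (hφ.comp hS)
  | step S' S'' O A _ hO hinj hOd hAd ih =>
    rw [Finset.image_union, Finset.image_union, him]
    refine LPath.step _ _ _ _ _ ih ?_ (hφ.comp hinj) ?_ ?_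
    · rw [← him, ← him, ← Finset.image_union, ← Finset.image_union]; exact hH _ hO
    · rw [← him]; exact (Finset.disjoint_image hφ).2 hOd
    · rw [← him, ← Finset.image_union]; exact (Finset.disjoint_image hφ).2 hAd

theorem image_range_glue (f g : ℕ → V) (N M : ℕ) :
    (Finset.range (N + M)).image (fun i => if i < N then f i else g (i - N)) =
      (Finset.range N).image f ∪ (Finset.range M).image g := by
  ext x
  simp only [Finset.mem_image, Finset.mem_range, Finset.mem_union]
  constructor
  · rintro ⟨i, hi, rfl⟩
    by_cases h : i < N
    · left; exact ⟨i, h, by simp [h]⟩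
    · right; exact ⟨i - N, by omega, by simp [h]⟩
  · rintro (⟨i, hi, rfl⟩ | ⟨i, hi, rfl⟩)
    · exact ⟨i, by omega, by simp [hi]⟩
    · exact ⟨N + i, by omega, by simp⟩

theorem exists_enum_finset [Nonempty V] (O : Finset V) :
    ∃ f : ℕ → V, (Finset.range O.card).image f = O := by
  refine ⟨fun i => if h : i < O.card then (O.equivFin.symm ⟨i, h⟩ : V) else Classical.arbitrary V,
    ?_⟩
  ext x
  simp only [Finset.mem_image, Finset.mem_range]
  constructor
  · rintro ⟨i, hi, rfl⟩
    rw [dif_pos hi]; exact (O.equivFin.symm ⟨i, hi⟩).2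
  · intro hx
    refine ⟨O.equivFin ⟨x, hx⟩, (O.equivFin ⟨x, hx⟩).2, ?_⟩
    simp

theorem exists_enum_tuple [Nonempty V] (S : Fin l → V) :
    ∃ f : ℕ → V, (∀ i : Fin l, f i = S i) ∧ (Finset.range l).image f = im S := by
  refine ⟨fun i => if h : i < l then S ⟨i, h⟩ else Classical.arbitrary V, ?_, ?_⟩
  · intro i; simp
  · ext x
    simp only [Finset.mem_image, Finset.mem_range, mem_im]
    constructor
    · rintro ⟨i, hi, rfl⟩; exact ⟨⟨i, hi⟩, by simp [hi]⟩
    · rintro ⟨i, rfl⟩; exact ⟨i, i.2, by simp⟩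

theorem LPath.enum [Nonempty V] (hH : ∀ e ∈ H, e.card = 2 * l + o) (h : LPath H S S' A) :
    ∃ (s : ℕ) (f : ℕ → V), A.card = s * (l + o) + l ∧
      (Finset.range (s * (l + o) + l)).image f = A ∧ (∀ i : Fin l, f i = S i) ∧
      (∀ i : Fin l, f (s * (l + o) + i) = S' i) ∧
      ∀ j < s, (Finset.range (2 * l + o)).image (fun i => f (j * (l + o) + i)) ∈ H := by
  induction h with
  | single hS =>
    obtain ⟨f, h1, h2⟩ := exists_enum_tuple S
    exact ⟨0, f, by rw [card_im S hS]; simp, by simpa using h2, h1, by simpa using h1, by simp⟩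
  | step S' S'' O A hA hO hinj hOd hAd ih =>
    obtain ⟨s, f, h1, h2, h3, h4, h5⟩ := ih
    obtain ⟨g, hg⟩ := exists_enum_finset O
    obtain ⟨g', hg', hg''⟩ := exists_enum_tuple S''
    have hOc : O.card = o := by
      have h1 := hH _ hO
      rw [Finset.union_assoc, Finset.card_union_of_disjoint (hAd.mono_left hA.end_subset),
        card_im _ hA.end_injective, Fintype.card_fin, Finset.card_union_of_disjoint hOd,
        card_im _ hinj, Fintype.card_fin] at h1
      omega
    rw [hOc] at hg
    set w : ℕ → V := fun i => if i < o then g i else g' (i - o) with hw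
    set N := s * (l + o) + l with hN
    have hwi : (Finset.range (o + l)).image w = O ∪ im S'' := by
      rw [hw, image_range_glue, hg, hg'']
    have hNs : (s + 1) * (l + o) + l = N + (o + l) := by rw [hN]; ring
    refine ⟨s + 1, fun i => if i < N then f i else w (i - N), ?_, ?_, ?_, ?_, ?_⟩
    · rw [hNs, Finset.card_union_of_disjoint hAd, h1, Finset.card_union_of_disjoint hOd, hOc,
        card_im _ hinj, Fintype.card_fin]
    · rw [hNs, image_range_glue, h2, hwi]
    · intro i
      have : (i : ℕ) < N := by rw [hN]; have := i.2; omega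
      simp only [this, if_true]; exact h3 i
    · intro i
      have e1 : (s + 1) * (l + o) + i = N + (o + i) := by rw [hN]; ring
      rw [e1]
      simp only [hw]
      simpa using hg' i
    · intro j hj
      rcases Nat.lt_succ_iff_lt_or_eq.1 hj with hj | rfl
      · convert h5 j hj using 1
        refine Finset.image_congr fun i hi => ?_
        have hi : i < 2 * l + o := by simpa using hi
        have : j * (l + o) + i < N := by
          have : (j + 1) * (l + o) ≤ s * (l + o) := Nat.mul_le_mul_right _ hj
          rw [hN]; linarith
        simp [this]
      · convert hO using 1
        obtain ⟨f', hf', hf''⟩ := exists_enum_tuple S'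
        rw [Finset.union_assoc, ← hwi, ← hf'', show 2 * l + o = l + (o + l) by ring,
          ← image_range_glue]
        refine Finset.image_congr fun i hi => ?_
        by_cases hil : i < l
        · have h6 : j * (l + o) + i < N := by rw [hN]; omega
          simp only [h6, hil, if_true]
          exact (h4 ⟨i, hil⟩).trans (hf' ⟨i, hil⟩).symm
        · have h6 : ¬ j * (l + o) + i < N := by rw [hN]; omega
          simp only [h6, hil, if_false]
          congr 1
          omega

end paths

theorem hasHamiltonCycle_of_closed {n l o : ℕ} (hl : 0 < l) {H : Finset (Finset (Fin n))}
    (hH : ∀ e ∈ H, e.card = 2 * l + o) {b e : Fin l → Fin n} {A O : Finset (Fin n)}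
    (h : LPath H b e A) (hAO : Disjoint A O) (hu : A ∪ O = Finset.univ)
    (he : im e ∪ O ∪ im b ∈ H) (hbe : Disjoint (im e) (im b)) :
    HasHamiltonCycle n (2 * l + o) l H := by
  have hne : Nonempty (Fin n) := ⟨b ⟨0, hl⟩⟩
  have hn0 : NeZero n := ⟨fun h => by subst h; exact (b ⟨0, hl⟩).elim0⟩
  obtain ⟨s, f, h1, h2, h3, h4, h5⟩ := h.enum hH
  obtain ⟨g, hg⟩ := exists_enum_finset O
  have hOc : O.card = o := by
    have h1 := hH _ he
    rw [Finset.union_right_comm, Finset.card_union_of_disjoint, Finset.card_union_of_disjoint hbe,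
      card_im _ h.end_injective, card_im _ h.beg_injective, Fintype.card_fin] at h1
    · omega
    · rw [Finset.disjoint_union_left]
      exact ⟨hAO.mono_left h.end_subset, hAO.mono_left h.beg_subset⟩
  rw [hOc] at hg
  set N := s * (l + o) + l with hN
  have hn : n = N + o := by
    have := congrArg Finset.card hu
    rw [Finset.card_union_of_disjoint hAO, h1, hOc, Finset.card_univ, Fintype.card_fin] at this
    exact this.symm
  have hn' : n = (s + 1) * (l + o) := by rw [hn, hN]; ring
  have hk : 2 * l + o - l = l + o := by omega
  set w : ℕ → Fin n := fun i => if i < N then f i else g (i - N) with hw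
  have hwim : (Finset.range n).image w = Finset.univ := by
    have h6 : Finset.range n = Finset.range (N + o) := congrArg _ hn
    rw [hw, h6, image_range_glue, h2, hg, hu]
  refine ⟨fun z => w z.val, ?_, ?_⟩
  · have hsurj : Function.Surjective (fun z : ZMod n => w z.val) := by
      intro x
      have hx : x ∈ (Finset.range n).image w := by rw [hwim]; exact Finset.mem_univ x
      obtain ⟨i, hi, rfl⟩ := Finset.mem_image.1 hx
      refine ⟨(i : ZMod n), ?_⟩
      simp only [ZMod.val_natCast, Nat.mod_eq_of_lt (Finset.mem_range.1 hi)]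
    exact (Fintype.bijective_iff_surjective_and_card _).2 ⟨hsurj, by simp [ZMod.card]⟩
  · rw [hk]
    intro j hj
    have hdiv : n / (l + o) = s + 1 := by
      rw [hn']; exact Nat.mul_div_cancel _ (by omega)
    rw [hdiv] at hj
    simp only [ZMod.val_natCast]
    rcases Nat.lt_succ_iff_lt_or_eq.1 hj with hj | rfl
    · convert h5 j hj using 1
      refine Finset.image_congr fun i hi => ?_
      have hi : i < 2 * l + o := by simpa using hi
      have h6 : j * (l + o) + i < N := by
        have : (j + 1) * (l + o) ≤ s * (l + o) := Nat.mul_le_mul_right _ hj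
        rw [hN]; linarith
      have h7 : j * (l + o) + i < n := by omega
      simp [Nat.mod_eq_of_lt h7, hw, h6]
    · convert he using 1
      obtain ⟨f', hf', hf''⟩ := exists_enum_tuple e
      obtain ⟨f1, hf1, hf1'⟩ := exists_enum_tuple b
      rw [← hf'', ← hf1', ← hg, Finset.union_assoc, ← image_range_glue g f1, ← image_range_glue f',
        show 2 * l + o = l + (o + l) by ring]
      refine Finset.image_congr fun i hi => ?_
      have hi : i < l + (o + l) := by simpa using hi
      by_cases hil : i < l
      · have h6 : j * (l + o) + i < N := by rw [hN]; omega
        have h7 : j * (l + o) + i < n := by omega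
        simp only [Nat.mod_eq_of_lt h7, hil, if_true, hw, h6]
        exact (h4 ⟨i, hil⟩).trans (hf' ⟨i, hil⟩).symm
      · have h6 : ¬ j * (l + o) + i < N := by rw [hN]; omega
        by_cases hio : i - l < o
        · have h7 : j * (l + o) + i < n := by omega
          simp only [Nat.mod_eq_of_lt h7, hil, if_false, hw, h6, hio, if_true]
          congr 1; omega
        · have h8 : j * (l + o) + i = (i - l - o) + n := by
            rw [hn', Nat.add_mul]; omega
          have h9 : i - l - o < l := by omega
          have h10 : i - l - o < N := by rw [hN]; omega
          rw [h8, Nat.add_mod_right, Nat.mod_eq_of_lt (by omega)]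
          simp only [hil, if_false, hio, hw, h10, if_true]
          exact (h3 ⟨_, h9⟩).trans (hf1 ⟨_, h9⟩).symm

section degree
variable {V : Type} [Fintype V] [DecidableEq V] {ι κ : Type} [Fintype ι] [Fintype κ]
  [DecidableEq ι] [DecidableEq κ] {H : Finset (Finset V)}

/-- `H` is a `K`-graph in which every set of at most `d` vertices is completed to an edge by a
random tuple of the right length with probability at least `γ`. -/
structure Deg (H : Finset (Finset V)) (K d : ℕ) (γ : ℝ) : Prop where
  unif : ∀ e ∈ H, e.card = K
  ext : ∀ D : Finset V, D.card ≤ d → γ ≤ pr (fun g : Fin (K - D.card) → V => D ∪ im g ∈ H)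

theorem im_split (e : ι → κ) [Fintype {j // ¬ ∃ i, e i = j}] (g : κ → V) :
    im g = im (g ∘ e) ∪ im (fun j : {j // ¬ ∃ i, e i = j} => g j.1) := by
  ext x
  simp only [Finset.mem_union, mem_im, Function.comp]
  constructor
  · rintro ⟨j, rfl⟩
    by_cases h : ∃ i, e i = j
    · obtain ⟨i, rfl⟩ := h; exact Or.inl ⟨i, rfl⟩
    · exact Or.inr ⟨⟨j, h⟩, rfl⟩
  · rintro (⟨i, rfl⟩ | ⟨j, rfl⟩)
    · exact ⟨_, rfl⟩
    · exact ⟨_, rfl⟩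

theorem Deg.extend {K d : ℕ} {γ : ℝ} (hH : Deg H K d γ) (hγ : 0 ≤ γ) (e : ι → κ)
    (he : Function.Injective e) (hι : Fintype.card ι ≤ d) (hκ : Fintype.card κ = K)
    {P : (ι → V) → Prop} (hP : ∀ a, P a → Function.Injective a) {b : ℝ} (hb : b ≤ pr P) :
    b * γ ≤ pr (fun g : κ → V => P (g ∘ e) ∧ im g ∈ H) := by
  classical
  have h1 := pr_split (V := V) e he
    (fun a (y : {j // ¬ ∃ i, e i = j} → V) => P a ∧ im a ∪ im y ∈ H)
  have h2 : pr (fun g : κ → V => P (g ∘ e) ∧ im g ∈ H) = _ :=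
    (pr_congr fun g => by rw [im_split e g]).trans h1
  rw [h2]
  refine pr_bind (Q := fun a (y : {j // ¬ ∃ i, e i = j} → V) => im a ∪ im y ∈ H) hb hγ
    fun a ha => ?_
  have hc := card_im a (hP a ha)
  refine (hH.ext (im a) (hc.trans_le hι)).trans (le_of_eq ?_)
  have hcard : Fintype.card {j // ¬ ∃ i, e i = j} = K - (im a).card := by
    rw [Fintype.card_subtype_compl, hκ, hc]
    congr 1
    have E : {j // ∃ i, e i = j} ≃ ι := (Equiv.ofInjective e he).symm
    exact Fintype.card_congr E
  have e2 := (Fintype.equivFinOfCardEq hcard).symm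
  rw [← pr_reindex e2]
  exact pr_congr fun g => by rw [im_comp_equiv]

theorem Deg.injective {K d : ℕ} {γ : ℝ} (hH : Deg H K d γ) (hκ : Fintype.card κ = K) {g : κ → V}
    (hg : im g ∈ H) : Function.Injective g :=
  injective_of_card_im ((hH.unif _ hg).trans hκ.symm)

/-- Vertex sets indexed by disjoint ranges of an injective tuple are disjoint. -/
theorem disjoint_im_comp {ι' : Type} [Fintype ι'] {g : κ → V} (hg : Function.Injective g)
    {e : ι → κ} {e' : ι' → κ} (h : ∀ i j, e i ≠ e' j) : Disjoint (im (g ∘ e)) (im (g ∘ e')) := by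
  rw [Finset.disjoint_left]
  intro x hx hx'
  obtain ⟨i, rfl⟩ := mem_im.1 hx
  obtain ⟨j, hj⟩ := mem_im.1 hx'
  exact h i j (hg hj).symm

end degree

section connect
variable {V : Type} [Fintype V] [DecidableEq V] {l o d : ℕ} {H : Finset (Finset V)} {γ : ℝ}

/-- Positions in an edge: the first `ℓ` vertices, the middle ones and the last `ℓ`. -/
abbrev Pos (l o : ℕ) : Type := Fin l ⊕ Fin o ⊕ Fin l

theorem card_pos_type (l o : ℕ) : Fintype.card (Pos l o) = 2 * l + o := by
  simp [Fintype.card_sum]; ring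

theorem conn_of_pair {κ : Type} [Fintype κ] [DecidableEq κ] {g : κ → V} (hg : im g ∈ H)
    (hinj : Function.Injective g) (e : Fin l ⊕ Fin l → κ) (he : Function.Injective e) :
    Conn H ((g ∘ e) ∘ Sum.inl) ((g ∘ e) ∘ Sum.inr) (im g \ im (g ∘ e)) := by
  refine Conn.of_edge ((hinj.comp he).comp Sum.inl_injective)
    ((hinj.comp he).comp Sum.inr_injective) (disjoint_im_comp (hinj.comp he) (by simp)) ?_ ?_
  · rw [← im_sum]; exact Finset.sdiff_disjoint
  · rw [Finset.union_right_comm, ← im_sum, Finset.union_sdiff_of_subset (im_comp_subset g e)]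
    exact hg

/-- Reachability in one step. -/
def Link (H : Finset (Finset V)) (a b : Fin l → V) (X : Finset V) : Prop :=
  ∃ I ⊆ X, Conn H a b I

theorem upSet_link (H : Finset (Finset V)) (a b : Fin l → V) : UpSet (Link H a b) := by
  rintro X Y hXY ⟨I, hI, h⟩
  exact ⟨I, hI.trans hXY, h⟩

theorem pair_rich [Nonempty V] {κ : Type} [Fintype κ] [DecidableEq κ] (e : Fin l ⊕ Fin l → κ)
    (he : Function.Injective e) {A : (Fin l → V) → Prop} {R : (κ → V) → Prop}
    (hR : ∀ g, R g → im g ∈ H ∧ Function.Injective g ∧ A ((g ∘ e) ∘ Sum.inl) ∧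
      ¬ A ((g ∘ e) ∘ Sum.inr)) {b : ℝ} (hb : 0 < b) (hbR : b ≤ pr R) {Q : ℕ}
    (hQ : Fintype.card κ ≤ Q) (hbQ : 2 / b ≤ Q) :
    b / 2 ≤ pr (fun x : (Fin l → V) × (Fin l → V) => A x.1 ∧ ¬ A x.2 ∧
      Rich Q (Link H x.1 x.2)) := by
  have h1 := rich_fiber e he R hb hbR hQ hbQ
  rw [← pr_sum_arrow (fun x y : Fin l → V => A x ∧ ¬ A y ∧ Rich Q (Link H x y))]
  refine h1.trans (pr_mono fun a ha => ?_)
  obtain ⟨_, g, hg, rfl, _⟩ := exists_of_pr_pos ha.pos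
  refine ⟨(hR g hg).2.2.1, (hR g hg).2.2.2, ha.imp ?_⟩
  rintro X ⟨g', hg', h, hX⟩
  rw [← h] at hX ⊢
  exact ⟨_, sdiff_le_iff.2 hX, conn_of_pair (hR g' hg').1 (hR g' hg').2.1 e he⟩

/-- A set of tuples of intermediate density is often left by changing one coordinate. -/
theorem exists_crossing (hl : 0 < l) {A : (Fin l → V) → Prop} {c : ℝ} (hc : 0 < c)
    (h1 : c ≤ pr A) (h2 : c ≤ pr fun a => ¬ A a) : ∃ i : Fin l, c ^ 2 / l ≤
      pr (fun a : Fin l ⊕ Unit → V => A (a ∘ Sum.inl) ∧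
        ¬ A (Function.update (a ∘ Sum.inl) i (a (Sum.inr ())))) := by
  have hV : Nonempty V := (nonempty_of_pr_pos (hc.trans_le h1)).map fun a => a ⟨0, hl⟩
  have h3 := pr_bind (Q := fun (_ : Fin l → V) (w : Fin l → V) => ¬ A w) h1 hc.le fun _ _ => h2
  let hyb : ℕ → (Fin l → V) × (Fin l → V) → Fin l → V := fun i x j =>
    if (j : ℕ) < i then x.2 j else x.1 j
  have h4 : ∀ x : (Fin l → V) × (Fin l → V), A x.1 ∧ ¬ A x.2 →
      ∃ i : Fin l, A (hyb i x) ∧ ¬ A (hyb (i + 1) x) := by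
    intro x hx
    by_contra hcon
    push Not at hcon
    have : ∀ i ≤ l, A (hyb i x) := by
      intro i
      induction i with
      | zero => intro _; simpa [hyb] using hx.1
      | succ i ih => intro hi; exact hcon ⟨i, hi⟩ (ih (by omega))
    refine hx.2 ?_
    convert this l le_rfl using 1
    funext j
    simp [hyb]
  obtain ⟨i, hi⟩ := exists_pr_ge _ (fun (i : Fin l) x => A (hyb i x) ∧ ¬ A (hyb (i + 1) x)) h4 h3
    (by positivity)
  refine ⟨i, ?_⟩
  have hsw : Function.Involutive (fun x : (Fin l → V) × (Fin l → V) =>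
      (hyb i x, (fun j => if (j : ℕ) < i then x.1 j else x.2 j : Fin l → V))) := by
    intro x
    refine Prod.ext ?_ ?_ <;> funext j <;> by_cases h : (j : ℕ) < i <;>
      simp only [hyb, h, if_true, if_false]
  have h5 := pr_equiv hsw.toPerm
    (fun x : (Fin l → V) × (Fin l → V) => A x.1 ∧ ¬ A (Function.update x.1 i (x.2 i)))
  have h6 := pr_sum_arrow (fun x y : Fin l → V => A x ∧ ¬ A (Function.update x i (y i)))
  have hei : Function.Injective (Sum.map id (fun _ => i) : Fin l ⊕ Unit → Fin l ⊕ Fin l) :=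
    Function.Injective.sumMap Function.injective_id fun _ _ _ => rfl
  have h7 := pr_proj (V := V) _ hei (fun a => A (a ∘ Sum.inl) ∧
        ¬ A (Function.update (a ∘ Sum.inl) i (a (Sum.inr ()))))
  rw [← h7]
  simp only [Fintype.card_fin] at hi
  rw [sq]
  refine hi.trans (le_of_eq ?_)
  refine Eq.trans ?_ h6.symm
  rw [← h5]
  refine pr_congr fun x => ?_
  have : hyb (i + 1) x = Function.update (hyb i x) i (x.2 i) := by
    funext j
    by_cases h : j = i
    · subst h; simp [hyb]
    · rw [Function.update_of_ne h]
      have h' : (j : ℕ) ≠ i := fun h' => h (Fin.ext h')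
      simp only [hyb]
      by_cases h'' : (j : ℕ) < i
      · simp [h'', Nat.lt_succ_of_lt h'']
      · simp [h'', show ¬ (j : ℕ) < i + 1 by omega]
  rw [this]
  simp [Function.Involutive.toPerm]

theorem Deg.expand (hH : Deg H (2 * l + o) d γ) (hγ : 0 < γ) (hl : 0 < l) (ho : 0 < o)
    (hd : l + 1 ≤ d) {c : ℝ} (hc : 0 < c) {Q : ℕ} (hQ : 2 * l + o ≤ Q)
    (hcQ : 8 * l / (c ^ 2 * γ) ≤ Q)
    (hV : 2 * l * (l + 1) ^ 2 / c ^ 2 ≤ Fintype.card V) {A : (Fin l → V) → Prop}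
    (h1 : c ≤ pr A) (h2 : c ≤ pr fun a => ¬ A a) : c ^ 2 * γ / (8 * l) ≤
      pr (fun x : (Fin l → V) × (Fin l → V) => A x.1 ∧ ¬ A x.2 ∧ Rich Q (Link H x.1 x.2)) := by
  have hVn : Nonempty V := (nonempty_of_pr_pos (hc.trans_le h1)).map fun a => a ⟨0, hl⟩
  have hV0 : (0 : ℝ) < Fintype.card V := by simp [Fintype.card_pos]
  have hl' : (0 : ℝ) < l := by exact_mod_cast hl
  obtain ⟨i, hi⟩ := exists_crossing hl hc h1 h2
  have h3 := pr_and_ge (fun a : Fin l ⊕ Unit → V => A (a ∘ Sum.inl) ∧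
        ¬ A (Function.update (a ∘ Sum.inl) i (a (Sum.inr ()))))
    (fun g => Function.Injective g ∧ Disjoint (Finset.univ.image g) ∅)
  have h4 := pr_collision (ι := Fin l ⊕ Unit) (∅ : Finset V)
  simp only [Fintype.card_sum, Fintype.card_fin, Fintype.card_unit, Finset.card_empty] at h4
  have h5 : ((l + 1 : ℕ) : ℝ) * ((l + 1 : ℕ) + (0 : ℕ)) / Fintype.card V ≤ c ^ 2 / (2 * l) := by
    rw [div_le_iff₀ (by positivity)] at hV
    rw [div_le_div_iff₀ hV0 (by positivity)]
    push_cast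
    nlinarith
  have h6 : c ^ 2 / l = c ^ 2 / (2 * l) + c ^ 2 / (2 * l) := by field_simp; ring
  let z0 : Fin o := ⟨0, ho⟩
  let e : Fin l ⊕ Unit → Pos l o := Sum.elim Sum.inl fun _ => Sum.inr (Sum.inl z0)
  have he : Function.Injective e := by
    rintro (a | a) (b | b) h <;> simp_all [e]
  have h7 := hH.extend hγ.le e he (by simpa using hd) (card_pos_type l o)
    (P := fun a : Fin l ⊕ Unit → V => (A (a ∘ Sum.inl) ∧
        ¬ A (Function.update (a ∘ Sum.inl) i (a (Sum.inr ())))) ∧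
        Function.Injective a ∧ Disjoint (Finset.univ.image a) ∅)
    (fun a ha => ha.2.1) (show c ^ 2 / (2 * l) ≤ _ by
      refine le_trans ?_ h3
      linarith)
  set R : (Pos l o → V) → Prop := fun g => ((A ((g ∘ e) ∘ Sum.inl) ∧
        ¬ A (Function.update ((g ∘ e) ∘ Sum.inl) i ((g ∘ e) (Sum.inr ())))) ∧
        Function.Injective (g ∘ e) ∧ Disjoint (Finset.univ.image (g ∘ e)) ∅) ∧ im g ∈ H with hR
  have h8 : c ^ 2 / (2 * l) * γ ≤ pr (fun g : Pos l o → V => (R g ∧ A (g ∘ Sum.inr ∘ Sum.inr))) +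
      pr (fun g : Pos l o → V => (R g ∧ ¬ A (g ∘ Sum.inr ∘ Sum.inr))) := by
    refine h7.trans (le_trans (pr_mono fun g hg => ?_) (pr_or_le _ _))
    by_cases h : A (g ∘ Sum.inr ∘ Sum.inr)
    · exact Or.inl ⟨hg, h⟩
    · exact Or.inr ⟨hg, h⟩
  have hinj : ∀ g : Pos l o → V, R g → Function.Injective g := fun g hg =>
    hH.injective (card_pos_type l o) hg.2
  have hb : 0 < c ^ 2 * γ / (4 * l) := by positivity
  have hbQ : 2 / (c ^ 2 * γ / (4 * l)) ≤ Q := by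
    refine le_trans (le_of_eq ?_) hcQ
    field_simp; ring
  have h9 : c ^ 2 / (2 * l) * γ = c ^ 2 * γ / (4 * l) + c ^ 2 * γ / (4 * l) := by
    field_simp; ring
  have h10 : c ^ 2 * γ / (8 * l) = c ^ 2 * γ / (4 * l) / 2 := by field_simp; ring
  rw [h10]
  rcases le_total (c ^ 2 * γ / (4 * l))
    (pr (fun g : Pos l o → V => (R g ∧ A (g ∘ Sum.inr ∘ Sum.inr)))) with h | h
  · refine pair_rich (Sum.elim (Sum.inr ∘ Sum.inr)
      fun j => if j = i then Sum.inr (Sum.inl z0) else Sum.inl j) ?_ ?_ hb h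
      ((card_pos_type l o).trans_le hQ) hbQ
    · rintro (a | a) (b | b) h <;> simp at h ⊢
      · exact h
      · split_ifs at h <;> simp at h
      · split_ifs at h <;> simp at h
      · split_ifs at h with h1 h2 h2
        · rw [h1, h2]
        · simpa using h
    · rintro g ⟨hg, hA⟩
      refine ⟨hg.2, hinj g hg, hA, ?_⟩
      convert hg.1.1.2 using 2
      funext j
      by_cases hj : j = i
      · subst hj; simp [e]
      · simp [hj, e]
  · refine pair_rich (Sum.elim Sum.inl (Sum.inr ∘ Sum.inr)) ?_ ?_ hb
      (show _ ≤ pr (fun g : Pos l o → V => (R g ∧ ¬ A (g ∘ Sum.inr ∘ Sum.inr))) by linarith)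
      ((card_pos_type l o).trans_le hQ) hbQ
    · rintro (a | a) (b | b) h <;> simp_all
    · rintro g ⟨hg, hA⟩
      exact ⟨hg.2, hinj g hg, hg.1.1.1, hA⟩

end connect

/-- Choosing a tuple and then two sets depending on it, all in general position. -/
theorem rich_through (ι : Type) [Fintype ι] [DecidableEq ι] (Q1 Q2 f : ℕ) {b : ℝ} (hb : 0 < b) :
    ∃ Q, ∀ (V : Type) [Fintype V] [DecidableEq V] (C D : (ι → V) → Finset V → Prop) (F : Finset V),
      Q ≤ Fintype.card V → F.card ≤ f →
      b ≤ pr (fun a => Rich Q1 (C a) ∧ Rich Q2 (D a)) →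
      ∀ Q' ≥ Q, Q' ≤ Fintype.card V →
      Rich Q' (fun Z => ∃ a X Y, im a ∪ X ∪ Y ⊆ Z ∧ C a X ∧ D a Y ∧ Disjoint (im a) X ∧
        Disjoint (im a) Y ∧ Disjoint X Y ∧ Disjoint (im a ∪ X ∪ Y) F) := by
  obtain ⟨q, hq⟩ := exists_nat_ge (1 / b)
  set q0 := q + Fintype.card ι with hq0
  set q1 := 8 * (q0 + Q1 + f + 1) ^ 3 with hq1
  set q2 := 8 * (q1 + Q2 + f + 1) ^ 3 with hq2
  have hle : ∀ a b : ℕ, a ≤ b + 1 → a ≤ 8 * (b + 1) ^ 3 := fun a b h => by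
    have h1 : b + 1 ≤ (b + 1) ^ 3 := Nat.le_self_pow (by norm_num) _
    omega
  refine ⟨q2, fun V _ _ C D F hV hF hpr Q' hQ' hQV => ?_⟩
  obtain ⟨a0, ha0, _⟩ := exists_of_pr_pos (hb.trans_le hpr)
  have hVne := ha0.nonempty
  have r1 : Rich q0 (fun Z => ∃ a, im a ⊆ Z ∧ Rich Q1 (C a) ∧ Rich Q2 (D a)) := by
    refine rich_of_tuple (ι := ι) ?_ hb (hpr.trans (pr_mono fun a ha =>
      ⟨a, Finset.Subset.refl _, ha⟩)) (by omega) (hq.trans (by simp [hq0]))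
    rintro Z Z' hZ ⟨a, ha, h⟩
    exact ⟨a, ha.trans hZ, h⟩
  have r2 := r1.bind (R := fun Z X => ∃ a, im a ⊆ Z ∧ C a X ∧ Rich Q2 (D a)) F
    (Q' := Q1) (fun Z hZ _ _ => by
      obtain ⟨a, ha, h, h'⟩ := hZ
      exact h.imp fun X hX => ⟨a, ha, hX, h'⟩) hF hq1.ge (by
        have : q1 ≤ q2 := hle _ _ (by omega)
        omega)
  have r3 := r2.bind (R := fun Z Y => ∃ a X, im a ∪ X ⊆ Z ∧ Disjoint (im a) X ∧ C a X ∧ D a Y)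
    F (Q' := Q2) (fun Z hZ _ _ => by
      obtain ⟨W, X, hWX, hd, _, _, _, _, _, a, ha, hX, hL⟩ := hZ
      exact hL.imp fun Y hY => ⟨a, X, (Finset.union_subset_union_left ha).trans hWX,
        hd.mono_left ha, hX, hY⟩) hF hq2.ge hV
  refine Rich.mono (r3.imp ?_) ?_ hQ'
  · rintro Z ⟨W, Y, hWY, hd, hWF, hYF, _, _, _, a, X, haX, hdX, hX, hY⟩
    refine ⟨a, X, Y, (Finset.union_subset_union_left haX).trans hWY, hX, hY, hdX,
      hd.mono_left (Finset.subset_union_left.trans haX),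
      hd.mono_left (Finset.subset_union_right.trans haX), ?_⟩
    rw [Finset.disjoint_union_left]
    exact ⟨hWF.mono_left haX, hYF⟩
  · rintro Z Z' hZ ⟨a, X, Y, h, h'⟩
    exact ⟨a, X, Y, h.trans hZ, h'⟩

/-- Any two disjoint `ℓ`-tuples are joined by many short paths. -/
theorem exists_rich_link {l o d : ℕ} (hl : 0 < l) (ho : 0 < o) (hd : l + 1 ≤ d) {γ : ℝ}
    (hγ : 0 < γ) : ∃ Q, ∀ (V : Type) [Fintype V] [DecidableEq V] (H : Finset (Finset V)),
      Deg H (2 * l + o) d γ → Q ≤ Fintype.card V → ∀ S S' : Fin l → V, Function.Injective S →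
      Function.Injective S' → Disjoint (im S) (im S') → Rich Q (Link H S S') := by
  have hl' : (0 : ℝ) < l := by exact_mod_cast hl
  set c := γ / 8 with hcdef
  have hc : 0 < c := by positivity
  have hc0 : 0 < c ^ 2 * γ / (8 * l) := by positivity
  obtain ⟨q1, hq1⟩ := exists_nat_ge (8 * l / (c ^ 2 * γ))
  obtain ⟨q2, hq2⟩ := exists_nat_ge (2 * l * (l + 1) ^ 2 / c ^ 2)
  obtain ⟨q3, hq3⟩ := exists_nat_ge (2 / γ)
  set Q0 := 2 * l + o + q1 + q3 with hQ0
  obtain ⟨Q1, hQ1⟩ := growth (Fin l) Q0 l (c := c) hc0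
  obtain ⟨Q2, hQ2⟩ := rich_through (Fin l) Q1 Q0 (l + l) (b := γ / 4) (by positivity)
  refine ⟨Q2 + Q1 + q2, fun V _ _ H hH hV S S' hS hS' hSS => ?_⟩
  have hVn : Nonempty V := ⟨S ⟨0, hl⟩⟩
  have hq2V : 2 * l * (l + 1) ^ 2 / c ^ 2 ≤ (Fintype.card V : ℝ) :=
    hq2.trans (by exact_mod_cast (by omega : q2 ≤ Fintype.card V))
  have hcS : (im S).card = l := by rw [card_im S hS, Fintype.card_fin]
  have hcS' : (im S').card = l := by rw [card_im S' hS', Fintype.card_fin]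
  have hcard : Fintype.card (Fin o ⊕ Fin l) = 2 * l + o - l := by
    simp [Fintype.card_sum]; omega
  have hbQ0 : 2 / γ ≤ (Q0 : ℝ) := hq3.trans (by exact_mod_cast (by omega : q3 ≤ Q0))
  have hnear : ∀ T : Fin l → V, Function.Injective T → ∀ e : Fin l → Fin o ⊕ Fin l,
      Function.Injective e → γ / 2 ≤ pr (fun a : Fin l → V => Rich Q0 fun X =>
        ∃ g : Fin o ⊕ Fin l → V, im T ∪ im g ∈ H ∧ g ∘ e = a ∧ im g ⊆ im a ∪ X) := by
    intro T hT e he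
    have hcT : (im T).card = l := by rw [card_im T hT, Fintype.card_fin]
    refine rich_fiber e he (fun g => im T ∪ im g ∈ H) hγ ?_ (hcard.trans_le (by omega)) hbQ0
    refine (hH.ext (im T) (by omega)).trans (le_of_eq ?_)
    have e2 := (Fintype.equivFinOfCardEq (show Fintype.card (Fin o ⊕ Fin l) = 2 * l + o - (im T).card by
      rw [hcard, hcT])).symm
    rw [← pr_reindex e2]
    exact pr_congr fun g => by rw [im_comp_equiv]
  have hgen : ∀ (T : Fin l → V) (g : Fin o ⊕ Fin l → V), Function.Injective T →
      im T ∪ im g ∈ H → Function.Injective g ∧ Disjoint (im T) (im g) := by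
    intro T g hT hg
    have h1 := hH.unif _ hg
    have h2 := Finset.card_union_add_card_inter (im T) (im g)
    have h3 := card_im_le g
    have h4 := card_im T hT
    simp only [Fintype.card_sum, Fintype.card_fin] at h3 h4
    refine ⟨injective_of_card_im (by simp only [Fintype.card_sum, Fintype.card_fin]; omega), ?_⟩
    rw [Finset.disjoint_iff_inter_eq_empty, ← Finset.card_eq_zero]
    omega
  have hstart : ∀ (T : Fin l → V) (g : Fin o ⊕ Fin l → V), Function.Injective T →
      im T ∪ im g ∈ H → Conn H T (g ∘ Sum.inr) (im (g ∘ Sum.inl)) ∧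
        Conn H (g ∘ Sum.inr) T (im (g ∘ Sum.inl)) := by
    intro T g hT hg
    obtain ⟨h1, h2⟩ := hgen T g hT hg
    rw [im_sum, Finset.disjoint_union_right] at h2
    have h3 : Disjoint (im (g ∘ Sum.inl)) (im (g ∘ Sum.inr)) := disjoint_im_comp h1 (by simp)
    have h4 := h1.comp Sum.inr_injective
    rw [im_sum, ← Finset.union_assoc] at hg
    refine ⟨Conn.of_edge hT h4 h2.2 (Finset.disjoint_union_right.2 ⟨h2.1.symm, h3⟩) hg,
      Conn.of_edge h4 hT h2.2.symm (Finset.disjoint_union_right.2 ⟨h3, h2.1.symm⟩) ?_⟩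
    convert hg using 1
    ext x; simp only [Finset.mem_union]; tauto
  have himg : ∀ (g : Fin o ⊕ Fin l → V) (X : Finset V), Function.Injective g →
      im g ⊆ im (g ∘ Sum.inr) ∪ X → im (g ∘ Sum.inl) ⊆ X := by
    intro g X hg hX x hx
    have h3 : Disjoint (im (g ∘ Sum.inl)) (im (g ∘ Sum.inr)) := disjoint_im_comp hg (by simp)
    rcases Finset.mem_union.1 (hX (im_comp_subset g _ hx)) with h | h
    · exact absurd h (Finset.disjoint_left.1 h3 hx)
    · exact h
  have h1 : c ≤ pr (fun a : Fin l → V => Rich Q0 (Link H S a)) := by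
    refine le_trans ?_ ((hnear S hS Sum.inr Sum.inr_injective).trans (pr_mono fun a ha => ha.imp ?_))
    · rw [hcdef]; linarith
    · rintro X ⟨g, hg, rfl, hX⟩
      exact ⟨_, himg g X (hgen S g hS hg).1 hX, (hstart S g hS hg).1⟩
  have h2 : γ / 2 ≤ pr (fun a : Fin l → V => Rich Q0 (Link H a S')) := by
    refine (hnear S' hS' Sum.inr Sum.inr_injective).trans (pr_mono fun a ha => ha.imp ?_)
    rintro X ⟨g, hg, rfl, hX⟩
    exact ⟨_, himg g X (hgen S' g hS' hg).1 hX, (hstart S' g hS' hg).2⟩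
  have h3 := hQ1 V (Link H S) (Link H) (im S) (by omega) hcS.le (fun a => upSet_link H S a)
    (by
      rintro a b X Y ⟨I, hI, hSa⟩ ⟨J, hJ, hab⟩ haX haY hXY hF hbF
      rw [Finset.disjoint_union_right] at hF
      refine ⟨I ∪ im a ∪ J, ?_, hSa.trans hab ?_⟩
      · intro x; have := @hI x; have := @hJ x; simp only [Finset.mem_union]; tauto
      · rw [Finset.disjoint_union_left, Finset.disjoint_union_right, Finset.disjoint_union_right]
        exact ⟨⟨(hF.1.mono_left (hJ.trans Finset.subset_union_right)).symm, hbF.symm⟩,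
          hXY.mono hI hJ, hF.2.mono_left (hI.trans (Finset.subset_union_right.trans
            Finset.subset_union_left))⟩)
    h1 (fun A hA hA' => hH.expand hγ hl ho hd hc (by omega)
      (hq1.trans (by exact_mod_cast (by omega : q1 ≤ Q0))) hq2V hA hA')
  have h4 := pr_and_ge (fun a : Fin l → V => Rich Q0 (Link H a S')) (fun a => Rich Q1 (Link H S a))
  have h5 := hQ2 V (fun a => Link H S a) (fun a => Link H a S') (im S ∪ im S') (by omega)
    ((Finset.card_union_le _ _).trans (by omega))
    (le_trans (by rw [hcdef] at h3; linarith) (h4.trans (pr_mono fun a ha => ⟨ha.2, ha.1⟩)))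
    (Q2 + Q1 + q2) (by omega) hV
  refine h5.imp ?_
  rintro Z ⟨a, X, Y, hZ, ⟨I, hI, hSa⟩, ⟨J, hJ, hab⟩, haX, haY, hXY, hF⟩
  rw [Finset.disjoint_union_right] at hF
  refine ⟨I ∪ im a ∪ J, ?_, hSa.trans hab ?_⟩
  · refine Finset.Subset.trans ?_ hZ
    intro x; have := @hI x; have := @hJ x; simp only [Finset.mem_union]; tauto
  · rw [Finset.disjoint_union_left, Finset.disjoint_union_right, Finset.disjoint_union_right]
    exact ⟨⟨(hF.1.mono_left (hJ.trans Finset.subset_union_right)).symm, hSS⟩,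
      hXY.mono hI hJ, hF.2.mono_left (hI.trans (Finset.subset_union_right.trans
            Finset.subset_union_left))⟩

section swap
variable {V : Type} [Fintype V] [DecidableEq V] {l o d : ℕ} {H : Finset (Finset V)} {γ : ℝ}

/-- Two edges sharing an `ℓ`-tuple form a path. -/
theorem lPath_of_two {κ κ' : Type} [Fintype κ] [DecidableEq κ] [Fintype κ'] [DecidableEq κ']
    {g : κ → V} {g' : κ' → V} (hg : im g ∈ H) (hinj : Function.Injective g) (hg' : im g' ∈ H)
    (hinj' : Function.Injective g') (e : Fin l ⊕ Fin l → κ) (he : Function.Injective e)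
    (e' : Fin l ⊕ Fin l → κ') (he' : Function.Injective e')
    (hM : (g ∘ e) ∘ Sum.inr = (g' ∘ e') ∘ Sum.inl)
    (hI : ∀ i j, g i = g' j → ∃ t, g i = g (e (Sum.inr t))) :
    LPath H ((g ∘ e) ∘ Sum.inl) ((g' ∘ e') ∘ Sum.inr) (im g ∪ im g') := by
  have h1 := conn_of_pair hg hinj e he
  have h2 := conn_of_pair hg' hinj' e' he'
  rw [hM] at h1
  have hsub : ∀ x, x ∈ im g → x ∈ im g' → x ∈ im ((g ∘ e) ∘ Sum.inr) := by
    intro x hx hx'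
    obtain ⟨i, rfl⟩ := mem_im.1 hx
    obtain ⟨j, hj⟩ := mem_im.1 hx'
    obtain ⟨t, ht⟩ := hI i j hj.symm
    exact mem_im.2 ⟨t, ht.symm⟩
  have hS : im ((g ∘ e) ∘ Sum.inl) ⊆ im g := (im_comp_subset _ _).trans (im_comp_subset _ _)
  have hS' : im ((g' ∘ e') ∘ Sum.inr) ⊆ im g' := (im_comp_subset _ _).trans (im_comp_subset _ _)
  have hM1 : im ((g ∘ e) ∘ Sum.inr) ⊆ im g := (im_comp_subset _ _).trans (im_comp_subset _ _)
  have hM2 : im ((g' ∘ e') ∘ Sum.inl) ⊆ im g' := (im_comp_subset _ _).trans (im_comp_subset _ _)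
  have hSM : Disjoint (im ((g ∘ e) ∘ Sum.inl)) (im ((g ∘ e) ∘ Sum.inr)) :=
    disjoint_im_comp (hinj.comp he) (by simp)
  have hSM' : Disjoint (im ((g' ∘ e') ∘ Sum.inl)) (im ((g' ∘ e') ∘ Sum.inr)) :=
    disjoint_im_comp (hinj'.comp he') (by simp)
  have h3 := h1.trans h2 (by
    rw [Finset.disjoint_left]
    intro x hx hx'
    have a1 : x ∈ im g ∧ x ∉ im ((g ∘ e) ∘ Sum.inr) := by
      rcases Finset.mem_union.1 hx with h | h
      · exact ⟨hS h, Finset.disjoint_left.1 hSM h⟩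
      · rw [Finset.mem_sdiff] at h
        exact ⟨h.1, fun h' => h.2 (im_comp_subset _ _ h')⟩
    have a2 : x ∈ im g' := by
      rcases Finset.mem_union.1 hx' with h | h
      · exact (Finset.mem_sdiff.1 h).1
      · exact hS' h
    exact a1.2 (hsub x a1.1 a2))
  have h4 := h3.2.2
  convert h4 using 1
  ext x
  have b1 := @hS x
  have b2 := @hS' x
  have b3 := @hM1 x
  have b4 := @hM2 x
  rw [hM] at b3
  have b5 : x ∈ im (g ∘ e) ↔ x ∈ im ((g ∘ e) ∘ Sum.inl) ∨ x ∈ im ((g' ∘ e') ∘ Sum.inl) := by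
    rw [← hM, ← Finset.mem_union, ← im_sum]
  have b6 : x ∈ im (g' ∘ e') ↔ x ∈ im ((g' ∘ e') ∘ Sum.inl) ∨ x ∈ im ((g' ∘ e') ∘ Sum.inr) := by
    rw [← Finset.mem_union, ← im_sum]
  simp only [Finset.mem_union, Finset.mem_sdiff, b5, b6]
  generalize (x ∈ im g) = c1 at *
  generalize (x ∈ im g') = c2 at *
  generalize (x ∈ im ((g ∘ e) ∘ Sum.inl)) = c3 at *
  generalize (x ∈ im ((g' ∘ e') ∘ Sum.inl)) = c4 at *
  generalize (x ∈ im ((g' ∘ e') ∘ Sum.inr)) = c5 at *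
  clear h1 h2 h3 h4 hsub hS hS' hM1 hM2 hSM hSM' b5 b6 hM hI
  grind

theorem Cov.map {W : Type} [DecidableEq W] {H' : Finset (Finset W)} (φ : V → W)
    (hφ : Function.Injective φ) (hH : ∀ e ∈ H, e.image φ ∈ H')
    {E : List ((Fin l → V) × (Fin l → V))} : ∀ {A}, Cov H A E →
      Cov H' (A.image φ) (E.map fun p => (φ ∘ p.1, φ ∘ p.2)) := by
  induction E with
  | nil => intro A h; have : A = ∅ := h; subst this; exact Finset.image_empty _
  | cons p E ih =>
    rintro A ⟨B, C, h1, h2, h3, rfl⟩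
    exact ⟨_, _, h1.map φ hφ hH, ih h2, (Finset.disjoint_image hφ).2 h3, Finset.image_union _ _⟩

theorem Sim.map {W : Type} [DecidableEq W] {H' : Finset (Finset W)} (φ : V → W)
    (hφ : Function.Injective φ) (hH : ∀ e ∈ H, e.image φ ∈ H') {A B : Finset V}
    (h : Sim l H A B) : Sim l H' (A.image φ) (B.image φ) := by
  obtain ⟨E, h1, h2⟩ := h
  exact ⟨_, h1.map φ hφ hH, h2.map φ hφ hH⟩

/-- `x` and `y` can be swapped using the vertices of `X`. -/
def Swap (l : ℕ) (H : Finset (Finset V)) (x y : V) (X : Finset V) : Prop :=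
  x ≠ y ∧ ∃ T ⊆ X, x ∉ T ∧ y ∉ T ∧ Sim l H (insert x T) (insert y T)

theorem upSet_swap (H : Finset (Finset V)) (x y : V) : UpSet (Swap l H x y) := by
  rintro X Y hXY ⟨h, T, hT, h'⟩
  exact ⟨h, T, hT.trans hXY, h'⟩

theorem Swap.trans {x y z : V} {X Y : Finset V} (h : Swap l H x y X) (h' : Swap l H y z Y)
    (hXY : Disjoint X Y) (hxz : x ≠ z) (hxY : x ∉ Y) (hzX : z ∉ X) :
    Swap l H x z ({y} ∪ X ∪ Y) := by
  obtain ⟨hxy, T, hT, hxT, hyT, hs⟩ := h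
  obtain ⟨hyz, T', hT', hyT', hzT', hs'⟩ := h'
  have hTT : Disjoint T T' := hXY.mono hT hT'
  have a1 : x ∉ T' := fun h => hxY (hT' h)
  have a2 : z ∉ T := fun h => hzX (hT h)
  refine ⟨hxz, insert y (T ∪ T'), ?_, ?_, ?_, ?_⟩
  · intro v; have := @hT v; have := @hT' v
    simp only [Finset.mem_insert, Finset.mem_union, Finset.mem_singleton]; tauto
  · simp [hxy, hxT, a1]
  · simp [hzT', a2, Ne.symm hyz]
  · have := hs.union hs' (by simp [Finset.disjoint_insert_left, Finset.disjoint_insert_right,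
      hxy.symm, hyT, hTT, a1]) (by simp [Finset.disjoint_insert_left,
      Finset.disjoint_insert_right, a2, hyT', hTT, hyz.symm])
    convert this using 1
    · ext v; simp only [Finset.mem_insert, Finset.mem_union]; tauto
    · ext v; simp only [Finset.mem_insert, Finset.mem_union]; tauto

theorem lPath_insert (hH : ∀ e ∈ H, e.card = 2 * l + (o + 1)) {f : Pos l o → V} {z : V}
    (hz : insert z (im f) ∈ H) : LPath H (f ∘ Sum.inl) (f ∘ (Sum.inr ∘ Sum.inr))
      (insert z (im f)) ∧ z ∉ im f ∧ Function.Injective f := by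
  have h1 := hH _ hz
  have h2 := card_im_le f
  rw [card_pos_type] at h2
  have h3 := Finset.card_insert_le z (im f)
  have hzf : z ∉ im f := fun h => by
    rw [Finset.insert_eq_of_mem h] at h1
    omega
  have hf : Function.Injective f := injective_of_card_im (by rw [card_pos_type]; omega)
  have h4 : im f = im (f ∘ Sum.inl) ∪ (im (f ∘ (Sum.inr ∘ Sum.inl)) ∪
      im (f ∘ (Sum.inr ∘ Sum.inr))) := by
    rw [im_sum f, im_sum (f ∘ Sum.inr)]; rfl
  have h5 : im (f ∘ Sum.inl) ∪ insert z (im (f ∘ (Sum.inr ∘ Sum.inl))) ∪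
      im (f ∘ (Sum.inr ∘ Sum.inr)) = insert z (im f) := by
    rw [h4]; ext v; simp only [Finset.mem_insert, Finset.mem_union]; tauto
  have h6 := (Conn.of_edge (H := H) (S := f ∘ Sum.inl) (S' := f ∘ (Sum.inr ∘ Sum.inr))
    (I := insert z (im (f ∘ (Sum.inr ∘ Sum.inl)))) (hf.comp Sum.inl_injective)
    (hf.comp (Sum.inr_injective.comp Sum.inr_injective)) (disjoint_im_comp hf (by simp)) (by
      have hzf' := hzf
      rw [h4] at hzf'
      simp only [Finset.mem_union, not_or] at hzf'
      rw [Finset.disjoint_insert_left, Finset.disjoint_union_right]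
      refine ⟨by simp only [Finset.mem_union, not_or]; exact ⟨hzf'.1, hzf'.2.2⟩,
        disjoint_im_comp hf (by simp), disjoint_im_comp hf (by simp)⟩) (by rwa [h5])).2.2
  rw [h5] at h6
  exact ⟨h6, hzf, hf⟩

theorem sim_of_common (hH : ∀ e ∈ H, e.card = 2 * l + (o + 1)) {f : Pos l o → V} {x y : V}
    (hx : insert x (im f) ∈ H) (hy : insert y (im f) ∈ H) :
    x ∉ im f ∧ y ∉ im f ∧ Sim l H (insert x (im f)) (insert y (im f)) :=
  ⟨(lPath_insert hH hx).2.1, (lPath_insert hH hy).2.1,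
    (lPath_insert hH hx).1.sim (lPath_insert hH hy).1⟩

/-- In a complete multipartite `k`-graph with two vertices in each part, a vertex of a middle part
can be swapped with a vertex of an end part. -/
theorem swap_blowup [NeZero l] [NeZero o] {H : Finset (Finset (Pos l o × Fin 2))}
    (hH : ∀ c : Pos l o → Fin 2, im (fun i => (i, c i)) ∈ H) :
    Swap l H (Sum.inr (Sum.inr 0), 1) (Sum.inr (Sum.inl 0), 1) Finset.univ := by
  set T : Finset (Pos l o × Fin 2) := Finset.univ.filter fun p =>
    Sum.elim (fun _ => true) (Sum.elim (fun t => decide (t ≠ 0 ∨ p.2 = 0))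
      fun _ => decide (p.2 = 0)) p.1 with hT
  let P : Fin l → Pos l o := fun j => if j = 0 then Sum.inr (Sum.inl 0) else Sum.inr (Sum.inr j)
  have hP : Function.Injective P := by
    intro a b h
    simp only [P] at h
    split_ifs at h with h1 h2 h2
    · rw [h1, h2]
    · simp at h
    · simp at h
    · simpa using h
  have hPl : ∀ a b, P a ≠ Sum.inl b := by
    intro a b h
    simp only [P] at h
    split_ifs at h
  have hcinj : ∀ c : Pos l o → Fin 2, Function.Injective (fun i => (i, c i)) :=
    fun c a b h => (Prod.mk.inj h).1
  let c1 : Pos l o → Fin 2 := fun _ => 0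
  let c2 : Pos l o → Fin 2 := Sum.elim (fun _ => 1) (Sum.elim (fun _ => 1) fun _ => 0)
  let c3 : Pos l o → Fin 2 := Sum.elim (fun _ => 0) (Sum.elim (fun _ => 0) fun j =>
    if j = 0 then 1 else 0)
  let c4 : Pos l o → Fin 2 := Sum.elim (fun _ => 1) (Sum.elim (fun t => if t = 0 then 0 else 1)
    fun _ => 0)
  have p1 := lPath_of_two (hH c1) (hcinj c1) (hH c2) (hcinj c2)
    (Sum.elim Sum.inl (Sum.inr ∘ Sum.inr)) (by rintro (a | a) (b | b) h <;> simp_all)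
    (Sum.elim (Sum.inr ∘ Sum.inr) Sum.inl) (by rintro (a | a) (b | b) h <;> simp_all)
    (by funext j; simp [c1, c2]) (by
      rintro (i | i | i) j h
      · simp [c1, c2] at h; obtain ⟨rfl, h⟩ := h; simp at h
      · simp [c1, c2] at h; obtain ⟨rfl, h⟩ := h; simp at h
      · exact ⟨i, rfl⟩)
  have p2 := lPath_of_two (hH c3) (hcinj c3) (hH c4) (hcinj c4)
    (Sum.elim Sum.inl P) (by
      rintro (a | a) (b | b) h
      · simpa using h
      · exact absurd h.symm (hPl _ _)
      · exact absurd h (hPl _ _)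
      · rw [hP h])
    (Sum.elim P Sum.inl) (by
      rintro (a | a) (b | b) h
      · rw [hP h]
      · exact absurd h (hPl _ _)
      · exact absurd h.symm (hPl _ _)
      · simpa using h)
    (by
      funext j
      by_cases hj : j = 0
      · simp [c3, c4, P, hj]
      · simp [c3, c4, P, hj]) (by
      rintro (i | i | i) j h
      · simp [c3, c4] at h; obtain ⟨rfl, h⟩ := h; simp at h
      · simp [c3, c4] at h; obtain ⟨rfl, h⟩ := h
        by_cases hi : i = 0
        · exact ⟨0, by simp [P, hi, c3]⟩
        · simp [hi] at h
      · simp [c3, c4] at h; obtain ⟨rfl, h⟩ := h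
        by_cases hi : i = 0
        · simp [hi] at h
        · exact ⟨i, by simp [P, hi, c3]⟩)
  refine ⟨by simp, T, Finset.subset_univ _, by simp [hT], by simp [hT], ?_⟩
  have e1 : im (fun i => (i, c1 i)) ∪ im (fun i => (i, c2 i)) =
      insert (Sum.inr (Sum.inl 0), 1) T := by
    ext ⟨i, s⟩
    simp only [Finset.mem_union, mem_im, Prod.mk.injEq, exists_eq_left, Finset.mem_insert, hT,
      Finset.mem_filter, Finset.mem_univ, true_and]
    rcases i with i | i | i <;> fin_cases s <;> simp [c1, c2]
    tauto
  have e2 : im (fun i => (i, c3 i)) ∪ im (fun i => (i, c4 i)) =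
      insert (Sum.inr (Sum.inr 0), 1) T := by
    ext ⟨i, s⟩
    simp only [Finset.mem_union, mem_im, Prod.mk.injEq, exists_eq_left, Finset.mem_insert, hT,
      Finset.mem_filter, Finset.mem_univ, true_and]
    rcases i with i | i | i <;> fin_cases s <;> simp [c3, c4] 
  rw [e1] at p1
  rw [e2] at p2
  refine LPath.sim ?_ p1
  convert p2 using 1
  · funext j; simp [c1, c3]
  · funext j; simp [c2, c4]

end swap

section reach
variable {V : Type} [Fintype V] [DecidableEq V] {l o d : ℕ} {H : Finset (Finset V)} {γ : ℝ}

theorem pr_unit (P : V → Prop) : pr (fun a : Unit → V => P (a ())) = pr P :=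
  pr_equiv (Equiv.funUnique Unit V) P

theorem im_unit (a : Unit → V) : im a = {a ()} := by
  ext x
  rw [mem_im, Finset.mem_singleton]
  exact ⟨fun ⟨_, h⟩ => h.symm, fun h => ⟨(), h.symm⟩⟩

/-- Most vertices have many edges whose link sets are popular. -/
theorem Deg.popular (hH : Deg H (2 * l + (o + 1)) d γ) (hγ : 0 < γ) (hd : 1 ≤ d) {c : ℝ}
    (hc : 0 ≤ c) :
    pr (fun x : V => ¬ (γ / 2 ≤ pr (fun f : Pos l o → V => insert x (im f) ∈ H ∧
      c ≤ pr (fun y : V => insert y (im f) ∈ H)))) ≤ 2 * c / γ := by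
  have h1 : ∀ x : V, γ ≤ pr (fun f : Pos l o → V => insert x (im f) ∈ H) := by
    intro x
    refine (hH.ext {x} (by simpa using hd)).trans (le_of_eq ?_)
    have hcard : Fintype.card (Pos l o) = 2 * l + (o + 1) - ({x} : Finset V).card := by
      rw [card_pos_type]; simp
    have e := (Fintype.equivFinOfCardEq hcard).symm
    rw [← pr_reindex e]
    exact pr_congr fun g => by rw [im_comp_equiv, Finset.insert_eq]
  have h2 : pr (fun z : V × (Pos l o → V) => insert z.1 (im z.2) ∈ H ∧
      ¬ c ≤ pr (fun y : V => insert y (im z.2) ∈ H)) ≤ c := by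
    rw [pr_swap (fun (x : V) (f : Pos l o → V) => insert x (im f) ∈ H ∧
      ¬ c ≤ pr (fun y : V => insert y (im f) ∈ H))]
    refine pr_prod_le_of_forall (P := fun (f : Pos l o → V) (x : V) => insert x (im f) ∈ H ∧
      ¬ c ≤ pr (fun y : V => insert y (im f) ∈ H)) hc fun f => ?_
    by_cases h : c ≤ pr (fun y : V => insert y (im f) ∈ H)
    · rw [pr_of_forall_not fun x => by simp [h]]; exact hc
    · exact (pr_mono fun x hx => hx.1).trans (not_le.1 h).le
  have h3 := pr_markov (P := fun (x : V) (f : Pos l o → V) => insert x (im f) ∈ H ∧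
      ¬ c ≤ pr (fun y : V => insert y (im f) ∈ H)) (half_pos hγ) h2
  refine (pr_mono fun x hx => ?_).trans (h3.trans (le_of_eq (by field_simp)))
  have h4 := (h1 x).trans ((pr_mono fun f hf => ?_).trans (pr_or_le
    (fun f : Pos l o → V => insert x (im f) ∈ H ∧ c ≤ pr (fun y : V => insert y (im f) ∈ H))
    (fun f : Pos l o → V => insert x (im f) ∈ H ∧
      ¬ c ≤ pr (fun y : V => insert y (im f) ∈ H))))
  · rw [not_le] at hx
    linarith
  · by_cases h : c ≤ pr (fun y : V => insert y (im f) ∈ H)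
    · exact Or.inl ⟨hf, h⟩
    · exact Or.inr ⟨hf, h⟩

theorem swap_start (hH : ∀ e ∈ H, e.card = 2 * l + (o + 1)) (hγ : 0 < γ) {c : ℝ} (hc : 0 < c)
    {Q : ℕ} (hQ : 2 * l + (o + 1) ≤ Q) (hcQ : 8 / (c * γ) ≤ Q)
    (hV : 4 * (2 * l + (o + 1)) * (2 * l + (o + 1) + 1) / (c * γ) ≤ Fintype.card V) {x : V}
    (hx : γ / 2 ≤ pr (fun f : Pos l o → V => insert x (im f) ∈ H ∧
      c ≤ pr (fun y : V => insert y (im f) ∈ H))) :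
    c * γ / 8 ≤ pr (fun a : Unit → V => Rich Q (Swap l H x (a ()))) := by
  have : Nonempty V := ⟨x⟩
  have hV0 : (0 : ℝ) < Fintype.card V := by simp [Fintype.card_pos]
  have hcγ : 0 < c * γ := mul_pos hc hγ
  have h1 := pr_bind (Q := fun (f : Pos l o → V) (y : Unit → V) => insert (y ()) (im f) ∈ H)
    hx hc.le fun f hf => hf.2.trans (le_of_eq (pr_unit (fun y => insert y (im f) ∈ H)).symm)
  rw [pr_swap (fun (f : Pos l o → V) (y : Unit → V) => (insert x (im f) ∈ H ∧
      c ≤ pr (fun y : V => insert y (im f) ∈ H)) ∧ insert (y ()) (im f) ∈ H),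
    ← pr_sum_arrow (fun (y : Unit → V) (f : Pos l o → V) => (insert x (im f) ∈ H ∧
      c ≤ pr (fun y : V => insert y (im f) ∈ H)) ∧ insert (y ()) (im f) ∈ H)] at h1
  have h2 := pr_and_ge (fun g : Unit ⊕ Pos l o → V => (insert x (im (g ∘ Sum.inr)) ∈ H ∧
      c ≤ pr (fun y : V => insert y (im (g ∘ Sum.inr)) ∈ H)) ∧
      insert ((g ∘ Sum.inl) ()) (im (g ∘ Sum.inr)) ∈ H)
      (fun g => Function.Injective g ∧ Disjoint (Finset.univ.image g) {x})
  have h3 := pr_collision (ι := Unit ⊕ Pos l o) ({x} : Finset V)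
  have hcard : Fintype.card (Unit ⊕ Pos l o) = 2 * l + (o + 1) := by
    rw [Fintype.card_sum, card_pos_type, Fintype.card_unit]; ring
  rw [hcard] at h3
  have h4 : ((2 * l + (o + 1) : ℕ) : ℝ) * (((2 * l + (o + 1) : ℕ) : ℝ) +
      (({x} : Finset V).card : ℝ)) / Fintype.card V ≤ c * γ / 4 := by
    rw [div_le_iff₀ hcγ] at hV
    rw [div_le_div_iff₀ hV0 (by norm_num)]
    simp only [Finset.card_singleton]
    push_cast
    nlinarith
  have h5 := rich_fiber (V := V) (Sum.inl : Unit → Unit ⊕ Pos l o) Sum.inl_injective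
    (fun g => ((insert x (im (g ∘ Sum.inr)) ∈ H ∧
      c ≤ pr (fun y : V => insert y (im (g ∘ Sum.inr)) ∈ H)) ∧
      insert ((g ∘ Sum.inl) ()) (im (g ∘ Sum.inr)) ∈ H) ∧
      (Function.Injective g ∧ Disjoint (Finset.univ.image g) {x}))
    (b := c * γ / 4) (by positivity) (by linarith) (hcard.trans_le hQ) (by
      refine le_trans (le_of_eq ?_) hcQ
      field_simp; norm_num)
  rw [show c * γ / 8 = c * γ / 4 / 2 by ring]
  refine h5.trans (pr_mono fun a ha => ha.imp ?_)
  rintro X ⟨g, ⟨⟨⟨h6, -⟩, h7⟩, -, h8⟩, rfl, h9⟩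
  obtain ⟨h10, h11, h12⟩ := sim_of_common hH h6 h7
  refine ⟨?_, im (g ∘ Sum.inr), ?_, h10, h11, h12⟩
  · rintro rfl
    exact Finset.disjoint_singleton_right.1 h8 (mem_im_self g (Sum.inl ()))
  · intro v hv
    rcases Finset.mem_union.1 (h9 (im_comp_subset _ _ hv)) with h | h
    · obtain ⟨u, rfl⟩ := mem_im.1 h
      exact absurd hv h11
    · exact h

theorem swap_expand [NeZero l] [NeZero o] (hH : Deg H (2 * l + o) d γ) (hγ : 0 < γ) (hd : 2 ≤ d)
    {c : ℝ} (hc : 0 < c) {Q : ℕ} (hQ : (2 * l + o) * 2 ≤ Q)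
    (hcQ : 4 / (c ^ 2 * γ) ^ 2 ^ (2 * l + o) ≤ Q)
    (hV : 2 * ((2 * l + o) * 2) ^ 2 / (c ^ 2 * γ) ^ 2 ^ (2 * l + o) ≤ Fintype.card V)
    {A : (Unit → V) → Prop} (h1 : c ≤ pr A) (h2 : c ≤ pr fun a => ¬ A a) :
    (c ^ 2 * γ) ^ 2 ^ (2 * l + o) / 4 ≤ pr (fun x : (Unit → V) × (Unit → V) =>
      A x.1 ∧ ¬ A x.2 ∧ Rich Q (Swap l H (x.1 ()) (x.2 ()))) := by
  have : Nonempty V := (nonempty_of_pr_pos (hc.trans_le h1)).map fun a => a ()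
  have hV0 : (0 : ℝ) < Fintype.card V := by simp [Fintype.card_pos]
  have hcγ : 0 < c ^ 2 * γ := by positivity
  set b := (c ^ 2 * γ) ^ 2 ^ (2 * l + o) with hb
  have hb0 : 0 < b := by positivity
  have h3 := pr_bind (P := A) (Q := fun (_ b : Unit → V) => ¬ A b) h1 hc.le fun a _ => h2
  rw [← pr_sum_arrow (fun a b : Unit → V => A a ∧ ¬ A b), ← sq] at h3
  let i1 : Pos l o := Sum.inr (Sum.inr 0)
  let i2 : Pos l o := Sum.inr (Sum.inl 0)
  let e : Unit ⊕ Unit → Pos l o := Sum.elim (fun _ => i1) fun _ => i2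
  have he : Function.Injective e := by rintro (a | a) (b | b) h <;> simp_all [e, i1, i2]
  have h4 := hH.extend hγ.le e he (by simpa using hd) (card_pos_type l o)
    (P := fun a : Unit ⊕ Unit → V => A (a ∘ Sum.inl) ∧ ¬ A (a ∘ Sum.inr)) (by
      rintro a ⟨h, h'⟩ x y hxy
      have key : a (Sum.inl ()) ≠ a (Sum.inr ()) := by
        intro h0
        refine h' ?_
        convert h using 1
        funext u
        exact h0.symm
      rcases x with x | x <;> rcases y with y | y
      · rfl
      · exact absurd hxy key
      · exact absurd hxy.symm key
      · rfl) h3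
  have h5 := pr_blowup 2 _ hcγ h4
  rw [card_pos_type, ← hb] at h5
  have h6 := pr_and_ge (fun y : Pos l o × Fin 2 → V => ∀ c : Pos l o → Fin 2,
      (A (((fun i => y (i, c i)) ∘ e) ∘ Sum.inl) ∧ ¬ A (((fun i => y (i, c i)) ∘ e) ∘ Sum.inr)) ∧
      im (fun i => y (i, c i)) ∈ H)
      (fun g => Function.Injective g ∧ Disjoint (Finset.univ.image g) ∅)
  have h7 := pr_collision (ι := Pos l o × Fin 2) (∅ : Finset V)
  have hcard : Fintype.card (Pos l o × Fin 2) = (2 * l + o) * 2 := by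
    rw [Fintype.card_prod, card_pos_type, Fintype.card_fin]
  rw [hcard] at h7
  have h8 : (((2 * l + o) * 2 : ℕ) : ℝ) * ((((2 * l + o) * 2 : ℕ) : ℝ) +
      ((∅ : Finset V).card : ℝ)) / Fintype.card V ≤ b / 2 := by
    rw [div_le_iff₀ hb0] at hV
    rw [div_le_div_iff₀ hV0 (by norm_num)]
    simp only [Finset.card_empty]
    push_cast
    nlinarith
  let e' : Unit ⊕ Unit → Pos l o × Fin 2 := Sum.elim (fun _ => (i1, 1)) fun _ => (i2, 1)
  have he' : Function.Injective e' := by rintro (a | a) (b | b) h <;> simp_all [e', i1, i2]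
  have h9 := rich_fiber (V := V) e' he' (fun y : Pos l o × Fin 2 → V => (∀ c : Pos l o → Fin 2,
      (A (((fun i => y (i, c i)) ∘ e) ∘ Sum.inl) ∧ ¬ A (((fun i => y (i, c i)) ∘ e) ∘ Sum.inr)) ∧
      im (fun i => y (i, c i)) ∈ H) ∧
      (Function.Injective y ∧ Disjoint (Finset.univ.image y) ∅))
    (b := b / 2) (by positivity) (by linarith) (hcard.trans_le hQ) (by
      refine le_trans (le_of_eq ?_) hcQ
      field_simp; norm_num)
  rw [show b / 4 = b / 2 / 2 by ring]
  refine h9.trans ?_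
  rw [← pr_sum_arrow (fun a b : Unit → V => A a ∧ ¬ A b ∧ Rich Q (Swap l H (a ()) (b ())))]
  refine pr_mono fun a ha => ?_
  obtain ⟨_, g, ⟨hg, -, -⟩, rfl, -⟩ := exists_of_pr_pos ha.pos
  have hg1 := (hg fun _ => 1).1
  refine ⟨hg1.1, hg1.2, ha.imp ?_⟩
  rintro X ⟨y, ⟨hy, hinj, -⟩, hya, hX⟩
  rw [← hya] at hX ⊢
  obtain ⟨s1, T, -, s2, s3, s4⟩ := swap_blowup (l := l) (o := o)
    (H := Finset.univ.filter fun f => f.image y ∈ H) (by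
      intro c
      rw [Finset.mem_filter]
      refine ⟨Finset.mem_univ _, ?_⟩
      have := (hy c).2
      rw [im, Finset.image_image]
      exact this)
  have s5 := s4.map y hinj (H' := H) fun f hf => (Finset.mem_filter.1 hf).2
  rw [Finset.image_insert, Finset.image_insert] at s5
  have n1 : y (Sum.inr (Sum.inr 0), 1) ∉ T.image y := by
    rw [Finset.mem_image]; rintro ⟨z, hz, h⟩; rw [hinj h] at hz; exact s2 hz
  have n2 : y (Sum.inr (Sum.inl 0), 1) ∉ T.image y := by
    rw [Finset.mem_image]; rintro ⟨z, hz, h⟩; rw [hinj h] at hz; exact s3 hz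
  refine ⟨fun h => s1 (hinj h), T.image y, ?_, n1, n2, s5⟩
  intro v hv
  have hv' : v ∈ im y := by
    obtain ⟨z, -, rfl⟩ := Finset.mem_image.1 hv
    exact mem_im_self y z
  rcases Finset.mem_union.1 (hX hv') with h | h
  · obtain ⟨u, rfl⟩ := mem_im.1 h
    rcases u with u | u
    · exact absurd hv n1
    · exact absurd hv n2
  · exact h

/-- Almost all pairs of vertices can be swapped in many ways. -/
theorem exists_rich_swap (l o d : ℕ) (hl : 0 < l) (ho : 0 < o) (hd : 2 ≤ d) {γ ε : ℝ} (hγ : 0 < γ)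
    (hε : 0 < ε) : ∃ Q : ℕ, ∀ (V : Type) [Fintype V] [DecidableEq V] (H : Finset (Finset V)),
      Deg H (2 * l + o) d γ → Q ≤ Fintype.card V →
        pr (fun x : V × V => ¬ Rich Q (Swap l H x.1 x.2)) ≤ ε := by
  obtain ⟨o', rfl⟩ : ∃ o', o = o' + 1 := ⟨o - 1, by omega⟩
  have : NeZero l := ⟨hl.ne'⟩
  set c' := ε * γ / 4 with hc'
  have hc0' : 0 < c' := by positivity
  set c := min (ε / 4) (c' * γ / 8) with hc
  have hc0 : 0 < c := lt_min (by positivity) (by positivity)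
  set b := (c ^ 2 * γ) ^ 2 ^ (2 * l + (o' + 1)) with hb
  have hb0 : 0 < b := by positivity
  set K : ℝ := 2 * l + (o' + 1) with hK
  obtain ⟨M, hM⟩ := exists_nat_ge (8 / (c' * γ) + 4 * K * (K + 1) / (c' * γ) + 4 / b +
    2 * (K * 2) ^ 2 / b)
  have hK0 : 0 ≤ K := by positivity
  have m1 : 0 ≤ 8 / (c' * γ) := by positivity
  have m2 : 0 ≤ 4 * K * (K + 1) / (c' * γ) := by positivity
  have m3 : 0 ≤ 4 / b := by positivity
  have m4 : 0 ≤ 2 * (K * 2) ^ 2 / b := by positivity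
  set Q0 := M + (2 * l + (o' + 1)) * 2 with hQ0
  have hMQ : (M : ℝ) ≤ Q0 := by exact_mod_cast Nat.le_add_right _ _
  obtain ⟨Q, hQ⟩ := growth Unit Q0 1 (c := c) (c0 := b / 4) (by positivity)
  refine ⟨Q + Q0, fun V _ _ H hH hV => ?_⟩
  have hV1 : Q ≤ Fintype.card V := by omega
  have hV2 : (M : ℝ) ≤ Fintype.card V := by exact_mod_cast (by omega : M ≤ Fintype.card V)
  have good : ∀ x : V, γ / 2 ≤ pr (fun f : Pos l o' → V => insert x (im f) ∈ H ∧
      c' ≤ pr (fun y : V => insert y (im f) ∈ H)) →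
      pr (fun y : V => ¬ Rich (Q + Q0) (Swap l H x y)) ≤ c := by
    intro x hx
    have h1 := swap_start (Q := Q0) hH.unif hγ hc0' (by omega) (by linarith) (by
      rw [hK] at *; linarith) hx
    have h2 := hQ V (fun a => Swap l H x (a ())) (fun a b => Swap l H (a ()) (b ())) {x} hV1
      (by simp) (fun a => upSet_swap _ _ _) (by
        intro a b X Y hX hY d1 d2 d3 d4 d5
        rw [Finset.disjoint_union_right, Finset.disjoint_union_left,
          Finset.disjoint_union_left, Finset.disjoint_union_left, Finset.disjoint_union_left] at d4
        have hx : x ≠ b () := by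
          rintro rfl
          exact Finset.disjoint_singleton_right.1 d5 (mem_im_self b ())
        have := hX.trans hY d3 hx (Finset.disjoint_singleton_right.1 d4.1.2)
          (Finset.disjoint_right.1 d4.2.1.2 (mem_im_self b ()))
        rwa [im_unit]) ((min_le_right _ _).trans h1) (fun A hA hA' =>
          swap_expand hH hγ hd hc0 (Nat.le_add_left _ _) (by linarith) (by
            push_cast
            rw [hK] at *; linarith) hA hA')
    rw [← pr_unit]
    refine (pr_mono fun a ha => ?_).trans h2
    exact fun h => ha (h.mono (upSet_swap _ _ _) (Nat.le_add_right _ _))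
  refine (pr_le_fiber (fun x y : V => ¬ Rich (Q + Q0) (Swap l H x y)) (ε / 2)
    (by positivity)).trans ?_
  have h3 := hH.popular hγ (by omega) hc0'.le
  have h4 : 2 * c' / γ = ε / 2 := by rw [hc']; field_simp; norm_num
  rw [h4] at h3
  have h5 : pr (fun x : V => ε / 2 ≤ pr (fun y : V => ¬ Rich (Q + Q0) (Swap l H x y))) ≤
      ε / 2 := by
    refine (pr_mono fun x hx => ?_).trans h3
    intro h
    have := hx.trans (good x h)
    have := min_le_left (ε / 4) (c' * γ / 8)
    linarith
  linarith

end reach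

section gadgets
variable {V : Type} [Fintype V] [DecidableEq V] {l o d : ℕ} {H : Finset (Finset V)} {γ : ℝ}

theorem le_bind_bound (a b f : ℕ) : a + b + f + 1 ≤ 8 * (a + b + f + 1) ^ 3 := by
  nlinarith [Nat.zero_le (a + b + f), Nat.zero_le ((a + b + f) ^ 2),
    Nat.zero_le ((a + b + f) ^ 3)]

/-- Every vertex can be inserted into many configurations of paths. -/
theorem exists_rich_vertex (l o d : ℕ) (hl : 0 < l) (ho : 0 < o) (hd : l + 1 ≤ d) {γ : ℝ}
    (hγ : 0 < γ) : ∃ Q : ℕ, ∀ (V : Type) [Fintype V] [DecidableEq V] (H : Finset (Finset V)),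
      Deg H (2 * l + o) d γ → Q ≤ Fintype.card V → ∀ v : V,
        Rich Q (fun X => ∃ I ⊆ X, ∃ J ⊆ X, v ∉ I ∧ v ∉ J ∧ Sim l H (insert v I) J) := by
  obtain ⟨Q1, hQ1⟩ := exists_rich_link hl ho hd hγ
  obtain ⟨o', rfl⟩ : ∃ o', o = o' + 1 := ⟨o - 1, by omega⟩
  obtain ⟨M, hM⟩ := exists_nat_ge (1 / γ)
  set Q0 := M + (2 * l + o') with hQ0
  refine ⟨8 * (Q0 + Q1 + 1 + 1) ^ 3, fun V _ _ H hH hV v => ?_⟩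
  have : Nonempty V := ⟨v⟩
  have h1 : Rich Q0 (fun X => ∃ f : Pos l o' → V, im f ⊆ X ∧ insert v (im f) ∈ H) := by
    refine rich_of_tuple (ι := Pos l o') ?_ hγ ((hH.ext {v} (by simp; omega)).trans ?_) (by
      rw [card_pos_type]; omega) (hM.trans (by exact_mod_cast Nat.le_add_right _ _))
    · rintro X Y hXY ⟨f, hf, h⟩
      exact ⟨f, hf.trans hXY, h⟩
    · have hcard : Fintype.card (Pos l o') = 2 * l + (o' + 1) - ({v} : Finset V).card := by
        rw [card_pos_type]; simp
      have e := (Fintype.equivFinOfCardEq hcard).symm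
      rw [← pr_reindex e]
      refine pr_mono fun g hg => ⟨g, subset_rfl, ?_⟩
      rw [Finset.insert_eq]
      rwa [im_comp_equiv] at hg
  have h2 := h1.bind (Q' := Q1) (R := fun X Y => ∃ f : Pos l o' → V, im f ⊆ X ∧
      insert v (im f) ∈ H ∧ Link H (f ∘ Sum.inl) (f ∘ (Sum.inr ∘ Sum.inr)) Y) {v} (by
    rintro X ⟨f, hfX, hf⟩ - -
    have hinj := (lPath_insert hH.unif hf).2.2
    refine (hQ1 V H hH ((by have := le_bind_bound Q0 Q1 1; omega : Q1 ≤ _).trans hV)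
      (f ∘ Sum.inl) (f ∘ (Sum.inr ∘ Sum.inr))
      (hinj.comp Sum.inl_injective) (hinj.comp (Sum.inr_injective.comp Sum.inr_injective))
      (disjoint_im_comp hinj (by simp))).imp fun Y hY => ⟨f, hfX, hf, hY⟩) (f := 1) (by simp)
      le_rfl hV
  refine h2.imp ?_
  rintro Z ⟨X, Y, hXY, -, -, hYv, -, -, -, f, hfX, hf, I, hIY, -, -, hI⟩
  obtain ⟨g1, g2, g3⟩ := lPath_insert hH.unif hf
  have hXZ : X ⊆ Z := Finset.subset_union_left.trans hXY
  have hYZ : Y ⊆ Z := Finset.subset_union_right.trans hXY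
  refine ⟨im f, hfX.trans hXZ, _, Finset.union_subset (Finset.union_subset
    ((im_comp_subset _ _).trans (hfX.trans hXZ)) (hIY.trans hYZ))
    ((im_comp_subset _ _).trans (hfX.trans hXZ)), g2, ?_, g1.sim hI⟩
  simp only [Finset.mem_union, not_or]
  exact ⟨⟨fun h => g2 (im_comp_subset _ _ h), fun h => Finset.disjoint_singleton_right.1 hYv
    (hIY h)⟩, fun h => g2 (im_comp_subset _ _ h)⟩

/-- Every set of `p` vertices can be inserted into many configurations of paths. -/
theorem exists_rich_insert (l o d : ℕ) (hl : 0 < l) (ho : 0 < o) (hd : l + 1 ≤ d) {γ : ℝ}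
    (hγ : 0 < γ) (p : ℕ) : ∃ Q : ℕ, ∀ (V : Type) [Fintype V] [DecidableEq V]
      (H : Finset (Finset V)), Deg H (2 * l + o) d γ → Q ≤ Fintype.card V → ∀ S : Finset V,
        S.card = p → Rich Q (fun X => ∃ I ⊆ X, ∃ J ⊆ X, Disjoint I S ∧ Disjoint J S ∧
          Sim l H (S ∪ I) J) := by
  induction p with
  | zero =>
    refine ⟨1, fun V _ _ H hH hV S hS => ⟨one_pos, ?_⟩⟩
    have : Nonempty V := Fintype.card_pos_iff.1 hV
    rw [Finset.card_eq_zero.1 hS, pr_of_forall fun g => ⟨∅, by simp, ∅, by simp, by simp,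
      by simp, by simpa using Sim.empty⟩]
    simp
  | succ p ih =>
    obtain ⟨Q1, hQ1⟩ := ih
    obtain ⟨Q2, hQ2⟩ := exists_rich_vertex l o d hl ho hd hγ
    refine ⟨8 * (Q1 + Q2 + (p + 1) + 1) ^ 3, fun V _ _ H hH hV S hS => ?_⟩
    obtain ⟨v, S, hv, rfl, hc⟩ := Finset.card_eq_succ.1 hS
    have hb := le_bind_bound Q1 Q2 (p + 1)
    refine ((hQ1 V H hH (by omega) S hc).bind (insert v S) (fun X _ _ _ => hQ2 V H hH
      (by omega) v) hS.le le_rfl hV).imp ?_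
    rintro Z ⟨X, Y, hXY, hd, hX, hY, -, -, ⟨I, hI, J, hJ, d1, d2, s⟩, I', hI', J', hJ', d3, d4, s'⟩
    have hXZ : X ⊆ Z := Finset.subset_union_left.trans hXY
    have hYZ : Y ⊆ Z := Finset.subset_union_right.trans hXY
    refine ⟨I ∪ I', Finset.union_subset (hI.trans hXZ) (hI'.trans hYZ), J ∪ J',
      Finset.union_subset (hJ.trans hXZ) (hJ'.trans hYZ), Finset.disjoint_union_left.2
      ⟨hX.mono_left hI, hY.mono_left hI'⟩, Finset.disjoint_union_left.2
      ⟨hX.mono_left hJ, hY.mono_left hJ'⟩, ?_⟩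
    rw [Finset.disjoint_insert_right] at hX hY
    have := s.union s' (by
      rw [Finset.disjoint_insert_right, Finset.disjoint_union_left, Finset.mem_union, not_or]
      exact ⟨⟨hv, fun h => hX.1 (hI h)⟩, (hY.2.mono_left hI').symm, hd.mono hI hI'⟩)
      (hd.mono hJ hJ')
    convert this using 1
    ext w; simp only [Finset.mem_insert, Finset.mem_union]; tauto

/-- Sets of `p` vertices can be swapped if all their pairs can. -/
theorem exists_rich_swaps (l Q : ℕ) (p : ℕ) : ∃ Q' : ℕ, ∀ (V : Type) [Fintype V] [DecidableEq V]
      (H : Finset (Finset V)), Q' ≤ Fintype.card V → ∀ A B : Finset V,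
        A.card = p → B.card = p → (∀ x ∈ A, ∀ y ∈ B, Rich Q (Swap l H x y)) →
        Rich Q' (fun X => ∃ T ⊆ X, Disjoint T (A ∪ B) ∧ Sim l H (A ∪ T) (B ∪ T)) := by
  induction p with
  | zero =>
    refine ⟨1, fun V _ _ H hV A B hA hB _ => ⟨one_pos, ?_⟩⟩
    have : Nonempty V := Fintype.card_pos_iff.1 hV
    rw [Finset.card_eq_zero.1 hA, Finset.card_eq_zero.1 hB, pr_of_forall fun g => ⟨∅, by simp,
      by simp, by simpa using Sim.empty⟩]
    simp
  | succ p ih =>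
    obtain ⟨Q1, hQ1⟩ := ih
    refine ⟨8 * (Q1 + Q + 2 * (p + 1) + 1) ^ 3, fun V _ _ H hV A B hA hB hAB => ?_⟩
    obtain ⟨x, A, hx, rfl, hA'⟩ := Finset.card_eq_succ.1 hA
    obtain ⟨y, B, hy, rfl, hB'⟩ := Finset.card_eq_succ.1 hB
    have hb := le_bind_bound Q1 Q (2 * (p + 1))
    refine ((hQ1 V H (by omega) A B hA' hB' fun a ha b hb => hAB a (by simp [ha]) b
      (by simp [hb])).bind (insert x A ∪ insert y B) (fun X _ _ _ => hAB x (by simp) y (by simp))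
      ((Finset.card_union_le _ _).trans (by omega)) le_rfl hV).imp ?_
    rintro Z ⟨X, Y, hXY, hd, hX, hY, -, -, ⟨T, hT, d1, s⟩, -, T', hT', d3, d4, s'⟩
    have hXZ : X ⊆ Z := Finset.subset_union_left.trans hXY
    have hYZ : Y ⊆ Z := Finset.subset_union_right.trans hXY
    refine ⟨T ∪ T', Finset.union_subset (hT.trans hXZ) (hT'.trans hYZ),
      Finset.disjoint_union_left.2 ⟨hX.mono_left hT, hY.mono_left hT'⟩, ?_⟩
    simp only [Finset.disjoint_union_right, Finset.disjoint_insert_right] at hX hY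
    have := s.union s' (by
      rw [Finset.disjoint_insert_right, Finset.disjoint_union_left, Finset.mem_union, not_or]
      exact ⟨⟨hx, fun h => hX.1.1 (hT h)⟩, (hY.1.2.mono_left hT').symm, hd.mono hT hT'⟩)
      (by
      rw [Finset.disjoint_insert_right, Finset.disjoint_union_left, Finset.mem_union, not_or]
      exact ⟨⟨hy, fun h => hX.2.1 (hT h)⟩, (hY.2.2.mono_left hT').symm, hd.mono hT hT'⟩)
    convert this using 1 <;>
    · ext w; simp only [Finset.mem_insert, Finset.mem_union]; tauto

/-- Almost sure pair properties can be added to a rich property. -/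
theorem Rich.pairs {Q : ℕ} {P : Finset V → Prop} (h : Rich Q P) (hP : UpSet P) {ε : ℝ}
    {G : V → V → Prop} (hG : pr (fun x : V × V => ¬ G x.1 x.2) ≤ ε)
    (hε : ε * (8 * Q ^ 3) ≤ 1) :
    Rich (2 * Q) (fun X => P X ∧ ∀ x ∈ X, ∀ y ∈ X, x ≠ y → G x y) := by
  have hV := h.nonempty
  have h0 : (0 : ℝ) < Q := Nat.cast_pos.2 h.1
  refine ⟨by have := h.1; omega, ?_⟩
  have h1 : 1 / (Q : ℝ) ≤ pr (fun g : Fin (2 * Q) → V => P (im g)) := by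
    have h' := h.2
    rw [← pr_proj (Fin.castLE (by omega : Q ≤ 2 * Q)) (Fin.castLE_injective _)] at h'
    exact h'.trans (pr_mono fun g hg => hP _ _ (im_comp_subset _ _) hg)
  have h2 := pr_and_ge (fun g : Fin (2 * Q) → V => P (im g))
    (fun g => ∀ x ∈ im g, ∀ y ∈ im g, x ≠ y → G x y)
  have h3 : pr (fun g : Fin (2 * Q) → V => ¬ ∀ x ∈ im g, ∀ y ∈ im g, x ≠ y → G x y) ≤
      1 / (2 * Q) := by
    have h4 := pr_exists_le (α := Fin (2 * Q) → V)
      (Finset.univ.filter fun p : Fin (2 * Q) × Fin (2 * Q) => p.1 ≠ p.2)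
      (fun p g => ¬ G (g p.1) (g p.2))
    refine (pr_mono fun g hg => ?_).trans (h4.trans ?_)
    · push Not at hg
      obtain ⟨x, hx, y, hy, hxy, hn⟩ := hg
      obtain ⟨i, rfl⟩ := mem_im.1 hx
      obtain ⟨j, rfl⟩ := mem_im.1 hy
      exact ⟨(i, j), by simpa using fun h => hxy (by rw [h]), hn⟩
    · have h5 : ∀ p ∈ (Finset.univ.filter fun p : Fin (2 * Q) × Fin (2 * Q) => p.1 ≠ p.2),
          pr (fun g : Fin (2 * Q) → V => ¬ G (g p.1) (g p.2)) ≤ ε := by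
        rintro ⟨i, j⟩ hp
        have hij : i ≠ j := by simpa using hp
        refine le_trans (le_of_eq ?_) hG
        have e1 := pr_proj (V := V) (fun b : Bool => if b then i else j) (by
          rintro (_ | _) (_ | _) h <;> simp_all [Ne.symm hij]) fun a => ¬ G (a true) (a false)
        have e2 := pr_equiv (Equiv.boolArrowEquivProd V) fun x : V × V => ¬ G x.2 x.1
        rw [pr_swap fun x y => ¬ G x y, ← e2]
        exact e1
      refine (Finset.sum_le_card_nsmul _ _ _ h5).trans ?_
      have hε0 : 0 ≤ ε := (pr_nonneg _).trans hG
      have h6 : (Finset.univ.filter fun p : Fin (2 * Q) × Fin (2 * Q) => p.1 ≠ p.2).card ≤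
          (2 * Q) * (2 * Q) := by
        refine (Finset.card_filter_le _ _).trans ?_
        simp
      have h7 : ((Finset.univ.filter fun p : Fin (2 * Q) × Fin (2 * Q) => p.1 ≠ p.2).card : ℝ) ≤
          (2 * Q) * (2 * Q) := by exact_mod_cast h6
      rw [nsmul_eq_mul, le_div_iff₀ (by positivity)]
      nlinarith [mul_le_mul_of_nonneg_right h7 (mul_nonneg hε0 h0.le)]
  have h8 : 1 / (Q : ℝ) = 1 / (2 * Q) + 1 / (2 * Q) := by field_simp; norm_num
  push_cast
  refine le_trans ?_ h2
  linarith

end gadgets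

section unit
variable {V κ : Type} [Fintype V] [DecidableEq V] [Fintype κ] [DecidableEq κ] {l o : ℕ}
  {H : Finset (Finset V)}

/-- A walk of disjoint `ℓ`-tuples in a complete `k`-partite configuration gives a path. -/
theorem exists_lPath_of_walk {N : ℕ} {y : κ × Fin N → V} (hy : Function.Injective y)
    (hκ : Fintype.card κ = 2 * l + o)
    (hH : ∀ c : κ → Fin N, im (fun i => y (i, c i)) ∈ H) (R : ℕ → Fin l → κ) (c : ℕ → Fin N)
    (hR : ∀ i, Function.Injective (R i)) : ∀ L : ℕ,
    (∀ i < L, ∀ j j', R i j ≠ R (i + 1) j') → Set.InjOn c (Set.Iic L) →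
    ∃ A : Finset V, LPath H (fun j => y (R 0 j, c 0)) (fun j => y (R L j, c L)) A ∧
      A.card = L * (l + o) + l ∧ ∀ v ∈ A, ∃ i ≤ L, ∃ a, v = y (a, c i) := by
  have hinj : ∀ i, Function.Injective fun j => y (R i j, c i) := fun i j j' h =>
    hR i (Prod.ext_iff.1 (hy h)).1
  intro L
  induction L with
  | zero =>
    intro _ _
    refine ⟨_, LPath.single _ (hinj 0), by rw [card_im _ (hinj 0)]; simp, fun v hv => ?_⟩
    obtain ⟨j, rfl⟩ := mem_im.1 hv
    exact ⟨0, le_rfl, _, rfl⟩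
  | succ L ih =>
    intro hd hc
    obtain ⟨A, hA, hcard, hv⟩ := ih (fun i hi => hd i (by omega))
      (hc.mono (Set.Iic_subset_Iic.2 (Nat.le_succ L)))
    set D : Finset κ := Finset.univ \ im (R L) with hD
    set B : Finset V := D.image fun a => y (a, c (L + 1)) with hB
    have hsub : im (fun j => y (R (L + 1) j, c (L + 1))) ⊆ B := by
      intro v hv
      obtain ⟨j, rfl⟩ := mem_im.1 hv
      refine Finset.mem_image_of_mem _ ?_
      rw [hD, Finset.mem_sdiff]
      refine ⟨Finset.mem_univ _, fun h => ?_⟩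
      obtain ⟨j', h⟩ := mem_im.1 h
      exact hd L (by omega) j' j h
    have hAB : Disjoint A B := by
      rw [Finset.disjoint_left]
      intro v hvA hvB
      obtain ⟨i, hi, a, rfl⟩ := hv v hvA
      obtain ⟨b, -, h⟩ := Finset.mem_image.1 hvB
      have := hc (by simp) (by simp; omega) (Prod.ext_iff.1 (hy h)).2
      omega
    have hBc : B.card = l + o := by
      rw [hB, Finset.card_image_of_injective _ fun a b h => (Prod.ext_iff.1 (hy h)).1, hD,
        Finset.card_sdiff_of_subset (Finset.subset_univ _), Finset.card_univ, hκ,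
        card_im _ (hR L), Fintype.card_fin]
      omega
    have hE : im (fun j => y (R L j, c L)) ∪ B ∈ H := by
      convert hH fun a => if a ∈ im (R L) then c L else c (L + 1) using 1
      ext v
      simp only [Finset.mem_union, mem_im, hB, hD, Finset.mem_image, Finset.mem_sdiff,
        Finset.mem_univ, true_and]
      constructor
      · rintro (⟨j, rfl⟩ | ⟨a, ha, rfl⟩)
        · exact ⟨R L j, by simp⟩
        · exact ⟨a, by simp [ha]⟩
      · rintro ⟨a, rfl⟩
        by_cases h : ∃ i, R L i = a
        · obtain ⟨i, rfl⟩ := h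
          exact Or.inl ⟨i, by simp⟩
        · exact Or.inr ⟨a, h, by simp [h]⟩
    have hun : B \ im (fun j => y (R (L + 1) j, c (L + 1))) ∪
        im (fun j => y (R (L + 1) j, c (L + 1))) = B := Finset.sdiff_union_of_subset hsub
    refine ⟨A ∪ B, ?_, by rw [Finset.card_union_of_disjoint hAB, hcard, hBc]; ring, ?_⟩
    · rw [← hun]
      exact LPath.step _ _ _ _ _ hA (by rwa [Finset.union_assoc, hun]) (hinj _)
        Finset.sdiff_disjoint (by rwa [hun])
    · intro v hv'
      rcases Finset.mem_union.1 hv' with h | h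
      · obtain ⟨i, hi, a, rfl⟩ := hv v h
        exact ⟨i, by omega, a, rfl⟩
      · obtain ⟨a, -, rfl⟩ := Finset.mem_image.1 h
        exact ⟨L + 1, le_rfl, a, rfl⟩

/-- A complete `k`-partite configuration contains two paths with the same ends whose lengths
differ by one. -/
theorem exists_unit_of_complete (hl : 0 < l) (ho : 0 < o) {y : Fin (2 * l + o) × Fin (2 * l + 1) → V}
    (hy : Function.Injective y)
    (hH : ∀ c : Fin (2 * l + o) → Fin (2 * l + 1), im (fun i => y (i, c i)) ∈ H) :
    ∃ K ⊆ im y, ∃ K' ⊆ im y, K.card = K'.card + (l + o) ∧ Sim l H K K' := by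
  have hlt : ∀ m, m % (2 * l + 1) < 2 * l + o := fun m =>
    (Nat.mod_lt _ (by omega)).trans_le (by omega)
  set q : ℕ → Fin l → Fin (2 * l + o) := fun i j => ⟨(i * l + j) % (2 * l + 1), hlt _⟩ with hq
  have hqi : ∀ i, Function.Injective (q i) := by
    intro i j j' h
    simp only [hq, Fin.mk.injEq] at h
    have h1 : (j : ℕ) ≡ j' [MOD (2 * l + 1)] := Nat.ModEq.add_left_cancel' _ h
    exact Fin.ext (Nat.ModEq.eq_of_lt_of_lt h1 (by omega) (by omega))
  have hqd : ∀ i j j', q i j ≠ q (i + 1) j' := by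
    intro i j j' h
    simp only [hq, Fin.mk.injEq] at h
    have h1 : (j : ℕ) ≡ l + j' [MOD (2 * l + 1)] :=
      Nat.ModEq.add_left_cancel' (i * l) (h.trans (by congr 1; ring))
    have := Nat.ModEq.eq_of_lt_of_lt h1 (by omega) (by omega)
    omega
  have hq0 : ∀ j j', q 0 j ≠ q (2 * l) j' := by
    intro j j' h
    simp only [hq, Fin.mk.injEq] at h
    have h1 : l + (j : ℕ) ≡ (2 * l + 1) * l + j' [MOD (2 * l + 1)] := by
      have : l + (0 * l + (j : ℕ)) ≡ l + (2 * l * l + j') [MOD (2 * l + 1)] :=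
        Nat.ModEq.add_left _ h
      convert this using 1 <;> ring
    have h2 : l + (j : ℕ) ≡ j' [MOD (2 * l + 1)] := by
      refine h1.trans ?_
      simp [Nat.ModEq, Nat.add_mod]
    have := Nat.ModEq.eq_of_lt_of_lt h2 (by omega) (by omega)
    omega
  have hN : NeZero (2 * l + 1) := ⟨by omega⟩
  have hsub : ∀ A : Finset V, ∀ (c : ℕ → Fin (2 * l + 1)) (L : ℕ),
      (∀ v ∈ A, ∃ i ≤ L, ∃ a, v = y (a, c i)) → A ⊆ im y := by
    intro A c L h v hv
    obtain ⟨i, -, a, rfl⟩ := h v hv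
    exact mem_im_self _ _
  obtain ⟨A, hA, hAc, hAv⟩ := exists_lPath_of_walk (o := o) hy (by simp) hH q
    (fun i => Fin.ofNat (2 * l + 1) i) hqi (2 * l) (fun i _ => hqd i) (by
      intro i hi j hj h
      simp only [Fin.ofNat, Fin.mk.injEq] at h
      simp only [Set.mem_Iic] at hi hj
      rwa [Nat.mod_eq_of_lt (by omega), Nat.mod_eq_of_lt (by omega)] at h)
  obtain ⟨B, hB, hBc, hBv⟩ := exists_lPath_of_walk (o := o) hy (by simp) hH
    (fun i => if Even i then q 0 else q (2 * l))
    (fun i => Fin.ofNat (2 * l + 1) (if i < 2 * l - 1 then i else 2 * l))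
    (fun i => by split_ifs <;> exact hqi _) (2 * l - 1) (by
      intro i _ j j'
      by_cases h : Even i
      · have h' : ¬ Even (i + 1) := by rw [Nat.even_add_one]; exact not_not_intro h
        simp only [if_pos h, if_neg h']
        exact hq0 j j'
      · have h' : Even (i + 1) := by rwa [Nat.even_add_one]
        simp only [if_pos h', if_neg h]
        exact (hq0 j' j).symm) (by
      intro i hi j hj h
      simp only [Fin.ofNat, Fin.mk.injEq] at h
      simp only [Set.mem_Iic] at hi hj
      rw [Nat.mod_eq_of_lt (by split_ifs <;> omega), Nat.mod_eq_of_lt (by split_ifs <;> omega)]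
        at h
      split_ifs at h <;> omega)
  have hodd : ¬ Even (2 * l - 1) := by
    rw [Nat.not_even_iff_odd]; exact ⟨l - 1, by omega⟩
  simp only [hodd, if_false, lt_irrefl, Even.zero, if_true] at hB
  rw [if_pos (by omega : 0 < 2 * l - 1)] at hB
  refine ⟨A, hsub _ _ _ hAv, B, hsub _ _ _ hBv, ?_, hA.sim hB⟩
  rw [hAc, hBc]
  obtain ⟨l', rfl⟩ : ∃ l', l = l' + 1 := ⟨l - 1, by omega⟩
  rw [show 2 * (l' + 1) - 1 = 2 * l' + 1 by omega]
  ring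

/-- Pairs of interchangeable sets whose sizes differ by exactly one edge are plentiful. -/
theorem exists_rich_unit (l o d : ℕ) (hl : 0 < l) (ho : 0 < o) {γ : ℝ}
    (hγ : 0 < γ) : ∃ Q : ℕ, ∀ (V : Type) [Fintype V] [DecidableEq V] (H : Finset (Finset V)),
      Deg H (2 * l + o) d γ → Q ≤ Fintype.card V →
        Rich Q (fun X => ∃ K ⊆ X, ∃ K' ⊆ X, K.card = K'.card + (l + o) ∧ Sim l H K K') := by
  set N := 2 * l + 1 with hN
  set b : ℝ := γ ^ N ^ Fintype.card (Fin (2 * l + o)) with hb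
  set C := Fintype.card (Fin (2 * l + o) × Fin N) with hC
  have hb0 : 0 < b := by positivity
  obtain ⟨M1, hM1⟩ := exists_nat_ge (1 / (b / 2))
  obtain ⟨M2, hM2⟩ := exists_nat_ge ((C * C : ℝ) / (b / 2))
  refine ⟨M1 + M2 + C + 1, fun V _ _ H hH hV => ?_⟩
  have : Nonempty V := Fintype.card_pos_iff.1 (by omega)
  have hn : (0 : ℝ) < Fintype.card V := by exact_mod_cast Fintype.card_pos
  have h1 := hH.ext ∅ (by simp)
  simp only [Finset.empty_union] at h1
  have h2 := pr_blowup N _ hγ h1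
  have h3 := pr_collision (V := V) (ι := Fin (2 * l + o) × Fin N) ∅
  refine rich_of_tuple (ι := Fin (2 * l + o) × Fin N) (b := b / 2) ?_ (by positivity)
    (le_trans ?_ (pr_mono (P := fun y => (∀ c : Fin (2 * l + o) → Fin N,
      im (fun i => y (i, c i)) ∈ H) ∧ Function.Injective y ∧ Disjoint (Finset.univ.image y) ∅) ?_))
    (by omega) (hM1.trans (by push_cast; linarith [(M2.cast_nonneg : (0:ℝ) ≤ M2),
      (C.cast_nonneg : (0:ℝ) ≤ C)]))
  · rintro X Y hXY ⟨K, hK, K', hK', h⟩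
    exact ⟨K, hK.trans hXY, K', hK'.trans hXY, h⟩
  · refine le_trans ?_ (pr_and_ge _ _)
    have h4 : (C : ℝ) * (C + (∅ : Finset V).card) / Fintype.card V ≤ b / 2 := by
      rw [div_le_iff₀ hn]
      rw [div_le_iff₀ (by positivity)] at hM2
      have h5 : (M2 : ℝ) ≤ Fintype.card V := by exact_mod_cast (by omega)
      simp only [Finset.card_empty, Nat.cast_zero, add_zero]
      nlinarith
    have h5 := h3.trans h4
    have h6 : b ≤ _ := h2
    refine le_trans ?_ (sub_le_sub h6 h5)
    linarith
  · rintro y ⟨h, hy, -⟩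
    exact exists_unit_of_complete hl ho hy h

end unit

section absorber
variable {V : Type} [Fintype V] [DecidableEq V] {l o d : ℕ} {H : Finset (Finset V)} {γ : ℝ}

theorem Rich.card_le {Q : ℕ} {P : Finset V → Prop} (h : Rich Q P) :
    Rich Q (fun X => P X ∧ X.card ≤ Q) :=
  ⟨h.1, h.2.trans (pr_mono fun g hg => ⟨hg, (card_im_le g).trans (by simp)⟩)⟩

/-- Inside `X` there are paths covering `S ∪ I` and paths with the same ends covering `J`, where
the sizes of `I` and `J` differ by at most `m`. -/
def Insertable (l : ℕ) (H : Finset (Finset V)) (S : Finset V) (m : ℕ) (X : Finset V) : Prop :=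
  ∃ I ⊆ X, ∃ J ⊆ X, Disjoint I S ∧ Disjoint J S ∧ Sim l H (S ∪ I) J ∧
    I.card ≤ J.card + m ∧ J.card ≤ I.card + m

theorem upSet_insertable (l : ℕ) (H : Finset (Finset V)) (S : Finset V) (m : ℕ) :
    UpSet (Insertable l H S m) := by
  rintro X Y hXY ⟨I, hI, J, hJ, h⟩
  exact ⟨I, hI.trans hXY, J, hJ.trans hXY, h⟩

/-- Two disjoint interchangeable pairs, one of which shifts the sizes by an edge, reduce the
imbalance. -/
theorem Insertable.balance {S X Y Z K K' : Finset V} (hH : ∀ e ∈ H, e.card = 2 * l + o)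
    (hS : S.card = l + o) {D : ℕ} (h : Insertable l H S ((D + 1) * (l + o)) X) (hXY : X ∪ Y ⊆ Z)
    (hd : Disjoint X Y) (hY : Disjoint Y S) (hK : K ⊆ Y) (hK' : K' ⊆ Y)
    (hc : K.card = K'.card + (l + o)) (hs : Sim l H K K') : Insertable l H S (D * (l + o)) Z := by
  obtain ⟨I, hI, J, hJ, dI, dJ, s, c1, c2⟩ := h
  have hXZ : X ⊆ Z := Finset.subset_union_left.trans hXY
  have hYZ : Y ⊆ Z := Finset.subset_union_right.trans hXY
  have hmod : (l + o) + I.card ≡ J.card [MOD (l + o)] := by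
    have := s.card_mod hH
    rwa [Finset.card_union_of_disjoint dI.symm, hS] at this
  have hmod' : I.card ≡ J.card [MOD (l + o)] := by
    refine Nat.ModEq.trans ?_ hmod
    simp [Nat.ModEq]
  have key : ∀ L L' : Finset V, L ⊆ Y → L' ⊆ Y → Sim l H L L' →
      I.card + L.card ≤ J.card + L'.card + D * (l + o) →
      J.card + L'.card ≤ I.card + L.card + D * (l + o) → Insertable l H S (D * (l + o)) Z := by
    intro L L' hL hL' hsim h1 h2
    refine ⟨I ∪ L, Finset.union_subset (hI.trans hXZ) (hL.trans hYZ), J ∪ L',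
      Finset.union_subset (hJ.trans hXZ) (hL'.trans hYZ), Finset.disjoint_union_left.2
      ⟨dI, hY.mono_left hL⟩, Finset.disjoint_union_left.2 ⟨dJ, hY.mono_left hL'⟩, ?_, ?_, ?_⟩
    · rw [← Finset.union_assoc]
      exact s.union hsim (Finset.disjoint_union_left.2 ⟨(hY.mono_left hL).symm, hd.mono hI hL⟩)
        (hd.mono hJ hL')
    · rwa [Finset.card_union_of_disjoint (hd.mono hI hL),
        Finset.card_union_of_disjoint (hd.mono hJ hL')]
    · rwa [Finset.card_union_of_disjoint (hd.mono hI hL),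
        Finset.card_union_of_disjoint (hd.mono hJ hL')]
  have hexp : (D + 1) * (l + o) = D * (l + o) + (l + o) := by ring
  rcases lt_trichotomy I.card J.card with h | h | h
  · have := Nat.le_of_dvd (by omega) ((Nat.modEq_iff_dvd' h.le).1 hmod')
    exact key K K' hK hK' hs (by omega) (by omega)
  · have e : Sim l H (∅ : Finset V) ∅ := Sim.empty
    exact key ∅ ∅ (by simp) (by simp) e (by simp; omega) (by simp; omega)
  · have := Nat.le_of_dvd (by omega) ((Nat.modEq_iff_dvd' h.le).1 hmod'.symm)
    exact key K' K hK' hK hs.symm (by omega) (by omega)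

theorem exists_rich_balanced (l o d : ℕ) (hl : 0 < l) (ho : 0 < o) (hd : l + 1 ≤ d) {γ : ℝ}
    (hγ : 0 < γ) : ∃ Q : ℕ, ∀ (V : Type) [Fintype V] [DecidableEq V]
      (H : Finset (Finset V)), Deg H (2 * l + o) d γ → Q ≤ Fintype.card V → ∀ S : Finset V,
        S.card = l + o → Rich Q (Insertable l H S 0) := by
  obtain ⟨Q0, hQ0⟩ := exists_rich_insert l o d hl ho hd hγ (l + o)
  obtain ⟨Q1, hQ1⟩ := exists_rich_unit l o d hl ho hγ
  have key : ∀ D : ℕ, D ≤ Q0 → ∃ Q : ℕ, ∀ (V : Type) [Fintype V] [DecidableEq V]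
      (H : Finset (Finset V)), Deg H (2 * l + o) d γ → Q ≤ Fintype.card V → ∀ S : Finset V,
        S.card = l + o → Rich Q (Insertable l H S ((Q0 - D) * (l + o))) := by
    intro D
    induction D with
    | zero =>
      refine fun _ => ⟨Q0, fun V _ _ H hH hV S hS => (hQ0 V H hH hV S hS).card_le.imp ?_⟩
      rintro X ⟨⟨I, hI, J, hJ, dI, dJ, s⟩, hX⟩
      have h1 := (Finset.card_le_card hI).trans hX
      have h2 := (Finset.card_le_card hJ).trans hX
      have h3 : Q0 ≤ (Q0 - 0) * (l + o) := by
        rw [Nat.sub_zero]; exact Nat.le_mul_of_pos_right _ (by omega)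
      exact ⟨I, hI, J, hJ, dI, dJ, s, by omega, by omega⟩
    | succ D ih =>
      intro hD
      obtain ⟨Q, hQ⟩ := ih (by omega)
      refine ⟨8 * (Q + Q1 + (l + o) + 1) ^ 3, fun V _ _ H hH hV S hS => ?_⟩
      have hb := le_bind_bound Q Q1 (l + o)
      refine ((hQ V H hH (by omega) S hS).bind S (fun X _ _ _ => hQ1 V H hH (by omega)) hS.le
        le_rfl hV).imp ?_
      rintro Z ⟨X, Y, hXY, hd, hX, hY, -, -, hI, K, hK, K', hK', hc, hs⟩
      rw [show Q0 - D = (Q0 - (D + 1)) + 1 by omega] at hI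
      exact hI.balance hH.unif hS hXY hd hY hK hK' hc hs
  obtain ⟨Q, hQ⟩ := key Q0 le_rfl
  refine ⟨Q, fun V _ _ H hH hV S hS => ?_⟩
  have := hQ V H hH hV S hS
  rwa [Nat.sub_self, Nat.zero_mul] at this

/-- Every set of `ℓ + o` vertices has many absorbers. -/
theorem exists_rich_absorber (l o d : ℕ) (hl : 0 < l) (ho : 0 < o) (hd : l + 1 ≤ d) {γ : ℝ}
    (hγ : 0 < γ) : ∃ Q : ℕ, ∀ (V : Type) [Fintype V] [DecidableEq V]
      (H : Finset (Finset V)), Deg H (2 * l + o) d γ → Q ≤ Fintype.card V → ∀ S : Finset V,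
        S.card = l + o → Rich Q (fun X => ∃ A ⊆ X, Disjoint A S ∧ Sim l H A (A ∪ S)) := by
  obtain ⟨Q0, hQ0⟩ := exists_rich_balanced l o d hl ho hd hγ
  have hε : (0 : ℝ) < 1 / (8 * (Q0 + 1) ^ 3) := by positivity
  obtain ⟨Q1, hQ1⟩ := exists_rich_swap l o d hl ho (by omega) hγ hε
  choose Q2 hQ2 using fun p => exists_rich_swaps l Q1 p
  set Q3 := ∑ p ∈ Finset.range (2 * Q0 + 1), Q2 p with hQ3
  refine ⟨Q1 + 8 * (2 * Q0 + Q3 + (l + o) + 1) ^ 3, fun V _ _ H hH hV S hS => ?_⟩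
  have hb := le_bind_bound (2 * Q0) Q3 (l + o)
  have h1 := (hQ0 V H hH (by omega) S hS).pairs (G := fun x y => Rich Q1 (Swap l H x y))
    (upSet_insertable _ _ _ _) (hQ1 V H hH (by omega)) (by
      rw [div_mul_eq_mul_div, one_mul, div_le_one (by positivity)]
      have : (0 : ℝ) ≤ Q0 := Nat.cast_nonneg _
      gcongr
      linarith)
  have h2 := h1.bind (Q' := Q3) (R := fun X Y => ∃ I ⊆ X, ∃ J ⊆ X, Disjoint I S ∧ Disjoint J S ∧
      Sim l H (S ∪ I) J ∧ ∃ T ⊆ Y, Sim l H (I \ J ∪ T) (J \ I ∪ T)) S (by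
    rintro X ⟨⟨I, hI, J, hJ, dI, dJ, s, c1, c2⟩, hp⟩ hX -
    have hcard : I.card = J.card := by omega
    have e1 := Finset.card_sdiff_add_card_inter I J
    have e2 := Finset.card_sdiff_add_card_inter J I
    rw [Finset.inter_comm] at e2
    have e3 := (Finset.card_le_card hI).trans hX
    have hle : Q2 (I \ J).card ≤ Q3 :=
      Finset.single_le_sum (f := Q2) (fun _ _ => Nat.zero_le _) (by simp; omega)
    have := hQ2 (I \ J).card V H (by omega) (I \ J) (J \ I) rfl (by omega) (by
      intro x hx y hy
      simp only [Finset.mem_sdiff] at hx hy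
      exact hp x (hI hx.1) y (hJ hy.1) fun h => hx.2 (h ▸ hy.1))
    refine (this.mono ?_ hle).imp ?_
    · rintro X Y hXY ⟨T, hT, h⟩
      exact ⟨T, hT.trans hXY, h⟩
    · rintro Y ⟨T, hT, -, hs⟩
      exact ⟨I, hI, J, hJ, dI, dJ, s, T, hT, hs⟩) hS.le (Nat.le_add_left _ Q1) hV
  refine h2.imp ?_
  rintro Z ⟨X, Y, hXY, hd, hX, hY, -, -, -, I, hI, J, hJ, dI, dJ, s, T, hT, s'⟩
  have hXZ : X ⊆ Z := Finset.subset_union_left.trans hXY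
  have hYZ : Y ⊆ Z := Finset.subset_union_right.trans hXY
  refine ⟨J ∪ (I \ J ∪ T), Finset.union_subset (hJ.trans hXZ) (Finset.union_subset
    (Finset.sdiff_subset.trans (hI.trans hXZ)) (hT.trans hYZ)), ?_, ?_⟩
  · simp only [Finset.disjoint_union_left]
    exact ⟨dJ, dI.mono_left Finset.sdiff_subset, hY.mono_left hT⟩
  · have := s.symm.union s' (by
      rw [Finset.disjoint_union_right]
      exact ⟨Finset.disjoint_sdiff, hd.mono hJ hT⟩) (by
      simp only [Finset.disjoint_union_left, Finset.disjoint_union_right]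
      exact ⟨⟨dJ.symm.mono_right Finset.sdiff_subset, Finset.disjoint_sdiff⟩,
        (hY.mono_left hT).symm, hd.mono hI hT⟩)
    convert this using 1
    ext w
    simp only [Finset.mem_union, Finset.mem_sdiff]
    tauto

end absorber

section supply
variable {V : Type} [Fintype V] [DecidableEq V] {l o d : ℕ} {H : Finset (Finset V)} {γ : ℝ}

/-- Any two disjoint tuples are connected by a short path inside `R` avoiding any given set of
at most `f` vertices. -/
def Supply (l : ℕ) (H : Finset (Finset V)) (R : Finset V) (f Q : ℕ) : Prop :=
  ∀ S S' : Fin l → V, Function.Injective S → Function.Injective S' → Disjoint (im S) (im S') →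
    ∀ F : Finset V, F.card ≤ f → ∃ I ⊆ R, Disjoint I F ∧ I.card ≤ Q ∧ Conn H S S' I

theorem exists_supply_univ (l o d : ℕ) (hl : 0 < l) (ho : 0 < o) (hd : l + 1 ≤ d) {γ : ℝ}
    (hγ : 0 < γ) : ∃ Q : ℕ, ∀ (V : Type) [Fintype V] [DecidableEq V]
      (H : Finset (Finset V)), Deg H (2 * l + o) d γ → Q ≤ Fintype.card V → ∀ f : ℕ,
        2 * Q ^ 2 * (Q + f) ≤ Fintype.card V → Supply l H Finset.univ f Q := by
  obtain ⟨Q, hQ⟩ := exists_rich_link hl ho hd hγ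
  refine ⟨Q, fun V _ _ H hH hV f hf S S' hS hS' hSS F hF => ?_⟩
  obtain ⟨X, ⟨I, hI, hc⟩, hX, hXF⟩ := (hQ V H hH hV S S' hS hS' hSS).exists_avoid F
    (le_trans (by gcongr) hf)
  exact ⟨I, Finset.subset_univ _, hXF.mono_left hI, (Finset.card_le_card hI).trans hX, hc⟩

theorem Cov.mem {E : List ((Fin l → V) × (Fin l → V))} {q : (Fin l → V) × (Fin l → V)} :
    ∀ {A : Finset V}, Cov H A E → q ∈ E → ∃ B ⊆ A, LPath H q.1 q.2 B := by
  induction E with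
  | nil => intro A _ h; simp at h
  | cons p E ih =>
    rintro A ⟨B, C, h1, h2, h3, rfl⟩ hq
    rcases List.mem_cons.1 hq with rfl | hq
    · exact ⟨B, Finset.subset_union_left, h1⟩
    · obtain ⟨D, hD, h⟩ := ih h2 hq
      exact ⟨D, hD.trans Finset.subset_union_right, h⟩

theorem Cov.disjoint_ends {E : List ((Fin l → V) × (Fin l → V))}
    {p q : (Fin l → V) × (Fin l → V)} {A : Finset V} (h : Cov H A (p :: E)) (hq : q ∈ E) :
    Disjoint (im p.1 ∪ im p.2) (im q.1 ∪ im q.2) := by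
  obtain ⟨B, C, h1, h2, h3, rfl⟩ := h
  obtain ⟨D, hD, h⟩ := h2.mem hq
  exact h3.mono (Finset.union_subset h1.beg_subset h1.end_subset)
    ((Finset.union_subset h.beg_subset h.end_subset).trans hD)

theorem Cov.length_le (hl : 0 < l) {E : List ((Fin l → V) × (Fin l → V))} :
    ∀ {A : Finset V}, Cov H A E → E.length ≤ A.card := by
  induction E with
  | nil => simp
  | cons p E ih =>
    rintro A ⟨B, C, h1, h2, h3, rfl⟩
    have h4 := Finset.card_le_card h1.beg_subset
    rw [card_im _ h1.beg_injective, Fintype.card_fin] at h4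
    rw [Finset.card_union_of_disjoint h3, List.length_cons]
    have := ih h2
    omega

theorem Cov.flatMap {ι : Type} [DecidableEq ι] {B : ι → Finset V}
    {E : ι → List ((Fin l → V) × (Fin l → V))}
    {L : List ι} (hL : L.Nodup) (h : ∀ j ∈ L, Cov H (B j) (E j))
    (hd : ∀ i ∈ L, ∀ j ∈ L, i ≠ j → Disjoint (B i) (B j)) :
    Cov H (L.toFinset.biUnion B) (L.flatMap E) := by
  induction L with
  | nil => simp [Cov]
  | cons a L ih =>
    rw [List.nodup_cons] at hL
    rw [List.toFinset_cons, Finset.biUnion_insert, List.flatMap_cons]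
    refine (h a (by simp)).append (ih hL.2 (fun j hj => h j (by simp [hj]))
      fun i hi j hj => hd i (by simp [hi]) j (by simp [hj])) ?_
    rw [Finset.disjoint_biUnion_right]
    intro j hj
    rw [List.mem_toFinset] at hj
    exact hd a (by simp) j (by simp [hj]) fun h => hL.1 (h ▸ hj)

/-- Systems of paths with given ends are merged into a single path by connecting paths that do
not depend on the system. -/
theorem Supply.merge {R : Finset V} {f Q : ℕ} (h : Supply l H R f Q)
    {E : List ((Fin l → V) × (Fin l → V))} : ∀ {p : (Fin l → V) × (Fin l → V)} {A F : Finset V},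
    Cov H A (p :: E) → F.card + Q * E.length ≤ f → ∃ I ⊆ R, Disjoint I F ∧
      I.card ≤ Q * E.length ∧ ∀ A', Cov H A' (p :: E) → Disjoint A' I →
        LPath H p.1 ((p :: E).getLast (List.cons_ne_nil _ _)).2 (A' ∪ I) := by
  induction E with
  | nil =>
    intro p A F _ _
    refine ⟨∅, by simp, by simp, by simp, ?_⟩
    rintro A' ⟨B, C, h1, h2, h3, rfl⟩ -
    have : C = ∅ := h2
    subst this
    simpa using h1
  | cons q E ih =>
    intro p A F hA hf
    have hd := hA.disjoint_ends (q := q) (by simp)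
    obtain ⟨B, C, h1, h2, h3, rfl⟩ := hA
    rw [List.length_cons, mul_add, mul_one] at hf
    obtain ⟨I, hI, hIF, hIc, hp⟩ := ih (p := q) (F := F) h2 (by omega)
    obtain ⟨D, -, hq⟩ := h2.mem (q := q) (by simp)
    obtain ⟨I', hI', hIF', hIc', hc⟩ := h p.2 q.1 h1.end_injective hq.beg_injective
      (hd.mono Finset.subset_union_right Finset.subset_union_left) (F ∪ I)
      ((Finset.card_union_le _ _).trans (by omega))
    rw [Finset.disjoint_union_right] at hIF'
    refine ⟨I ∪ I', Finset.union_subset hI hI', Finset.disjoint_union_left.2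
      ⟨hIF, hIF'.1⟩, (Finset.card_union_le _ _).trans (by rw [List.length_cons, mul_add]; omega),
      ?_⟩
    rintro A' ⟨B', C', g1, g2, g3, rfl⟩ hd'
    simp only [Finset.disjoint_union_left, Finset.disjoint_union_right] at hd'
    have := g1.join hc (hp C' g2 hd'.1.2) (Finset.disjoint_union_right.2 ⟨g3, hd'.1.1⟩)
      (by
        simp only [Finset.disjoint_union_right]
        exact ⟨hd'.2.1.symm, hd'.2.2.symm, hIF'.2⟩)
    rw [List.getLast_cons (List.cons_ne_nil _ _)]
    convert this using 1
    ext x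
    simp only [Finset.mem_union]
    tauto

end supply

section selection

theorem eventually_log_le (a : ℕ) {c : ℝ} (hc : 0 < c) :
    ∃ N : ℕ, ∀ n : ℕ, N ≤ n → Real.log ((n : ℝ) ^ a) ≤ c * n := by
  have h := (Real.isLittleO_log_id_atTop.comp_tendsto tendsto_natCast_atTop_atTop).def
    (show 0 < c / (a + 1) by positivity)
  obtain ⟨N, hN⟩ := Filter.eventually_atTop.1 h
  refine ⟨N, fun n hn => ?_⟩
  have h1 := hN n hn
  simp only [Function.comp, id, Real.norm_eq_abs, Nat.abs_cast] at h1
  have h2 := (le_abs_self _).trans h1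
  rw [Real.log_pow]
  have hn0 : (0 : ℝ) ≤ n := Nat.cast_nonneg _
  have ha : (0 : ℝ) ≤ a := Nat.cast_nonneg _
  calc (a : ℝ) * Real.log n ≤ a * (c / (a + 1) * n) := by gcongr
    _ = c * n * (a / (a + 1)) := by ring
    _ ≤ c * n * 1 := by
      gcongr
      rw [div_le_one (by positivity)]
      linarith
    _ = c * n := mul_one _

theorem exists_nat_between {c : ℝ} (hc : 0 < c) : ∃ N : ℕ, ∀ n : ℕ, N ≤ n →
    ∃ J : ℕ, c / 2 * n ≤ J ∧ (J : ℝ) ≤ c * n := by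
  obtain ⟨N, hN⟩ := exists_nat_ge (2 / c)
  refine ⟨N, fun n hn => ⟨⌊c * n⌋₊, ?_, Nat.floor_le (by positivity)⟩⟩
  have h1 : (N : ℝ) ≤ n := by exact_mod_cast hn
  have h2 := hN.trans h1
  rw [div_le_iff₀ hc] at h2
  have := Nat.lt_floor_add_one (c * n)
  linarith

/-- Uniform version of the selection lemma: linearly many disjoint candidates can be chosen so
that every test is passed by a constant proportion of them. -/
theorem exists_selection (q a : ℕ) {β c : ℝ} (hβ0 : 0 < β) (hβ1 : β ≤ 1) (hc0 : 0 < c)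
    (hc : 16 * c * q ^ 2 ≤ β) : ∃ N : ℕ, ∀ (V G ι : Type) [Fintype V] [DecidableEq V]
      [Fintype G] [Nonempty G] [Fintype ι] (supp : G → Finset V) (good : ι → G → Prop),
      N ≤ Fintype.card V → (∀ g, (supp g).card ≤ q) →
      (∀ F : Finset V, pr (fun g => ¬ Disjoint (supp g) F) ≤ q * F.card / Fintype.card V) →
      Fintype.card ι ≤ Fintype.card V ^ a → (∀ i, β ≤ pr (good i)) →
      ∀ J : ℕ, c / 2 * Fintype.card V ≤ J → (J : ℝ) ≤ c * Fintype.card V →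
      ∃ g : Fin J → G, (∀ i j, i ≠ j → Disjoint (supp (g i)) (supp (g j))) ∧
        ∀ i, β / 2 * J ≤ ∑ j, ind (good i (g j)) := by
  obtain ⟨N1, hN1⟩ := eventually_log_le a (show 0 < β ^ 2 / 64 * (c / 2) by positivity)
  refine ⟨N1 + 1, fun V G ι _ _ _ _ _ supp good hV hs hconf hι hgood J hJge hJle => ?_⟩
  set n := Fintype.card V with hn
  have hn0 : (0 : ℝ) < n := by exact_mod_cast (by omega : 0 < n)
  have hlog : Real.log (Fintype.card ι) ≤ β ^ 2 / 64 * J := by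
    have h1 := hN1 n (by omega)
    rcases Nat.eq_zero_or_pos (Fintype.card ι) with h0 | h0
    · rw [h0]; simp; positivity
    · have h2 : Real.log (Fintype.card ι) ≤ Real.log ((n : ℝ) ^ a) :=
        Real.log_le_log (by exact_mod_cast h0) (by exact_mod_cast hι)
      have : β ^ 2 / 64 * (c / 2 * n) ≤ β ^ 2 / 64 * J := by gcongr
      linarith
  have hG : (0 : ℝ) < Fintype.card G := by simp [Fintype.card_pos]
  have hpr : ∀ P : G → Prop, ∑ g, (1 / (Fintype.card G : ℝ)) * ind (P g) = pr P := by
    intro P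
    rw [← Finset.mul_sum, pr]; ring
  have hsum : ∀ P : G → Prop, [DecidablePred P] → ∑ g with P g, (1 / (Fintype.card G : ℝ)) = pr P := by
    intro P _
    rw [← hpr, Finset.sum_filter]
    refine Finset.sum_congr rfl fun g _ => ?_
    by_cases h : P g <;> simp [ind, h]
  obtain ⟨g, hg1, -, hg2⟩ := exists_disjoint_sequence (fun _ : G => 1 / (Fintype.card G : ℝ))
    (fun _ => by positivity) (by simp) supp q J hs (c * q ^ 2) (β / 8)
    (by positivity) (by linarith) (by positivity) (by linarith) (by
      intro F hF
      rw [hsum]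
      refine (hconf F).trans ?_
      rw [div_le_iff₀ hn0]
      have hF' : (F.card : ℝ) ≤ J * q := by exact_mod_cast hF
      have hq0 : (0 : ℝ) ≤ q := Nat.cast_nonneg _
      calc (q : ℝ) * F.card ≤ q * (c * n * q) := by
            gcongr
            exact hF'.trans (by gcongr)
        _ = _ := by ring)
    (fun i g => ind (¬ good i g)) (fun _ _ => ind_nonneg _) (fun _ _ => ind_le_one _)
    (fun _ => 1 - β) (by
      intro i
      rw [hpr (fun g => ¬ good i g), pr_not]
      linarith [hgood i]) (fun _ => by linarith)
  refine ⟨g, hg1, fun i => ?_⟩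
  have h := hg2 i
  simp_rw [ind_not] at h
  rw [Finset.sum_sub_distrib] at h
  simp only [Finset.sum_const, Finset.card_univ, Fintype.card_fin, nsmul_eq_mul, mul_one] at h
  have h3 : Real.log (Fintype.card ι) / (β / 8) ≤ β / 8 * J := by
    rw [div_le_iff₀ (by positivity)]
    nlinarith
  have hJ0 : (0 : ℝ) ≤ J := Nat.cast_nonneg _
  nlinarith [mul_le_mul_of_nonneg_left hc hJ0]

end selection

section reservoir
variable {V : Type} [Fintype V] [DecidableEq V] {l o d : ℕ} {H : Finset (Finset V)} {γ : ℝ}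

theorem pr_not_disjoint_im {ι : Type} [Fintype ι] [DecidableEq ι] (F : Finset V) :
    pr (fun g : ι → V => ¬ Disjoint (im g) F) ≤ Fintype.card ι * F.card / Fintype.card V := by
  rcases isEmpty_or_nonempty V with hV | hV
  · rw [pr_of_forall_not]
    · positivity
    · intro g
      rw [Finset.eq_empty_of_isEmpty F]; simp
  have h := pr_exists_le (α := ι → V) Finset.univ fun i g => g i ∈ F
  refine (pr_mono fun g hg => ?_).trans (h.trans (le_of_eq ?_))
  · rw [Finset.not_disjoint_iff] at hg
    obtain ⟨v, hv, hF⟩ := hg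
    obtain ⟨i, rfl⟩ := mem_im.1 hv
    exact ⟨i, Finset.mem_univ _, hF⟩
  · rw [Finset.sum_congr rfl fun i _ => (pr_eval i fun v => v ∈ F).trans (pr_mem F)]
    simp; ring

/-- There is a small set, avoiding a given small set, through which many connections exist. -/
theorem exists_reservoir (l o d : ℕ) (hl : 0 < l) (ho : 0 < o) (hd : l + 1 ≤ d) {γ : ℝ}
    (hγ : 0 < γ) : ∃ Q : ℕ, ∃ α0 : ℝ, 0 < α0 ∧ ∀ α : ℝ, 0 < α → ∃ c : ℝ, 0 < c ∧
      ∃ N : ℕ, ∀ (V : Type) [Fintype V] [DecidableEq V]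
      (H : Finset (Finset V)), Deg H (2 * l + o) d γ → N ≤ Fintype.card V → ∀ A : Finset V,
        (A.card : ℝ) ≤ α0 * Fintype.card V → ∃ R : Finset V, Disjoint R A ∧
          (R.card : ℝ) ≤ α * Fintype.card V ∧
          ∀ f : ℕ, (f : ℝ) ≤ c * Fintype.card V → Supply l H R f Q := by
  obtain ⟨Q, hQ⟩ := exists_rich_link hl ho hd hγ
  have hQ1 : (0 : ℝ) < Q + 1 := by positivity
  set β : ℝ := 1 / (2 * (Q + 1)) with hβ
  have hβ0 : 0 < β := by positivity
  have hβ1 : β ≤ 1 := by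
    rw [hβ, div_le_one (by positivity)]
    linarith [(Nat.cast_nonneg Q : (0:ℝ) ≤ Q)]
  refine ⟨Q, β / (Q + 1), by positivity, fun α hα => ?_⟩
  set c : ℝ := min (α / (Q + 1)) (β / (16 * (Q + 1) ^ 2)) with hc
  have hc0 : 0 < c := by positivity
  obtain ⟨N, hN⟩ := exists_selection Q (2 * l) hβ0 hβ1 hc0 (by
    have h1 : c ≤ β / (16 * (Q + 1) ^ 2) := min_le_right _ _
    rw [le_div_iff₀ (by positivity)] at h1
    refine le_trans ?_ h1
    have : (Q : ℝ) ^ 2 ≤ (Q + 1) ^ 2 := by gcongr; linarith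
    nlinarith)
  obtain ⟨N2, hN2⟩ := exists_nat_between hc0
  refine ⟨β * c / 8, by positivity, N + N2 + Q + 1, fun V _ _ H hH hV A hA => ?_⟩
  set n := Fintype.card V with hn
  have hVn : Nonempty V := Fintype.card_pos_iff.1 (by omega)
  have hn0 : (0 : ℝ) < n := by exact_mod_cast (by omega : 0 < n)
  have hQ0 : (0 : ℝ) ≤ Q := Nat.cast_nonneg _
  obtain ⟨J, hJge, hJle⟩ := hN2 n (by omega)
  set OK : (Fin l → V) × (Fin l → V) → Prop := fun x => Function.Injective x.1 ∧
    Function.Injective x.2 ∧ Disjoint (im x.1) (im x.2) with hOK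
  obtain ⟨g, hg1, hg2⟩ := hN V (Fin Q → V) ((Fin l → V) × (Fin l → V)) im
    (fun x g => OK x → Link H x.1 x.2 (im g) ∧ Disjoint (im g) A) (by omega)
    (fun g => (card_im_le g).trans (by simp)) (fun F => by
      have := pr_not_disjoint_im (ι := Fin Q) F
      rwa [Fintype.card_fin] at this)
    (by simp; rw [← pow_add, two_mul]) (by
      intro x
      by_cases hx : OK x
      · simp only [hx, true_imp_iff]
        refine le_trans ?_ (pr_and_ge _ _)
        have h1 := (hQ V H hH (by omega) x.1 x.2 hx.1 hx.2.1 hx.2.2)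
        have h2 := pr_not_disjoint_im (ι := Fin Q) A
        have h3 : (Fintype.card (Fin Q) : ℝ) * A.card / n ≤ β := by
          rw [Fintype.card_fin, div_le_iff₀ hn0]
          calc (Q : ℝ) * A.card ≤ (Q + 1) * (β / (Q + 1) * n) := by
                gcongr; linarith
            _ = β * n := by field_simp
        have h4 : 2 * β ≤ 1 / Q := by
          have : (0 : ℝ) < Q := by exact_mod_cast h1.1
          rw [hβ, mul_one_div, div_le_div_iff₀ (by positivity) this]
          linarith
        have := h1.2
        linarith
      · simp only [hx, false_imp_iff]
        rw [pr_of_forall fun _ => trivial]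
        exact hβ1) J hJge hJle
  refine ⟨(Finset.univ.filter fun j => Disjoint (im (g j)) A).biUnion fun j => im (g j), ?_, ?_, ?_⟩
  · rw [Finset.disjoint_biUnion_left]
    intro j hj
    exact (Finset.mem_filter.1 hj).2
  · have h1 : ((Finset.univ.filter fun j => Disjoint (im (g j)) A).biUnion fun j => im (g j)).card
        ≤ J * Q := by
      refine (Finset.card_biUnion_le_card_mul _ _ Q fun j _ => (card_im_le _).trans
        (by simp)).trans ?_
      gcongr
      exact (Finset.card_filter_le _ _).trans (by simp)
    have h2 : (J : ℝ) * Q ≤ α * n := by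
      have h3 : c ≤ α / (Q + 1) := min_le_left _ _
      rw [le_div_iff₀ hQ1] at h3
      calc (J : ℝ) * Q ≤ c * n * (Q + 1) := by gcongr; linarith
        _ = c * (Q + 1) * n := by ring
        _ ≤ _ := by gcongr
    exact le_trans (by exact_mod_cast h1) h2
  · intro f hf S S' hS hS' hSS F hF
    have h1 := hg2 (S, S')
    have hx : OK (S, S') := ⟨hS, hS', hSS⟩
    simp only [hx, true_imp_iff] at h1
    have h2 : ∃ j, (Link H S S' (im (g j)) ∧ Disjoint (im (g j)) A) ∧ Disjoint (im (g j)) F := by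
      by_contra hcon
      push Not at hcon
      have h3 : ∀ j, ind (Link H S S' (im (g j)) ∧ Disjoint (im (g j)) A) ≤
          ∑ v ∈ F, ind (v ∈ im (g j)) := by
        intro j
        by_cases h : Link H S S' (im (g j)) ∧ Disjoint (im (g j)) A
        · obtain ⟨v, hv, hF'⟩ := Finset.not_disjoint_iff.1 (hcon j h)
          refine (ind_le_one _).trans ?_
          rw [← ind_of hv]
          exact Finset.single_le_sum (f := fun v => ind (v ∈ im (g j)))
            (fun _ _ => ind_nonneg _) hF'
        · rw [ind_of_not h]
          exact Finset.sum_nonneg fun _ _ => ind_nonneg _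
      have h4 := h1.trans (Finset.sum_le_sum fun j _ => h3 j)
      rw [Finset.sum_comm] at h4
      have h5 : ∀ v ∈ F, ∑ j, ind (v ∈ im (g j)) ≤ 1 := by
        intro v _
        by_cases h : ∃ j, v ∈ im (g j)
        · obtain ⟨j, hj⟩ := h
          rw [Finset.sum_eq_single j]
          · exact ind_le_one _
          · intro b _ hb
            exact ind_of_not fun hv => Finset.disjoint_left.1 (hg1 b j hb) hv hj
          · simp
        · push Not at h
          rw [Finset.sum_eq_zero fun j _ => ind_of_not (h j)]
          norm_num
      have h6 := h4.trans (Finset.sum_le_card_nsmul _ _ _ h5)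
      rw [nsmul_eq_mul, mul_one] at h6
      have h7 : (F.card : ℝ) ≤ β * c / 8 * n := le_trans (by exact_mod_cast hF) hf
      have h8 : β / 2 * (c / 2 * n) ≤ β / 2 * J := by gcongr
      have h9 : 0 < β * c * n := by positivity
      nlinarith
    obtain ⟨j, ⟨⟨I, hI, hc⟩, hA'⟩, hF'⟩ := h2
    refine ⟨I, hI.trans ?_, hF'.mono_left hI, (Finset.card_le_card hI).trans
      ((card_im_le _).trans (by simp)), hc⟩
    exact Finset.subset_biUnion_of_mem (fun j => im (g j)) (by simp [hA'])

end reservoir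

section absorbing
variable {V : Type} [Fintype V] [DecidableEq V] {l o d : ℕ} {H : Finset (Finset V)} {γ : ℝ}

/-- A set is distributed over absorbers when every part of it has many absorbers. -/
theorem exists_absorb {ι : Type} [DecidableEq ι] (I : Finset ι) (A : ι → Finset V)
    (E : ι → List ((Fin l → V) × (Fin l → V))) (hE : ∀ j ∈ I, Cov H (A j) (E j)) {s M : ℕ}
    (hM : ∀ S : Finset V, S.card = s → ∃ I' ⊆ I, M ≤ I'.card ∧ ∀ j ∈ I', Cov H (A j ∪ S) (E j)) :
    ∀ m ≤ M, ∀ U : Finset V, U.card = m * s → ∃ T : ι → Finset V,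
      (∀ j ∈ I, Cov H (A j ∪ T j) (E j)) ∧ (∀ i ∈ I, ∀ j ∈ I, i ≠ j → Disjoint (T i) (T j)) ∧
      I.biUnion T = U ∧ (I.filter fun j => T j ≠ ∅).card ≤ m := by
  intro m
  induction m with
  | zero =>
    intro _ U hU
    rw [Nat.zero_mul, Finset.card_eq_zero] at hU
    subst hU
    refine ⟨fun _ => ∅, by simpa using hE, by simp, ?_, by simp⟩
    ext; simp
  | succ m ih =>
    intro hm U hU
    obtain ⟨S, hS, hSc⟩ := Finset.exists_subset_card_eq (s := U) (n := s)
      (by rw [hU]; exact Nat.le_mul_of_pos_left _ (by omega))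
    obtain ⟨T, h1, h2, h3, h4⟩ := ih (by omega) (U \ S) (by
      rw [Finset.card_sdiff_of_subset hS, hU, hSc, Nat.add_mul, one_mul, Nat.add_sub_cancel])
    obtain ⟨I', hI', hc, hI⟩ := hM S hSc
    obtain ⟨j, hj, hjT⟩ := Finset.exists_mem_notMem_of_card_lt_card
      (s := I.filter fun j => T j ≠ ∅) (t := I') (by omega)
    have hjI := hI' hj
    have hTj : T j = ∅ := by
      by_contra h
      exact hjT (Finset.mem_filter.2 ⟨hjI, h⟩)
    have hdT : ∀ i ∈ I, Disjoint (T i) S := fun i hi =>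
      Finset.sdiff_disjoint.mono_left (h3 ▸ Finset.subset_biUnion_of_mem T hi)
    refine ⟨Function.update T j S, ?_, ?_, ?_, ?_⟩
    · intro i hi
      by_cases h : i = j
      · subst h; rw [Function.update_self]; exact hI i hj
      · rw [Function.update_of_ne h]; exact h1 i hi
    · intro a ha b hb hab
      by_cases haj : a = j
      · subst haj
        rw [Function.update_self, Function.update_of_ne (Ne.symm hab)]
        exact (hdT b hb).symm
      · rw [Function.update_of_ne haj]
        by_cases hbj : b = j
        · subst hbj; rw [Function.update_self]; exact hdT a ha
        · rw [Function.update_of_ne hbj]; exact h2 a ha b hb hab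
    · rw [← Finset.sdiff_union_of_subset hS, ← h3]
      ext v
      simp only [Finset.mem_biUnion, Finset.mem_union]
      constructor
      · rintro ⟨i, hi, hv⟩
        by_cases h : i = j
        · subst h; rw [Function.update_self] at hv; exact Or.inr hv
        · rw [Function.update_of_ne h] at hv; exact Or.inl ⟨i, hi, hv⟩
      · rintro (⟨i, hi, hv⟩ | hv)
        · refine ⟨i, hi, ?_⟩
          have : i ≠ j := by rintro rfl; simp [hTj] at hv
          rwa [Function.update_of_ne this]
        · exact ⟨j, hjI, by rwa [Function.update_self]⟩
    · refine (Finset.card_le_card (t := insert j (I.filter fun j => T j ≠ ∅)) ?_).trans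
        ((Finset.card_insert_le _ _).trans (by omega))
      intro i hi
      rw [Finset.mem_filter] at hi
      by_cases h : i = j
      · simp [h]
      · rw [Function.update_of_ne h] at hi
        simp [hi.1, hi.2]

/-- Patterns of systems of paths on a tuple of `q` vertices. -/
abbrev Pattern (l q : ℕ) : Type :=
  Finset (Fin q) × (Σ p : Fin (q + 1), Fin p → (Fin l → Fin q) × (Fin l → Fin q))

/-- The list of ends of a pattern. -/
def Pattern.ends {q : ℕ} (x : Pattern l q × (Fin q → V)) : List ((Fin l → V) × (Fin l → V)) :=
  List.ofFn fun i => (x.2 ∘ (x.1.2.2 i).1, x.2 ∘ (x.1.2.2 i).2)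

/-- The vertex set of a pattern. -/
def Pattern.verts {q : ℕ} (x : Pattern l q × (Fin q → V)) : Finset V := x.1.1.image x.2

theorem exists_pattern (hl : 0 < l) {q : ℕ} (g : Fin q → V) {A : Finset V} (hA : A ⊆ im g)
    {E : List ((Fin l → V) × (Fin l → V))} (hE : Cov H A E) :
    ∃ x : Pattern l q, Pattern.ends (x, g) = E ∧ Pattern.verts (x, g) = A := by
  have hlen : E.length < q + 1 := by
    have := hE.length_le hl
    have := Finset.card_le_card hA
    have := card_im_le g
    rw [Fintype.card_fin] at this
    omega
  have hpre : ∀ p ∈ E, ∃ y : (Fin l → Fin q) × (Fin l → Fin q), (g ∘ y.1, g ∘ y.2) = p := by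
    intro p hp
    obtain ⟨B, hB, hP⟩ := hE.mem hp
    have h1 : ∀ i, ∃ j, g j = p.1 i := fun i =>
      mem_im.1 (hA (hB (hP.beg_subset (mem_im_self _ i))))
    have h2 : ∀ i, ∃ j, g j = p.2 i := fun i =>
      mem_im.1 (hA (hB (hP.end_subset (mem_im_self _ i))))
    choose y1 hy1 using h1
    choose y2 hy2 using h2
    exact ⟨(y1, y2), Prod.ext (funext hy1) (funext hy2)⟩
  choose y hy using hpre
  refine ⟨(Finset.univ.filter fun j => g j ∈ A, ⟨⟨E.length, hlen⟩, fun i => y (E.get i) (List.get_mem _ _)⟩), ?_, ?_⟩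
  · refine List.ext_get (by simp [Pattern.ends]) fun i h1 h2 => ?_
    simp only [Pattern.ends, List.get_ofFn]
    exact hy _ (List.get_mem _ _)
  · ext v
    simp only [Pattern.verts, Finset.mem_image, Finset.mem_filter, Finset.mem_univ, true_and]
    constructor
    · rintro ⟨j, hj, rfl⟩; exact hj
    · intro hv
      obtain ⟨j, rfl⟩ := mem_im.1 (hA hv)
      exact ⟨j, hv, rfl⟩

/-- There is a short path which can absorb any small set of the right divisibility. -/
theorem exists_absorbing_path (l o d : ℕ) (hl : 0 < l) (ho : 0 < o) (hd : l + 1 ≤ d) {γ : ℝ}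
    (hγ : 0 < γ) {α : ℝ} (hα : 0 < α) : ∃ α' : ℝ, 0 < α' ∧ ∃ N : ℕ,
      ∀ (V : Type) [Fintype V] [DecidableEq V] (H : Finset (Finset V)),
      Deg H (2 * l + o) d γ → N ≤ Fintype.card V → ∃ (A : Finset V) (b e : Fin l → V),
        LPath H b e A ∧ (A.card : ℝ) ≤ α * Fintype.card V ∧
        ∀ U : Finset V, Disjoint U A → (l + o) ∣ U.card → (U.card : ℝ) ≤ α' * Fintype.card V →
          LPath H b e (A ∪ U) := by
  obtain ⟨Q, hQ⟩ := exists_rich_absorber l o d hl ho hd hγ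
  obtain ⟨Q', hQ'⟩ := exists_supply_univ l o d hl ho hd hγ
  set K := Fintype.card (Pattern l Q) with hK
  have hK0 : (0 : ℝ) < K := by
    have : Nonempty (Pattern l Q) := ⟨(∅, ⟨0, fun i => i.elim0⟩)⟩
    exact_mod_cast Fintype.card_pos
  set β : ℝ := 1 / (Q + 1) / (K + 1) with hβ
  have hβ0 : 0 < β := by positivity
  have hQ0 : (0 : ℝ) ≤ Q := Nat.cast_nonneg _
  have hQ0' : (0 : ℝ) ≤ Q' := Nat.cast_nonneg _
  have hβ1 : β ≤ 1 := by
    rw [hβ, div_div, div_le_one (by positivity)]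
    nlinarith
  set c : ℝ := min (min (α / ((Q + 1) * (Q' + 1))) (β / (16 * (Q + 1) ^ 2)))
    (1 / (4 * (Q' + 1) ^ 3 * (Q + 1))) with hc
  have hc0 : 0 < c := by positivity
  have hc1 : c * ((Q + 1) * (Q' + 1)) ≤ α := by
    have h1 : c ≤ α / ((Q + 1) * (Q' + 1)) := (min_le_left _ _).trans (min_le_left _ _)
    rwa [le_div_iff₀ (by positivity)] at h1
  have hc2 : 16 * c * Q ^ 2 ≤ β := by
    have h1 : c ≤ β / (16 * (Q + 1) ^ 2) := (min_le_left _ _).trans (min_le_right _ _)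
    rw [le_div_iff₀ (by positivity)] at h1
    refine le_trans ?_ h1
    have : (Q : ℝ) ^ 2 ≤ (Q + 1) ^ 2 := by gcongr; linarith
    nlinarith
  have hc3 : c * (4 * (Q' + 1) ^ 3 * (Q + 1)) ≤ 1 := by
    have h1 : c ≤ 1 / (4 * (Q' + 1) ^ 3 * (Q + 1)) := min_le_right _ _
    rwa [le_div_iff₀ (by positivity)] at h1
  obtain ⟨N1, hN1⟩ := exists_nat_between hc0
  obtain ⟨N2, hN2⟩ := exists_selection Q (l + o) hβ0 hβ1 hc0 hc2
  refine ⟨β / 2 * (c / 2), by positivity,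
    N1 + N2 + Q + Q' + 4 * Q' ^ 3 + l + o + 1, fun V _ _ H hH hV => ?_⟩
  set n := Fintype.card V with hn
  have hn0 : (0 : ℝ) < n := by exact_mod_cast (by omega : 0 < n)
  have hVn : Nonempty V := Fintype.card_pos_iff.1 (by omega)
  obtain ⟨J, hJge, hJle⟩ := hN1 n (by omega)
  have hJ0 : (0 : ℝ) < J := lt_of_lt_of_le (by positivity) hJge
  set good : {S : Finset V // S.card = l + o} → Pattern l Q × (Fin Q → V) → Prop := fun S x =>
    Cov H (Pattern.verts x) (Pattern.ends x) ∧ Cov H (Pattern.verts x ∪ S.1) (Pattern.ends x)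
    with hgood
  have hpat : Nonempty (Pattern l Q) := ⟨(∅, ⟨0, fun i => i.elim0⟩)⟩
  obtain ⟨g, hg1, hg2⟩ := hN2 V (Pattern l Q × (Fin Q → V)) {S : Finset V // S.card = l + o}
    (fun x => im x.2) good (by omega) (fun x => (card_im_le _).trans (by simp)) (fun F => by
      have h1 := pr_not_disjoint_im (ι := Fin Q) F
      rw [Fintype.card_fin] at h1
      exact pr_prod_le_of_forall (P := fun (_ : Pattern l Q) g => ¬ Disjoint (im g) F)
        (by positivity) fun _ => h1)
    (by
      rw [Fintype.card_finset_len]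
      exact Nat.choose_le_pow _ _) (by
      intro S
      rw [pr_prod (fun a b => good S (a, b)), ← hK, le_div_iff₀ hK0]
      have h1 := hQ V H hH (by omega) S.1 S.2
      have h2 := pr_exists_le (α := Fin Q → V) Finset.univ fun a b => good S (a, b)
      refine le_trans ?_ h2
      refine le_trans ?_ (h1.2.trans (pr_mono ?_))
      · have hQpos : (0 : ℝ) < Q := by exact_mod_cast h1.1
        rw [hβ, div_mul_eq_mul_div, div_le_iff₀ (by positivity)]
        have : 1 / ((Q : ℝ) + 1) ≤ 1 / Q := by gcongr; linarith
        have h3 : 0 < 1 / ((Q : ℝ) + 1) := by positivity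
        have h4 : 0 < 1 / (Q : ℝ) := by positivity
        calc 1 / ((Q : ℝ) + 1) * K ≤ 1 / Q * K := by gcongr
          _ ≤ 1 / Q * (K + 1) := by gcongr; linarith
      · rintro g ⟨A, hA, -, E, hE1, hE2⟩
        obtain ⟨x, hx1, hx2⟩ := exists_pattern hl g hA hE1
        exact ⟨x, Finset.mem_univ _, by simp only [hgood, hx1, hx2]; exact ⟨hE1, hE2⟩⟩)
      J hJge hJle
  classical
  set I : Finset (Fin J) := Finset.univ.filter fun j =>
    Cov H (Pattern.verts (g j)) (Pattern.ends (g j)) with hI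
  set A : Fin J → Finset V := fun j => Pattern.verts (g j) with hA
  set E : Fin J → List ((Fin l → V) × (Fin l → V)) := fun j => Pattern.ends (g j) with hE
  have hAim : ∀ j, A j ⊆ im (g j).2 := fun j => Finset.image_subset_image (Finset.subset_univ _)
  have hAd : ∀ i ∈ I, ∀ j ∈ I, i ≠ j → Disjoint (A i) (A j) := fun i _ j _ hij =>
    (hg1 i j hij).mono (hAim i) (hAim j)
  have hcov : ∀ j ∈ I, Cov H (A j) (E j) := fun j hj => (Finset.mem_filter.1 hj).2
  have hmany : ∀ S : Finset V, S.card = l + o → ∃ I' ⊆ I, ⌈β / 2 * J⌉₊ ≤ I'.card ∧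
      ∀ j ∈ I', Cov H (A j ∪ S) (E j) := by
    intro S hS
    have h1 := hg2 ⟨S, hS⟩
    rw [sum_ind_eq_card] at h1
    refine ⟨_, ?_, Nat.ceil_le.2 h1, ?_⟩
    · intro j hj
      exact Finset.mem_filter.2 ⟨Finset.mem_univ _, (Finset.mem_filter.1 hj).2.1⟩
    · intro j hj
      exact (Finset.mem_filter.1 hj).2.2
  have hall := Cov.flatMap (H := H) (E := E) I.nodup_toList (B := A)
    (fun j hj => hcov j (Finset.mem_toList.1 hj))
    (fun i hi j hj => hAd i (Finset.mem_toList.1 hi) j (Finset.mem_toList.1 hj))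
  rw [Finset.toList_toFinset] at hall
  have hcard : (I.biUnion A).card ≤ J * Q := by
    refine (Finset.card_biUnion_le_card_mul _ _ Q fun j _ =>
      (Finset.card_le_card (hAim j)).trans ((card_im_le _).trans (by simp))).trans ?_
    gcongr
    exact (Finset.card_le_univ _).trans (by simp)
  have hne : I.toList.flatMap E ≠ [] := by
    obtain ⟨S, -, hS⟩ := Finset.exists_subset_card_eq (s := (Finset.univ : Finset V)) (n := l + o)
      (by rw [Finset.card_univ]; omega)
    obtain ⟨I', hI', hc', hj⟩ := hmany S hS
    have h1 : 0 < I'.card := lt_of_lt_of_le (Nat.ceil_pos.2 (by positivity)) hc'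
    obtain ⟨j, hj'⟩ := Finset.card_pos.1 h1
    intro h
    rw [List.flatMap_eq_nil_iff] at h
    have h2 := h j (Finset.mem_toList.2 (hI' hj'))
    have h3 := hj j hj'
    rw [h2] at h3
    have h4 : A j ∪ S = ∅ := h3
    rw [Finset.union_eq_empty] at h4
    rw [h4.2] at hS
    simp at hS
    omega
  obtain ⟨p, Et, hEt⟩ := List.exists_cons_of_ne_nil hne
  rw [hEt] at hall
  have hlen := hall.length_le hl
  rw [List.length_cons] at hlen
  have hJQ : (J : ℝ) * ((Q + 1) * (Q' + 1)) ≤ c * n * ((Q + 1) * (Q' + 1)) := by gcongr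
  obtain ⟨L, -, hLF, hLc, hL⟩ := (hQ' V H hH (by omega) (J * Q + Q' * (J * Q)) (by
    have h1 : (J : ℝ) * (4 * (Q' + 1) ^ 3 * (Q + 1)) ≤ n := by
      calc (J : ℝ) * (4 * (Q' + 1) ^ 3 * (Q + 1)) ≤ c * n * (4 * (Q' + 1) ^ 3 * (Q + 1)) := by
            gcongr
        _ = c * (4 * (Q' + 1) ^ 3 * (Q + 1)) * n := by ring
        _ ≤ 1 * n := by gcongr
        _ = n := one_mul _
    have h2 : (4 : ℝ) * Q' ^ 3 ≤ n := by exact_mod_cast (by omega)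
    have h3 : (2 : ℝ) * Q' ^ 2 * (Q' + (J * Q + Q' * (J * Q))) ≤ n := by
      have h4 : (4 : ℝ) * (Q' ^ 2 * (J * Q + Q' * (J * Q))) ≤ J * (4 * (Q' + 1) ^ 3 * (Q + 1)) := by
        have e : (4 : ℝ) * (Q' ^ 2 * (J * Q + Q' * (J * Q))) = J * (4 * (Q' ^ 2 * (Q' + 1)) * Q) := by
          ring
        rw [e]
        gcongr
        · nlinarith
        · linarith
      nlinarith
    exact_mod_cast h3)).merge (F := I.biUnion A) hall (by
      gcongr
      exact (by omega : Et.length ≤ _).trans hcard)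
  refine ⟨I.biUnion A ∪ L, p.1, _, hL _ hall hLF.symm, ?_, ?_⟩
  · have h1 : (I.biUnion A ∪ L).card ≤ J * Q + Q' * (J * Q) := by
      refine (Finset.card_union_le _ _).trans (Nat.add_le_add hcard (hLc.trans ?_))
      gcongr
      exact (by omega : Et.length ≤ _).trans hcard
    have h2 : ((I.biUnion A ∪ L).card : ℝ) ≤ J * Q + Q' * (J * Q) := by exact_mod_cast h1
    have h3 : c * ((Q + 1) * (Q' + 1)) * n ≤ α * n := by gcongr
    nlinarith
  · rintro U hU ⟨m, hm⟩ hUc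
    rw [Finset.disjoint_union_right] at hU
    have hlo : 1 ≤ l + o := by omega
    have hmM : m ≤ ⌈β / 2 * J⌉₊ := by
      have h1 : (m : ℝ) ≤ U.card := by
        rw [hm]; exact_mod_cast Nat.le_mul_of_pos_left _ hlo
      have h2 : β / 2 * (c / 2 * n) ≤ β / 2 * J := by gcongr
      have h3 : (m : ℝ) ≤ ⌈β / 2 * J⌉₊ := le_trans (by linarith) (Nat.le_ceil _)
      exact_mod_cast h3
    obtain ⟨T, hT1, hT2, hT3, -⟩ := exists_absorb I A E hcov hmany m hmM U (by rw [hm, mul_comm])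
    have hTU : ∀ j ∈ I, T j ⊆ U := fun j hj => hT3 ▸ Finset.subset_biUnion_of_mem T hj
    have hdAT : ∀ i ∈ I, ∀ j ∈ I, Disjoint (A i) (T j) := fun i hi j hj =>
      hU.1.symm.mono (Finset.subset_biUnion_of_mem A hi) (hTU j hj)
    have hall' := Cov.flatMap (H := H) (E := E) I.nodup_toList (B := fun j => A j ∪ T j)
      (fun j hj => hT1 j (Finset.mem_toList.1 hj)) (by
        intro i hi j hj hij
        rw [Finset.mem_toList] at hi hj
        simp only [Finset.disjoint_union_left, Finset.disjoint_union_right]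
        have := hAd i hi j hj hij
        have := hT2 i hi j hj hij
        have := hdAT i hi j hj
        have := (hdAT j hj i hi).symm
        tauto)
    rw [Finset.toList_toFinset, hEt] at hall'
    have hun : (I.biUnion fun j => A j ∪ T j) = I.biUnion A ∪ U := by
      rw [← hT3]
      ext v
      simp only [Finset.mem_biUnion, Finset.mem_union]
      constructor
      · rintro ⟨j, hj, h | h⟩
        · exact Or.inl ⟨j, hj, h⟩
        · exact Or.inr ⟨j, hj, h⟩
      · rintro (⟨j, hj, h⟩ | ⟨j, hj, h⟩)
        · exact ⟨j, hj, Or.inl h⟩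
        · exact ⟨j, hj, Or.inr h⟩
    rw [hun] at hall'
    have := hL _ hall' (Finset.disjoint_union_left.2 ⟨hLF.symm, hU.2⟩)
    rwa [Finset.union_right_comm] at this

end absorbing

section sampling
variable {V : Type} [Fintype V] [DecidableEq V]

/-- The lower tail of a sum of independent random variables with values in `[0, 1]`. -/
theorem pr_sum_lower {κ : Type} [Fintype κ] [DecidableEq κ] [Nonempty V] (ψ : V → ℝ)
    (h0 : ∀ v, 0 ≤ ψ v) (h1 : ∀ v, ψ v ≤ 1) {ε : ℝ} (hε : 0 < ε) (hε1 : ε ≤ 1) :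
    pr (fun x : κ → V => ∑ u, ψ (x u) ≤
      Fintype.card κ * ((∑ v, ψ v) / Fintype.card V - ε)) ≤
        Real.exp (-(Fintype.card κ * ε ^ 2 / 4)) := by
  classical
  set μ := (∑ v, ψ v) / Fintype.card V with hμ
  set r : ℝ := (Fintype.card κ : ℝ) with hr
  set t := ε / 2 with ht
  have hV : (0 : ℝ) < Fintype.card V := by exact_mod_cast Fintype.card_pos
  have hpt : ∀ v, Real.exp (-(t * ψ v)) ≤ 1 - t * ψ v + t ^ 2 := by
    intro v
    have ha : 0 ≤ t * ψ v := mul_nonneg (by linarith) (h0 v)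
    have hb : t * ψ v ≤ t := mul_le_of_le_one_right (by linarith) (h1 v)
    have := Real.abs_exp_sub_one_sub_id_le (x := -(t * ψ v)) (by rw [abs_neg, abs_of_nonneg ha]; linarith)
    have h2 := (abs_le.1 this).2
    nlinarith
  have hsum : ∑ v, Real.exp (-(t * ψ v)) ≤ Fintype.card V * Real.exp (t ^ 2 - t * μ) := by
    calc ∑ v, Real.exp (-(t * ψ v)) ≤ ∑ v, (1 - t * ψ v + t ^ 2) := Finset.sum_le_sum fun v _ => hpt v
      _ = Fintype.card V * (1 + (t ^ 2 - t * μ)) := by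
        rw [Finset.sum_add_distrib, Finset.sum_sub_distrib, ← Finset.mul_sum, hμ]
        simp only [Finset.sum_const, Finset.card_univ, nsmul_eq_mul]
        field_simp
        ring
      _ ≤ _ := by
        gcongr
        linarith [Real.add_one_le_exp (t ^ 2 - t * μ)]
  have hprod : ∑ x : κ → V, Real.exp (-(t * ∑ u, ψ (x u))) = (∑ v, Real.exp (-(t * ψ v))) ^ Fintype.card κ := by
    rw [← Finset.card_univ, ← Finset.prod_const, Finset.prod_univ_sum]
    simp only [Fintype.piFinset_univ]
    refine Finset.sum_congr rfl fun x _ => ?_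
    rw [← Real.exp_sum, Finset.mul_sum, Finset.sum_neg_distrib]
  have hind : ∀ x : κ → V, ind (∑ u, ψ (x u) ≤ r * (μ - ε)) ≤
      Real.exp (-(t * ∑ u, ψ (x u))) * Real.exp (t * (r * (μ - ε))) := by
    intro x
    rw [← Real.exp_add]
    by_cases h : ∑ u, ψ (x u) ≤ r * (μ - ε)
    · rw [ind_of h, Real.one_le_exp_iff]
      have : t * ∑ u, ψ (x u) ≤ t * (r * (μ - ε)) := mul_le_mul_of_nonneg_left h (by linarith)
      linarith
    · rw [ind_of_not h]; positivity
  rw [pr, Fintype.card_fun, Nat.cast_pow, div_le_iff₀ (by positivity)]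
  calc ∑ x : κ → V, ind (∑ u, ψ (x u) ≤ r * (μ - ε)) ≤
        ∑ x : κ → V, Real.exp (-(t * ∑ u, ψ (x u))) * Real.exp (t * (r * (μ - ε))) :=
        Finset.sum_le_sum fun x _ => hind x
    _ = (∑ v, Real.exp (-(t * ψ v))) ^ Fintype.card κ * Real.exp (t * (r * (μ - ε))) := by
        rw [← Finset.sum_mul, hprod]
    _ ≤ (Fintype.card V * Real.exp (t ^ 2 - t * μ)) ^ Fintype.card κ *
          Real.exp (t * (r * (μ - ε))) := by
        gcongr
    _ = _ := by
        rw [mul_pow, ← Real.exp_nat_mul, mul_assoc, ← Real.exp_add, mul_comm]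
        congr 2
        rw [ht, hr]
        ring

/-- The probability that `j` random vertices complete `A` to an edge. -/
noncomputable def dens (H : Finset (Finset V)) (j : ℕ) (A : Finset V) : ℝ :=
  pr (fun g : Fin j → V => A ∪ im g ∈ H)

variable {H : Finset (Finset V)}

theorem dens_nonneg (j : ℕ) (A : Finset V) : 0 ≤ dens H j A := pr_nonneg _

theorem dens_le_one (j : ℕ) (A : Finset V) : dens H j A ≤ 1 := pr_le_one _

theorem dens_succ (j : ℕ) (A : Finset V) :
    dens H (j + 1) A = (∑ v, dens H j (insert v A)) / Fintype.card V := by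
  have h := pr_prod (fun (v : V) (g : Fin j → V) => insert v A ∪ im g ∈ H)
  rw [dens]
  simp only [dens]
  rw [← h, ← pr_equiv (Fin.consEquiv fun _ => V)]
  refine pr_congr fun x => ?_
  have : A ∪ im ((Fin.consEquiv fun _ => V) x) = insert x.1 A ∪ im x.2 := by
    ext v
    simp only [Finset.mem_union, mem_im, Finset.mem_insert, Fin.exists_fin_succ, Fin.consEquiv]
    simp [eq_comm]
    tauto
  exact iff_of_eq (congrArg (· ∈ H) this)

theorem dens_zero (A : Finset V) : dens H 0 A = ind (A ∈ H) := by
  rw [dens, pr]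
  simp [im]

/-- The sample `x` represents all densities well. -/
def Typical (H : Finset (Finset V)) (q m s : ℕ) (ε : ℝ) (x : Fin s → V) : Prop :=
  ∀ j < m, ∀ a : Fin q → Fin s, ((s : ℝ) - q) * (dens H (j + 1) (im (x ∘ a)) - ε) ≤
    ∑ u, dens H j (insert (x u) (im (x ∘ a)))

theorem pr_not_typical [Nonempty V] {q s : ℕ} (hq : q ≤ s) (m : ℕ) {ε : ℝ} (hε : 0 < ε)
    (hε1 : ε ≤ 1) : pr (fun x : Fin s → V => ¬ Typical H q m s ε x) ≤
      m * s ^ q * Real.exp (-((s - q) * ε ^ 2 / 4)) := by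
  classical
  have hone : ∀ (j : ℕ) (a : Fin q → Fin s),
      pr (fun x : Fin s → V => ¬ ((s : ℝ) - q) * (dens H (j + 1) (im (x ∘ a)) - ε) ≤
        ∑ u, dens H j (insert (x u) (im (x ∘ a)))) ≤ Real.exp (-((s - q) * ε ^ 2 / 4)) := by
    intro j a
    set e : {u // u ∈ im a} → Fin s := Subtype.val with he
    have hcard : (s : ℝ) - q ≤ Fintype.card {u // ¬ ∃ i, e i = u} := by
      have h1 : Fintype.card {u // ¬ ∃ i, e i = u} = s - (im a).card := by
        rw [Fintype.card_subtype_compl, Fintype.card_fin]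
        congr 1
        have E : {u // ∃ i, e i = u} ≃ {u // u ∈ im a} :=
          (Equiv.ofInjective e Subtype.val_injective).symm
        rw [Fintype.card_congr E, Fintype.card_coe]
      have h2 := card_im_le a
      rw [Fintype.card_fin] at h2
      rw [h1, sub_le_iff_le_add]
      exact_mod_cast (by omega : s ≤ s - (im a).card + q)
    set a' : Fin q → {u // u ∈ im a} := fun i => ⟨a i, mem_im_self _ i⟩ with ha'
    have h1 := pr_split (V := V) e Subtype.val_injective
      (fun y (z : {u // ¬ ∃ i, e i = u} → V) => ∑ u, dens H j (insert (z u) (im (y ∘ a'))) ≤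
        Fintype.card {u // ¬ ∃ i, e i = u} *
          ((∑ v, dens H j (insert v (im (y ∘ a')))) / Fintype.card V - ε))
    refine (pr_mono fun x hx => ?_).trans (h1.le.trans (pr_prod_le_of_forall
      (P := fun y (z : {u // ¬ ∃ i, e i = u} → V) => ∑ u, dens H j (insert (z u) (im (y ∘ a'))) ≤
        Fintype.card {u // ¬ ∃ i, e i = u} *
          ((∑ v, dens H j (insert v (im (y ∘ a')))) / Fintype.card V - ε))
        (by positivity) fun y => ?_))
    swap
    · have h3 := pr_sum_lower (κ := {u // ¬ ∃ i, e i = u})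
        (fun v => dens H j (insert v (im (y ∘ a'))))
        (fun v => dens_nonneg _ _) (fun v => dens_le_one _ _) hε hε1
      refine le_trans (le_of_eq ?_) (h3.trans ?_)
      · congr!
      · gcongr
    rw [← dens_succ]
    rw [not_le] at hx
    have hcomp : (x ∘ e) ∘ a' = x ∘ a := rfl
    rw [hcomp]
    have hq' : (q : ℝ) ≤ s := by exact_mod_cast hq
    have hle : ∑ u : {u // ¬ ∃ i, e i = u}, dens H j (insert (x u.1) (im (x ∘ a))) ≤
        ∑ u, dens H j (insert (x u) (im (x ∘ a))) := by
      rw [← Fintype.sum_subtype_add_sum_subtype (fun u => ∃ i, e i = u)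
        fun u => dens H j (insert (x u) (im (x ∘ a)))]
      exact le_add_of_nonneg_left (Finset.sum_nonneg fun _ _ => dens_nonneg _ _)
    refine hle.trans (hx.le.trans ?_)
    by_cases hs : dens H (j + 1) (im (x ∘ a)) - ε ≤ 0
    · have h3 : ((s : ℝ) - q) * (dens H (j + 1) (im (x ∘ a)) - ε) ≤ 0 :=
        mul_nonpos_of_nonneg_of_nonpos (sub_nonneg.2 hq') hs
      have h4 : 0 ≤ ∑ u, dens H j (insert (x u) (im (x ∘ a))) :=
        Finset.sum_nonneg fun _ _ => dens_nonneg _ _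
      exact absurd (hx.trans_le h3) h4.not_gt
    · exact mul_le_mul_of_nonneg_right hcard (le_of_not_ge hs)
  have h2 : pr (fun x : Fin s → V => ¬ Typical H q m s ε x) ≤ pr (fun x : Fin s → V =>
      ∃ ja ∈ (Finset.univ : Finset (Fin m × (Fin q → Fin s))),
        ¬ ((s : ℝ) - q) * (dens H (ja.1 + 1) (im (x ∘ ja.2)) - ε) ≤
        ∑ u, dens H ja.1 (insert (x u) (im (x ∘ ja.2)))) := by
    refine pr_mono fun x hx => ?_
    simp only [Typical, not_forall] at hx
    obtain ⟨j, hj, a, h⟩ := hx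
    exact ⟨(⟨j, hj⟩, a), Finset.mem_univ _, h⟩
  refine h2.trans ((pr_exists_le _ _).trans ((Finset.sum_le_card_nsmul _ _ _
    fun ja _ => hone ja.1 ja.2).trans (le_of_eq ?_)))
  simp [Fintype.card_prod, nsmul_eq_mul]

end sampling

section sampling
variable {V : Type} [Fintype V] [DecidableEq V] {H : Finset (Finset V)}

/-- The hypergraph induced on a sample of vertices. -/
def smp (H : Finset (Finset V)) (K : ℕ) {s : ℕ} (x : Fin s → V) : Finset (Finset (Fin s)) :=
  Finset.univ.filter fun e => e.image x ∈ H ∧ e.card = K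

theorem im_eq_of_card_le {q : ℕ} {A : Finset V} (hA : A.Nonempty) (hq : A.card ≤ q) :
    ∃ a : Fin q → V, im a = A := by
  obtain ⟨v, hv⟩ := hA
  refine ⟨fun i => if h : i.1 < A.card then (A.equivFin.symm ⟨i, h⟩ : V) else v, ?_⟩
  ext x
  rw [mem_im]
  constructor
  · rintro ⟨i, rfl⟩
    split_ifs with h
    · exact (A.equivFin.symm ⟨i, h⟩).2
    · exact hv
  · intro hx
    refine ⟨⟨A.equivFin ⟨x, hx⟩, (A.equivFin ⟨x, hx⟩).2.trans_le hq⟩, ?_⟩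
    simp

theorem im_comp {ι : Type} [Fintype ι] {W : Type} [DecidableEq W] (x : V → W) (a : ι → V) :
    im (x ∘ a) = (im a).image x := by
  rw [im, im, Finset.image_image]

theorem Typical.dens_le {q m s : ℕ} {ε : ℝ} {x : Fin s → V} (hx : Typical H q m s ε x)
    (hs : q ≤ s) (hs0 : 0 < s) (hε : 0 ≤ ε) (hH : ∀ e ∈ H, e.card = q) :
    ∀ j ≤ m, ∀ A : Finset (Fin s), A.Nonempty → A.card + j ≤ q →
      dens H j (A.image x) - j * (ε + q / s) ≤ dens (smp H q x) j A := by
  intro j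
  induction j with
  | zero =>
    intro _ A hA hq
    rw [dens_zero, dens_zero, Nat.cast_zero, zero_mul, sub_zero]
    refine ind_mono fun h => ?_
    rw [smp, Finset.mem_filter]
    refine ⟨Finset.mem_univ _, h, le_antisymm (by omega) ?_⟩
    rw [← hH _ h]
    exact Finset.card_image_le
  | succ j ih =>
    intro hj A hA hq
    obtain ⟨a, ha⟩ := im_eq_of_card_le (q := q) hA (by omega)
    have h1 := hx j (by omega) a
    rw [im_comp, ha] at h1
    have hsp : (0 : ℝ) < s := by exact_mod_cast hs0
    have hqs : (q : ℝ) ≤ s := by exact_mod_cast hs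
    have h2 : ∑ u, (dens H j (insert (x u) (A.image x)) - j * (ε + q / s)) ≤
        ∑ u, dens (smp H q x) j (insert u A) := by
      refine Finset.sum_le_sum fun u _ => ?_
      rw [← Finset.image_insert]
      refine ih (by omega) _ (Finset.insert_nonempty _ _) ?_
      have := Finset.card_insert_le u A
      omega
    rw [dens_succ (V := Fin s), Fintype.card_fin, le_div_iff₀ hsp]
    rw [Finset.sum_sub_distrib, Finset.sum_const, Finset.card_univ, Fintype.card_fin,
      nsmul_eq_mul] at h2
    have h3 := dens_le_one (H := H) (j + 1) (A.image x)
    have h4 := dens_nonneg (H := H) (j + 1) (A.image x)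
    have h5 : (s : ℝ) * (q / s) = q := by field_simp
    have h6 : (s : ℝ) * dens H (j + 1) (A.image x) - q - s * ε ≤
        ((s : ℝ) - q) * (dens H (j + 1) (A.image x) - ε) := by
      have : 0 ≤ (q : ℝ) * ε := by positivity
      have : (q : ℝ) * dens H (j + 1) (A.image x) ≤ q := mul_le_of_le_one_right (by positivity) h3
      linarith
    push_cast
    have h7 : (dens H (j + 1) (A.image x) - ((j : ℝ) + 1) * (ε + q / s)) * s =
        s * dens H (j + 1) (A.image x) - s * ε - s * (q / s) - s * (j * (ε + q / s)) := by ring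
    rw [h7, h5]
    linarith

theorem card_im_eq (m : ℕ) {T : Finset V} (hT : T.card = m) :
    (Finset.univ.filter fun g : Fin m → V => im g = T).card = m.factorial := by
  classical
  have hc : Fintype.card (Fin m) = Fintype.card T := by simp [hT]
  have h1 : Fintype.card (Fin m ≃ T) = m.factorial := by
    rw [Fintype.card_equiv (Fintype.equivOfCardEq hc), Fintype.card_fin]
  rw [← h1, ← Finset.card_univ]
  symm
  refine Finset.card_nbij (fun σ i => (σ i).1) ?_ ?_ ?_
  · intro σ _
    rw [Finset.mem_coe, Finset.mem_filter]
    refine ⟨Finset.mem_univ _, ?_⟩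
    ext v
    rw [mem_im]
    constructor
    · rintro ⟨i, rfl⟩; exact (σ i).2
    · intro hv; exact ⟨σ.symm ⟨v, hv⟩, by simp⟩
  · intro σ _ σ' _ h
    ext i
    exact congrFun h i
  · intro g hg
    rw [Finset.mem_coe, Finset.mem_filter] at hg
    have hg := hg.2
    have hinj : Function.Injective g := injective_of_card_im (by rw [hg, hT, Fintype.card_fin])
    refine ⟨Equiv.ofBijective (fun i => ⟨g i, hg ▸ mem_im_self g i⟩) ?_, by simp, rfl⟩
    rw [Fintype.bijective_iff_injective_and_card]
    exact ⟨fun i j h => hinj (congrArg Subtype.val h), hc⟩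

/-- Degrees count sets, densities count tuples. -/
theorem dens_eq_hDeg {n d m : ℕ} {G : Finset (Finset (Fin n))} (hG : IsKGraph n (d + m) G)
    {D : Finset (Fin n)} (hD : D.card = d) :
    dens G m D * n ^ m = m.factorial * hDeg n (d + m) G D := by
  classical
  set 𝒯 : Finset (Finset (Fin n)) := Finset.univ.filter fun T => T.card = m ∧ Disjoint D T ∧ D ∪ T ∈ G
  have h1 : hDeg n (d + m) G D = 𝒯.card := by
    rw [hDeg, Nat.card_eq_fintype_card, hD, Nat.add_sub_cancel_left, Fintype.card_subtype]
  have h2 : (Finset.univ.filter fun g : Fin m → Fin n => D ∪ im g ∈ G).card = 𝒯.card * m.factorial := by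
    rw [Finset.card_eq_sum_card_fiberwise (f := fun g => im g) (t := 𝒯)]
    · rw [← smul_eq_mul, ← Finset.sum_const]
      refine Finset.sum_congr rfl fun T hT => ?_
      rw [Finset.mem_filter] at hT
      rw [← card_im_eq m hT.2.1, Finset.filter_filter]
      congr 1
      ext g
      simp only [Finset.mem_filter, Finset.mem_univ, true_and, and_iff_right_iff_imp]
      intro h
      rw [h]; exact hT.2.2.2
    · intro g hg
      rw [Finset.mem_coe, Finset.mem_filter] at hg
      have h3 := hG _ hg.2
      have h4 := card_im_le g
      rw [Fintype.card_fin] at h4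
      have h5 := Finset.card_union_add_card_inter D (im g)
      change im g ∈ 𝒯
      rw [Finset.mem_filter]
      refine ⟨Finset.mem_univ _, by omega, ?_, hg.2⟩
      rw [Finset.disjoint_iff_inter_eq_empty, ← Finset.card_eq_zero]
      omega
  rcases Nat.eq_zero_or_pos n with rfl | hn
  · rw [dens, pr, sum_ind_eq_card, h2, h1]
    rcases Nat.eq_zero_or_pos m with rfl | hm
    · simp
    · have : 𝒯 = ∅ := by
        rw [Finset.filter_eq_empty_iff]
        rintro T - ⟨hT, -⟩
        have := Finset.card_le_univ T
        rw [Fintype.card_fin] at this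
        omega
      simp [this]
  · have : (n : ℝ) ≠ 0 := by positivity
    rw [dens, pr, sum_ind_eq_card, h2, h1, Fintype.card_fun, Fintype.card_fin, Fintype.card_fin]
    push_cast
    field_simp

theorem le_minDeg {n k d : ℕ} (hd : d ≤ n) {G : Finset (Finset (Fin n))} {b : ℕ}
    (h : ∀ D : Finset (Fin n), D.card = d → b ≤ hDeg n k G D) : b ≤ minDeg n k d G := by
  obtain ⟨D, -, hD⟩ := Finset.exists_subset_card_eq (s := (Finset.univ : Finset (Fin n))) (n := d)
    (by simpa using hd)
  refine le_csInf ⟨_, D, hD, rfl⟩ ?_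
  rintro _ ⟨D, hD, rfl⟩
  exact h D hD

theorem minDeg_le {n k d : ℕ} {G : Finset (Finset (Fin n))} {D : Finset (Fin n)}
    (hD : D.card = d) : minDeg n k d G ≤ hDeg n k G D :=
  Nat.sInf_le ⟨D, hD, rfl⟩

end sampling

/-- A fractional tiling with copies of two edges sharing `2 * l` vertices, given by a list of
edges whose vertices are weighted by their load. -/
def FracTile (l o : ℕ) {s : ℕ} (G : Finset (Finset (Fin s))) (β : ℝ) : Prop :=
  ∃ (J : Type) (_ : Fintype J) (_ : Nonempty J) (S S' : J → Fin l → Fin s)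
    (O : J → Finset (Fin s)),
    (∀ j, im (S j) ∪ O j ∪ im (S' j) ∈ G ∧ (O j).card = o) ∧
    ∀ u, ∑ j, (2 * ind (u ∈ O j) + ind (u ∈ im (S j)) + ind (u ∈ im (S' j))) ≤
      β * Fintype.card J

/-- Density `τ` forces nearly perfect fractional tilings. -/
def FracHyp (l o d m : ℕ) (τ : ℝ) : Prop :=
  ∀ η : ℝ, 0 < η → ∀ s₀ : ℕ, ∃ s ≥ s₀, ∀ G : Finset (Finset (Fin s)),
    (∀ e ∈ G, e.card = 2 * l + o) → (∀ D : Finset (Fin s), D.card = d → τ ≤ dens G m D) →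
      FracTile l o G (2 * (1 + η) * (l + o) / s)

/-- A symmetric probability distribution on edges with small loads and no concentration. -/
def Spread {V : Type} [Fintype V] [DecidableEq V] (l o : ℕ) (H : Finset (Finset V))
    (b C : ℝ) : Prop :=
  ∃ (Y : Type) (_ : Fintype Y) (p : Y → ℝ) (S S' : Y → Fin l → V) (O : Y → Finset V) (σ : Y ≃ Y),
    (∀ y, 0 ≤ p y) ∧ ∑ y, p y = 1 ∧
    (∀ y, im (S y) ∪ O y ∪ im (S' y) ∈ H ∧ (O y).card = o) ∧
    (∀ y, p (σ y) = p y ∧ S (σ y) = S' y ∧ S' (σ y) = S y ∧ O (σ y) = O y) ∧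
    (∀ v, ∑ y, p y * (ind (v ∈ O y) + ind (v ∈ im (S' y))) ≤ b) ∧
    (∀ a v, ∑ y, p y * ind (S y = a ∧ v ∈ O y ∪ im (S' y)) ≤
      C / (Fintype.card V : ℝ) ^ (l + 1)) ∧
    ∀ a a' v, ∑ y, p y * ind (S y = a ∧ S' y = a' ∧ v ∈ O y) ≤
      C / (Fintype.card V : ℝ) ^ (2 * l + 1)

theorem exists_exp_small (q m : ℕ) {c ζ : ℝ} (hc : 0 < c) (hζ : 0 < ζ) :
    ∃ N : ℕ, ∀ s ≥ N, (m : ℝ) * (s : ℝ) ^ q * Real.exp (-((s - q) * c)) ≤ ζ := by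
  have h1 := (isLittleO_pow_exp_pos_mul_atTop q hc).comp_tendsto tendsto_natCast_atTop_atTop
  have h2 := h1.bound (c := ζ / ((m + 1) * Real.exp (q * c))) (by positivity)
  obtain ⟨N, hN⟩ := Filter.eventually_atTop.1 h2
  refine ⟨N, fun s hs => ?_⟩
  have h3 := hN s hs
  simp only [Function.comp, Real.norm_eq_abs, abs_pow, Nat.abs_cast, Real.abs_exp] at h3
  have h4 : Real.exp (-((s - q) * c)) = Real.exp (q * c) / Real.exp (c * s) := by
    rw [← Real.exp_sub]; congr 1; ring
  rw [h4]
  rw [div_mul_eq_mul_div, le_div_iff₀ (by positivity)] at h3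
  rw [← mul_div_assoc, div_le_iff₀ (Real.exp_pos _)]
  refine le_trans ?_ h3
  have : (0 : ℝ) ≤ s ^ q * Real.exp (q * c) := by positivity
  nlinarith

section spread
variable {V : Type} [Fintype V] [DecidableEq V] {H : Finset (Finset V)}

/-- A sample of bounded size rarely contains a given tuple. -/
theorem pr_hit [Nonempty V] {ι : Type} [Fintype ι] (s : ℕ) (w : ι → V) :
    pr (fun x : Fin s → V => ∃ e : ι → Fin s, Function.Injective e ∧ x ∘ e = w) ≤
      (s : ℝ) ^ Fintype.card ι / (Fintype.card V : ℝ) ^ Fintype.card ι := by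
  classical
  have h1 : pr (fun x : Fin s → V => ∃ e ∈ (Finset.univ : Finset (ι → Fin s)),
      Function.Injective e ∧ x ∘ e = w) ≤ _ := pr_exists_le _ _
  refine (pr_mono fun x ⟨e, he⟩ => ⟨e, Finset.mem_univ _, he⟩).trans (h1.trans ?_)
  refine (Finset.sum_le_card_nsmul _ _ (1 / (Fintype.card V : ℝ) ^ Fintype.card ι)
    fun e _ => ?_).trans (le_of_eq ?_)
  · by_cases he : Function.Injective e
    · refine (pr_mono fun x hx => hx.2).trans (((pr_proj e he fun y => y = w)).le.trans ?_)
      rw [pr, sum_ind_eq_card, Finset.filter_eq' Finset.univ w]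
      simp
    · rw [pr_of_forall_not fun x hx => he hx.1]
      positivity
  · rw [nsmul_eq_mul, Finset.card_univ, Fintype.card_fun, Fintype.card_fin, mul_one_div]
    push_cast; rfl

theorem sum_sigma_le {X : Type} [Fintype X] {J : X → Type} [∀ x, Fintype (J x)]
    [∀ x, Nonempty (J x)] (F : (x : X) → J x × Bool → ℝ) (c : ℝ) (E : X → Prop)
    (h : ∀ x, ∑ y, F x y ≤ 2 * Fintype.card (J x) * (c * ind (E x))) :
    ∑ y : Σ x, J x × Bool, 1 / (Fintype.card X * (2 * Fintype.card (J y.1)) : ℝ) * F y.1 y.2 ≤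
      c * pr E := by
  rw [Fintype.sum_sigma, pr, ← mul_div_assoc, Finset.mul_sum, Finset.sum_div]
  refine Finset.sum_le_sum fun x _ => ?_
  have hX : (0 : ℝ) < Fintype.card X := by exact_mod_cast Fintype.card_pos_iff.2 ⟨x⟩
  have hJ : (0 : ℝ) < Fintype.card (J x) := by exact_mod_cast Fintype.card_pos
  have hs : ∑ y : J x × Bool, 1 / (Fintype.card X * (2 * Fintype.card (J x)) : ℝ) * F x y =
      1 / (Fintype.card X * (2 * Fintype.card (J x)) : ℝ) * ∑ y, F x y :=
    (Finset.mul_sum _ _ _).symm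
  refine hs.le.trans ?_
  rw [one_div_mul_eq_div, div_le_div_iff₀ (by positivity) hX]
  have := mul_le_mul_of_nonneg_right (h x) hX.le
  linarith

theorem pr_subtype_le {Z : Type} [Fintype Z] (P E : Z → Prop) [DecidablePred P] {a : ℝ}
    (ha : a < 1) (hP : 1 - a ≤ pr P) :
    pr (fun z : {z // P z} => E z.1) ≤ pr E / (1 - a) := by
  classical
  have hZ : Nonempty Z := nonempty_of_pr_pos (lt_of_lt_of_le (by linarith) hP)
  have hZ0 : (0 : ℝ) < Fintype.card Z := by exact_mod_cast Fintype.card_pos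
  have h1 : (Fintype.card {z // P z} : ℝ) = pr P * Fintype.card Z := by
    rw [pr, sum_ind_eq_card, Fintype.card_subtype]
    field_simp
  have h2 : ∑ z : {z // P z}, ind (E z.1) ≤ pr E * Fintype.card Z := by
    rw [pr, div_mul_cancel₀ _ hZ0.ne', ← Fintype.sum_subtype_add_sum_subtype P fun z => ind (E z)]
    exact le_add_of_nonneg_right (Finset.sum_nonneg fun _ _ => ind_nonneg _)
  rw [pr, h1]
  have h3 : 0 < pr P := lt_of_lt_of_le (by linarith) hP
  rw [div_le_div_iff₀ (by positivity) (by linarith)]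
  have h4 := mul_le_mul_of_nonneg_right h2 (by linarith : (0 : ℝ) ≤ 1 - a)
  refine h4.trans ?_
  have h5 : 0 ≤ pr E * Fintype.card Z := mul_nonneg (pr_nonneg _) hZ0.le
  nlinarith

end spread

section spread
variable {V : Type} [DecidableEq V] {l o : ℕ}

/-- The parts of an edge whose number of vertices is as large as possible. -/
theorem edge_parts {S S' : Fin l → V} {O : Finset V}
    (h : (im S ∪ O ∪ im S').card = 2 * l + o) (hO : O.card = o) :
    Function.Injective S ∧ Function.Injective S' ∧ Disjoint O (im S) ∧ Disjoint O (im S') ∧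
      Disjoint (im S) (im S') := by
  have h1 := Finset.card_union_add_card_inter (im S ∪ O) (im S')
  have h2 := Finset.card_union_add_card_inter (im S) O
  have h3 := card_im_le S
  have h4 := card_im_le S'
  rw [Fintype.card_fin] at h3 h4
  have h5 : Disjoint (im S ∪ O) (im S') := by
    rw [Finset.disjoint_iff_inter_eq_empty, ← Finset.card_eq_zero]; omega
  have h6 : Disjoint (im S) O := by
    rw [Finset.disjoint_iff_inter_eq_empty, ← Finset.card_eq_zero]; omega
  rw [Finset.disjoint_union_left] at h5
  exact ⟨injective_of_card_im (by rw [Fintype.card_fin]; omega),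
    injective_of_card_im (by rw [Fintype.card_fin]; omega), h6.symm, h5.2, h5.1⟩

theorem injective_sum_elim {ι κ W : Type} [Fintype ι] [Fintype κ] [DecidableEq W] {f : ι → W}
    {g : κ → W} (hf : Function.Injective f) (hg : Function.Injective g)
    (h : Disjoint (im f) (im g)) : Function.Injective (Sum.elim f g) :=
  hf.sumElim hg fun i j hij => Finset.disjoint_left.1 h (mem_im_self f i)
    (hij ▸ mem_im_self g j)

theorem pr_good {l o d m : ℕ} {γ a : ℝ} (hγ : 0 < γ) (ha : 0 < a) (hdm : d + m = 2 * l + o)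
    (hd : 1 ≤ d) : ∃ s₀ : ℕ, ∀ s ≥ s₀, ∃ N : ℕ, ∀ (V : Type) [Fintype V] [DecidableEq V]
      (H : Finset (Finset V)), N ≤ Fintype.card V → (∀ e ∈ H, e.card = 2 * l + o) →
      ∀ τ, (∀ D : Finset V, D.card = d → τ + γ ≤ dens H m D) → ∃ P : (Fin s → V) → Prop,
        1 - a ≤ pr P ∧ ∀ x, P x → Function.Injective x ∧
          ∀ D : Finset (Fin s), D.card = d → τ ≤ dens (smp H (2 * l + o) x) m D := by
  set q := 2 * l + o with hq
  set ε := min 1 (γ / (2 * (m + 1))) with hε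
  have hε0 : 0 < ε := lt_min one_pos (by positivity)
  have hε1 : ε ≤ 1 := min_le_left _ _
  have hε2 : m * ε ≤ γ / 2 := by
    have h1 : ε ≤ γ / (2 * (m + 1)) := min_le_right _ _
    rw [le_div_iff₀ (by positivity)] at h1
    nlinarith
  obtain ⟨s₁, hs₁⟩ := exists_exp_small q m (c := ε ^ 2 / 4) (ζ := a / 2) (by positivity)
    (by positivity)
  obtain ⟨s₂, hs₂⟩ := exists_nat_ge (2 * m * q / γ)
  refine ⟨max s₁ (max s₂ (q + 1)), fun s hs => ?_⟩
  simp only [ge_iff_le, max_le_iff] at hs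
  obtain ⟨N, hN⟩ := exists_nat_ge (2 * s ^ 2 / a : ℝ)
  refine ⟨max N 1, fun V _ _ H hV hH τ hτ => ?_⟩
  rw [max_le_iff] at hV
  have : Nonempty V := Fintype.card_pos_iff.1 hV.2
  have hn : (0 : ℝ) < Fintype.card V := by exact_mod_cast hV.2
  refine ⟨fun x => Function.Injective x ∧ Typical H q m s ε x, ?_, fun x hx => ⟨hx.1, ?_⟩⟩
  · have h1 := pr_and_ge (fun x : Fin s → V => Function.Injective x) (Typical H q m s ε)
    have h2 := pr_not_typical (V := V) (H := H) (q := q) (s := s) (by omega) m hε0 hε1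
    have h3 := pr_collision (V := V) (ι := Fin s) ∅
    rw [pr_not] at h3
    simp only [Finset.disjoint_empty_right, and_true, Fintype.card_fin, Finset.card_empty,
      Nat.cast_zero, add_zero] at h3
    have h4 := hs₁ s hs.1
    have h5 : (s * s : ℝ) / Fintype.card V ≤ a / 2 := by
      have : (2 * s ^ 2 / a : ℝ) ≤ Fintype.card V := hN.trans (by exact_mod_cast hV.1)
      rw [div_le_iff₀ ha] at this
      rw [div_le_iff₀ hn]
      nlinarith
    have h6 : -((s - q : ℝ) * (ε ^ 2 / 4)) = -((s - q) * ε ^ 2 / 4) := by ring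
    rw [h6] at h4
    linarith
  · intro D hD
    have hs0 : (0 : ℝ) < s := by exact_mod_cast (by omega : 0 < s)
    have h1 := hx.2.dens_le (by omega) (by omega) hε0.le hH m le_rfl D
      (Finset.card_pos.1 (by omega)) (by omega)
    have h2 := hτ (D.image x) (by rw [Finset.card_image_of_injective _ hx.1, hD])
    have h3 : (m : ℝ) * (q / s) ≤ γ / 2 := by
      have h4 : (2 * m * q / γ : ℝ) ≤ s := hs₂.trans (by exact_mod_cast hs.2.1)
      rw [div_le_iff₀ hγ] at h4
      rw [← mul_div_assoc, div_le_iff₀ hs0]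
      linarith
    nlinarith

theorem exists_spread (l o d m : ℕ) (hdm : d + m = 2 * l + o) (hd : 1 ≤ d) {τ γ η : ℝ}
    (hτ : FracHyp l o d m τ) (hγ : 0 < γ) (hη : 0 < η) :
    ∃ C : ℝ, 0 < C ∧ ∃ N : ℕ, ∀ (V : Type) [Fintype V] [DecidableEq V] (H : Finset (Finset V)),
      (∀ e ∈ H, e.card = 2 * l + o) → (∀ D : Finset V, D.card = d → τ + γ ≤ dens H m D) →
      N ≤ Fintype.card V → Spread l o H ((1 + η) * (l + o) / Fintype.card V) C := by
  classical
  set a : ℝ := min η 1 / 4 with ha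
  have ha0 : 0 < a := by have := lt_min hη one_pos; positivity
  have ha1 : a ≤ 1 / 4 := by have := min_le_right η 1; linarith
  have haη : (1 + a) / (1 - a) ≤ 1 + η := by
    have := min_le_left η 1
    rw [div_le_iff₀ (by linarith)]
    nlinarith
  obtain ⟨s₀, hs₀⟩ := pr_good (l := l) (o := o) (d := d) (m := m) hγ ha0 hdm hd
  obtain ⟨s, hs, hfrac⟩ := hτ a ha0 (max s₀ 1)
  obtain ⟨N, hN⟩ := hs₀ s ((le_max_left _ _).trans hs)
  have hs1 : 1 ≤ s := (le_max_right _ _).trans hs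
  have hs1' : (1 : ℝ) ≤ s := by exact_mod_cast hs1
  refine ⟨2 * (s : ℝ) ^ (2 * l + 1), by positivity, max N 1, fun V _ _ H hH hdeg hV => ?_⟩
  rw [max_le_iff] at hV
  have : Nonempty V := Fintype.card_pos_iff.1 hV.2
  have hn : (0 : ℝ) < Fintype.card V := by exact_mod_cast hV.2
  obtain ⟨P, hP, hgood⟩ := hN V H hV.1 hH τ hdeg
  have hX : Nonempty {x // P x} := by
    have : Nonempty (Fin s → V) := inferInstance
    obtain ⟨x, hx⟩ := exists_of_pr_pos (lt_of_lt_of_le (by linarith) hP)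
    exact ⟨⟨x, hx⟩⟩
  have hft : ∀ x : {x // P x}, FracTile l o (smp H (2 * l + o) x.1)
      (2 * (1 + a) * (l + o) / s) := fun x => hfrac _ (fun e he => (Finset.mem_filter.1 he).2.2)
        (hgood x.1 x.2).2
  choose J iF iN S S' O hedge hload using hft
  have hxinj : ∀ x : {x // P x}, Function.Injective x.1 := fun x => (hgood x.1 x.2).1
  have hmem : ∀ x j, (im (S x j) ∪ O x j ∪ im (S' x j)).image x.1 ∈ H ∧
      (im (S x j) ∪ O x j ∪ im (S' x j)).card = 2 * l + o := fun x j =>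
    (Finset.mem_filter.1 (hedge x j).1).2
  have hparts := fun x j => edge_parts (hmem x j).2 (hedge x j).2
  have hXpos : (0 : ℝ) < Fintype.card {x // P x} := by exact_mod_cast Fintype.card_pos
  have hJpos : ∀ x, (0 : ℝ) < Fintype.card (J x) := fun x => by exact_mod_cast Fintype.card_pos
  set T : (x : {x // P x}) → J x × Bool → Fin l → V := fun x y =>
    x.1 ∘ (bif y.2 then S' x y.1 else S x y.1) with hT
  set T' : (x : {x // P x}) → J x × Bool → Fin l → V := fun x y =>
    x.1 ∘ (bif y.2 then S x y.1 else S' x y.1) with hT'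
  have hpr : ∀ E : (Fin s → V) → Prop, ∀ c : ℝ, pr E ≤ c →
      pr (fun x : {x // P x} => E x.1) ≤ c / (1 - a) := fun E c hc =>
    (pr_subtype_le P E (by linarith) hP).trans (by gcongr; linarith)
  refine ⟨Σ x : {x // P x}, J x × Bool, inferInstance,
    fun y => 1 / (Fintype.card {x // P x} * (2 * Fintype.card (J y.1))),
    fun y => T y.1 y.2, fun y => T' y.1 y.2,
    fun y => (O y.1 y.2.1).image y.1.1,
    Equiv.sigmaCongrRight fun x => (Equiv.refl (J x)).prodCongr Equiv.boolNot,
    fun y => by positivity, ?_, ?_, ?_, ?_, ?_, ?_⟩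
  · rw [Fintype.sum_sigma]
    have hone : ∀ x : {x // P x}, ∑ _y : J x × Bool,
        1 / (Fintype.card {x // P x} * (2 * Fintype.card (J x)) : ℝ) =
          1 / Fintype.card {x // P x} := by
      intro x
      have := hJpos x
      rw [Finset.sum_const, Finset.card_univ, Fintype.card_prod, Fintype.card_bool, nsmul_eq_mul]
      push_cast
      field_simp
    rw [Finset.sum_congr rfl fun x _ => hone x]
    simp
  · rintro ⟨x, j, b⟩
    refine ⟨?_, by
      dsimp only
      rw [Finset.card_image_of_injective _ (hxinj x), (hedge x j).2]⟩
    have := (hmem x j).1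
    rw [Finset.image_union, Finset.image_union, ← im_comp, ← im_comp] at this
    cases b
    · exact this
    · simp only [hT, hT', cond_true]
      rwa [Finset.union_comm, ← Finset.union_assoc, Finset.union_right_comm]
  · rintro ⟨x, j, b⟩
    cases b <;> exact ⟨rfl, rfl, rfl, rfl⟩
  · intro v
    refine (sum_sigma_le (fun x y => ind (v ∈ (O x y.1).image x.1) + ind (v ∈ im (T' x y)))
      ((1 + a) * (l + o) / s) (fun x => ∃ e : Unit → Fin s, Function.Injective e ∧
        x.1 ∘ e = fun _ => v) fun x => ?_).trans ?_
    · by_cases hv : ∃ u, x.1 u = v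
      · obtain ⟨u, rfl⟩ := hv
        rw [ind_of ⟨fun _ => u, fun _ _ _ => rfl, rfl⟩, Fintype.sum_prod_type]
        have h1 := hload x u
        refine le_trans (le_of_eq (Finset.sum_congr rfl fun j _ => ?_)) (h1.trans (le_of_eq ?_))
        · rw [Fintype.sum_bool]
          simp only [hT', cond_true, cond_false, im_comp,
            (hxinj x).mem_finset_image]
          ring
        · ring
      · have h0 : ∀ B : Finset (Fin s), ¬ v ∈ B.image x.1 := fun B hB => by
          obtain ⟨u, -, hu⟩ := Finset.mem_image.1 hB
          exact hv ⟨u, hu⟩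
        simp only [hT', im_comp, ind_of_not (h0 _)]
        simp only [add_zero, Finset.sum_const_zero]
        have := ind_nonneg (∃ e : Unit → Fin s, Function.Injective e ∧ x.1 ∘ e = fun _ => v)
        positivity
    · have h1 := hpr _ _ (pr_hit (V := V) s fun _ : Unit => v)
      rw [Fintype.card_unit, pow_one, pow_one] at h1
      refine (mul_le_mul_of_nonneg_left h1 (by positivity)).trans ?_
      have h2 : (0 : ℝ) < 1 - a := by linarith
      have hs' : (s : ℝ) ≠ 0 := by positivity
      rw [show (1 + a) * (l + o) / s * (s / Fintype.card V / (1 - a)) =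
        (1 + a) / (1 - a) * ((l + o) / Fintype.card V) by field_simp, mul_div_assoc]
      gcongr
  · intro c v
    refine (sum_sigma_le (fun x y => ind (T x y = c ∧ v ∈ (O x y.1).image x.1 ∪ im (T' x y)))
      1 (fun x => ∃ e : Fin l ⊕ Unit → Fin s, Function.Injective e ∧
        x.1 ∘ e = Sum.elim c fun _ => v) fun x => ?_).trans ?_
    · refine (Finset.sum_le_card_nsmul _ _ (ind (∃ e : Fin l ⊕ Unit → Fin s, Function.Injective e ∧
        x.1 ∘ e = Sum.elim c fun _ => v))
        fun y _ => ind_mono ?_).trans (le_of_eq ?_)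
      · rintro ⟨rfl, hv⟩
        obtain ⟨j, b⟩ := y
        obtain ⟨i1, i2, d1, d2, d3⟩ := hparts x j
        have key : ∀ B C : Fin l → Fin s, Function.Injective B → Disjoint (O x j) (im B) →
            Disjoint (im B) (im C) → v ∈ (O x j).image x.1 ∪ im (x.1 ∘ C) →
            ∃ e : Fin l ⊕ Unit → Fin s, Function.Injective e ∧
              x.1 ∘ e = Sum.elim (x.1 ∘ B) fun _ => v := by
          intro B C hB hOB hBC hv
          rw [im_comp, ← Finset.image_union, Finset.mem_image] at hv
          obtain ⟨u, hu, rfl⟩ := hv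
          refine ⟨Sum.elim B fun _ => u, injective_sum_elim hB (fun _ _ _ => rfl) ?_, ?_⟩
          · rw [Finset.disjoint_right]
            rintro w hw
            obtain ⟨_, rfl⟩ := mem_im.1 hw
            rcases Finset.mem_union.1 hu with h | h
            · exact Finset.disjoint_left.1 hOB h
            · exact Finset.disjoint_right.1 hBC h
          · rw [Sum.comp_elim]; rfl
        cases b
        · exact key _ _ i1 d1 d3 hv
        · exact key _ _ i2 d2 d3.symm hv
      · rw [nsmul_eq_mul, Finset.card_univ, Fintype.card_prod, Fintype.card_bool]
        push_cast
        ring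
    · have h1 := hpr _ _ (pr_hit (V := V) s (Sum.elim c fun _ : Unit => v))
      rw [Fintype.card_sum, Fintype.card_unit, Fintype.card_fin] at h1
      rw [one_mul]
      refine h1.trans ?_
      rw [div_le_iff₀ (by linarith), div_mul_eq_mul_div]
      gcongr
      have h2 : (s : ℝ) ^ (l + 1) ≤ s ^ (2 * l + 1) := pow_le_pow_right₀ hs1' (by omega)
      have h3 : (0 : ℝ) ≤ s ^ (2 * l + 1) := by positivity
      nlinarith [mul_nonneg h3 (by linarith : 0 ≤ 1 - 2 * a)]
  · intro c c' v
    refine (sum_sigma_le (fun x y => ind (T x y = c ∧ T' x y = c' ∧ v ∈ (O x y.1).image x.1))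
      1 (fun x => ∃ e : (Fin l ⊕ Fin l) ⊕ Unit → Fin s, Function.Injective e ∧
        x.1 ∘ e = Sum.elim (Sum.elim c c') fun _ => v) fun x => ?_).trans ?_
    · refine (Finset.sum_le_card_nsmul _ _ (ind (∃ e : (Fin l ⊕ Fin l) ⊕ Unit → Fin s, Function.Injective e ∧
        x.1 ∘ e = Sum.elim (Sum.elim c c') fun _ => v))
        fun y _ => ind_mono ?_).trans (le_of_eq ?_)
      · rintro ⟨rfl, rfl, hv⟩
        obtain ⟨j, b⟩ := y
        obtain ⟨i1, i2, d1, d2, d3⟩ := hparts x j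
        have key : ∀ B C : Fin l → Fin s, Function.Injective B → Function.Injective C →
            Disjoint (O x j) (im B) → Disjoint (O x j) (im C) →
            Disjoint (im B) (im C) → v ∈ (O x j).image x.1 →
            ∃ e : (Fin l ⊕ Fin l) ⊕ Unit → Fin s, Function.Injective e ∧
              x.1 ∘ e = Sum.elim (Sum.elim (x.1 ∘ B) (x.1 ∘ C)) fun _ => v := by
          intro B C hB hC hOB hOC hBC hv
          obtain ⟨u, hu, rfl⟩ := Finset.mem_image.1 hv
          refine ⟨Sum.elim (Sum.elim B C) fun _ => u, injective_sum_elim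
            (injective_sum_elim hB hC hBC) (fun _ _ _ => rfl) ?_, ?_⟩
          · rw [im_sum, Sum.elim_comp_inl, Sum.elim_comp_inr, Finset.disjoint_right]
            rintro w hw
            obtain ⟨_, rfl⟩ := mem_im.1 hw
            rw [Finset.mem_union, not_or]
            exact ⟨Finset.disjoint_left.1 hOB hu, Finset.disjoint_left.1 hOC hu⟩
          · rw [Sum.comp_elim, Sum.comp_elim]; rfl
        cases b
        · exact key _ _ i1 i2 d1 d2 d3 hv
        · exact key _ _ i2 i1 d2 d1 d3.symm hv
      · rw [nsmul_eq_mul, Finset.card_univ, Fintype.card_prod, Fintype.card_bool]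
        push_cast
        ring
    · have h1 := hpr _ _ (pr_hit (V := V) s (Sum.elim (Sum.elim c c') fun _ : Unit => v))
      rw [Fintype.card_sum, Fintype.card_sum, Fintype.card_unit, Fintype.card_fin,
        ← two_mul] at h1
      rw [one_mul]
      refine h1.trans ?_
      rw [div_le_iff₀ (by linarith), div_mul_eq_mul_div]
      gcongr
      have h2 : (0 : ℝ) ≤ s ^ (2 * l + 1) := by positivity
      nlinarith

end spread

section glue

/-- Two weighted families of sets with labels can be coupled along the labels so that coupled
sets are disjoint, with little loss of weight. -/
theorem exists_glue {Ω Y E V : Type} [Fintype Ω] [Fintype Y] [Fintype E] [DecidableEq V]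
    (w : Ω → ℝ) (p : Y → ℝ) (hw : ∀ ω, 0 ≤ w ω) (hp : ∀ y, 0 ≤ p y) (e : Ω → E) (f : Y → E)
    (A : Ω → Finset V) (B : Y → Finset V) {R : ℕ} (hA : ∀ ω, (A ω).card ≤ R)
    (hm : ∀ S, ∑ ω, w ω * ind (e ω = S) ≤ ∑ y, p y * ind (f y = S)) {K θ : ℝ} (hK : 0 ≤ K)
    (hθ : 0 < θ) (hs : ∀ S v, ∑ y, p y * ind (f y = S ∧ v ∈ B y) ≤ K) :
    ∃ w' : Ω × Y → ℝ, (∀ z, 0 ≤ w' z) ∧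
      (∀ z, 0 < w' z → 0 < w z.1 ∧ 0 < p z.2 ∧ e z.1 = f z.2 ∧ Disjoint (A z.1) (B z.2)) ∧
      (∀ ω, ∑ y, w' (ω, y) ≤ w ω) ∧ (∀ y, ∑ ω, w' (ω, y) ≤ p y) ∧
      ∑ ω, w ω - Fintype.card E * θ - R * K / θ * ∑ ω, w ω ≤ ∑ z, w' z := by
  classical
  set π : E → ℝ := fun S => ∑ y, p y * ind (f y = S) with hπ
  have hπ0 : ∀ S, 0 ≤ π S := fun S => Finset.sum_nonneg fun y _ => mul_nonneg (hp y) (ind_nonneg _)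
  set w' : Ω × Y → ℝ := fun z =>
    w z.1 / π (e z.1) * (p z.2 * ind (f z.2 = e z.1 ∧ Disjoint (A z.1) (B z.2))) with hw'
  have h0 : ∀ z, 0 ≤ w' z := fun z =>
    mul_nonneg (div_nonneg (hw _) (hπ0 _)) (mul_nonneg (hp _) (ind_nonneg _))
  refine ⟨w', h0, fun z hz => ?_, fun ω => ?_, fun y => ?_, ?_⟩
  · have hne := hz.ne'
    simp only [hw', mul_ne_zero_iff, div_ne_zero_iff] at hne
    obtain ⟨⟨h1, -⟩, h2, h3⟩ := hne
    have h4 : f z.2 = e z.1 ∧ Disjoint (A z.1) (B z.2) := by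
      by_contra h
      exact h3 (ind_of_not h)
    exact ⟨(hw _).lt_of_ne' h1, (hp _).lt_of_ne' h2, h4.1.symm, h4.2⟩
  · have h1 : ∑ y, w' (ω, y) ≤ w ω / π (e ω) * π (e ω) := by
      rw [hπ, Finset.mul_sum]
      exact Finset.sum_le_sum fun y _ => mul_le_mul_of_nonneg_left
        (mul_le_mul_of_nonneg_left (ind_mono And.left) (hp y)) (div_nonneg (hw _) (hπ0 _))
    refine h1.trans ?_
    by_cases h : π (e ω) = 0
    · rw [h, mul_zero]; exact hw ω
    · rw [div_mul_cancel₀ _ h]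
  · have h1 : ∀ ω, w' (ω, y) ≤ p y / π (f y) * (w ω * ind (e ω = f y)) := by
      intro ω
      by_cases h : f y = e ω
      · rw [ind_of h.symm, h]
        have h2 : ind (f y = e ω ∧ Disjoint (A ω) (B y)) ≤ 1 := ind_le_one _
        have h3 : 0 ≤ w ω / π (e ω) * p y := mul_nonneg (div_nonneg (hw _) (hπ0 _)) (hp _)
        have h4 := mul_le_mul_of_nonneg_left h2 h3
        simp only [hw']
        refine le_trans (le_of_eq ?_) (h4.trans (le_of_eq ?_)) <;> ring
      · simp only [hw']
        rw [ind_of_not fun h' => h h'.1, mul_zero, mul_zero]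
        exact mul_nonneg (div_nonneg (hp _) (hπ0 _)) (mul_nonneg (hw _) (ind_nonneg _))
    refine (Finset.sum_le_sum fun ω _ => h1 ω).trans ?_
    rw [← Finset.mul_sum]
    refine (mul_le_mul_of_nonneg_left (hm (f y)) (div_nonneg (hp _) (hπ0 _))).trans ?_
    by_cases h : π (f y) = 0
    · rw [h, div_zero, zero_mul]; exact hp y
    · exact (div_mul_cancel₀ _ h).le
  · have h1 : ∀ ω, w ω - w ω * ind (π (e ω) < θ) - R * K / θ * w ω ≤ ∑ y, w' (ω, y) := by
      intro ω
      have hRK : 0 ≤ R * K / θ * w ω := mul_nonneg (by positivity) (hw ω)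
      by_cases h : π (e ω) < θ
      · rw [ind_of h]
        have := Finset.sum_nonneg fun y (_ : y ∈ Finset.univ) => h0 (ω, y)
        linarith
      · rw [ind_of_not h]
        rw [not_lt] at h
        have hpos : 0 < π (e ω) := hθ.trans_le h
        have h2 : π (e ω) - R * K ≤
            ∑ y, p y * ind (f y = e ω ∧ Disjoint (A ω) (B y)) := by
          have h3 : ∀ y, p y * ind (f y = e ω) ≤ p y * ind (f y = e ω ∧ Disjoint (A ω) (B y)) +
              ∑ v ∈ A ω, p y * ind (f y = e ω ∧ v ∈ B y) := by
            intro y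
            have hnn : ∀ v ∈ A ω, 0 ≤ p y * ind (f y = e ω ∧ v ∈ B y) := fun v _ =>
              mul_nonneg (hp y) (ind_nonneg _)
            by_cases hd : Disjoint (A ω) (B y)
            · have : ind (f y = e ω) ≤ ind (f y = e ω ∧ Disjoint (A ω) (B y)) :=
                ind_mono fun h => ⟨h, hd⟩
              have h5 := mul_le_mul_of_nonneg_left this (hp y)
              have := Finset.sum_nonneg hnn
              linarith
            · rw [Finset.not_disjoint_iff] at hd
              obtain ⟨v, hvA, hvB⟩ := hd
              have h4 := Finset.single_le_sum hnn hvA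
              have : ind (f y = e ω) ≤ ind (f y = e ω ∧ v ∈ B y) := ind_mono fun h => ⟨h, hvB⟩
              have h5 := mul_le_mul_of_nonneg_left this (hp y)
              have h6 := mul_nonneg (hp y) (ind_nonneg (f y = e ω ∧ Disjoint (A ω) (B y)))
              linarith
          have h4 := Finset.sum_le_sum fun y (_ : y ∈ Finset.univ) => h3 y
          rw [Finset.sum_add_distrib, Finset.sum_comm] at h4
          have h5 : ∑ v ∈ A ω, ∑ y, p y * ind (f y = e ω ∧ v ∈ B y) ≤ R * K := by
            refine (Finset.sum_le_card_nsmul _ _ K fun v _ => hs _ v).trans ?_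
            rw [nsmul_eq_mul]
            exact mul_le_mul_of_nonneg_right (by exact_mod_cast hA ω) hK
          linarith
        have h6 := mul_le_mul_of_nonneg_left h2 (div_nonneg (hw ω) hpos.le)
        simp only [hw']
        rw [← Finset.mul_sum]
        refine le_trans ?_ h6
        rw [mul_sub, div_mul_cancel₀ _ hpos.ne', mul_zero, sub_zero]
        have : w ω / π (e ω) * (R * K) ≤ R * K / θ * w ω := by
          rw [div_mul_eq_mul_div, div_mul_eq_mul_div, mul_comm (w ω)]
          gcongr
          exact mul_nonneg (by positivity) (hw ω)
        linarith
    have h2 : ∑ ω, w ω * ind (π (e ω) < θ) ≤ Fintype.card E * θ := by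
      have h3 : ∀ ω, w ω * ind (π (e ω) < θ) = ∑ S, ind (π S < θ) * (w ω * ind (e ω = S)) := by
        intro ω
        rw [Finset.sum_eq_single (e ω) (fun S _ hS => by rw [ind_of_not (Ne.symm hS)]; ring)
          (fun h => absurd (Finset.mem_univ _) h), ind_of rfl]
        ring
      rw [Finset.sum_congr rfl fun ω _ => h3 ω, Finset.sum_comm, ← Finset.card_univ,
        ← nsmul_eq_mul]
      refine Finset.sum_le_card_nsmul _ _ _ fun S _ => ?_
      rw [← Finset.mul_sum]
      by_cases h : π S < θ
      · rw [ind_of h, one_mul]; exact (hm S).trans h.le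
      · rw [ind_of_not h, zero_mul]; exact hθ.le
    have h3 := Finset.sum_le_sum fun ω (_ : ω ∈ Finset.univ) => h1 ω
    rw [Finset.sum_sub_distrib, Finset.sum_sub_distrib, ← Finset.mul_sum] at h3
    rw [Fintype.sum_prod_type]
    linarith

/-- A probability distribution on sets of size `r` inside `U` satisfying `T` that covers the
points of `U` almost evenly. -/
def TileDist {V : Type} [DecidableEq V] (T : Finset V → Prop) (U : Finset V) (r : ℕ)
    (η : ℝ) : Prop :=
  ∃ (Ω : Type) (_ : Fintype Ω) (μ : Ω → ℝ) (A : Ω → Finset V), (∀ ω, 0 ≤ μ ω) ∧ ∑ ω, μ ω = 1 ∧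
    (∀ ω, A ω ⊆ U ∧ T (A ω) ∧ (A ω).card = r) ∧
    ∀ v ∈ U, ∑ ω, μ ω * ind (v ∈ A ω) ≤ (1 + η) * r / U.card

theorem TileDist.of_weights {V Ω : Type} [DecidableEq V] [Fintype Ω] {T : Finset V → Prop}
    {U : Finset V} {r : ℕ} {η ζ b : ℝ} {w : Ω → ℝ} {A : Ω → Finset V} (hw : ∀ ω, 0 ≤ w ω)
    (hA : ∀ ω, 0 < w ω → A ω ⊆ U ∧ T (A ω) ∧ (A ω).card = r) (hζ : 0 < ζ)
    (hW : ζ ≤ ∑ ω, w ω) (hb : ∀ v, ∑ ω, w ω * ind (v ∈ A ω) ≤ b)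
    (hbη : b ≤ (1 + η) * r / U.card * ζ) : TileDist T U r η := by
  classical
  set W := ∑ ω, w ω with hWdef
  have hW0 : 0 < W := hζ.trans_le hW
  have key : ∀ g : Ω → ℝ, ∑ ω : {ω // 0 < w ω}, w ω.1 * g ω.1 = ∑ ω, w ω * g ω := by
    intro g
    rw [← Fintype.sum_subtype_add_sum_subtype (fun ω => 0 < w ω) fun ω => w ω * g ω]
    have : ∀ x : {ω // ¬ 0 < w ω}, w x.1 * g x.1 = 0 := fun x => by
      rw [le_antisymm (not_lt.1 x.2) (hw _), zero_mul]
    rw [Finset.sum_eq_zero fun x _ => this x, add_zero]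
  refine ⟨{ω // 0 < w ω}, inferInstance, fun ω => w ω.1 / W, fun ω => A ω.1,
    fun ω => div_nonneg (hw _) hW0.le, ?_, fun ω => hA ω.1 ω.2, fun v hv => ?_⟩
  · rw [← Finset.sum_div]
    have := key fun _ => 1
    simp only [mul_one] at this
    rw [this, div_self hW0.ne']
  · have h1 : ∀ ω : {ω // 0 < w ω}, w ω.1 / W * ind (v ∈ A ω.1) =
        w ω.1 * ind (v ∈ A ω.1) / W := fun ω => by ring
    rw [Finset.sum_congr rfl fun ω _ => h1 ω, ← Finset.sum_div, key fun ω => ind (v ∈ A ω),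
      div_le_iff₀ hW0]
    have hb0 : 0 ≤ b := (Finset.sum_nonneg fun ω _ => mul_nonneg (hw ω) (ind_nonneg _)).trans (hb v)
    have h2 : 0 ≤ (1 + η) * r / U.card := nonneg_of_mul_nonneg_left (hb0.trans hbη) hζ
    exact (hb v).trans (hbη.trans (mul_le_mul_of_nonneg_left hW h2))

end glue

section tiles
variable {V : Type} [Fintype V] [DecidableEq V] {l o : ℕ} {H : Finset (Finset V)}

/-- Being the vertex set of an `ℓ`-path. -/
def PathTile (l : ℕ) (H : Finset (Finset V)) (A : Finset V) : Prop :=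
  ∃ b e : Fin l → V, LPath H b e A

/-- Being the vertex set of two edges with `2 * l` common vertices. -/
def PairTile (l : ℕ) (H : Finset (Finset V)) (A : Finset V) : Prop :=
  ∃ e₁ ∈ H, ∃ e₂ ∈ H, (e₁ ∩ e₂).card = 2 * l ∧ e₁ ∪ e₂ = A

theorem Spread.path_dist [Nonempty V] {b C θ ζ η : ℝ} {M : ℕ} (h : Spread l o H b C)
    (hH : ∀ e ∈ H, e.card = 2 * l + o) (hC : 0 ≤ C) (hθ : 0 < θ) (hζ : 0 < ζ)
    (hκ : M * ((Fintype.card V : ℝ) ^ l * θ +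
      (M * (l + o) + l : ℕ) * (C / (Fintype.card V : ℝ) ^ (l + 1)) / θ) ≤ 1 - ζ)
    (hb : (M + 1) * b ≤ (1 + η) * (M * (l + o) + l : ℕ) / Fintype.card V * ζ) :
    TileDist (PathTile l H) Finset.univ (M * (l + o) + l) η := by
  classical
  obtain ⟨Y, _, p, S, S', O, σ, hp0, hp1, hedge, hσ, hload, hs1, -⟩ := h
  have hparts := fun y => edge_parts (hH _ (hedge y).1) (hedge y).2
  set K := C / (Fintype.card V : ℝ) ^ (l + 1) with hK
  set R := M * (l + o) + l with hR
  set κ := (Fintype.card V : ℝ) ^ l * θ + R * K / θ with hκdef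
  have hK0 : 0 ≤ K := by positivity
  have hκ0 : 0 ≤ κ := by positivity
  have key : ∀ L ≤ M, ∃ (Ω : Type) (_ : Fintype Ω) (w : Ω → ℝ) (e : Ω → Fin l → V)
      (A : Ω → Finset V), (∀ ω, 0 ≤ w ω) ∧
      (∀ ω, 0 < w ω → (∃ b, LPath H b (e ω) (A ω)) ∧ (A ω).card = L * (l + o) + l) ∧
      (∀ ω, (A ω).card ≤ L * (l + o) + l) ∧
      (∀ T, ∑ ω, w ω * ind (e ω = T) ≤ ∑ y, p y * ind (S y = T)) ∧
      (∀ v, ∑ ω, w ω * ind (v ∈ A ω) ≤ (L + 1) * b) ∧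
      1 - L * κ ≤ ∑ ω, w ω ∧ ∑ ω, w ω ≤ 1 := by
    intro L
    induction L with
    | zero =>
      intro _
      refine ⟨Y, inferInstance, p, S, fun y => im (S y), hp0, fun y _ => ⟨⟨S y, LPath.single _
        (hparts y).1⟩, by rw [card_im _ (hparts y).1, Fintype.card_fin]; omega⟩, fun y =>
        (card_im_le _).trans (by rw [Fintype.card_fin]; omega), fun T => le_rfl, fun v => ?_,
        by simp [hp1], hp1.le⟩
      rw [Nat.cast_zero, zero_add, one_mul, ← Equiv.sum_comp σ]
      refine (Finset.sum_le_sum fun y _ => ?_).trans (hload v)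
      dsimp only
      rw [(hσ y).1, (hσ y).2.1]
      exact mul_le_mul_of_nonneg_left (le_add_of_nonneg_left (ind_nonneg _)) (hp0 y)
    | succ L ih =>
      intro hL
      obtain ⟨Ω, _, w, e, A, hw0, hw1, hA, hm, hl, hW, hW1⟩ := ih (by omega)
      have hAR : ∀ ω, (A ω).card ≤ R := fun ω => (hA ω).trans (by
        rw [hR]; exact Nat.add_le_add_right (Nat.mul_le_mul_right _ (by omega)) _)
      obtain ⟨w', h0, h1, h2, h3, h4⟩ := exists_glue w p hw0 hp0 e S A
        (fun y => O y ∪ im (S' y)) hAR hm hK0 hθ hs1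
      refine ⟨Ω × Y, inferInstance, w', fun z => S' z.2, fun z => A z.1 ∪ (O z.2 ∪ im (S' z.2)),
        h0, fun z hz => ?_, fun z => ?_, fun T => ?_, fun v => ?_, ?_, ?_⟩
      · obtain ⟨hz1, hz2, hz3, hz4⟩ := h1 z hz
        obtain ⟨⟨b', hb'⟩, hc⟩ := hw1 _ hz1
        obtain ⟨i1, i2, d1, d2, d3⟩ := hparts z.2
        refine ⟨⟨b', LPath.step _ _ _ _ _ hb' ?_ i2 d2 hz4⟩, ?_⟩
        · rw [hz3]; exact (hedge z.2).1
        · rw [Finset.card_union_of_disjoint hz4, Finset.card_union_of_disjoint d2, hc,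
            (hedge z.2).2, card_im _ i2, Fintype.card_fin]
          ring
      · refine (Finset.card_union_le _ _).trans ((add_le_add (hA z.1)
          (Finset.card_union_le _ _)).trans ?_)
        have := card_im_le (S' z.2)
        rw [Fintype.card_fin] at this
        rw [(hedge z.2).2, add_mul]
        omega
      · rw [Fintype.sum_prod_type_right]
        calc _ = ∑ y, (∑ ω, w' (ω, y)) * ind (S' y = T) :=
              Finset.sum_congr rfl fun y _ => (Finset.sum_mul _ _ _).symm
          _ ≤ ∑ y, p y * ind (S' y = T) := Finset.sum_le_sum fun y _ =>
              mul_le_mul_of_nonneg_right (h3 y) (ind_nonneg _)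
          _ = _ := by
              rw [← Equiv.sum_comp σ]
              exact Finset.sum_congr rfl fun y _ => by rw [(hσ y).1, (hσ y).2.2.1]
      · have h5 : ∀ z : Ω × Y, w' z * ind (v ∈ A z.1 ∪ (O z.2 ∪ im (S' z.2))) ≤
            w' z * ind (v ∈ A z.1) + w' z * (ind (v ∈ O z.2) + ind (v ∈ im (S' z.2))) := by
          intro z
          rw [← mul_add]
          refine mul_le_mul_of_nonneg_left ?_ (h0 z)
          rw [ind_congr Finset.mem_union]
          refine (ind_or_le _ _).trans (add_le_add_right ?_ _)
          rw [ind_congr Finset.mem_union]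
          exact ind_or_le _ _
        refine (Finset.sum_le_sum fun z _ => h5 z).trans ?_
        rw [Finset.sum_add_distrib]
        have h6 : ∑ z : Ω × Y, w' z * ind (v ∈ A z.1) ≤ (L + 1) * b := by
          rw [Fintype.sum_prod_type]
          refine le_trans (Finset.sum_le_sum fun ω _ => ?_) (hl v)
          dsimp only
          rw [← Finset.sum_mul]
          exact mul_le_mul_of_nonneg_right (h2 ω) (ind_nonneg _)
        have h7 : ∑ z : Ω × Y, w' z * (ind (v ∈ O z.2) + ind (v ∈ im (S' z.2))) ≤ b := by
          rw [Fintype.sum_prod_type_right]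
          refine le_trans (Finset.sum_le_sum fun y _ => ?_) (hload v)
          dsimp only
          rw [← Finset.sum_mul]
          exact mul_le_mul_of_nonneg_right (h3 y) (add_nonneg (ind_nonneg _) (ind_nonneg _))
        push_cast
        linarith
      · rw [Fintype.card_fun, Fintype.card_fin] at h4
        have h8 : (R * K / θ) * ∑ ω, w ω ≤ R * K / θ := mul_le_of_le_one_right (by positivity) hW1
        push_cast at h4 ⊢
        rw [add_mul, one_mul]
        linarith
      · rw [Fintype.sum_prod_type]
        exact (Finset.sum_le_sum fun ω _ => h2 ω).trans hW1
  obtain ⟨Ω, _, w, e, A, hw0, hw1, -, -, hl, hW, -⟩ := key M le_rfl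
  exact TileDist.of_weights hw0 (fun ω hω => ⟨Finset.subset_univ _,
    ⟨_, e ω, (hw1 ω hω).1.choose_spec⟩, (hw1 ω hω).2⟩) hζ (by linarith) hl
      (by rwa [Finset.card_univ])

theorem Spread.pair_dist [Nonempty V] {b C θ ζ η : ℝ} (h : Spread l o H b C)
    (hH : ∀ e ∈ H, e.card = 2 * l + o) (hC : 0 ≤ C) (hθ : 0 < θ) (hζ : 0 < ζ)
    (hκ : (Fintype.card V : ℝ) ^ (2 * l) * θ +
      (2 * l + o : ℕ) * (C / (Fintype.card V : ℝ) ^ (2 * l + 1)) / θ ≤ 1 - ζ)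
    (hb : 2 * b ≤ (1 + η) * (2 * (l + o) : ℕ) / Fintype.card V * ζ) :
    TileDist (PairTile l H) Finset.univ (2 * (l + o)) η := by
  classical
  obtain ⟨Y, _, p, S, S', O, σ, hp0, hp1, hedge, hσ, hload, -, hs2⟩ := h
  have hparts := fun y => edge_parts (hH _ (hedge y).1) (hedge y).2
  obtain ⟨w', h0, h1, h2, h3, h4⟩ := exists_glue p p hp0 hp0 (fun y => (S y, S' y))
    (fun y => (S y, S' y)) (fun y => im (S y) ∪ O y ∪ im (S' y)) O
    (fun y => (hH _ (hedge y).1).le) (fun _ => le_rfl)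
    (K := C / (Fintype.card V : ℝ) ^ (2 * l + 1)) (by positivity) hθ (fun T v => by
      refine le_trans (le_of_eq ?_) (hs2 T.1 T.2 v)
      refine Finset.sum_congr rfl fun y _ => ?_
      rw [ind_congr (_ : _ ↔ (S y = T.1 ∧ S' y = T.2 ∧ v ∈ O y))]
      rw [Prod.ext_iff, and_assoc])
  refine TileDist.of_weights (A := fun z : Y × Y => im (S z.1) ∪ O z.1 ∪ im (S' z.1) ∪ O z.2)
    h0 (fun z hz => ?_) hζ ?_ (b := 2 * b) (fun v => ?_) (by rwa [Finset.card_univ])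
  · obtain ⟨-, -, h5, h6⟩ := h1 z hz
    rw [Prod.mk.injEq] at h5
    obtain ⟨i1, i2, d1, d2, d3⟩ := hparts z.1
    have hS : (im (S z.1) ∪ im (S' z.1)).card = 2 * l := by
      rw [Finset.card_union_of_disjoint d3, card_im _ i1, card_im _ i2, Fintype.card_fin]
      ring
    refine ⟨Finset.subset_univ _, ⟨_, (hedge z.1).1, _, (hedge z.2).1, ?_, ?_⟩, ?_⟩
    · rw [← h5.1, ← h5.2, ← hS]
      congr 1
      rw [Finset.disjoint_union_left, Finset.disjoint_union_left] at h6
      ext v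
      have h7 : v ∈ O z.1 → v ∉ O z.2 := fun h => Finset.disjoint_left.1 h6.1.2 h
      simp only [Finset.mem_inter, Finset.mem_union]
      tauto
    · rw [← h5.1, ← h5.2]
      ext v
      simp only [Finset.mem_union]
      tauto
    · rw [Finset.card_union_of_disjoint h6, hH _ (hedge z.1).1, (hedge z.2).2]
      ring
  · rw [Fintype.card_prod, Fintype.card_fun, Fintype.card_fin, hp1] at h4
    have : ((Fintype.card V ^ l * Fintype.card V ^ l : ℕ) : ℝ) =
        (Fintype.card V : ℝ) ^ (2 * l) := by push_cast; ring
    rw [this] at h4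
    linarith
  · have h5 : ∀ z : Y × Y, w' z * ind (v ∈ im (S z.1) ∪ O z.1 ∪ im (S' z.1) ∪ O z.2) ≤
        w' z * (ind (v ∈ im (S z.1)) + ind (v ∈ O z.1) + ind (v ∈ im (S' z.1))) +
          w' z * ind (v ∈ O z.2) := by
      intro z
      rw [← mul_add]
      refine mul_le_mul_of_nonneg_left ?_ (h0 z)
      rw [ind_congr Finset.mem_union]
      refine (ind_or_le _ _).trans (add_le_add_left ?_ _)
      rw [ind_congr Finset.mem_union]
      refine (ind_or_le _ _).trans (add_le_add_left ?_ _)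
      rw [ind_congr Finset.mem_union]
      exact ind_or_le _ _
    refine (Finset.sum_le_sum fun z _ => h5 z).trans ?_
    rw [Finset.sum_add_distrib, Fintype.sum_prod_type, Fintype.sum_prod_type_right]
    have h6 : ∑ y, ∑ y', w' (y, y') *
        (ind (v ∈ im (S y)) + ind (v ∈ O y) + ind (v ∈ im (S' y))) ≤
        ∑ y, (p y * ind (v ∈ im (S y)) + p y * (ind (v ∈ O y) + ind (v ∈ im (S' y)))) := by
      refine Finset.sum_le_sum fun y _ => ?_
      rw [← Finset.sum_mul]
      refine (mul_le_mul_of_nonneg_right (h2 y) (add_nonneg (add_nonneg (ind_nonneg _)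
        (ind_nonneg _)) (ind_nonneg _))).trans (le_of_eq (by ring))
    have h7 : ∑ y, ∑ x, w' (x, y) * ind (v ∈ O y) ≤ ∑ y, p y * ind (v ∈ O y) := by
      refine Finset.sum_le_sum fun y _ => ?_
      rw [← Finset.sum_mul]
      exact mul_le_mul_of_nonneg_right (h3 y) (ind_nonneg _)
    have h8 : ∑ y, p y * ind (v ∈ im (S y)) = ∑ y, p y * ind (v ∈ im (S' y)) := by
      rw [← Equiv.sum_comp σ]
      exact Finset.sum_congr rfl fun y _ => by rw [(hσ y).1, (hσ y).2.1]
    have h9 := hload v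
    rw [Finset.sum_add_distrib, h8] at h6
    have h10 : ∑ y, p y * (ind (v ∈ O y) + ind (v ∈ im (S' y))) =
        ∑ y, p y * ind (v ∈ O y) + ∑ y, p y * ind (v ∈ im (S' y)) := by
      rw [← Finset.sum_add_distrib]
      exact Finset.sum_congr rfl fun y _ => by ring
    simp only at h6 h7 ⊢
    linarith

end tiles

section transfer
variable {V : Type} [Fintype V] [DecidableEq V] {l o : ℕ} {H : Finset (Finset V)}

/-- The hypergraph induced on a set of vertices. -/
def sub (H : Finset (Finset V)) (U : Finset V) : Finset (Finset U) :=
  Finset.univ.filter fun e => e.image Subtype.val ∈ H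

/-- The number of `m`-tuples in `U` that complete `D` to an edge. -/
noncomputable def codeg (H : Finset (Finset V)) (m : ℕ) (U D : Finset V) : ℝ :=
  ∑ g : Fin m → V, ind (im g ⊆ U ∧ D ∪ im g ∈ H)

theorem mem_sub {U : Finset V} {e : Finset U} : e ∈ sub H U ↔ e.image Subtype.val ∈ H := by
  simp [sub]

theorem card_of_mem_sub {U : Finset V} {q : ℕ} (hH : ∀ e ∈ H, e.card = q) {e : Finset U}
    (he : e ∈ sub H U) : e.card = q := by
  rw [← hH _ (mem_sub.1 he), Finset.card_image_of_injective _ Subtype.val_injective]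

theorem le_dens_sub {U : Finset V} {m : ℕ} {τ : ℝ} (hU : 0 < U.card) {D : Finset U}
    (h : τ * (U.card : ℝ) ^ m ≤ codeg H m U (D.image Subtype.val)) : τ ≤ dens (sub H U) m D := by
  classical
  rw [dens, pr, le_div_iff₀ (by rw [Fintype.card_fun, Fintype.card_coe]; positivity),
    Fintype.card_fun, Fintype.card_fin, Fintype.card_coe, Nat.cast_pow]
  refine h.trans ?_
  rw [codeg, sum_ind_eq_card, sum_ind_eq_card, Nat.cast_le]
  refine (Finset.card_le_card (t := Finset.image (fun g : Fin m → U => Subtype.val ∘ g) _)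
    fun g hg => ?_).trans Finset.card_image_le
  rw [Finset.mem_filter] at hg
  rw [Finset.mem_image]
  refine ⟨fun i => ⟨g i, hg.2.1 (mem_im_self g i)⟩, ?_, rfl⟩
  rw [Finset.mem_filter, mem_sub, Finset.image_union, ← im_comp]
  exact ⟨Finset.mem_univ _, hg.2.2⟩

theorem TileDist.map_val {U : Finset V} {T' : Finset U → Prop} {T : Finset V → Prop} {r : ℕ}
    {η : ℝ} (h : TileDist T' Finset.univ r η) (hT : ∀ A, T' A → T (A.image Subtype.val)) :
    TileDist T U r η := by
  obtain ⟨Ω, _, μ, A, h0, h1, h2, h3⟩ := h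
  refine ⟨Ω, inferInstance, μ, fun ω => (A ω).image Subtype.val, h0, h1, fun ω => ⟨?_,
    hT _ (h2 ω).2.1, ?_⟩, fun v hv => ?_⟩
  · intro v hv
    obtain ⟨u, -, rfl⟩ := Finset.mem_image.1 hv
    exact u.2
  · rw [Finset.card_image_of_injective _ Subtype.val_injective, (h2 ω).2.2]
  · have := h3 ⟨v, hv⟩ (Finset.mem_univ _)
    rw [Finset.card_univ, Fintype.card_coe] at this
    refine le_trans (le_of_eq (Finset.sum_congr rfl fun ω _ => ?_)) this
    rw [ind_congr]
    simp [hv]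

theorem exists_path_dist {d m : ℕ} (hdm : d + m = 2 * l + o) (hd : 1 ≤ d) {τ γ η : ℝ}
    (hτ : FracHyp l o d m τ) (hγ : 0 < γ) (hη : 0 < η) (hη1 : η ≤ 1) {M : ℕ} (hM : 8 ≤ M * η) :
    ∃ N : ℕ, ∀ (V : Type) [Fintype V] [DecidableEq V] (H : Finset (Finset V)) (U : Finset V),
      (∀ e ∈ H, e.card = 2 * l + o) → N ≤ U.card →
      (∀ D : Finset V, D ⊆ U → D.card = d → (τ + γ) * (U.card : ℝ) ^ m ≤ codeg H m U D) →
      TileDist (PathTile l H) U (M * (l + o) + l) η := by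
  obtain ⟨C, hC, N, hN⟩ := exists_spread l o d m hdm hd hτ hγ (η := η / 8) (by positivity)
  have hM0 : (0 : ℝ) < M := by
    by_contra h
    rw [not_lt] at h
    nlinarith
  set δ := η / (16 * M) with hδ
  have hδ0 : 0 < δ := by positivity
  set R := M * (l + o) + l with hR
  obtain ⟨N', hN'⟩ := exists_nat_ge (M * (R * C / δ) / (η / 16))
  refine ⟨max N (max N' 1), fun V _ _ H U hH hU hdeg => ?_⟩
  simp only [max_le_iff] at hU
  have hcard : Fintype.card U = U.card := Fintype.card_coe U
  have hn : (0 : ℝ) < U.card := by exact_mod_cast hU.2.2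
  have : Nonempty U := Fintype.card_pos_iff.1 (by omega)
  have hsp := hN U (sub H U) (fun e he => card_of_mem_sub hH he) (fun D hD =>
    le_dens_sub hU.2.2 (hdeg _ (fun v hv => by
      obtain ⟨u, -, rfl⟩ := Finset.mem_image.1 hv
      exact u.2) (by rw [Finset.card_image_of_injective _ Subtype.val_injective, hD])))
    (by omega)
  refine TileDist.map_val (T' := PathTile l (sub H U)) (hsp.path_dist (M := M)
    (θ := δ / (U.card : ℝ) ^ l) (ζ := 1 - η / 8)
    (fun e he => card_of_mem_sub hH he) hC.le (by positivity) (by linarith) ?_ ?_) ?_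
  · rw [hcard, ← hR]
    have h1 : (U.card : ℝ) ^ l * (δ / (U.card : ℝ) ^ l) = δ := by field_simp
    have h2 : R * (C / (U.card : ℝ) ^ (l + 1)) / (δ / (U.card : ℝ) ^ l) =
        R * C / δ / U.card := by rw [pow_succ]; field_simp
    have h3 : M * δ = η / 16 := by rw [hδ]; field_simp
    have h4 : M * (R * C / δ / U.card) ≤ η / 16 := by
      have : M * (R * C / δ) / (η / 16) ≤ U.card := hN'.trans (by exact_mod_cast hU.2.1)
      rw [div_le_iff₀ (by positivity)] at this
      rw [← mul_div_assoc, div_le_iff₀ hn]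
      linarith
    rw [h1, h2, mul_add, h3]
    linarith
  · rw [hcard, mul_div_assoc', div_mul_eq_mul_div, div_le_div_iff_of_pos_right hn]
    have h1 : (M + 1 : ℝ) ≤ (1 + η / 8) * M := by linarith
    have h2 : (1 + η / 8) * (1 + η / 8) ≤ (1 + η) * (1 - η / 8) := by nlinarith
    have h3 : (M : ℝ) * (l + o) ≤ R := by rw [hR]; push_cast; linarith
    have h4 : (0 : ℝ) ≤ l + o := by positivity
    calc (M + 1 : ℝ) * ((1 + η / 8) * (l + o)) ≤
        (1 + η / 8) * M * ((1 + η / 8) * (l + o)) := by gcongr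
      _ = (1 + η / 8) * (1 + η / 8) * (M * (l + o)) := by ring
      _ ≤ (1 + η) * (1 - η / 8) * R := by
        apply mul_le_mul h2 h3 (by positivity)
        exact mul_nonneg (by linarith) (by linarith)
      _ = _ := by ring
  · rintro A ⟨b, e, h⟩
    exact ⟨_, _, h.map Subtype.val Subtype.val_injective fun e he => mem_sub.1 he⟩

theorem exists_pair_dist {d m : ℕ} (hdm : d + m = 2 * l + o) (hd : 1 ≤ d) {τ γ η : ℝ}
    (hτ : FracHyp l o d m τ) (hγ : 0 < γ) (hη : 0 < η) (hη1 : η ≤ 1) :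
    ∃ N : ℕ, ∀ (V : Type) [Fintype V] [DecidableEq V] (H : Finset (Finset V)) (U : Finset V),
      (∀ e ∈ H, e.card = 2 * l + o) → N ≤ U.card →
      (∀ D : Finset V, D ⊆ U → D.card = d → (τ + γ) * (U.card : ℝ) ^ m ≤ codeg H m U D) →
      TileDist (PairTile l H) U (2 * (l + o)) η := by
  obtain ⟨C, hC, N, hN⟩ := exists_spread l o d m hdm hd hτ hγ (η := η / 8) (by positivity)
  set δ := η / 16 with hδ
  have hδ0 : 0 < δ := by positivity
  set R := 2 * l + o with hR
  obtain ⟨N', hN'⟩ := exists_nat_ge ((R * C / δ) / (η / 16))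
  refine ⟨max N (max N' 1), fun V _ _ H U hH hU hdeg => ?_⟩
  simp only [max_le_iff] at hU
  have hcard : Fintype.card U = U.card := Fintype.card_coe U
  have hn : (0 : ℝ) < U.card := by exact_mod_cast hU.2.2
  have : Nonempty U := Fintype.card_pos_iff.1 (by omega)
  have hsp := hN U (sub H U) (fun e he => card_of_mem_sub hH he) (fun D hD =>
    le_dens_sub hU.2.2 (hdeg _ (fun v hv => by
      obtain ⟨u, -, rfl⟩ := Finset.mem_image.1 hv
      exact u.2) (by rw [Finset.card_image_of_injective _ Subtype.val_injective, hD])))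
    (by omega)
  refine TileDist.map_val (T' := PairTile l (sub H U)) (hsp.pair_dist
    (θ := δ / (U.card : ℝ) ^ (2 * l)) (ζ := 1 - η / 8)
    (fun e he => card_of_mem_sub hH he) hC.le (by positivity) (by linarith) ?_ ?_) ?_
  · rw [hcard, ← hR]
    have h1 : (U.card : ℝ) ^ (2 * l) * (δ / (U.card : ℝ) ^ (2 * l)) = δ := by field_simp
    have h2 : R * (C / (U.card : ℝ) ^ (2 * l + 1)) / (δ / (U.card : ℝ) ^ (2 * l)) =
        R * C / δ / U.card := by rw [pow_succ]; field_simp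
    have h4 : R * C / δ / U.card ≤ η / 16 := by
      have : (R * C / δ) / (η / 16) ≤ U.card := hN'.trans (by exact_mod_cast hU.2.1)
      rw [div_le_iff₀ (by positivity)] at this
      rw [div_le_iff₀ hn]
      linarith
    rw [h1, h2]
    linarith
  · rw [hcard, mul_div_assoc', div_mul_eq_mul_div, div_le_div_iff_of_pos_right hn]
    have h2 : (1 + η / 8) ≤ (1 + η) * (1 - η / 8) := by nlinarith
    have h4 : (0 : ℝ) ≤ 2 * (l + o) := by positivity
    have := mul_le_mul_of_nonneg_left h2 h4
    push_cast
    linarith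
  · rintro A ⟨e₁, h1, e₂, h2, h3, rfl⟩
    refine ⟨_, mem_sub.1 h1, _, mem_sub.1 h2, ?_, (Finset.image_union _ _).symm⟩
    rw [← Finset.image_inter _ _ Subtype.val_injective,
      Finset.card_image_of_injective _ Subtype.val_injective, h3]

end transfer

section bite
variable {V : Type} [Fintype V] [DecidableEq V] {H : Finset (Finset V)}

/-- The number of occurrences of `v` in the `m`-tuples in `U` that complete `D` to an edge. -/
noncomputable def occ (H : Finset (Finset V)) (m : ℕ) (U D : Finset V) (v : V) : ℝ :=
  ∑ i : Fin m, ∑ g : Fin m → V, ind ((im g ⊆ U ∧ D ∪ im g ∈ H) ∧ g i = v)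

theorem occ_nonneg (m : ℕ) (U D : Finset V) (v : V) : 0 ≤ occ H m U D v :=
  Finset.sum_nonneg fun _ _ => Finset.sum_nonneg fun _ _ => ind_nonneg _

theorem sum_ind_mem (B : Finset V) (v : V) : ∑ x ∈ B, ind (v = x) = ind (v ∈ B) := by
  by_cases h : v ∈ B
  · rw [ind_of h, Finset.sum_eq_single v (fun x _ hx => ind_of_not hx.symm) (fun h' => absurd h h'),
      ind_of rfl]
  · rw [ind_of_not h]
    exact Finset.sum_eq_zero fun x hx => ind_of_not fun h' => h (h' ▸ hx)

theorem sum_occ (m : ℕ) (U D B : Finset V) : ∑ v ∈ B, occ H m U D v =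
    ∑ i : Fin m, ∑ g : Fin m → V, ind (im g ⊆ U ∧ D ∪ im g ∈ H) * ind (g i ∈ B) := by
  simp only [occ]
  rw [Finset.sum_comm]
  refine Finset.sum_congr rfl fun i _ => ?_
  rw [Finset.sum_comm]
  refine Finset.sum_congr rfl fun g _ => ?_
  rw [← sum_ind_mem, Finset.mul_sum]
  exact Finset.sum_congr rfl fun v _ => ind_and _ _

theorem sum_occ_le (m : ℕ) (U D : Finset V) : ∑ v ∈ U, occ H m U D v ≤ m * codeg H m U D := by
  rw [sum_occ, codeg]
  refine (Finset.sum_le_card_nsmul _ _ (∑ g : Fin m → V, ind (im g ⊆ U ∧ D ∪ im g ∈ H))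
    fun i _ => Finset.sum_le_sum fun g _ =>
      mul_le_of_le_one_right (ind_nonneg _) (ind_le_one _)).trans (le_of_eq ?_)
  rw [Finset.card_univ, Fintype.card_fin, nsmul_eq_mul]

theorem occ_le (m : ℕ) (U D : Finset V) (v : V) :
    occ H m U D v ≤ m * (U.card : ℝ) ^ (m - 1) := by
  have h : ∀ i : Fin m, ∑ g : Fin m → V, ind ((im g ⊆ U ∧ D ∪ im g ∈ H) ∧ g i = v) ≤
      (U.card : ℝ) ^ (m - 1) := by
    intro i
    classical
    rw [sum_ind_eq_card]
    have hsub : (Finset.univ.filter fun g : Fin m → V =>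
        (im g ⊆ U ∧ D ∪ im g ∈ H) ∧ g i = v) ⊆
        Fintype.piFinset fun j => if j = i then {v} else U := by
      intro g hg
      rw [Finset.mem_filter] at hg
      rw [Fintype.mem_piFinset]
      intro j
      split_ifs with h
      · rw [Finset.mem_singleton, h]; exact hg.2.2
      · exact hg.2.1.1 (mem_im_self g j)
    have h1 := Finset.card_le_card hsub
    rw [Fintype.card_piFinset, ← Finset.mul_prod_erase _ _ (Finset.mem_univ i), if_pos rfl,
      Finset.card_singleton, one_mul, Finset.prod_congr rfl fun j hj =>
        (by rw [if_neg (Finset.ne_of_mem_erase hj)] :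
          (if j = i then ({v} : Finset V) else U).card = U.card), Finset.prod_const,
      Finset.card_erase_of_mem (Finset.mem_univ i), Finset.card_univ, Fintype.card_fin] at h1
    exact_mod_cast h1
  rw [occ]
  refine (Finset.sum_le_card_nsmul _ _ _ fun i _ => h i).trans (le_of_eq ?_)
  rw [Finset.card_univ, Fintype.card_fin, nsmul_eq_mul]

theorem codeg_le (m : ℕ) (U D : Finset V) : codeg H m U D ≤ (U.card : ℝ) ^ m := by
  classical
  rw [codeg, sum_ind_eq_card]
  have h1 : (Finset.univ.filter fun g : Fin m → V => im g ⊆ U ∧ D ∪ im g ∈ H) ⊆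
      Fintype.piFinset fun _ => U := by
    intro g hg
    rw [Finset.mem_filter] at hg
    exact Fintype.mem_piFinset.2 fun j => hg.2.1 (mem_im_self g j)
  have h2 := Finset.card_le_card h1
  rw [Fintype.card_piFinset_const] at h2
  exact_mod_cast h2

theorem codeg_sdiff (m : ℕ) (U D B : Finset V) :
    codeg H m U D - ∑ v ∈ B, occ H m U D v ≤ codeg H m (U \ B) D := by
  rw [sum_occ, Finset.sum_comm, codeg, codeg, ← Finset.sum_sub_distrib]
  refine Finset.sum_le_sum fun g _ => ?_
  rw [← Finset.mul_sum]
  have hnn : ∀ i ∈ Finset.univ, 0 ≤ ind (g i ∈ B) := fun _ _ => ind_nonneg _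
  by_cases h : im g ⊆ U ∧ D ∪ im g ∈ H
  · rw [ind_of h, one_mul]
    by_cases hB : ∃ i, g i ∈ B
    · obtain ⟨i, hi⟩ := hB
      have h1 := Finset.single_le_sum hnn (Finset.mem_univ i)
      rw [ind_of hi] at h1
      have := ind_nonneg (im g ⊆ U \ B ∧ D ∪ im g ∈ H)
      linarith
    · have h1 : im g ⊆ U \ B ∧ D ∪ im g ∈ H := by
        refine ⟨fun v hv => Finset.mem_sdiff.2 ⟨h.1 hv, fun hvB => ?_⟩, h.2⟩
        obtain ⟨i, rfl⟩ := mem_im.1 hv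
        exact hB ⟨i, hvB⟩
      rw [ind_of h1]
      have := Finset.sum_nonneg hnn
      linarith
  · rw [ind_of_not h]
    have := ind_nonneg (im g ⊆ U \ B ∧ D ∪ im g ∈ H)
    linarith

theorem one_sub_pow_le {x : ℝ} (h0 : 0 ≤ x) (h1 : x ≤ 1) (m : ℕ) :
    (1 - x) ^ m ≤ 1 - m * x + m ^ 2 * x ^ 2 := by
  induction m with
  | zero => simp
  | succ m ih =>
    rw [pow_succ]
    have h2 := mul_le_mul_of_nonneg_right ih (by linarith : 0 ≤ 1 - x)
    refine h2.trans ?_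
    push_cast
    have h3 : (0 : ℝ) ≤ m * x ^ 2 := by positivity
    have h4 : (0 : ℝ) ≤ m ^ 2 * x ^ 3 := by positivity
    nlinarith [sq_nonneg x]

theorem density_step {m : ℕ} {x θ ξ ρ ρ₀ : ℝ} (hx0 : 0 ≤ x) (hxθ : x ≤ θ) (hθ : θ ≤ 1 / 2)
    (hξ0 : 0 ≤ ξ) (hρ : ρ ≤ ρ₀) (hρ0 : 0 ≤ ρ₀) (hρ1 : ρ₀ ≤ 1) :
    (ρ - 2 ^ m * (m ^ 2 * θ ^ 2 + m * θ * ξ + m * θ ^ 2)) * (1 - x) ^ m ≤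
      ρ₀ - (m * x * (ρ₀ + ξ) + m * θ ^ 2) := by
  have h6 := one_sub_pow_le hx0 (by linarith : x ≤ 1) m
  have h7 : (1 / 2 : ℝ) ^ m ≤ (1 - x) ^ m := pow_le_pow_left₀ (by norm_num) (by linarith) m
  have h8 : (1 : ℝ) ≤ 2 ^ m * (1 - x) ^ m := by
    have h9 : (2 : ℝ) ^ m * (1 / 2) ^ m = 1 := by rw [← mul_pow]; norm_num
    have h10 := mul_le_mul_of_nonneg_left h7 (by positivity : (0 : ℝ) ≤ 2 ^ m)
    linarith
  have hP0 : 0 ≤ (1 - x) ^ m := pow_nonneg (by linarith) _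
  generalize (1 - x) ^ m = P at *
  have hθ0 : 0 ≤ θ := hx0.trans hxθ
  have he0 : 0 ≤ m ^ 2 * θ ^ 2 + m * θ * ξ + m * θ ^ 2 := by positivity
  have hxe : m ^ 2 * x ^ 2 + m * x * ξ + m * θ ^ 2 ≤ m ^ 2 * θ ^ 2 + m * θ * ξ + m * θ ^ 2 := by
    gcongr
  generalize m ^ 2 * θ ^ 2 + m * θ * ξ + m * θ ^ 2 = e at *
  have h10 : ρ * P ≤ ρ₀ * P := mul_le_mul_of_nonneg_right hρ hP0
  have h11 : e ≤ 2 ^ m * P * e := le_mul_of_one_le_left he0 h8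
  have h12 : ρ₀ * P ≤ ρ₀ * (1 - m * x + m ^ 2 * x ^ 2) := mul_le_mul_of_nonneg_left h6 hρ0
  have h13 : ρ₀ * (m ^ 2 * x ^ 2) ≤ m ^ 2 * x ^ 2 := mul_le_of_le_one_left (by positivity) hρ1
  linarith

/-- One round of the nibble: a few disjoint tiles whose removal hardly changes the densities. -/
theorem exists_bite {T : Finset V → Prop} {U : Finset V} {r m d J : ℕ} {η θ : ℝ}
    (hT : TileDist T U r η) (hm : 1 ≤ m) (hr : 0 < r) (hη0 : 0 ≤ η) (hη1 : η ≤ 1) (hθ : 0 < θ)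
    (hθr : 4 * r * θ ≤ 1) (hU : 0 < U.card) (hJ : (J * r : ℝ) ≤ θ * U.card)
    (hlog : r * Real.log ((Fintype.card V : ℝ) ^ d) ≤ θ ^ 3 * U.card) :
    ∃ g : Fin J → Finset V, (∀ i j, i ≠ j → Disjoint (g i) (g j)) ∧
      (∀ j, g j ⊆ U ∧ T (g j) ∧ (g j).card = r) ∧
      ∀ (D : Fin d → V) (ρ : ℝ), ρ * (U.card : ℝ) ^ m ≤ codeg H m U (im D) →
        (ρ - 2 ^ m * (m ^ 2 * θ ^ 2 + m * θ * (η + θ + 8 * r * θ) + m * θ ^ 2)) *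
          ((U \ Finset.univ.biUnion g).card : ℝ) ^ m ≤
            codeg H m (U \ Finset.univ.biUnion g) (im D) := by
  classical
  obtain ⟨Ω, _, μ, A, hμ0, hμ1, hA, hload⟩ := hT
  set u : ℝ := (U.card : ℝ) with hu
  have hu0 : 0 < u := Nat.cast_pos.2 hU
  have hr0 : (0 : ℝ) < r := by exact_mod_cast hr
  have hr1 : (1 : ℝ) ≤ r := by exact_mod_cast hr
  have hm0 : (0 : ℝ) < m := by exact_mod_cast hm
  have hθ1 : θ ≤ 1 / 4 := by nlinarith
  have hpow : u ^ m = u * u ^ (m - 1) := by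
    rw [← pow_succ']; congr 1; omega
  set Z : ℝ := r * m * u ^ (m - 1) with hZ
  have hZ0 : 0 < Z := by positivity
  set f : (Fin d → V) → Ω → ℝ := fun D ω => (∑ v ∈ A ω, occ H m U (im D) v) / Z with hf
  have hf0 : ∀ D ω, 0 ≤ f D ω := fun D ω =>
    div_nonneg (Finset.sum_nonneg fun v _ => occ_nonneg _ _ _ _) hZ0.le
  have hf1 : ∀ D ω, f D ω ≤ 1 := by
    intro D ω
    rw [hf]
    dsimp only
    rw [div_le_one hZ0]
    refine (Finset.sum_le_card_nsmul _ _ _ fun v _ => occ_le m U (im D) v).trans (le_of_eq ?_)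
    rw [(hA ω).2.2, nsmul_eq_mul, hZ]
    ring
  have hexp : ∀ D, ∑ ω, μ ω * f D ω ≤ (1 + η) * (codeg H m U (im D) / u ^ m) := by
    intro D
    have h1 : ∀ ω, μ ω * f D ω =
        (∑ v ∈ U, occ H m U (im D) v * (μ ω * ind (v ∈ A ω))) / Z := by
      intro ω
      rw [hf]
      dsimp only
      rw [← mul_div_assoc, Finset.mul_sum]
      congr 1
      rw [← Finset.sum_subset (hA ω).1 (fun v _ hv => by rw [ind_of_not hv]; ring)]
      exact Finset.sum_congr rfl fun v hv => by rw [ind_of hv]; ring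
    rw [Finset.sum_congr rfl fun ω _ => h1 ω, ← Finset.sum_div, Finset.sum_comm]
    have h2 : ∑ v ∈ U, ∑ ω, occ H m U (im D) v * (μ ω * ind (v ∈ A ω)) ≤
        (m * codeg H m U (im D)) * ((1 + η) * r / u) := by
      have h3 : 0 ≤ (1 + η) * r / u := by positivity
      refine le_trans ?_ (mul_le_mul_of_nonneg_right (sum_occ_le (H := H) m U (im D)) h3)
      rw [Finset.sum_mul]
      refine Finset.sum_le_sum fun v hv => ?_
      rw [← Finset.mul_sum]
      exact mul_le_mul_of_nonneg_left (hload v hv) (occ_nonneg _ _ _ _)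
    rw [div_le_iff₀ hZ0]
    refine h2.trans (le_of_eq ?_)
    rw [hZ, hpow]
    field_simp
  have hconf : ∀ F : Finset V, F.card ≤ J * r →
      ∑ ω with ¬ Disjoint (A ω) F, μ ω ≤ 2 * r * θ := by
    intro F hF
    have h1 : ∑ ω with ¬ Disjoint (A ω) F, μ ω ≤ ∑ ω, ∑ v ∈ F ∩ U, μ ω * ind (v ∈ A ω) := by
      rw [Finset.sum_filter]
      refine Finset.sum_le_sum fun ω _ => ?_
      have hnn : ∀ v ∈ F ∩ U, 0 ≤ μ ω * ind (v ∈ A ω) := fun v _ =>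
        mul_nonneg (hμ0 ω) (ind_nonneg _)
      split_ifs with h
      · exact Finset.sum_nonneg hnn
      · rw [Finset.not_disjoint_iff] at h
        obtain ⟨v, hvA, hvF⟩ := h
        refine le_trans (le_of_eq ?_) (Finset.single_le_sum hnn
          (Finset.mem_inter.2 ⟨hvF, (hA ω).1 hvA⟩))
        rw [ind_of hvA, mul_one]
    rw [Finset.sum_comm] at h1
    refine h1.trans ((Finset.sum_le_card_nsmul _ _ _ fun v hv =>
      hload v (Finset.mem_inter.1 hv).2).trans ?_)
    rw [nsmul_eq_mul]
    have h2 : ((F ∩ U).card : ℝ) ≤ J * r := by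
      exact_mod_cast (Finset.card_le_card Finset.inter_subset_left).trans hF
    calc ((F ∩ U).card : ℝ) * ((1 + η) * r / u) ≤ (θ * u) * (2 * r / u) := by
          gcongr
          · exact h2.trans hJ
          · linarith
      _ = _ := by field_simp
  obtain ⟨g, hg1, -, hg3⟩ := exists_disjoint_sequence μ hμ0 hμ1 A r J (fun ω => (hA ω).2.2.le)
    (2 * r * θ) θ (by positivity) (by linarith) hθ (by linarith) hconf f hf0 hf1
    (fun D => min 1 ((1 + η) * (codeg H m U (im D) / u ^ m))) (fun D => le_min (by
      rw [← hμ1]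
      exact Finset.sum_le_sum fun ω _ => mul_le_of_le_one_right (hμ0 ω) (hf1 D ω)) (hexp D))
    fun D => min_le_left _ _
  refine ⟨fun j => A (g j), hg1, fun j => hA _, fun D ρ hρ => ?_⟩
  set B := Finset.univ.biUnion fun j => A (g j) with hB
  have hBU : B ⊆ U := Finset.biUnion_subset.2 fun j _ => (hA _).1
  have hBcard : (B.card : ℝ) = J * r := by
    rw [hB, Finset.card_biUnion fun i _ j _ h => hg1 i j h,
      Finset.sum_congr rfl fun j _ => (hA (g j)).2.2]
    simp
  have hsd : ((U \ B).card : ℝ) = u - J * r := by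
    rw [Finset.card_sdiff_of_subset hBU, Nat.cast_sub (Finset.card_le_card hBU), hBcard]
  obtain ⟨x, hx⟩ : ∃ x : ℝ, x = J * r / u := ⟨_, rfl⟩
  have hx0 : 0 ≤ x := hx ▸ by positivity
  have hxθ : x ≤ θ := by rw [hx, div_le_iff₀ hu0]; exact hJ
  have hJx : (J * r : ℝ) = x * u := by rw [hx, div_mul_cancel₀ _ hu0.ne']
  set ρ₀ := codeg H m U (im D) / u ^ m with hρ₀
  have hcod : codeg H m U (im D) = ρ₀ * u ^ m := by
    rw [hρ₀, div_mul_cancel₀ _ (pow_pos hu0 m).ne']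
  have hρ0 : ρ ≤ ρ₀ := by rw [hρ₀, le_div_iff₀ (pow_pos hu0 m)]; exact hρ
  have hρ1 : ρ₀ ≤ 1 := by
    rw [hρ₀, div_le_one (pow_pos hu0 m)]
    exact codeg_le m U (im D)
  have hρnn : 0 ≤ ρ₀ := div_nonneg (Finset.sum_nonneg fun _ _ => ind_nonneg _) (pow_pos hu0 m).le
  have h1 := hg3 D
  rw [Fintype.card_fun, Fintype.card_fin, Nat.cast_pow] at h1
  have h2 : ∑ v ∈ B, occ H m U (im D) v = Z * ∑ j, f D (g j) := by
    rw [hB, Finset.sum_biUnion fun i _ j _ h => hg1 i j h, Finset.mul_sum]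
    refine Finset.sum_congr rfl fun j _ => ?_
    rw [hf]
    dsimp only
    field_simp
  have h3 := codeg_sdiff (H := H) m U (im D) B
  have hmin : min 1 ((1 + η) * ρ₀) ≤ ρ₀ + η := by
    refine (min_le_right _ _).trans ?_
    nlinarith
  have hξ : (J : ℝ) * (min 1 ((1 + η) * ρ₀) + θ + 4 * (2 * r * θ)) ≤
      J * (ρ₀ + (η + θ + 8 * r * θ)) :=
    mul_le_mul_of_nonneg_left (by linarith) (Nat.cast_nonneg _)
  clear_value u
  have hlog' : Real.log ((Fintype.card V : ℝ) ^ d) / θ ≤ θ ^ 2 * u / r := by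
    rw [div_le_div_iff₀ hθ hr0]
    nlinarith
  have hξ0 : 0 ≤ η + θ + 8 * r * θ := by positivity
  set ξ := η + θ + 8 * r * θ with hξdef
  have h4 : Z * ∑ j, f D (g j) ≤ u ^ m * (m * x * (ρ₀ + ξ) + m * θ ^ 2) := by
    have h5 : ∑ j, f D (g j) ≤ J * (ρ₀ + ξ) + θ ^ 2 * u / r := by linarith
    refine (mul_le_mul_of_nonneg_left h5 hZ0.le).trans (le_of_eq ?_)
    rw [hZ, hpow, hx]
    field_simp
  rw [h2, hcod] at h3
  rw [hsd, hJx, show u - x * u = u * (1 - x) by ring, mul_pow]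
  have h9 := mul_le_mul_of_nonneg_left (density_step (m := m) hx0 hxθ (hθ1.trans (by norm_num)) hξ0
    hρ0 hρnn hρ1) (pow_nonneg hu0.le m)
  linarith

end bite

theorem nibble_constants {m : ℕ} (hm : 1 ≤ m) {γ ε : ℝ} (hγ : 0 < γ) (hε : 0 < ε) (hε1 : ε ≤ 1) :
    ∃ η : ℝ, 0 < η ∧ η ≤ 1 ∧ ∀ r : ℕ, 0 < r → ∃ θ : ℝ, 0 < θ ∧ 4 * r * θ ≤ 1 ∧ ∃ K : ℕ,
      (1 - θ / 2) ^ K ≤ ε ∧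
      K * (2 ^ m * (m ^ 2 * θ ^ 2 + m * θ * (η + θ + 8 * r * θ) + m * θ ^ 2)) ≤ γ := by
  have hL : 0 ≤ Real.log (1 / ε) := Real.log_nonneg (by rw [le_div_iff₀ hε]; linarith)
  set L := Real.log (1 / ε) with hLdef
  have hm0 : (0 : ℝ) < m := by exact_mod_cast hm
  have hB : 0 < 2 * L + 1 := by linarith
  have hc : 0 < (2 * L + 1) * 2 ^ m * m := by positivity
  refine ⟨min 1 (γ / 2 / ((2 * L + 1) * 2 ^ m * m)), by positivity, min_le_left _ _, fun r hr => ?_⟩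
  have hη := min_le_right 1 (γ / 2 / ((2 * L + 1) * 2 ^ m * m))
  have hη0 : 0 < min 1 (γ / 2 / ((2 * L + 1) * 2 ^ m * m)) := by positivity
  generalize min 1 (γ / 2 / ((2 * L + 1) * 2 ^ m * m)) = η at hη hη0 ⊢
  rw [le_div_iff₀ hc] at hη
  have hr1 : (1 : ℝ) ≤ r := by exact_mod_cast hr
  set q : ℝ := m ^ 2 + 2 * m + 8 * m * r with hq
  have hq0 : 0 < q := by positivity
  have hc' : 0 < (2 * L + 1) * 2 ^ m * q := by positivity
  have hθa := min_le_left (1 / (4 * r : ℝ)) (γ / 2 / ((2 * L + 1) * 2 ^ m * q))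
  have hθb := min_le_right (1 / (4 * r : ℝ)) (γ / 2 / ((2 * L + 1) * 2 ^ m * q))
  have hθ0 : 0 < min (1 / (4 * r : ℝ)) (γ / 2 / ((2 * L + 1) * 2 ^ m * q)) := by positivity
  generalize min (1 / (4 * r : ℝ)) (γ / 2 / ((2 * L + 1) * 2 ^ m * q)) = θ at hθa hθb hθ0
  rw [le_div_iff₀ (by positivity)] at hθa
  rw [le_div_iff₀ hc'] at hθb
  have hθ1 : θ ≤ 1 := by nlinarith
  refine ⟨θ, hθ0, by linarith, ⌈2 * L / θ⌉₊, ?_, ?_⟩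
  · have hK := Nat.le_ceil (2 * L / θ)
    rw [div_le_iff₀ hθ0] at hK
    have h1 : (1 - θ / 2) ^ ⌈2 * L / θ⌉₊ ≤ Real.exp (-(θ / 2)) ^ ⌈2 * L / θ⌉₊ :=
      pow_le_pow_left₀ (by linarith) (by have := Real.add_one_le_exp (-(θ / 2)); linarith) _
    refine h1.trans ?_
    rw [← Real.exp_nat_mul]
    refine (Real.exp_le_exp.2 (by linarith : _ ≤ -L)).trans (le_of_eq ?_)
    rw [hLdef, one_div, Real.log_inv, neg_neg, Real.exp_log hε]
  · have hK := (Nat.ceil_lt_add_one (by positivity : 0 ≤ 2 * L / θ)).le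
    have hKθ : (⌈2 * L / θ⌉₊ : ℝ) * θ ≤ 2 * L + 1 := by
      have := mul_le_mul_of_nonneg_right hK hθ0.le
      rw [add_mul, div_mul_cancel₀ _ hθ0.ne'] at this
      linarith
    generalize (⌈2 * L / θ⌉₊ : ℝ) = K at hKθ
    have h2 : 0 ≤ 2 ^ m * (m * η + θ * q) := by positivity
    calc K * (2 ^ m * (m ^ 2 * θ ^ 2 + m * θ * (η + θ + 8 * r * θ) + m * θ ^ 2)) =
          K * θ * (2 ^ m * (m * η + θ * q)) := by rw [hq]; ring
      _ ≤ (2 * L + 1) * (2 ^ m * (m * η + θ * q)) := mul_le_mul_of_nonneg_right hKθ h2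
      _ ≤ γ := by linarith

/-- An almost perfect tiling, found by a nibble, if every dense set admits a nearly uniform
distribution on tiles. -/
theorem exists_tiling {m : ℕ} (d : ℕ) (hm : 1 ≤ m) (hd : 1 ≤ d) {γ ε : ℝ} (hγ : 0 < γ) (hε : 0 < ε)
    (hε1 : ε ≤ 1) : ∃ η : ℝ, 0 < η ∧ η ≤ 1 ∧ ∀ r : ℕ, 0 < r → ∀ N₀ : ℕ, ∃ N₁ : ℕ,
      ∀ {V : Type} [Fintype V] [DecidableEq V] {H : Finset (Finset V)} {T : Finset V → Prop}
        {σ : ℝ} {U₀ : Finset V}, N₁ ≤ Fintype.card V →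
        (∀ U ⊆ U₀, N₀ ≤ U.card → (∀ D : Finset V, D.card = d →
          σ * (U.card : ℝ) ^ m ≤ codeg H m U D) → TileDist T U r η) →
        (∀ D : Finset V, D.card = d → (σ + γ) * (U₀.card : ℝ) ^ m ≤ codeg H m U₀ D) →
        ∃ 𝒯 : Finset (Finset V), (∀ A ∈ 𝒯, ∀ B ∈ 𝒯, A ≠ B → Disjoint A B) ∧
          (∀ A ∈ 𝒯, A ⊆ U₀ ∧ T A ∧ A.card = r) ∧
          ((U₀ \ 𝒯.biUnion id).card : ℝ) ≤ ε * Fintype.card V := by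
  obtain ⟨η, hη0, hη1, hη⟩ := nibble_constants hm hγ hε hε1
  refine ⟨η, hη0, hη1, fun r hr N₀ => ?_⟩
  obtain ⟨θ, hθ0, hθr, K, hK, hKγ⟩ := hη r hr
  set Δ := 2 ^ m * (m ^ 2 * θ ^ 2 + m * θ * (η + θ + 8 * r * θ) + m * θ ^ 2) with hΔ
  have hΔ0 : 0 ≤ Δ := by positivity
  have hr0 : (0 : ℝ) < r := by exact_mod_cast hr
  have hr1 : (1 : ℝ) ≤ r := by exact_mod_cast hr
  have hθ1 : θ ≤ 1 / 4 := by nlinarith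
  obtain ⟨Nl, hNl⟩ := eventually_log_le d (show 0 < θ ^ 3 * ε / r by positivity)
  obtain ⟨Na, hNa⟩ := exists_nat_ge (N₀ / ε)
  obtain ⟨Nb, hNb⟩ := exists_nat_ge (2 * r / (θ * ε))
  rw [div_le_iff₀ hε] at hNa
  rw [div_le_iff₀ (by positivity)] at hNb
  refine ⟨max Nl (max Na Nb), fun {V} _ _ {H T σ U₀} hn hdist hdeg => ?_⟩
  simp only [max_le_iff] at hn
  obtain ⟨hn1, hn2, hn3⟩ := hn
  set n := Fintype.card V with hnV
  have hlog := hNl n hn1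
  have hna : (N₀ : ℝ) ≤ ε * n := by
    have : (Na : ℝ) ≤ n := by exact_mod_cast hn2
    nlinarith
  have hnb : 2 * r ≤ θ * (ε * n) := by
    have : (Nb : ℝ) ≤ n := by exact_mod_cast hn3
    have := mul_le_mul_of_nonneg_right this (by positivity : 0 ≤ θ * ε)
    linarith
  have key : ∀ j : ℕ, j ≤ K → ∃ 𝒯 : Finset (Finset V),
      (∀ A ∈ 𝒯, ∀ B ∈ 𝒯, A ≠ B → Disjoint A B) ∧ (∀ A ∈ 𝒯, A ⊆ U₀ ∧ T A ∧ A.card = r) ∧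
      (((U₀ \ 𝒯.biUnion id).card : ℝ) ≤ ε * n ∨
        ((U₀ \ 𝒯.biUnion id).card : ℝ) ≤ (1 - θ / 2) ^ j * U₀.card ∧
        ∀ D : Finset V, D.card = d → (σ + γ - j * Δ) * ((U₀ \ 𝒯.biUnion id).card : ℝ) ^ m ≤
          codeg H m (U₀ \ 𝒯.biUnion id) D) := by
    intro j
    induction j with
    | zero => exact fun _ => ⟨∅, by simp, by simp, Or.inr ⟨by simp, by simpa using hdeg⟩⟩
    | succ j ih =>
      intro hj
      obtain ⟨𝒯, h1, h2, h3⟩ := ih (by omega)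
      rcases h3 with h3 | ⟨h3, h4⟩
      · exact ⟨𝒯, h1, h2, Or.inl h3⟩
      by_cases hu : ((U₀ \ 𝒯.biUnion id).card : ℝ) ≤ ε * n
      · exact ⟨𝒯, h1, h2, Or.inl hu⟩
      push Not at hu
      set U := U₀ \ 𝒯.biUnion id with hU
      have hjΔ : j * Δ ≤ γ := by
        refine (mul_le_mul_of_nonneg_right ?_ hΔ0).trans hKγ
        exact_mod_cast (by omega : j ≤ K)
      have hupos : 0 < (U.card : ℝ) := by nlinarith
      have hJ1 := Nat.floor_le (show 0 ≤ θ * U.card / r by positivity)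
      have hJ2 := Nat.lt_floor_add_one (θ * U.card / r)
      rw [le_div_iff₀ hr0] at hJ1
      rw [div_lt_iff₀ hr0] at hJ2
      generalize ⌊θ * U.card / r⌋₊ = J at hJ1 hJ2
      obtain ⟨g, hg1, hg2, hg3⟩ := exists_bite (H := H) (d := d) (m := m) (J := J) (θ := θ)
        (hdist U Finset.sdiff_subset (by exact_mod_cast hna.trans hu.le) fun D hD =>
          (mul_le_mul_of_nonneg_right (by linarith) (by positivity)).trans (h4 D hD))
        hm hr hη0.le hη1 hθ0 hθr (by exact_mod_cast hupos) hJ1 (by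
          have h5 := mul_le_mul_of_nonneg_left hlog hr0.le
          have h6 : r * (θ ^ 3 * ε / r * n) = θ ^ 3 * (ε * n) := by field_simp
          rw [h6] at h5
          exact h5.trans (mul_le_mul_of_nonneg_left hu.le (by positivity)))
      have hUeq : U₀ \ (𝒯 ∪ Finset.univ.image g).biUnion id = U \ Finset.univ.biUnion g := by
        ext v
        simp only [hU, Finset.mem_sdiff, Finset.mem_biUnion, Finset.mem_union, Finset.mem_image,
          Finset.mem_univ, true_and, id]
        constructor
        · rintro ⟨ha, hb⟩
          exact ⟨⟨ha, fun ⟨A, hA, hv⟩ => hb ⟨A, Or.inl hA, hv⟩⟩,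
            fun ⟨i, hv⟩ => hb ⟨g i, Or.inr ⟨i, rfl⟩, hv⟩⟩
        · rintro ⟨⟨ha, hb⟩, hc⟩
          refine ⟨ha, ?_⟩
          rintro ⟨A, hA | ⟨i, rfl⟩, hv⟩
          exacts [hb ⟨A, hA, hv⟩, hc ⟨i, hv⟩]
      have hdis : ∀ A ∈ 𝒯, ∀ i, Disjoint A (g i) := fun A hA i =>
        Finset.disjoint_left.2 fun v hv hv' => (Finset.mem_sdiff.1 ((hg2 i).1 hv')).2
          (Finset.mem_biUnion.2 ⟨A, hA, hv⟩)
      refine ⟨𝒯 ∪ Finset.univ.image g, ?_, ?_, Or.inr ?_⟩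
      · simp only [Finset.mem_union, Finset.mem_image, Finset.mem_univ, true_and]
        rintro A (hA | ⟨i, rfl⟩) B (hB | ⟨i', rfl⟩) hAB
        · exact h1 A hA B hB hAB
        · exact hdis A hA i'
        · exact (hdis B hB i).symm
        · exact hg1 i i' fun h => hAB (h ▸ rfl)
      · simp only [Finset.mem_union, Finset.mem_image, Finset.mem_univ, true_and]
        rintro A (hA | ⟨i, rfl⟩)
        · exact h2 A hA
        · exact ⟨(hg2 i).1.trans Finset.sdiff_subset, (hg2 i).2⟩
      · rw [hUeq]
        constructor
        · have h5 : ((Finset.univ.biUnion g).card : ℝ) = J * r := by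
            rw [Finset.card_biUnion fun i _ j _ h => hg1 i j h,
              Finset.sum_congr rfl fun j _ => (hg2 j).2.2]
            simp
          have h6 : Finset.univ.biUnion g ⊆ U := Finset.biUnion_subset.2 fun j _ => (hg2 j).1
          rw [Finset.card_sdiff_of_subset h6, Nat.cast_sub (Finset.card_le_card h6), h5, pow_succ]
          have h7 : θ * (ε * n) ≤ θ * U.card := mul_le_mul_of_nonneg_left hu.le hθ0.le
          have h8 := mul_le_mul_of_nonneg_right h3 (by linarith : 0 ≤ 1 - θ / 2)
          linarith
        · intro D hD
          obtain ⟨a, rfl⟩ := im_eq_of_card_le (q := d) (Finset.card_pos.1 (by omega)) hD.le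
          refine (mul_le_mul_of_nonneg_right (le_of_eq ?_) (by positivity)).trans
            (hg3 a _ (h4 _ hD))
          push_cast
          ring
  obtain ⟨𝒯, h1, h2, h3⟩ := key K le_rfl
  refine ⟨𝒯, h1, h2, ?_⟩
  rcases h3 with h3 | ⟨h3, -⟩
  · exact h3
  · refine h3.trans (mul_le_mul hK ?_ (by positivity) hε.le)
    exact_mod_cast Finset.card_le_univ U₀

section density
variable {V : Type} [Fintype V] [DecidableEq V] {H : Finset (Finset V)}

theorem codeg_univ [Nonempty V] (m : ℕ) (D : Finset V) :
    codeg H m Finset.univ D = dens H m D * (Fintype.card V : ℝ) ^ m := by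
  have hV : (0 : ℝ) < Fintype.card V := by exact_mod_cast Fintype.card_pos
  rw [dens, pr, Fintype.card_fun, Fintype.card_fin, Nat.cast_pow, div_mul_cancel₀ _ (by positivity),
    codeg]
  exact Finset.sum_congr rfl fun g _ => ind_congr ⟨fun h => h.2, fun h => ⟨Finset.subset_univ _, h⟩⟩

theorem le_codeg_compl [Nonempty V] {m : ℕ} (hm : 1 ≤ m) {B D : Finset V} {β ρ : ℝ}
    (hB : (B.card : ℝ) ≤ β * Fintype.card V) (hρ : ρ ≤ dens H m D) :
    (ρ - m * β) * ((Finset.univ \ B).card : ℝ) ^ m ≤ codeg H m (Finset.univ \ B) D := by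
  have hV : (0 : ℝ) < Fintype.card V := by exact_mod_cast Fintype.card_pos
  rcases le_total (ρ - m * β) 0 with h | h
  · exact (mul_nonpos_of_nonpos_of_nonneg h (by positivity)).trans
      (Finset.sum_nonneg fun _ _ => ind_nonneg _)
  refine le_trans ?_ (codeg_sdiff m Finset.univ D B)
  rw [codeg_univ]
  have h1 : ∑ v ∈ B, occ H m Finset.univ D v ≤ β * m * (Fintype.card V : ℝ) ^ m := by
    refine (Finset.sum_le_card_nsmul _ _ _ fun v _ => occ_le m Finset.univ D v).trans ?_
    rw [nsmul_eq_mul, Finset.card_univ]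
    calc (B.card : ℝ) * (m * (Fintype.card V : ℝ) ^ (m - 1)) ≤
          β * Fintype.card V * (m * (Fintype.card V : ℝ) ^ (m - 1)) := by gcongr
      _ = β * m * (Fintype.card V : ℝ) ^ m := by
          rw [← Nat.sub_add_cancel hm, pow_succ, Nat.add_sub_cancel]; ring
  have h2 : ((Finset.univ \ B).card : ℝ) ^ m ≤ (Fintype.card V : ℝ) ^ m := by
    gcongr
    exact Finset.card_le_univ _
  have h3 := mul_le_mul_of_nonneg_left h2 h
  have h4 := mul_le_mul_of_nonneg_right hρ (by positivity : 0 ≤ (Fintype.card V : ℝ) ^ m)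
  linarith

theorem le_dens_of_card_add {d m : ℕ} {τ : ℝ} (hτ : 0 ≤ τ) (hd : d ≤ Fintype.card V)
    (h : ∀ D : Finset V, D.card = d → τ ≤ dens H m D) (j : ℕ) :
    ∀ D : Finset V, D.card + j = d → (1 - d / Fintype.card V : ℝ) ^ j * τ ≤ dens H (m + j) D := by
  induction j with
  | zero => simpa using h
  | succ j ih =>
    intro D hD
    have hV : (0 : ℝ) < Fintype.card V := by exact_mod_cast (by omega : 0 < Fintype.card V)
    have hdV : (d : ℝ) ≤ Fintype.card V := by exact_mod_cast hd
    have hq : 0 ≤ 1 - (d : ℝ) / Fintype.card V := by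
      rw [sub_nonneg, div_le_one hV]; exact hdV
    rw [← add_assoc, dens_succ, le_div_iff₀ hV]
    have h1 : ((Finset.univ \ D).card : ℝ) * ((1 - d / Fintype.card V : ℝ) ^ j * τ) ≤
        ∑ v ∈ Finset.univ \ D, dens H (m + j) (insert v D) := by
      rw [← nsmul_eq_mul]
      refine Finset.card_nsmul_le_sum _ _ _ fun v hv => ih _ ?_
      rw [Finset.card_insert_of_notMem (Finset.mem_sdiff.1 hv).2]
      omega
    have h2 : ∑ v ∈ Finset.univ \ D, dens H (m + j) (insert v D) ≤
        ∑ v, dens H (m + j) (insert v D) :=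
      Finset.sum_le_sum_of_subset_of_nonneg (Finset.subset_univ _) fun _ _ _ => dens_nonneg _ _
    refine le_trans ?_ (h1.trans h2)
    have h3 : (1 - d / Fintype.card V : ℝ) * Fintype.card V ≤ (Finset.univ \ D).card := by
      rw [Finset.card_sdiff_of_subset (Finset.subset_univ _), Finset.card_univ,
        Nat.cast_sub (Finset.card_le_univ D), sub_mul, div_mul_cancel₀ _ hV.ne', one_mul]
      have : (D.card : ℝ) ≤ d := by exact_mod_cast (by omega : D.card ≤ d)
      linarith
    calc (1 - d / Fintype.card V : ℝ) ^ (j + 1) * τ * Fintype.card V =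
          (1 - d / Fintype.card V : ℝ) * Fintype.card V * ((1 - d / Fintype.card V : ℝ) ^ j * τ) := by
          ring
      _ ≤ _ := mul_le_mul_of_nonneg_right h3 (by positivity)

theorem Deg.of_dens {d m : ℕ} {γ : ℝ} (hγ : 0 ≤ γ) (hV : 2 * d * d + d + 1 ≤ Fintype.card V)
    (hH : ∀ e ∈ H, e.card = d + m) (h : ∀ D : Finset V, D.card = d → γ ≤ dens H m D) :
    Deg H (d + m) d (γ / 2) := by
  refine ⟨hH, fun D hD => ?_⟩
  have h1 := le_dens_of_card_add hγ (by omega) h (d - D.card) D (by omega)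
  rw [dens] at h1
  rw [show d + m - D.card = m + (d - D.card) by omega]
  refine le_trans ?_ h1
  have hn : (2 * d * d + d + 1 : ℝ) ≤ Fintype.card V := by exact_mod_cast hV
  have hd0 : (0 : ℝ) ≤ d := Nat.cast_nonneg _
  have hn0 : (0 : ℝ) < Fintype.card V := by nlinarith
  have hq1 : (d : ℝ) / Fintype.card V ≤ 1 := by
    rw [div_le_one hn0]; nlinarith
  have hq0 : 0 ≤ (d : ℝ) / Fintype.card V := by positivity
  have h2 := one_add_mul_le_pow (a := -((d : ℝ) / Fintype.card V)) (by linarith) (d - D.card)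
  have h3 : ((d - D.card : ℕ) : ℝ) * (d / Fintype.card V) ≤ 1 / 2 := by
    have h4 : ((d - D.card : ℕ) : ℝ) ≤ d := by exact_mod_cast Nat.sub_le _ _
    refine (mul_le_mul_of_nonneg_right h4 hq0).trans ?_
    rw [← mul_div_assoc, div_le_iff₀ hn0]
    linarith
  have h5 : (1 / 2 : ℝ) ≤ (1 - d / Fintype.card V : ℝ) ^ (d - D.card) := by
    rw [sub_eq_add_neg]; linarith
  have := mul_le_mul_of_nonneg_right h5 hγ
  linarith

end density

theorem hasHamiltonCycle_of_conn {n l o : ℕ} (hl : 0 < l) {H : Finset (Finset (Fin n))}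
    (hH : ∀ e ∈ H, e.card = 2 * l + o) {b e : Fin l → Fin n} {X I : Finset (Fin n)}
    (h : LPath H b e X) (hc : Conn H e b I) (hXI : Disjoint X I) (hu : X ∪ I = Finset.univ) :
    HasHamiltonCycle n (2 * l + o) l H := by
  obtain ⟨hd, hI, hp⟩ := hc
  generalize hY : im e ∪ I ∪ im b = Y at hp
  cases hp with
  | single =>
    have := Finset.disjoint_self_iff_empty _ |>.1 hd
    exact absurd (mem_im_self b ⟨0, hl⟩) (by rw [this]; simp)
  | step S' _ O A hA hedge hb hOb hAO =>
    rw [Finset.disjoint_union_right] at hAO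
    have hsub : ∀ v, v ∈ A ∪ O → v ∉ im e → v ∈ I := by
      intro v hv hve
      have h1 : v ∈ im e ∪ I ∪ im b := by
        rw [hY]
        simp only [Finset.mem_union] at hv ⊢
        tauto
      have h2 : v ∉ im b := fun hvb => by
        rcases Finset.mem_union.1 hv with hv | hv
        · exact Finset.disjoint_left.1 hAO.2 hv hvb
        · exact Finset.disjoint_left.1 hOb hv hvb
      simp only [Finset.mem_union] at h1
      tauto
    have hOe : ∀ v ∈ O, v ∉ im e := fun v hv hve =>
      Finset.disjoint_left.1 hAO.1 (hA.beg_subset hve) hv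
    have hXA : Disjoint X (A \ im e) := Finset.disjoint_left.2 fun v hv hv' => by
      rw [Finset.mem_sdiff] at hv'
      exact Finset.disjoint_left.1 hXI hv (hsub v (Finset.mem_union_left _ hv'.1) hv'.2)
    have hIsub : I ⊆ X ∪ A ∪ O := fun v hv => by
      have h1 : v ∈ A ∪ (O ∪ im b) := by
        rw [← hY]
        simp [hv]
      have h2 : v ∈ im b → v ∈ X := fun hv => h.beg_subset hv
      simp only [Finset.mem_union] at h1 ⊢
      tauto
    refine hasHamiltonCycle_of_closed hl hH (h.concat hA hXA) (O := O) ?_ ?_ hedge ?_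
    · rw [Finset.disjoint_union_left]
      refine ⟨Finset.disjoint_left.2 fun v hv hv' => ?_, hAO.1⟩
      exact Finset.disjoint_left.1 hXI hv (hsub v (Finset.mem_union_right _ hv') (hOe v hv'))
    · refine Finset.eq_univ_of_forall fun v => ?_
      have hv : v ∈ X ∪ I := hu ▸ Finset.mem_univ v
      rcases Finset.mem_union.1 hv with hv | hv
      · exact Finset.mem_union_left _ (Finset.mem_union_left _ hv)
      · exact hIsub hv
    · exact hAO.2.mono_left hA.end_subset

theorem hasYTilingCover_of_frac {l o d m : ℕ} (ho : 0 < o) (hdm : d + m = 2 * l + o) (hd : 1 ≤ d)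
    (hm : 1 ≤ m) {τ γ ε : ℝ} (hτ : FracHyp l o d m τ) (hγ : 0 < γ) (hε : 0 < ε) :
    ∃ N : ℕ, ∀ n ≥ N, ∀ G : Finset (Finset (Fin n)), (∀ e ∈ G, e.card = 2 * l + o) →
      (∀ D : Finset (Fin n), D.card = d → τ + γ ≤ dens G m D) → HasYTilingCover n l G (ε * n) := by
  classical
  obtain ⟨η, hη0, hη1, hη⟩ := exists_tiling (m := m) d hm hd (half_pos hγ) (ε := min 1 ε)
    (by positivity) (min_le_left _ _)
  obtain ⟨N₀, hN₀⟩ := exists_pair_dist hdm hd hτ (half_pos hγ) hη0 hη1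
  obtain ⟨N₁, hN₁⟩ := hη (2 * (l + o)) (by omega) N₀
  refine ⟨N₁ + 1, fun n hn G hG hdens => ?_⟩
  have : Nonempty (Fin n) := ⟨⟨0, by omega⟩⟩
  obtain ⟨𝒯, h1, h2, h3⟩ := hN₁ (V := Fin n) (H := G) (T := PairTile l G) (σ := τ + γ / 2)
    (U₀ := Finset.univ) (by rw [Fintype.card_fin]; omega)
    (fun U _ hU hcod => hN₀ (Fin n) G U hG hU fun D _ hD => hcod D hD)
    (fun D hD => by
      rw [codeg_univ, Finset.card_univ]
      exact mul_le_mul_of_nonneg_right (by linarith [hdens D hD]) (by positivity))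
  choose e₁ he₁ e₂ he₂ he using fun A : 𝒯 => (h2 A.1 A.2).2.1
  refine ⟨𝒯.card, fun j => e₁ (𝒯.equivFin.symm j), fun j => e₂ (𝒯.equivFin.symm j),
    fun j => ⟨he₁ _, he₂ _, (he _).1⟩, fun i j hij => ?_, ?_⟩
  · rw [(he _).2, (he _).2]
    refine h1 _ (Subtype.prop _) _ (Subtype.prop _) fun h => hij ?_
    exact 𝒯.equivFin.symm.injective (Subtype.ext h)
  · have h4 : (Finset.univ.biUnion fun j => e₁ (𝒯.equivFin.symm j) ∪ e₂ (𝒯.equivFin.symm j)) =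
        𝒯.biUnion id := by
      ext v
      simp only [(he _).2, Finset.mem_biUnion, Finset.mem_univ, true_and, id]
      constructor
      · rintro ⟨j, hj⟩
        exact ⟨_, Subtype.prop _, hj⟩
      · rintro ⟨A, hA, hv⟩
        exact ⟨𝒯.equivFin ⟨A, hA⟩, by simpa using hv⟩
    rw [h4]
    rw [Finset.card_sdiff_of_subset (Finset.subset_univ _), Finset.card_univ,
      Nat.cast_sub (Finset.card_le_univ _), Fintype.card_fin] at h3
    refine h3.trans (mul_le_mul_of_nonneg_right (min_le_right _ _) (Nat.cast_nonneg _))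

/-- An absorbing path, long path tiles and a reservoir supplying the connections close up to a
Hamilton cycle. -/
theorem hasHamiltonCycle_of_tiles {n l o : ℕ} (hl : 0 < l) (hn : l + o ∣ n)
    {G : Finset (Finset (Fin n))} (hG : ∀ e ∈ G, e.card = 2 * l + o) {A R : Finset (Fin n)}
    {b e : Fin l → Fin n} {u f Q : ℕ} (hA : LPath G b e A)
    (habs : ∀ U : Finset (Fin n), Disjoint U A → l + o ∣ U.card → U.card ≤ u →
      LPath G b e (A ∪ U))
    (hRA : Disjoint R A) (hR : Supply l G R f Q) {𝒯 : Finset (Finset (Fin n))} (hne : 𝒯.Nonempty)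
    (hdis : ∀ X ∈ 𝒯, ∀ Y ∈ 𝒯, X ≠ Y → Disjoint X Y)
    (htile : ∀ X ∈ 𝒯, X ⊆ Finset.univ \ (A ∪ R) ∧ PathTile l G X) (hf : Q * 𝒯.card ≤ f)
    (hu : ((Finset.univ \ (A ∪ R)) \ 𝒯.biUnion id).card + R.card ≤ u) :
    HasHamiltonCycle n (2 * l + o) l G := by
  classical
  have hp : ∀ X, ∃ p : (Fin l → Fin n) × (Fin l → Fin n), X ∈ 𝒯 → LPath G p.1 p.2 X := by
    intro X
    by_cases h : X ∈ 𝒯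
    · obtain ⟨b', e', h'⟩ := (htile X h).2
      exact ⟨(b', e'), fun _ => h'⟩
    · exact ⟨(b, e), fun h' => absurd h' h⟩
  choose p hp using hp
  set P := 𝒯.biUnion id with hP
  obtain ⟨E, hE⟩ : ∃ E, E = 𝒯.toList.flatMap fun X => [p X] := ⟨_, rfl⟩
  have hEl : E.length = 𝒯.card := by
    rw [hE, ← List.map_eq_flatMap, List.length_map, Finset.length_toList]
  have hE0 : E ≠ [] := fun h => by
    rw [h, List.length_nil] at hEl
    exact hne.card_pos.ne hEl
  have hcE : Cov G P E := by
    have h := Cov.flatMap (H := G) (B := id) (E := fun X => [p X]) 𝒯.nodup_toList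
      (fun X hX => (hp X (Finset.mem_toList.1 hX)).cov)
      (fun X hX Y hY => hdis X (Finset.mem_toList.1 hX) Y (Finset.mem_toList.1 hY))
    rwa [Finset.toList_toFinset, ← hE] at h
  have hPW : ∀ v ∈ P, v ∉ A ∧ v ∉ R := by
    intro v hv
    obtain ⟨X, hX, hvX⟩ := Finset.mem_biUnion.1 hv
    have h := (htile X hX).1 hvX
    simp only [Finset.mem_sdiff, Finset.mem_univ, Finset.mem_union, true_and, not_or] at h
    exact h
  have hAP : Disjoint A P := Finset.disjoint_left.2 fun v hv hv' => (hPW v hv').1 hv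
  have hcov : Cov G (A ∪ P) ((b, e) :: E) := ⟨A, P, hA, hcE, hAP, rfl⟩
  obtain ⟨I, hIR, -, hIcard, hmerge⟩ := hR.merge (F := ∅) hcov (by
    rw [Finset.card_empty, hEl]; omega)
  rw [List.getLast_cons hE0] at hmerge
  have hlast := List.getLast_mem hE0
  generalize E.getLast hE0 = q at hmerge hlast
  have hqb := hcov.disjoint_ends hlast
  simp only [Finset.disjoint_union_left, Finset.disjoint_union_right] at hqb
  have hI : ∀ v ∈ I, v ∉ A ∧ v ∉ P := fun v hv =>
    ⟨fun h => Finset.disjoint_left.1 hRA (hIR hv) h, fun h => (hPW v h).2 (hIR hv)⟩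
  have hlong := hmerge _ hcov (Finset.disjoint_right.2 fun v hv => by
    have := hI v hv
    simp only [Finset.mem_union]
    tauto)
  obtain ⟨I', hIR', hII', -, hconn⟩ := hR q.2 b hlong.end_injective hlong.beg_injective
    hqb.2.1.symm I (by rw [hEl] at hIcard; exact hIcard.trans hf)
  have hI' : ∀ v ∈ I', v ∉ A ∧ v ∉ P ∧ v ∉ I := fun v hv =>
    ⟨fun h => Finset.disjoint_left.1 hRA (hIR' hv) h, fun h => (hPW v h).2 (hIR' hv),
      fun h => Finset.disjoint_left.1 hII' hv h⟩
  set U := Finset.univ \ (A ∪ P ∪ I ∪ I') with hU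
  have hUA : Disjoint U A := Finset.disjoint_left.2 fun v hv hv' => by simp [hU, hv'] at hv
  have hdvd : l + o ∣ U.card := by
    obtain ⟨s, hs⟩ := hlong.card hG
    obtain ⟨s', hs'⟩ := hconn.2.2.card hG
    have h1 : (im q.2 ∪ I' ∪ im b).card = l + I'.card + l := by
      have h2 := hconn.2.1
      rw [Finset.disjoint_union_right] at h2
      rw [Finset.card_union_of_disjoint, Finset.card_union_of_disjoint h2.1.symm,
        card_im _ hlong.end_injective, card_im _ hlong.beg_injective, Fintype.card_fin]
      exact Finset.disjoint_union_left.2 ⟨hqb.2.1.symm, h2.2⟩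
    have h3 : (A ∪ P ∪ I ∪ I').card = (s + s') * (l + o) := by
      rw [Finset.card_union_of_disjoint, hs]
      · have : I'.card + l = s' * (l + o) := by omega
        rw [add_mul]
        omega
      · refine Finset.disjoint_right.2 fun v hv => ?_
        have := hI' v hv
        simp only [Finset.mem_union]
        tauto
    rw [hU, Finset.card_sdiff_of_subset (Finset.subset_univ _), Finset.card_univ,
      Fintype.card_fin, h3]
    exact Nat.dvd_sub hn (Dvd.intro_left _ rfl)
  have hUcard : U.card ≤ u := by
    refine le_trans (Finset.card_le_card ?_) ((Finset.card_union_le _ _).trans hu)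
    intro v hv
    simp only [hU, Finset.mem_sdiff, Finset.mem_univ, Finset.mem_union, true_and] at hv ⊢
    tauto
  have hX := hmerge (A ∪ U ∪ P) ⟨A ∪ U, P, habs U hUA hdvd hUcard, hcE, by
    refine Finset.disjoint_left.2 fun v hv hv' => ?_
    have := hPW v hv'
    simp only [hU, Finset.mem_sdiff, Finset.mem_univ, Finset.mem_union, true_and] at hv
    tauto, rfl⟩ (Finset.disjoint_right.2 fun v hv => by
    have := hI v hv
    simp only [hU, Finset.mem_sdiff, Finset.mem_univ, Finset.mem_union, true_and]
    tauto)
  refine hasHamiltonCycle_of_conn hl hG hX hconn ?_ ?_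
  · refine Finset.disjoint_right.2 fun v hv => ?_
    have := hI' v hv
    simp only [hU, Finset.mem_sdiff, Finset.mem_univ, Finset.mem_union, true_and]
    tauto
  · refine Finset.eq_univ_of_forall fun v => ?_
    simp only [hU, Finset.mem_sdiff, Finset.mem_univ, Finset.mem_union, true_and]
    tauto

theorem hasHamiltonCycle_of_frac {l o d m : ℕ} (hl : 0 < l) (ho : 0 < o) (hdm : d + m = 2 * l + o)
    (hd : l + 1 ≤ d) (hm : 1 ≤ m) {τ γ : ℝ} (hτ0 : 0 ≤ τ) (hτ : FracHyp l o d m τ) (hγ : 0 < γ) :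
    ∃ N : ℕ, ∀ n ≥ N, l + o ∣ n → ∀ G : Finset (Finset (Fin n)), (∀ e ∈ G, e.card = 2 * l + o) →
      (∀ D : Finset (Fin n), D.card = d → τ + γ ≤ dens G m D) →
      HasHamiltonCycle n (2 * l + o) l G := by
  classical
  have hm0 : (0 : ℝ) < m := by exact_mod_cast hm
  obtain ⟨Q, α₀, hα₀, hres⟩ := exists_reservoir l o d hl ho hd (half_pos hγ)
  obtain ⟨α, hα, hα1, hα2, hα3⟩ : ∃ α : ℝ, 0 < α ∧ α ≤ α₀ ∧ α ≤ γ / (8 * m) ∧ α ≤ 1 / 8 :=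
    ⟨min α₀ (min (γ / (8 * m)) (1 / 8)), by positivity, min_le_left _ _,
      (min_le_right _ _).trans (min_le_left _ _), (min_le_right _ _).trans (min_le_right _ _)⟩
  obtain ⟨α', hα', NA, habs⟩ := exists_absorbing_path l o d hl ho hd (half_pos hγ) hα
  obtain ⟨ρ, hρ, hρ1, hρ2, hρ3⟩ : ∃ ρ : ℝ, 0 < ρ ∧ ρ ≤ α' / 2 ∧ ρ ≤ γ / (8 * m) ∧ ρ ≤ 1 / 8 :=
    ⟨min (α' / 2) (min (γ / (8 * m)) (1 / 8)), by positivity, min_le_left _ _,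
      (min_le_right _ _).trans (min_le_left _ _), (min_le_right _ _).trans (min_le_right _ _)⟩
  obtain ⟨c, hc, NR, hR⟩ := hres ρ hρ
  obtain ⟨ε, hε, hε1, hε2⟩ : ∃ ε : ℝ, 0 < ε ∧ ε ≤ α' / 2 ∧ ε ≤ 1 / 2 :=
    ⟨min (α' / 2) (1 / 2), by positivity, min_le_left _ _, min_le_right _ _⟩
  obtain ⟨η, hη0, hη1, hη⟩ := exists_tiling (m := m) d hm (by omega) (by positivity : 0 < γ / 4) hε
    (by linarith)
  obtain ⟨M, hM⟩ := exists_nat_ge (max (8 / η) (Q / c))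
  rw [max_le_iff, div_le_iff₀ hη0, div_le_iff₀ hc] at hM
  obtain ⟨N₀, hN₀⟩ := exists_path_dist hdm (by omega) hτ (half_pos hγ) hη0 hη1 hM.1
  obtain ⟨N₁, hN₁⟩ := hη (M * (l + o) + l) (by omega) N₀
  refine ⟨NA + NR + N₁ + (2 * d * d + d + 1), fun n hn hdvd G hG hdens => ?_⟩
  have hn0 : 0 < n := by omega
  have hn0' : (0 : ℝ) < n := by exact_mod_cast hn0
  have : Nonempty (Fin n) := ⟨⟨0, hn0⟩⟩
  have hDeg : Deg G (2 * l + o) d (γ / 2) := by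
    rw [← hdm]
    exact Deg.of_dens hγ.le (by rw [Fintype.card_fin]; omega) (by rwa [hdm])
      fun D hD => by linarith [hdens D hD]
  obtain ⟨A, b, e, hA, hAcard, hAabs⟩ := habs (Fin n) G hDeg (by rw [Fintype.card_fin]; omega)
  obtain ⟨R, hRA, hRcard, hRsup⟩ := hR (Fin n) G hDeg (by rw [Fintype.card_fin]; omega) A
    (hAcard.trans (mul_le_mul_of_nonneg_right hα1 (Nat.cast_nonneg _)))
  have hAR : ((A ∪ R).card : ℝ) ≤ (α + ρ) * Fintype.card (Fin n) := by
    have : ((A ∪ R).card : ℝ) ≤ A.card + R.card := by exact_mod_cast Finset.card_union_le A R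
    linarith
  have hβ : m * (α + ρ) ≤ γ / 4 := by
    rw [le_div_iff₀ (by positivity)] at hα2 hρ2
    linarith
  obtain ⟨𝒯, h1, h2, h3⟩ := hN₁ (V := Fin n) (H := G) (T := PathTile l G) (σ := τ + γ / 2)
    (U₀ := Finset.univ \ (A ∪ R)) (by rw [Fintype.card_fin]; omega)
    (fun U _ hU hcod => hN₀ (Fin n) G U hG hU fun D _ hD => hcod D hD)
    (fun D hD => le_trans (mul_le_mul_of_nonneg_right (by linarith) (by positivity))
      (le_codeg_compl hm hAR (hdens D hD)))
  rw [Fintype.card_fin] at hAcard hRcard h3 hRsup hAR hAabs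
  have hne : 𝒯.Nonempty := by
    rw [Finset.nonempty_iff_ne_empty]
    rintro rfl
    rw [Finset.biUnion_empty, Finset.sdiff_empty, Finset.card_sdiff_of_subset
      (Finset.subset_univ _), Finset.card_univ, Nat.cast_sub (Finset.card_le_univ _),
      Fintype.card_fin] at h3
    nlinarith
  have hcount : 𝒯.card * (M * (l + o) + l) ≤ n := by
    have h := Finset.card_le_univ (𝒯.biUnion id)
    rw [Finset.card_biUnion (t := id) fun X hX Y hY hXY => h1 X hX Y hY hXY,
      Finset.sum_congr rfl fun X hX =>
        (by exact (h2 X hX).2.2 : (id X : Finset (Fin n)).card = M * (l + o) + l), Finset.sum_const, smul_eq_mul,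
      Fintype.card_fin] at h
    exact h
  have hQ : ((Q * 𝒯.card : ℕ) : ℝ) ≤ c * n := by
    have h4 : M ≤ M * (l + o) + l := by nlinarith
    have h5 : (𝒯.card * M : ℝ) ≤ n := by
      exact_mod_cast (Nat.mul_le_mul_left 𝒯.card h4).trans hcount
    push_cast
    have h6 := mul_le_mul_of_nonneg_right hM.2 (Nat.cast_nonneg (α := ℝ) 𝒯.card)
    have h7 := mul_le_mul_of_nonneg_left h5 hc.le
    linarith
  refine hasHamiltonCycle_of_tiles hl hdvd hG (u := ⌊α' * n⌋₊) hA (fun U hUA hUd hU =>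
    hAabs U hUA hUd ((Nat.le_floor_iff (by positivity)).1 hU)) hRA (hRsup _ hQ) hne h1
    (fun X hX => ⟨(h2 X hX).1, (h2 X hX).2.1⟩) le_rfl ?_
  rw [Nat.le_floor_iff (by positivity), Nat.cast_add]
  have h8 := mul_le_mul_of_nonneg_right hε1 hn0'.le
  have h9 := mul_le_mul_of_nonneg_right hρ1 hn0'.le
  linarith

theorem sum_ind_le_one {J : Type} [Fintype J] {P : J → Prop} (h : ∀ i j, P i → P j → i = j) :
    ∑ j, ind (P j) ≤ 1 := by
  by_cases hP : ∃ i, P i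
  · obtain ⟨i, hi⟩ := hP
    rw [Finset.sum_eq_single i (fun j _ hj => ind_of_not fun h' => hj (h _ _ h' hi)) (by simp)]
    exact ind_le_one _
  · rw [Finset.sum_eq_zero fun j _ => ind_of_not fun h' => hP ⟨j, h'⟩]
    exact zero_le_one

theorem exists_halves {V : Type} [DecidableEq V] {l : ℕ} {W : Finset V} (hW : W.card = 2 * l) :
    ∃ S S' : Fin l → V, im S ∪ im S' = W ∧ Disjoint (im S) (im S') := by
  have hc : Fintype.card (Fin l ⊕ Fin l) = Fintype.card W := by
    rw [Fintype.card_sum, Fintype.card_fin, Fintype.card_coe, hW, two_mul]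
  set φ := Fintype.equivOfCardEq hc
  refine ⟨fun i => φ (Sum.inl i), fun i => φ (Sum.inr i), ?_, ?_⟩
  · ext v
    simp only [Finset.mem_union, mem_im]
    constructor
    · rintro (⟨i, rfl⟩ | ⟨i, rfl⟩) <;> exact Subtype.prop _
    · intro hv
      rcases h : φ.symm ⟨v, hv⟩ with i | i
      · exact Or.inl ⟨i, by rw [← h]; simp⟩
      · exact Or.inr ⟨i, by rw [← h]; simp⟩
  · refine Finset.disjoint_left.2 fun v hv hv' => ?_
    obtain ⟨i, hi⟩ := mem_im.1 hv
    obtain ⟨j, hj⟩ := mem_im.1 hv'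
    exact absurd (φ.injective (Subtype.ext (hi.trans hj.symm))) (by simp)

theorem fracTile_of_tiling {s l o : ℕ} (hs : 0 < s) {η : ℝ} (hη : 0 < η)
    {G : Finset (Finset (Fin s))} (hG : ∀ e ∈ G, e.card = 2 * l + o)
    (h : HasYTilingCover s l G (η / (1 + η) * s)) : FracTile l o G (2 * (1 + η) * (l + o) / s) := by
  obtain ⟨t, e₁, e₂, he, hdis, hcov⟩ := h
  have hs0 : (0 : ℝ) < s := by exact_mod_cast hs
  choose S S' hW hSS using fun j => exists_halves (he j).2.2
  have hcard : ∀ j, (e₁ j ∪ e₂ j).card = 2 * (l + o) := by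
    intro j
    have := Finset.card_union_add_card_inter (e₁ j) (e₂ j)
    rw [(he j).2.2, hG _ (he j).1, hG _ (he j).2.1] at this
    omega
  rw [Finset.card_biUnion fun i _ j _ hij => hdis i j hij,
    Finset.sum_congr rfl fun j _ => hcard j] at hcov
  simp only [Finset.sum_const, Finset.card_univ, Fintype.card_fin, smul_eq_mul] at hcov
  push_cast at hcov
  have hcov' : (s : ℝ) ≤ (1 + η) * (t * (2 * (l + o))) := by
    have h1 : (s : ℝ) - η / (1 + η) * s = s / (1 + η) := by field_simp; ring
    have h2 : s / (1 + η) ≤ t * (2 * (l + o)) := by linarith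
    rw [div_le_iff₀ (by positivity)] at h2
    linarith
  have ht : t ≠ 0 := by
    rintro rfl
    simp at hcov'
    omega
  have hO₁ : ∀ j, im (S j) ∪ (e₁ j \ e₂ j) ∪ im (S' j) = e₁ j := fun j => by
    have := hW j
    ext v
    have h1 := congrArg (v ∈ ·) this
    simp only [Finset.mem_union, Finset.mem_inter, eq_iff_iff] at h1
    simp only [Finset.mem_union, Finset.mem_sdiff]
    tauto
  have hO₂ : ∀ j, im (S j) ∪ (e₂ j \ e₁ j) ∪ im (S' j) = e₂ j := fun j => by
    have := hW j
    ext v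
    have h1 := congrArg (v ∈ ·) this
    simp only [Finset.mem_union, Finset.mem_inter, eq_iff_iff] at h1
    simp only [Finset.mem_union, Finset.mem_sdiff]
    tauto
  refine ⟨Fin t × Bool, inferInstance, ⟨⟨0, Nat.pos_of_ne_zero ht⟩, true⟩, fun x => S x.1,
    fun x => S' x.1, fun x => if x.2 then e₁ x.1 \ e₂ x.1 else e₂ x.1 \ e₁ x.1, ?_, ?_⟩
  · rintro ⟨j, b⟩
    have h1 := Finset.card_sdiff_add_card_inter (e₁ j) (e₂ j)
    have h2 := Finset.card_sdiff_add_card_inter (e₂ j) (e₁ j)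
    rw [Finset.inter_comm] at h2
    rw [(he j).2.2, hG _ (he j).1] at h1
    rw [(he j).2.2, hG _ (he j).2.1] at h2
    cases b
    · exact ⟨by simpa [hO₂] using (he j).2.1, by simp; omega⟩
    · exact ⟨by simpa [hO₁] using (he j).1, by simp; omega⟩
  · intro u
    rw [Fintype.sum_prod_type]
    simp only [Fintype.sum_bool, if_true, Bool.false_eq_true, if_false, Fintype.card_prod,
      Fintype.card_fin, Fintype.card_bool]
    have hterm : ∀ j, 2 * ind (u ∈ e₁ j \ e₂ j) + ind (u ∈ im (S j)) + ind (u ∈ im (S' j)) +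
        (2 * ind (u ∈ e₂ j \ e₁ j) + ind (u ∈ im (S j)) + ind (u ∈ im (S' j))) ≤
        2 * ind (u ∈ e₁ j ∪ e₂ j) := by
      intro j
      have h1 := congrArg (u ∈ ·) (hW j)
      have h2 : u ∈ im (S j) → u ∉ im (S' j) := fun h h' => Finset.disjoint_left.1 (hSS j) h h'
      simp only [Finset.mem_union, Finset.mem_inter, eq_iff_iff] at h1
      simp only [Finset.mem_union, Finset.mem_sdiff]
      by_cases h3 : u ∈ im (S j) <;> by_cases h4 : u ∈ im (S' j) <;> by_cases h5 : u ∈ e₁ j <;>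
        by_cases h6 : u ∈ e₂ j <;> simp_all [ind] <;> norm_num
    have hle : ∑ j, ind (u ∈ e₁ j ∪ e₂ j) ≤ 1 := sum_ind_le_one fun i j hi hj => by
      by_contra hij
      exact Finset.disjoint_left.1 (hdis i j hij) hi hj
    refine (Finset.sum_le_sum fun j _ => hterm j).trans ?_
    rw [← Finset.mul_sum, div_mul_eq_mul_div, le_div_iff₀ hs0]
    push_cast
    nlinarith

theorem fracTile_of_hamilton {s l o : ℕ} (hs : 0 < s) (hw : l + o ∣ s) {η : ℝ} (hη : 0 < η)
    {G : Finset (Finset (Fin s))} (h : HasHamiltonCycle s (2 * l + o) l G) :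
    FracTile l o G (2 * (1 + η) * (l + o) / s) := by
  obtain ⟨f, hf, hedge⟩ := h
  rw [show 2 * l + o - l = l + o by omega] at hedge
  obtain ⟨w, hwdef⟩ : ∃ w, w = l + o := ⟨_, rfl⟩
  rw [← hwdef] at hw hedge
  obtain ⟨t, rfl⟩ := hw
  have hw0 : 0 < w := Nat.pos_of_mul_pos_right hs
  have ht0 : 0 < t := Nat.pos_of_mul_pos_left hs
  rw [Nat.mul_div_cancel_left _ hw0] at hedge
  have : NeZero (w * t) := ⟨hs.ne'⟩
  have hF : ∀ x y : ℕ, f (x : ZMod (w * t)) = f (y : ZMod (w * t)) ↔ x ≡ y [MOD w * t] :=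
    fun x y => hf.1.eq_iff.trans (ZMod.natCast_eq_natCast_iff _ _ _)
  have hcount : ∀ c p : ℕ, ∑ j : Fin t, ind (∃ i < w, j * w + (c + i) ≡ p [MOD w * t]) ≤ 1 := by
    intro c p
    refine sum_ind_le_one ?_
    rintro j j' ⟨i, hi, h⟩ ⟨i', hi', h'⟩
    have h1 := h.trans h'.symm
    have h2 := h1.of_mul_right t
    have h3 : c + i ≡ c + i' [MOD w] := by
      simpa [Nat.ModEq, Nat.add_mod, Nat.mul_mod] using h2
    have h4 : i = i' := (Nat.ModEq.add_left_cancel' c h3).eq_of_lt_of_lt hi hi'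
    subst h4
    have h5 := Nat.ModEq.add_right_cancel' _ h1
    rw [mul_comm w t] at h5
    exact Fin.ext ((Nat.ModEq.mul_right_cancel' hw0.ne' h5).eq_of_lt_of_lt j.2 j'.2)
  refine ⟨Fin t, inferInstance, ⟨⟨0, ht0⟩⟩, fun j i => f ((j * w + (0 + i) : ℕ) : ZMod (w * t)),
    fun j i => f ((j * w + (w + i) : ℕ) : ZMod (w * t)),
    fun j => (Finset.range o).image fun i => f ((j * w + (l + i) : ℕ) : ZMod (w * t)), ?_, ?_⟩
  · intro j
    constructor
    · convert hedge j j.2 using 1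
      ext v
      simp only [Finset.mem_union, mem_im, Finset.mem_image, Finset.mem_range]
      constructor
      · rintro ((⟨i, rfl⟩ | ⟨i, hi, rfl⟩) | ⟨i, rfl⟩)
        · exact ⟨0 + i, by omega, rfl⟩
        · exact ⟨l + i, by omega, rfl⟩
        · exact ⟨w + i, by omega, rfl⟩
      · rintro ⟨i, hi, rfl⟩
        by_cases h1 : i < l
        · exact Or.inl (Or.inl ⟨⟨i, h1⟩, by rw [Nat.zero_add]⟩)
        by_cases h2 : i < l + o
        · exact Or.inl (Or.inr ⟨i - l, by omega, by rw [Nat.add_sub_cancel' (by omega)]⟩)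
        · exact Or.inr ⟨⟨i - w, by omega⟩, by dsimp only; rw [Nat.add_sub_cancel' (by omega)]⟩
    · rw [Finset.card_image_of_injOn, Finset.card_range]
      intro i hi i' hi' h
      have h1 := Nat.ModEq.add_left_cancel' _ (Nat.ModEq.add_left_cancel' _ ((hF _ _).1 h))
      have h2 : w ≤ w * t := Nat.le_mul_of_pos_right w ht0
      simp only [Finset.coe_range, Set.mem_Iio] at hi hi'
      exact h1.eq_of_lt_of_lt (by omega) (by omega)
  · intro u
    obtain ⟨x, rfl⟩ := hf.2 u
    obtain ⟨p, rfl⟩ : ∃ p : ℕ, (p : ZMod (w * t)) = x := ⟨x.val, ZMod.natCast_zmod_val x⟩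
    have hres : ∀ (j : Fin t) (c : ℕ), j * w + c ≡ p [MOD w * t] → c % w = p % w := by
      intro j c hc
      have h1 := hc.of_mul_right t
      simpa [Nat.ModEq, Nat.add_mod, Nat.mul_mod] using h1
    have hsum : ∑ j : Fin t, (2 * ind (f p ∈ (Finset.range o).image fun i =>
          f ((j * w + (l + i) : ℕ) : ZMod (w * t))) +
        ind (f p ∈ im fun i : Fin l => f ((j * w + (0 + i) : ℕ) : ZMod (w * t))) +
        ind (f p ∈ im fun i : Fin l => f ((j * w + (w + i) : ℕ) : ZMod (w * t)))) ≤ 2 := by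
      simp only [mem_im, Finset.mem_image, Finset.mem_range, hF]
      by_cases hp : p % w < l
      · have hterm : ∀ j : Fin t, 2 * ind (∃ i < o, j * w + (l + i) ≡ p [MOD w * t]) +
            ind (∃ i : Fin l, j * w + (0 + i) ≡ p [MOD w * t]) +
            ind (∃ i : Fin l, j * w + (w + i) ≡ p [MOD w * t]) ≤
            ind (∃ i < w, j * w + (0 + i) ≡ p [MOD w * t]) +
            ind (∃ i < w, j * w + (w + i) ≡ p [MOD w * t]) := by
          intro j
          rw [ind_of_not (p := ∃ i < o, j * w + (l + i) ≡ p [MOD w * t])]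
          · have h1 := ind_mono (p := ∃ i : Fin l, j * w + (0 + i) ≡ p [MOD w * t])
              (q := ∃ i < w, j * w + (0 + i) ≡ p [MOD w * t])
              fun ⟨i, hi⟩ => ⟨i, by omega, hi⟩
            have h2 := ind_mono (p := ∃ i : Fin l, j * w + (w + i) ≡ p [MOD w * t])
              (q := ∃ i < w, j * w + (w + i) ≡ p [MOD w * t])
              fun ⟨i, hi⟩ => ⟨i, by omega, hi⟩
            linarith
          · rintro ⟨i, hi, h⟩
            have := hres j _ h
            rw [Nat.mod_eq_of_lt (by omega)] at this
            omega
        refine (Finset.sum_le_sum fun j _ => hterm j).trans ?_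
        rw [Finset.sum_add_distrib]
        linarith [hcount 0 p, hcount w p]
      · have hterm : ∀ j : Fin t, 2 * ind (∃ i < o, j * w + (l + i) ≡ p [MOD w * t]) +
            ind (∃ i : Fin l, j * w + (0 + i) ≡ p [MOD w * t]) +
            ind (∃ i : Fin l, j * w + (w + i) ≡ p [MOD w * t]) ≤
            2 * ind (∃ i < w, j * w + (l + i) ≡ p [MOD w * t]) := by
          intro j
          rw [ind_of_not (p := ∃ i : Fin l, j * w + (0 + i) ≡ p [MOD w * t]),
            ind_of_not (p := ∃ i : Fin l, j * w + (w + i) ≡ p [MOD w * t])]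
          · have h1 := ind_mono (p := ∃ i < o, j * w + (l + i) ≡ p [MOD w * t])
              (q := ∃ i < w, j * w + (l + i) ≡ p [MOD w * t])
              fun ⟨i, hi, h⟩ => ⟨i, by omega, h⟩
            linarith
          · rintro ⟨i, h⟩
            have := hres j _ h
            rw [Nat.add_mod_left, Nat.mod_eq_of_lt (by omega)] at this
            omega
          · rintro ⟨i, h⟩
            have := hres j _ h
            rw [Nat.mod_eq_of_lt (by omega)] at this
            omega
        refine (Finset.sum_le_sum fun j _ => hterm j).trans ?_
        rw [← Finset.mul_sum]
        linarith [hcount l p]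
    refine hsum.trans ?_
    have hs0 : (0 : ℝ) < ((w * t : ℕ) : ℝ) := by exact_mod_cast hs
    rw [div_mul_eq_mul_div, le_div_iff₀ hs0, Fintype.card_fin]
    have hw1 : (l : ℝ) + o = w := by rw [hwdef]; push_cast; rfl
    rw [hw1]
    push_cast at hs0 ⊢
    nlinarith

open Filter in
theorem limsup_nonneg_le {α : Type} {f : Filter α} [f.NeBot] {u : α → ℝ} {b : ℝ}
    (h0 : ∀ x, 0 ≤ u x) (hb : ∀ x, u x ≤ b) : 0 ≤ limsup u f ∧ limsup u f ≤ b :=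
  ⟨le_limsup_of_frequently_le (Eventually.of_forall h0).frequently (isBoundedUnder_of ⟨b, hb⟩),
    limsup_le_of_le (isBoundedUnder_of ⟨0, h0⟩).isCoboundedUnder_le (Eventually.of_forall hb)⟩

theorem hDeg_le_choose {n d m : ℕ} {G : Finset (Finset (Fin n))} {D : Finset (Fin n)}
    (hD : D.card = d) : hDeg n (d + m) G D ≤ n.choose m := by
  classical
  rw [hDeg, Nat.card_eq_fintype_card, hD, Nat.add_sub_cancel_left]
  calc _ ≤ Fintype.card {T : Finset (Fin n) // T.card = m} :=
        Fintype.card_subtype_mono _ _ fun T hT => hT.1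
    _ = n.choose m := by rw [Fintype.card_finset_len, Fintype.card_fin]

theorem minDeg_le_choose {n d m : ℕ} {G : Finset (Finset (Fin n))} :
    minDeg n (d + m) d G ≤ n.choose m := by
  by_cases h : ∃ D : Finset (Fin n), D.card = d
  · obtain ⟨D, hD⟩ := h
    exact (minDeg_le hD).trans (hDeg_le_choose hD)
  · have : {m' : ℕ | ∃ S : Finset (Fin n), S.card = d ∧ hDeg n (d + m) G S = m'} = ∅ :=
      Set.eq_empty_of_forall_notMem fun x ⟨S, hS, _⟩ => h ⟨S, hS⟩
    rw [minDeg, this, Nat.sInf_empty]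
    exact Nat.zero_le _

/-- The least minimum `d`-degree that forces the property `P` in a `k`-graph. -/
noncomputable def degThreshold (k d n : ℕ) (P : Finset (Finset (Fin n)) → Prop) : ℕ :=
  sInf {t : ℕ | ∀ H : Finset (Finset (Fin n)), IsKGraph n k H → t ≤ minDeg n k d H → P H}

theorem degThreshold_le {k d n t : ℕ} {P : Finset (Finset (Fin n)) → Prop}
    (h : ∀ H : Finset (Finset (Fin n)), IsKGraph n k H → t ≤ minDeg n k d H → P H) :
    degThreshold k d n P ≤ t :=
  Nat.sInf_le h

theorem degThreshold_le_choose {d m n : ℕ} {P : Finset (Finset (Fin n)) → Prop} :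
    degThreshold (d + m) d n P ≤ n.choose m + 1 :=
  degThreshold_le fun H _ h => by
    have := minDeg_le_choose (d := d) (m := m) (G := H)
    omega

theorem degThreshold_spec {d m n : ℕ} {P : Finset (Finset (Fin n)) → Prop}
    {H : Finset (Finset (Fin n))} (hH : IsKGraph n (d + m) H)
    (h : degThreshold (d + m) d n P ≤ minDeg n (d + m) d H) : P H := by
  have hne : {t : ℕ | ∀ H : Finset (Finset (Fin n)), IsKGraph n (d + m) H →
      t ≤ minDeg n (d + m) d H → P H}.Nonempty :=
    ⟨n.choose m + 1, fun H _ h => by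
      have := minDeg_le_choose (d := d) (m := m) (G := H)
      omega⟩
  exact Nat.sInf_mem hne H hH h

theorem ratio_nonneg (a b : ℕ) : (0 : ℝ) ≤ (a : ℝ) / b := by positivity

theorem degThreshold_ratio_le {d m n : ℕ} (P : Finset (Finset (Fin n)) → Prop) :
    (degThreshold (d + m) d n P : ℝ) / (n.choose m : ℝ) ≤ 2 := by
  rcases Nat.eq_zero_or_pos (n.choose m) with h | h
  · rw [h]; norm_num
  · have h1 : (degThreshold (d + m) d n P : ℝ) ≤ n.choose m + 1 := by
      exact_mod_cast degThreshold_le_choose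
    have h2 : (1 : ℝ) ≤ n.choose m := by exact_mod_cast h
    rw [div_le_iff₀ (by linarith)]
    linarith

theorem prop_of_dens {d m n : ℕ} (hd : d ≤ n) {P : Finset (Finset (Fin n)) → Prop} {τ : ℝ}
    (hτ0 : 0 ≤ τ) (hn : 0 < n) (hτ : (degThreshold (d + m) d n P : ℝ) ≤ τ * n.choose m)
    {G : Finset (Finset (Fin n))} (hG : IsKGraph n (d + m) G)
    (h : ∀ D : Finset (Fin n), D.card = d → τ ≤ dens G m D) : P G := by
  refine degThreshold_spec hG (le_minDeg hd fun D hD => ?_)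
  have h1 := dens_eq_hDeg hG hD
  have h2 : (n.descFactorial m : ℝ) ≤ (n : ℝ) ^ m := by exact_mod_cast Nat.descFactorial_le_pow n m
  rw [Nat.descFactorial_eq_factorial_mul_choose] at h2
  push_cast at h2
  have h3 : τ * (n : ℝ) ^ m ≤ dens G m D * (n : ℝ) ^ m :=
    mul_le_mul_of_nonneg_right (h D hD) (by positivity)
  have h4 : (0 : ℝ) < m.factorial := by exact_mod_cast m.factorial_pos
  have h5 : (m.factorial : ℝ) * (τ * n.choose m) ≤ m.factorial * hDeg n (d + m) G D := by
    nlinarith [mul_le_mul_of_nonneg_left h2 hτ0]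
  have h6 := le_of_mul_le_mul_left h5 h4
  exact_mod_cast hτ.trans h6

theorem exists_dens_of_minDeg (d m : ℕ) {τ γ : ℝ} (hτ : 0 ≤ τ) (hγ : 0 < γ) :
    ∃ N : ℕ, ∀ n ≥ N, ∀ G : Finset (Finset (Fin n)), IsKGraph n (d + m) G →
      (τ + 2 * γ) * n.choose m ≤ minDeg n (d + m) d G →
        ∀ D : Finset (Fin n), D.card = d → τ + γ ≤ dens G m D := by
  obtain ⟨N, hN⟩ := exists_nat_ge ((τ + 2 * γ) * m ^ 2 / γ)
  refine ⟨N + m + 1, fun n hn G hG h D hD => ?_⟩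
  have hn0 : (0 : ℝ) < n := by exact_mod_cast (show 0 < n by omega)
  have hmn : (m : ℝ) ≤ n := by exact_mod_cast (show m ≤ n by omega)
  have hNn : (N : ℝ) ≤ n := by exact_mod_cast (show N ≤ n by omega)
  rw [div_le_iff₀ hγ] at hN
  have h1 := dens_eq_hDeg hG hD
  have h2 : ((n : ℝ) - m) ^ m ≤ m.factorial * n.choose m := by
    have h3 := Nat.pow_sub_le_descFactorial n m
    rw [Nat.descFactorial_eq_factorial_mul_choose] at h3
    have h4 : (((n + 1 - m : ℕ) : ℝ)) ^ m ≤ m.factorial * n.choose m := by exact_mod_cast h3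
    refine le_trans (pow_le_pow_left₀ (by linarith) ?_ m) h4
    rw [Nat.cast_sub (by omega)]
    push_cast
    linarith
  have h3 : (1 - (m : ℝ) ^ 2 / n) * n ^ m ≤ ((n : ℝ) - m) ^ m := by
    have h4 : (-2 : ℝ) ≤ -(m / n) := by
      have : (m : ℝ) / n ≤ 1 := (div_le_one hn0).2 hmn
      linarith
    have h5 := one_add_mul_le_pow h4 m
    have h6 : ((n : ℝ) - m) ^ m = (1 + -(m / n)) ^ m * n ^ m := by
      rw [← mul_pow]
      congr 1
      field_simp
      ring
    rw [h6]
    refine mul_le_mul_of_nonneg_right (le_trans (le_of_eq ?_) h5) (by positivity)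
    ring
  have h4 : τ + γ ≤ (τ + 2 * γ) * (1 - (m : ℝ) ^ 2 / n) := by
    have h5 : (τ + 2 * γ) * (m ^ 2 / n) ≤ γ := by
      rw [← mul_div_assoc, div_le_iff₀ hn0]
      nlinarith
    linarith
  have h5 : (hDeg n (d + m) G D : ℝ) ≥ (τ + 2 * γ) * n.choose m :=
    h.trans (by exact_mod_cast minDeg_le hD)
  have hp : (0 : ℝ) < (n : ℝ) ^ m := by positivity
  refine le_of_mul_le_mul_right ?_ hp
  rw [h1]
  calc (τ + γ) * (n : ℝ) ^ m ≤ (τ + 2 * γ) * (1 - (m : ℝ) ^ 2 / n) * n ^ m :=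
        mul_le_mul_of_nonneg_right h4 hp.le
    _ = (τ + 2 * γ) * ((1 - (m : ℝ) ^ 2 / n) * n ^ m) := mul_assoc _ _ _
    _ ≤ (τ + 2 * γ) * (m.factorial * n.choose m) :=
        mul_le_mul_of_nonneg_left (h3.trans h2) (by linarith)
    _ = m.factorial * ((τ + 2 * γ) * n.choose m) := by ring
    _ ≤ m.factorial * hDeg n (d + m) G D := mul_le_mul_of_nonneg_left h5 (by positivity)

theorem exists_degThreshold_ratio_le (d m : ℕ) (hm : 1 ≤ m) {τ γ : ℝ} (hτ : 0 ≤ τ) (hγ : 0 < γ) :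
    ∃ N : ℕ, ∀ n ≥ N, ∀ P : Finset (Finset (Fin n)) → Prop,
      (∀ G : Finset (Finset (Fin n)), IsKGraph n (d + m) G →
        (∀ D : Finset (Fin n), D.card = d → τ + γ ≤ dens G m D) → P G) →
      (degThreshold (d + m) d n P : ℝ) / (n.choose m : ℝ) ≤ τ + 3 * γ := by
  obtain ⟨N, hN⟩ := exists_dens_of_minDeg d m hτ hγ
  obtain ⟨M, hM⟩ := exists_nat_ge (m.factorial / γ)
  refine ⟨N + M + m, fun n hn P hP => ?_⟩
  have h1 : degThreshold (d + m) d n P ≤ ⌈(τ + 2 * γ) * n.choose m⌉₊ :=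
    degThreshold_le fun H hH h => hP H hH (hN n (by omega) H hH (Nat.ceil_le.1 h))
  have hc : (1 : ℝ) ≤ γ * n.choose m := by
    have h2 := Nat.pow_sub_le_descFactorial n m
    rw [Nat.descFactorial_eq_factorial_mul_choose] at h2
    have h3 : M ≤ m.factorial * n.choose m :=
      le_trans (by omega) ((Nat.le_self_pow (by omega) (n + 1 - m)).trans h2)
    have h4 : (M : ℝ) ≤ m.factorial * n.choose m := by exact_mod_cast h3
    have h5 : (0 : ℝ) < m.factorial := by exact_mod_cast m.factorial_pos
    rw [div_le_iff₀ hγ] at hM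
    refine le_of_mul_le_mul_left ?_ h5
    nlinarith
  have hc0 : (0 : ℝ) < n.choose m := by
    by_contra h
    nlinarith
  have h2 : (degThreshold (d + m) d n P : ℝ) ≤ ⌈(τ + 2 * γ) * n.choose m⌉₊ := by exact_mod_cast h1
  have h3 := (Nat.ceil_lt_add_one (a := (τ + 2 * γ) * n.choose m) (by positivity)).le
  rw [div_le_iff₀ hc0]
  linarith

theorem HasYTilingCover.mono {n l : ℕ} {H : Finset (Finset (Fin n))} {u v : ℝ} (huv : u ≤ v)
    (h : HasYTilingCover n l H u) : HasYTilingCover n l H v := by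
  obtain ⟨m, e₁, e₂, h1, h2, h3⟩ := h
  exact ⟨m, e₁, e₂, h1, h2, h3.trans huv⟩

open Filter Topology in
theorem hVal_eq_tVal (l o d m : ℕ) (hl : 0 < l) (ho : 0 < o) (hdm : d + m = 2 * l + o)
    (hd : l + 1 ≤ d) (hm : 1 ≤ m) : hVal (d + m) d l = tVal (d + m) d l := by
  have hkl : d + m - l = l + o := by omega
  have hne : (atTop ⊓ 𝓟 {n : ℕ | l + o ∣ n}).NeBot := by
    rw [← frequently_mem_iff_neBot, frequently_atTop]
    intro a
    exact ⟨(l + o) * a, Nat.le_mul_of_pos_left a (by omega), Dvd.intro _ rfl⟩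
  set F := atTop ⊓ 𝓟 {n : ℕ | l + o ∣ n} with hF
  set f : ℕ → ℝ := fun n =>
    (degThreshold (d + m) d n (HasHamiltonCycle n (d + m) l) : ℝ) / (n.choose m : ℝ) with hf
  set g : ℝ → ℕ → ℝ := fun ε n =>
    (degThreshold (d + m) d n (fun G => HasYTilingCover n l G (ε * n)) : ℝ) / (n.choose m : ℝ)
    with hg
  have hh : hVal (d + m) d l = limsup f F := by
    rw [hVal, hkl, Nat.add_sub_cancel_left]
    rfl
  have ht : tVal (d + m) d l = limsup (fun ε => limsup (g ε) atTop) (𝓝[>] 0) := by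
    rw [tVal, Nat.add_sub_cancel_left]
    rfl
  have hf0 : ∀ n, 0 ≤ f n := fun n => ratio_nonneg _ _
  have hf2 : ∀ n, f n ≤ 2 := fun n => degThreshold_ratio_le _
  have hg0 : ∀ ε n, 0 ≤ g ε n := fun ε n => ratio_nonneg _ _
  have hg2 : ∀ ε n, g ε n ≤ 2 := fun ε n => degThreshold_ratio_le _
  have hG : ∀ ε, 0 ≤ limsup (g ε) atTop ∧ limsup (g ε) atTop ≤ 2 := fun ε =>
    limsup_nonneg_le (hg0 ε) (hg2 ε)
  have hT := limsup_nonneg_le (f := 𝓝[>] (0 : ℝ)) (fun ε => (hG ε).1) (fun ε => (hG ε).2)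
  have hH := limsup_nonneg_le (f := F) hf0 hf2
  have hc : ∀ n ≥ m, (0 : ℝ) < n.choose m := fun n hn => by exact_mod_cast Nat.choose_pos hn
  rw [hh, ht]
  refine le_antisymm (le_of_forall_pos_le_add fun γ hγ => ?_)
    (le_of_forall_pos_le_add fun γ hγ => ?_)
  · set τ := limsup (fun ε => limsup (g ε) atTop) (𝓝[>] 0) + γ / 4 with hτ
    have hτ0 : 0 ≤ τ := by linarith [hT.1]
    have hfrac : FracHyp l o d m τ := by
      intro η hη s₀
      have h1 : ∀ᶠ ε in 𝓝[>] (0 : ℝ), limsup (g ε) atTop < τ :=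
        eventually_lt_of_limsup_lt (by linarith) (isBoundedUnder_of ⟨2, fun ε => (hG ε).2⟩)
      have h2 : ∀ᶠ ε in 𝓝[>] (0 : ℝ), ε < η / (1 + η) :=
        mem_nhdsWithin_of_mem_nhds (Iio_mem_nhds (by positivity))
      obtain ⟨ε, hε1, hε2⟩ := (h1.and h2).exists
      have h3 : ∀ᶠ n in atTop, g ε n < τ :=
        eventually_lt_of_limsup_lt hε1 (isBoundedUnder_of ⟨2, hg2 ε⟩)
      obtain ⟨s, hs1, hs2⟩ := (h3.and (eventually_ge_atTop (s₀ + d + m))).exists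
      refine ⟨s, by omega, fun G hG hD => fracTile_of_tiling (by omega) hη hG ?_⟩
      have hs3 := (div_le_iff₀ (hc s (by omega))).1 hs1.le
      refine HasYTilingCover.mono (mul_le_mul_of_nonneg_right hε2.le (Nat.cast_nonneg _)) ?_
      exact prop_of_dens (P := fun G => HasYTilingCover s l G (ε * s)) (by omega) hτ0 (by omega) hs3
        (fun e he => (hG e he).trans hdm.symm) hD
    obtain ⟨N₁, hN₁⟩ := hasHamiltonCycle_of_frac hl ho hdm hd hm hτ0 hfrac (γ := γ / 4) (by linarith)
    obtain ⟨N₂, hN₂⟩ := exists_degThreshold_ratio_le d m hm hτ0 (γ := γ / 4) (by linarith)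
    refine limsup_le_of_le (isBoundedUnder_of ⟨0, hf0⟩).isCoboundedUnder_le ?_
    rw [hF, eventually_inf_principal]
    filter_upwards [eventually_ge_atTop (N₁ + N₂)] with n hn hdvd
    have := hN₂ n (by omega) (HasHamiltonCycle n (d + m) l) fun G hG hD => by
      rw [hdm]
      exact hN₁ n (by omega) hdvd G (fun e he => (hG e he).trans hdm) hD
    linarith
  · set τ := limsup f F + γ / 4 with hτ
    have hτ0 : 0 ≤ τ := by linarith [hH.1]
    have hfrac : FracHyp l o d m τ := by
      intro η hη s₀
      have h3 : ∀ᶠ n in F, f n < τ :=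
        eventually_lt_of_limsup_lt (by linarith) (isBoundedUnder_of ⟨2, hf2⟩)
      have h4 : ∀ᶠ n in F, s₀ + d + m ≤ n := (eventually_ge_atTop _).filter_mono inf_le_left
      have h5 : ∀ᶠ n in F, l + o ∣ n := mem_inf_of_right (mem_principal_self _)
      obtain ⟨s, ⟨hs1, hs2⟩, hs4⟩ := ((h3.and h4).and h5).exists
      refine ⟨s, by omega, fun G hG hD => fracTile_of_hamilton (by omega) hs4 hη ?_⟩
      have hs3 := (div_le_iff₀ (hc s (by omega))).1 hs1.le
      rw [← hdm]
      exact prop_of_dens (by omega) hτ0 (by omega) hs3 (fun e he => (hG e he).trans hdm.symm) hD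
    refine limsup_le_of_le (isBoundedUnder_of ⟨0, fun ε => (hG ε).1⟩).isCoboundedUnder_le ?_
    filter_upwards [self_mem_nhdsWithin] with ε hε
    obtain ⟨N₁, hN₁⟩ := hasYTilingCover_of_frac ho hdm (by omega) hm hfrac (γ := γ / 4)
      (by linarith) (Set.mem_Ioi.1 hε)
    obtain ⟨N₂, hN₂⟩ := exists_degThreshold_ratio_le d m hm hτ0 (γ := γ / 4) (by linarith)
    refine limsup_le_of_le (isBoundedUnder_of ⟨0, hg0 ε⟩).isCoboundedUnder_le ?_
    filter_upwards [eventually_ge_atTop (N₁ + N₂)] with n hn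
    have := hN₂ n (by omega) (fun G => HasYTilingCover n l G (ε * n)) fun G hG hD =>
      hN₁ n (by omega) G (fun e he => (hG e he).trans hdm) hD
    linarith

/-- If `k ≥ 3`, `1 ≤ ℓ < k/2`, `1 ≤ d ≤ k-1` and
`0.82 (k-ℓ) ≤ k-d < k-ℓ`, then `h_d^ℓ(k) = t(k,d,ℓ)`. -/
theorem dirac_equals_tiling (k l d : ℕ) (hk : 3 ≤ k) (hl : 1 ≤ l) (hlk : 2 * l < k)
    (hd1 : 1 ≤ d) (hdk : d ≤ k - 1)
    (h1 : (0.82 : ℝ) * ((k : ℝ) - (l : ℝ)) ≤ (k : ℝ) - (d : ℝ))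
    (h2 : (k : ℝ) - (d : ℝ) < (k : ℝ) - (l : ℝ)) :
    hVal k d l = tVal k d l := by
  have hld : l < d := by
    have : (l : ℝ) < d := by linarith
    exact_mod_cast this
  obtain ⟨m, rfl⟩ : ∃ m, k = d + m := ⟨k - d, by omega⟩
  exact hVal_eq_tVal l (d + m - 2 * l) d m hl (by omega) (by omega) (by omega) (by omega)
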